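/- Let n ≥ 2 and let Ω ⊂ ℂⁿ be a bounded domain, p ∈ ∂Ω. Assume there are a neighborhood U of p and a C² function ρ : U → ℝ with nonvanishing gradient such that Ω ∩ U = {ρ < 0} and such that the Levi form of ρ is positive definite at every point of U, i.e. Σ_{j,l=1}^n (∂²ρ/∂z_j∂z̄_l)(w) t_j t̄_l > 0 for every w ∈ U and every t ∈ ℂⁿ \ {0} (Ω is strongly pseudoconvex near p). Assume also that the closure of Ω has a Stein neighborhood basis. Then there exists an injective holomorphic map f, defined on an open neighborhood of the closure of Ω with values in ℂⁿ, such that f(cl Ω) is contained in the closed unit ball of ℂⁿ, f(p) = eₙ = (0,…,0,1), and {z ∈ cl Ω : ‖f(z)‖ = 1} = {p}. -/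

import Mathlib

open Metric Set Filter Asymptotics
open scoped Manifold Topology

noncomputable section

/-- ℂⁿ with its Hermitian (Euclidean) structure. -/
abbrev CSp (n : ℕ) := EuclideanSpace ℂ (Fin n)

/-- A bounded domain: open, connected and bounded. -/
def IsBoundedDomain {n : ℕ} (Ω : Set (CSp n)) : Prop :=
  IsOpen Ω ∧ IsConnected Ω ∧ Bornology.IsBounded Ω

/-- A holomorphically convex (Stein) open subset of ℂⁿ: for every compact `K ⊆ U`
the holomorphically convex hull of `K` in `U` is compact. -/
def IsSteinOpen {n : ℕ} (U : Set (CSp n)) : Prop :=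
  IsOpen U ∧ ∀ K : Set (CSp n), K ⊆ U → IsCompact K →
    IsCompact {z ∈ U | ∀ g : CSp n → ℂ, DifferentiableOn ℂ g U →
      ‖g z‖ ≤ sSup ((fun w => ‖g w‖) '' K)}

/-- A set `L` has a Stein neighborhood basis. -/
def HasSteinNbhdBasis {n : ℕ} (L : Set (CSp n)) : Prop :=
  ∀ U : Set (CSp n), IsOpen U → L ⊆ U → ∃ V, IsSteinOpen V ∧ L ⊆ V ∧ V ⊆ U

/-- The last coordinate index of `Fin n`. -/
def lastI (n : ℕ) (hn : 0 < n) : Fin n := ⟨n - 1, by omega⟩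

/-- The point `eₙ = (0,…,0,1)`. -/
def eLast (n : ℕ) (hn : 0 < n) : CSp n := EuclideanSpace.single (lastI n hn) 1

/-- Positive definiteness of the Levi form of `ρ` at `w`, expressed through the real
Hessian:  `Σ ρ_{z_j z̄_l}(w) t_j conj t_l = (1/4)(Hess ρ(w)(t,t) + Hess ρ(w)(it,it))`,
so the Levi form is positive definite at `w` iff the right-hand side is positive for
every `t ≠ 0`. -/
def LeviPosDef {n : ℕ} (ρ : CSp n → ℝ) (w : CSp n) : Prop :=
  ∀ t : CSp n, t ≠ 0 →
    0 < iteratedFDeriv ℝ 2 ρ w ![t, t] +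
        iteratedFDeriv ℝ 2 ρ w ![(Complex.I : ℂ) • t, (Complex.I : ℂ) • t]

end

open Metric Set Filter Asymptotics
open scoped Manifold Topology
noncomputable section

section PartA1
open MeasureTheory
open scoped ContDiff

variable {n : ℕ}

/-- basis vector -/
def eB (j : Fin n) : CSp n := EuclideanSpace.single j 1

def dbar (j : Fin n) (f : CSp n → ℂ) (x : CSp n) : ℂ :=
  (1/2) * (fderiv ℝ f x (eB j) + Complex.I * fderiv ℝ f x (Complex.I • eB j))

def dd (j : Fin n) (f : CSp n → ℂ) (x : CSp n) : ℂ :=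
  (1/2) * (fderiv ℝ f x (eB j) - Complex.I * fderiv ℝ f x (Complex.I • eB j))

/-- smooth with compact support -/
def Tst (f : CSp n → ℂ) : Prop := ContDiff ℝ ∞ f ∧ HasCompactSupport f

lemma sm_diff {f : CSp n → ℂ} (hf : ContDiff ℝ ∞ f) (x : CSp n) : DifferentiableAt ℝ f x :=
  (hf.differentiable (by simp)) x

lemma contDiff_fderiv_apply' {f : CSp n → ℂ} (hf : ContDiff ℝ ∞ f) (v : CSp n) :
    ContDiff ℝ ∞ (fun x => fderiv ℝ f x v) := by
  have h := hf.fderiv_right (m := ∞) (by simp)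
  exact h.clm_apply contDiff_const

lemma dbar_sm {f : CSp n → ℂ} (hf : ContDiff ℝ ∞ f) (j : Fin n) : ContDiff ℝ ∞ (dbar j f) := by
  unfold dbar
  exact contDiff_const.mul ((contDiff_fderiv_apply' hf _).add
    (contDiff_const.mul (contDiff_fderiv_apply' hf _)))

lemma dd_sm {f : CSp n → ℂ} (hf : ContDiff ℝ ∞ f) (j : Fin n) : ContDiff ℝ ∞ (dd j f) := by
  unfold dd
  exact contDiff_const.mul ((contDiff_fderiv_apply' hf _).sub
    (contDiff_const.mul (contDiff_fderiv_apply' hf _)))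

lemma dbar_congr {f g : CSp n → ℂ} {x : CSp n} (h : f =ᶠ[𝓝 x] g) (j : Fin n) :
    dbar j f x = dbar j g x := by
  unfold dbar; rw [h.fderiv_eq]

lemma dd_congr {f g : CSp n → ℂ} {x : CSp n} (h : f =ᶠ[𝓝 x] g) (j : Fin n) :
    dd j f x = dd j g x := by
  unfold dd; rw [h.fderiv_eq]

lemma dbar_eventuallyEq {f g : CSp n → ℂ} {x : CSp n} (h : f =ᶠ[𝓝 x] g) (j : Fin n) :
    dbar j f =ᶠ[𝓝 x] dbar j g := by
  filter_upwards [h.eventuallyEq_nhds] with y hy using dbar_congr hy j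

lemma dd_eventuallyEq {f g : CSp n → ℂ} {x : CSp n} (h : f =ᶠ[𝓝 x] g) (j : Fin n) :
    dd j f =ᶠ[𝓝 x] dd j g := by
  filter_upwards [h.eventuallyEq_nhds] with y hy using dd_congr hy j

lemma dbar_zero' (j : Fin n) (x : CSp n) : dbar j (fun _ => (0:ℂ)) x = 0 := by
  unfold dbar; simp

lemma dbar_const' (j : Fin n) (c : ℂ) (x : CSp n) : dbar j (fun _ => c) x = 0 := by
  unfold dbar; simp

lemma dd_const' (j : Fin n) (c : ℂ) (x : CSp n) : dd j (fun _ => c) x = 0 := by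
  unfold dd; simp

lemma dbar_supp {f : CSp n → ℂ} (j : Fin n) : tsupport (dbar j f) ⊆ tsupport f := by
  apply closure_minimal _ (isClosed_tsupport f)
  intro x hx
  by_contra h
  apply hx
  rw [dbar_congr (notMem_tsupport_iff_eventuallyEq.1 h) j]
  exact dbar_zero' j x

lemma dd_supp {f : CSp n → ℂ} (j : Fin n) : tsupport (dd j f) ⊆ tsupport f := by
  apply closure_minimal _ (isClosed_tsupport f)
  intro x hx
  by_contra h
  apply hx
  rw [dd_congr (notMem_tsupport_iff_eventuallyEq.1 h) j]
  exact dd_const' j 0 x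

lemma Tst.dbar {f : CSp n → ℂ} (hf : Tst f) (j : Fin n) : Tst (dbar j f) :=
  ⟨dbar_sm hf.1 j, hf.2.of_isClosed_subset (isClosed_tsupport _) (dbar_supp j)⟩

lemma Tst.dd {f : CSp n → ℂ} (hf : Tst f) (j : Fin n) : Tst (dd j f) :=
  ⟨dd_sm hf.1 j, hf.2.of_isClosed_subset (isClosed_tsupport _) (dd_supp j)⟩

lemma Tst.mul_right {f g : CSp n → ℂ} (hf : Tst f) (hg : ContDiff ℝ ∞ g) :
    Tst (fun x => f x * g x) := ⟨hf.1.mul hg, hf.2.mul_right⟩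

lemma Tst.mul_left {f g : CSp n → ℂ} (hf : Tst f) (hg : ContDiff ℝ ∞ g) :
    Tst (fun x => g x * f x) := ⟨hg.mul hf.1, hf.2.mul_left⟩

lemma sm_conj {f : CSp n → ℂ} (hf : ContDiff ℝ ∞ f) :
    ContDiff ℝ ∞ (fun x => (starRingEnd ℂ) (f x)) :=
  Complex.conjCLE.contDiff.comp hf

lemma Tst.conj {f : CSp n → ℂ} (hf : Tst f) : Tst (fun x => (starRingEnd ℂ) (f x)) := by
  refine ⟨sm_conj hf.1, ?_⟩
  exact hf.2.comp_left (g := fun z => (starRingEnd ℂ) z) (by simp)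

lemma Tst.integrable {f : CSp n → ℂ} (hf : Tst f) : Integrable f :=
  hf.1.continuous.integrable_of_hasCompactSupport hf.2

lemma dbar_mul {f g : CSp n → ℂ} {x : CSp n} (hf : DifferentiableAt ℝ f x)
    (hg : DifferentiableAt ℝ g x) (j : Fin n) :
    dbar j (fun y => f y * g y) x = dbar j f x * g x + f x * dbar j g x := by
  unfold dbar
  rw [fderiv_fun_mul hf hg]
  simp
  ring

lemma dd_mul {f g : CSp n → ℂ} {x : CSp n} (hf : DifferentiableAt ℝ f x)
    (hg : DifferentiableAt ℝ g x) (j : Fin n) :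
    dd j (fun y => f y * g y) x = dd j f x * g x + f x * dd j g x := by
  unfold dd
  rw [fderiv_fun_mul hf hg]
  simp
  ring

lemma dbar_sub {f g : CSp n → ℂ} {x : CSp n} (hf : DifferentiableAt ℝ f x)
    (hg : DifferentiableAt ℝ g x) (j : Fin n) :
    dbar j (fun y => f y - g y) x = dbar j f x - dbar j g x := by
  unfold dbar
  rw [fderiv_fun_sub hf hg]
  simp
  ring

lemma dbar_add {f g : CSp n → ℂ} {x : CSp n} (hf : DifferentiableAt ℝ f x)
    (hg : DifferentiableAt ℝ g x) (j : Fin n) :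
    dbar j (fun y => f y + g y) x = dbar j f x + dbar j g x := by
  unfold dbar
  rw [fderiv_fun_add hf hg]
  simp
  ring

lemma dd_add {f g : CSp n → ℂ} {x : CSp n} (hf : DifferentiableAt ℝ f x)
    (hg : DifferentiableAt ℝ g x) (j : Fin n) :
    dd j (fun y => f y + g y) x = dd j f x + dd j g x := by
  unfold dd
  rw [fderiv_fun_add hf hg]
  simp
  ring

lemma dd_sub {f g : CSp n → ℂ} {x : CSp n} (hf : DifferentiableAt ℝ f x)
    (hg : DifferentiableAt ℝ g x) (j : Fin n) :
    dd j (fun y => f y - g y) x = dd j f x - dd j g x := by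
  unfold dd
  rw [fderiv_fun_sub hf hg]
  simp
  ring

lemma fderiv_conj' {f : CSp n → ℂ} {x : CSp n} (hf : DifferentiableAt ℝ f x) (v : CSp n) :
    fderiv ℝ (fun y => (starRingEnd ℂ) (f y)) x v = (starRingEnd ℂ) (fderiv ℝ f x v) := by
  have h := (Complex.conjCLE.toContinuousLinearMap.hasFDerivAt (x := f x)).comp x hf.hasFDerivAt
  have h2 : HasFDerivAt (fun y => (starRingEnd ℂ) (f y))
    (Complex.conjCLE.toContinuousLinearMap.comp (fderiv ℝ f x)) x := h
  rw [h2.fderiv]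
  simp

lemma dd_conj {f : CSp n → ℂ} {x : CSp n} (hf : DifferentiableAt ℝ f x) (j : Fin n) :
    dd j (fun y => (starRingEnd ℂ) (f y)) x = (starRingEnd ℂ) (dbar j f x) := by
  unfold dd dbar
  rw [fderiv_conj' hf, fderiv_conj' hf]
  simp [Complex.conj_ofNat]
  ring

lemma dbar_conj {f : CSp n → ℂ} {x : CSp n} (hf : DifferentiableAt ℝ f x) (j : Fin n) :
    dbar j (fun y => (starRingEnd ℂ) (f y)) x = (starRingEnd ℂ) (dd j f x) := by
  unfold dd dbar
  rw [fderiv_conj' hf, fderiv_conj' hf]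
  simp [Complex.conj_ofNat]

lemma fderiv_fderiv_comm {f : CSp n → ℂ} (hf : ContDiff ℝ ∞ f) (x v w : CSp n) :
    fderiv ℝ (fun y => fderiv ℝ f y v) x w = fderiv ℝ (fun y => fderiv ℝ f y w) x v := by
  have h1 : DifferentiableAt ℝ (fderiv ℝ f) x :=
    ((hf.fderiv_right (m := ∞) (by simp)).differentiable (by simp)) x
  have hs := second_derivative_symmetric (f := f) (f' := fderiv ℝ f) (x := x)
    (f'' := fderiv ℝ (fderiv ℝ f) x)
    (fun y => (sm_diff hf y).hasFDerivAt) h1.hasFDerivAt v w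
  have key : ∀ a b : CSp n, fderiv ℝ (fun y => fderiv ℝ f y a) x b
      = fderiv ℝ (fderiv ℝ f) x b a := by
    intro a b
    have := (h1.hasFDerivAt.clm_apply (hasFDerivAt_const a x)).fderiv
    rw [this]; simp
  rw [key, key, hs]

lemma fderiv_dbar {f : CSp n → ℂ} (hf : ContDiff ℝ ∞ f) (j : Fin n) (x v : CSp n) :
    fderiv ℝ (dbar j f) x v = (1/2) * (fderiv ℝ (fun y => fderiv ℝ f y v) x (eB j) +
      Complex.I * fderiv ℝ (fun y => fderiv ℝ f y v) x (Complex.I • eB j)) := by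
  have h : ∀ w : CSp n, DifferentiableAt ℝ (fun y => fderiv ℝ f y w) x := fun w =>
    sm_diff (contDiff_fderiv_apply' hf w) x
  rw [← fderiv_fderiv_comm hf x _ v, ← fderiv_fderiv_comm hf x _ v]
  unfold dbar
  rw [fderiv_const_mul ((h _).fun_add ((h _).const_mul _)),
    fderiv_fun_add (h _) ((h _).const_mul _), fderiv_const_mul (h _)]
  simp
  ring

lemma fderiv_dd {f : CSp n → ℂ} (hf : ContDiff ℝ ∞ f) (j : Fin n) (x v : CSp n) :
    fderiv ℝ (dd j f) x v = (1/2) * (fderiv ℝ (fun y => fderiv ℝ f y v) x (eB j) -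
      Complex.I * fderiv ℝ (fun y => fderiv ℝ f y v) x (Complex.I • eB j)) := by
  have h : ∀ w : CSp n, DifferentiableAt ℝ (fun y => fderiv ℝ f y w) x := fun w =>
    sm_diff (contDiff_fderiv_apply' hf w) x
  rw [← fderiv_fderiv_comm hf x _ v, ← fderiv_fderiv_comm hf x _ v]
  unfold dd
  rw [fderiv_const_mul ((h _).fun_sub ((h _).const_mul _)),
    fderiv_fun_sub (h _) ((h _).const_mul _), fderiv_const_mul (h _)]
  simp

lemma dbar_dd_comm {f : CSp n → ℂ} (hf : ContDiff ℝ ∞ f) (j k : Fin n) (x : CSp n) :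
    dbar k (dd j f) x = dd j (dbar k f) x := by
  rw [dbar, dd, fderiv_dd hf, fderiv_dd hf, fderiv_dbar hf, fderiv_dbar hf,
    fderiv_fderiv_comm hf x (eB k) (eB j), fderiv_fderiv_comm hf x (eB k) (Complex.I • eB j),
    fderiv_fderiv_comm hf x (Complex.I • eB k) (eB j),
    fderiv_fderiv_comm hf x (Complex.I • eB k) (Complex.I • eB j)]
  ring

lemma dbar_dbar_comm {f : CSp n → ℂ} (hf : ContDiff ℝ ∞ f) (j k : Fin n) (x : CSp n) :
    dbar k (dbar j f) x = dbar j (dbar k f) x := by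
  rw [dbar, dbar, fderiv_dbar hf, fderiv_dbar hf, fderiv_dbar hf, fderiv_dbar hf,
    fderiv_fderiv_comm hf x (eB k) (eB j), fderiv_fderiv_comm hf x (eB k) (Complex.I • eB j),
    fderiv_fderiv_comm hf x (Complex.I • eB k) (eB j),
    fderiv_fderiv_comm hf x (Complex.I • eB k) (Complex.I • eB j)]
  ring

lemma integral_fderiv_zero {f : CSp n → ℂ} (hf : Tst f) (v : CSp n) :
    ∫ x, fderiv ℝ f x v = 0 := by
  have h := integral_mul_fderiv_eq_neg_fderiv_mul_of_integrable (μ := (volume : Measure (CSp n)))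
    (f := fun _ => (1:ℂ)) (g := f) (v := v) (by simp)
    (by
      simp only [one_mul]
      exact ((contDiff_fderiv_apply' hf.1 v).continuous).integrable_of_hasCompactSupport
        (hf.2.fderiv_apply (𝕜 := ℝ) v))
    (by simpa using hf.integrable) (fun x _ => by fun_prop) (fun x _ => sm_diff hf.1 x)
  simpa using h

lemma integral_dbar_zero {f : CSp n → ℂ} (hf : Tst f) (j : Fin n) : ∫ x, dbar j f x = 0 := by
  have hi : ∀ v, Integrable (fun x => fderiv ℝ f x v) := fun v =>
    ((contDiff_fderiv_apply' hf.1 v).continuous).integrable_of_hasCompactSupport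
        (hf.2.fderiv_apply (𝕜 := ℝ) v)
  unfold dbar
  rw [integral_const_mul, integral_add (hi _) ((hi _).const_mul _), integral_const_mul,
    integral_fderiv_zero hf, integral_fderiv_zero hf]
  simp

lemma integral_dd_zero {f : CSp n → ℂ} (hf : Tst f) (j : Fin n) : ∫ x, dd j f x = 0 := by
  have hi : ∀ v, Integrable (fun x => fderiv ℝ f x v) := fun v =>
    ((contDiff_fderiv_apply' hf.1 v).continuous).integrable_of_hasCompactSupport
        (hf.2.fderiv_apply (𝕜 := ℝ) v)
  unfold dd
  rw [integral_const_mul, integral_sub (hi _) ((hi _).const_mul _), integral_const_mul,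
    integral_fderiv_zero hf, integral_fderiv_zero hf]
  simp

lemma ibp_dbar {f g : CSp n → ℂ} (hf : Tst f) (hg : ContDiff ℝ ∞ g) (j : Fin n) :
    ∫ x, dbar j f x * g x = - ∫ x, f x * dbar j g x := by
  have h := integral_dbar_zero (hf.mul_right hg) j
  have h2 : ∀ x, dbar j (fun x => f x * g x) x = dbar j f x * g x + f x * dbar j g x :=
    fun x => dbar_mul (sm_diff hf.1 x) (sm_diff hg x) j
  simp_rw [h2] at h
  rw [integral_add ((hf.dbar j).mul_right hg).integrable
    (hf.mul_right (dbar_sm hg j)).integrable] at h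
  linear_combination h

lemma ibp_dd {f g : CSp n → ℂ} (hf : Tst f) (hg : ContDiff ℝ ∞ g) (j : Fin n) :
    ∫ x, dd j f x * g x = - ∫ x, f x * dd j g x := by
  have h := integral_dd_zero (hf.mul_right hg) j
  have h2 : ∀ x, dd j (fun x => f x * g x) x = dd j f x * g x + f x * dd j g x :=
    fun x => dd_mul (sm_diff hf.1 x) (sm_diff hg x) j
  simp_rw [h2] at h
  rw [integral_add ((hf.dd j).mul_right hg).integrable
    (hf.mul_right (dd_sm hg j)).integrable] at h
  linear_combination h

end PartA1
end

open Metric Set Filter Asymptotics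
open scoped Manifold Topology
noncomputable section

section PartA2
open MeasureTheory
open scoped ContDiff ComplexConjugate

variable {n : ℕ}

/-- complexification of a real function -/
def rc (φ : CSp n → ℝ) : CSp n → ℂ := fun x => (φ x : ℂ)

def wt (φ : CSp n → ℝ) : CSp n → ℂ := fun x => Complex.exp (-(φ x : ℂ))

def del (φ : CSp n → ℝ) (j : Fin n) (u : CSp n → ℂ) : CSp n → ℂ :=
  fun x => dd j u x - dd j (rc φ) x * u x

lemma rc_sm {φ : CSp n → ℝ} (h : ContDiff ℝ ∞ φ) : ContDiff ℝ ∞ (rc φ) :=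
  Complex.ofRealCLM.contDiff.comp h

lemma rc_diff {φ : CSp n → ℝ} {x : CSp n} (h : DifferentiableAt ℝ φ x) :
    DifferentiableAt ℝ (rc φ) x :=
  Complex.ofRealCLM.differentiableAt.comp x h

lemma wt_sm {φ : CSp n → ℝ} (h : ContDiff ℝ ∞ φ) : ContDiff ℝ ∞ (wt φ) :=
  (rc_sm h).neg.cexp

lemma dd_comp {f : CSp n → ℂ} {x : CSp n} (hf : DifferentiableAt ℝ f x) {g : ℂ → ℂ} {g' : ℂ}
    (hg : HasDerivAt g g' (f x)) (j : Fin n) :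
    dd j (fun y => g (f y)) x = g' * dd j f x := by
  have h := (hg.hasFDerivAt.restrictScalars ℝ).comp x hf.hasFDerivAt
  have h2 : fderiv ℝ (fun y => g (f y)) x = _ := h.fderiv
  unfold dd
  rw [h2]
  simp
  ring

lemma dbar_comp {f : CSp n → ℂ} {x : CSp n} (hf : DifferentiableAt ℝ f x) {g : ℂ → ℂ} {g' : ℂ}
    (hg : HasDerivAt g g' (f x)) (j : Fin n) :
    dbar j (fun y => g (f y)) x = g' * dbar j f x := by
  have h := (hg.hasFDerivAt.restrictScalars ℝ).comp x hf.hasFDerivAt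
  have h2 : fderiv ℝ (fun y => g (f y)) x = _ := h.fderiv
  unfold dbar
  rw [h2]
  simp
  ring

lemma hasDerivAt_cexp_neg (z : ℂ) : HasDerivAt (fun z : ℂ => Complex.exp (-z)) (-Complex.exp (-z)) z := by
  simpa using (hasDerivAt_neg z).cexp

lemma dd_wt {φ : CSp n → ℝ} {x : CSp n} (h : DifferentiableAt ℝ φ x) (j : Fin n) :
    dd j (wt φ) x = - dd j (rc φ) x * wt φ x := by
  have := dd_comp (rc_diff h) (hasDerivAt_cexp_neg (rc φ x)) j
  unfold wt
  simp only [rc] at this ⊢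
  rw [this]; ring

lemma dbar_wt {φ : CSp n → ℝ} {x : CSp n} (h : DifferentiableAt ℝ φ x) (j : Fin n) :
    dbar j (wt φ) x = - dbar j (rc φ) x * wt φ x := by
  have := dbar_comp (rc_diff h) (hasDerivAt_cexp_neg (rc φ x)) j
  unfold wt
  simp only [rc] at this ⊢
  rw [this]; ring

lemma dbar_rc {φ : CSp n → ℝ} {x : CSp n} (h : DifferentiableAt ℝ φ x) (j : Fin n) :
    dbar j (rc φ) x = conj (dd j (rc φ) x) := by
  rw [← dbar_conj (rc_diff h)]
  congr 1
  ext y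
  simp [rc]

lemma dd_rc {φ : CSp n → ℝ} {x : CSp n} (h : DifferentiableAt ℝ φ x) (j : Fin n) :
    dd j (rc φ) x = conj (dbar j (rc φ) x) := by
  rw [dbar_rc h]; simp

lemma del_sm {φ : CSp n → ℝ} (hφ : ContDiff ℝ ∞ φ) {u : CSp n → ℂ} (hu : ContDiff ℝ ∞ u)
    (j : Fin n) : ContDiff ℝ ∞ (del φ j u) :=
  (dd_sm hu j).sub ((dd_sm (rc_sm hφ) j).mul hu)

lemma Tst.sub {f g : CSp n → ℂ} (hf : Tst f) (hg : Tst g) : Tst (fun x => f x - g x) :=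
  ⟨hf.1.sub hg.1, hf.2.sub hg.2⟩

lemma Tst.del {φ : CSp n → ℝ} (hφ : ContDiff ℝ ∞ φ) {u : CSp n → ℂ} (hu : Tst u)
    (j : Fin n) : Tst (del φ j u) :=
  (hu.dd j).sub (hu.mul_left (dd_sm (rc_sm hφ) j))

lemma be_pair {φ : CSp n → ℝ} (hφ : ContDiff ℝ ∞ φ) {u v : CSp n → ℂ} (hu : Tst u) (hv : Tst v)
    (j k : Fin n) :
    ∫ x, del φ j u x * conj (del φ k v x) * wt φ x =
      (∫ x, dbar k u x * conj (dbar j v x) * wt φ x) +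
      ∫ x, dbar k (dd j (rc φ)) x * u x * conj (v x) * wt φ x := by
  have hφd : ∀ x, DifferentiableAt ℝ φ x := fun x => (hφ.differentiable (by simp)) x
  have hdu : Tst (del φ j u) := hu.del hφ j
  have hvb := hv.conj
  -- step 1
  have e1 : ∀ x, conj (del φ k v x) * wt φ x = dbar k (fun y => conj (v y) * wt φ y) x := by
    intro x
    rw [dbar_mul (sm_diff hvb.1 x) (sm_diff (wt_sm hφ) x), dbar_wt (hφd x),
      dbar_conj (sm_diff hv.1 x), dbar_rc (hφd x)]
    simp only [del, map_sub, map_mul]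
    ring
  have s1 : ∫ x, del φ j u x * conj (del φ k v x) * wt φ x =
      - ∫ x, dbar k (del φ j u) x * (conj (v x) * wt φ x) := by
    rw [ibp_dbar hdu (hvb.1.mul (wt_sm hφ)) k, neg_neg]
    apply integral_congr_ae
    filter_upwards with x
    rw [mul_assoc, e1]
  -- step 2
  have e2 : ∀ x, dbar k (del φ j u) x = del φ j (dbar k u) x - dbar k (dd j (rc φ)) x * u x := by
    intro x
    unfold del
    rw [dbar_sub (sm_diff (dd_sm hu.1 j) x)
      ((sm_diff (dd_sm (rc_sm hφ) j) x).fun_mul (sm_diff hu.1 x)),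
      dbar_mul (sm_diff (dd_sm (rc_sm hφ) j) x) (sm_diff hu.1 x), dbar_dd_comm hu.1]
    ring
  have hduk := hu.dbar k
  have e3 : ∀ x, del φ j (dbar k u) x * wt φ x = dd j (fun y => dbar k u y * wt φ y) x := by
    intro x
    rw [dd_mul (sm_diff hduk.1 x) (sm_diff (wt_sm hφ) x), dd_wt (hφd x)]
    simp only [del]
    ring
  have s2 : ∫ x, del φ j (dbar k u) x * (conj (v x) * wt φ x) =
      - ∫ x, dbar k u x * conj (dbar j v x) * wt φ x := by
    have := ibp_dd (hduk.mul_right (wt_sm hφ)) hvb.1 j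
    simp_rw [dd_conj (sm_diff hv.1 _)] at this
    have e4 : ∀ x, del φ j (dbar k u) x * (conj (v x) * wt φ x)
        = dd j (fun y => dbar k u y * wt φ y) x * conj (v x) := by
      intro x
      rw [← e3]; ring
    simp_rw [e4, this]
    congr 1
    apply integral_congr_ae
    filter_upwards with x
    ring
  rw [s1]
  simp_rw [e2, sub_mul]
  rw [integral_sub, s2]
  · simp only [neg_sub, sub_neg_eq_add]
    rw [add_comm]
    congr 1
    apply integral_congr_ae
    filter_upwards with x
    ring
  · exact ((hduk.del hφ j).mul_right (hvb.1.mul (wt_sm hφ))).integrable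
  · exact ((hu.mul_left (dbar_sm (dd_sm (rc_sm hφ) j) k)).mul_right (hvb.1.mul (wt_sm hφ))).integrable

/-- algebraic identity used in the Bochner–Kodaira estimate -/
lemma curl_alg (a : Fin n → Fin n → ℂ) :
    - ((1/2 : ℝ) * ∑ j, ∑ k, ‖a j k - a k j‖^2) ≤ (∑ j, ∑ k, a k j * conj (a j k)).re := by
  have h : ∀ j k, ‖a j k - a k j‖^2 = ‖a j k‖^2 + ‖a k j‖^2 - 2 * (a k j * conj (a j k)).re := by
    intro j k
    rw [Complex.sq_norm, Complex.sq_norm, Complex.sq_norm, Complex.normSq_sub]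
    have : (a j k * conj (a k j)).re = (a k j * conj (a j k)).re := by
      simp; ring
    rw [this]
  simp_rw [h]
  simp only [Finset.sum_sub_distrib, Finset.sum_add_distrib, ← Finset.mul_sum, Complex.re_sum]
  have h2 : 0 ≤ ∑ j, ∑ k, ‖a j k‖^2 := by positivity
  have h3 : ∑ j, ∑ k, ‖a k j‖^2 = ∑ j, ∑ k, ‖a j k‖^2 := Finset.sum_comm
  rw [h3]
  linarith

def curl (Y : Fin n → CSp n → ℂ) (j k : Fin n) (x : CSp n) : ℂ := dbar j (Y k) x - dbar k (Y j) x

def levi (φ : CSp n → ℝ) (t : Fin n → ℂ) (x : CSp n) : ℝ :=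
  (∑ j, ∑ k, dbar k (dd j (rc φ)) x * t j * conj (t k)).re

lemma wt_eq (φ : CSp n → ℝ) (x : CSp n) : wt φ x = ((Real.exp (-φ x) : ℝ) : ℂ) := by
  simp [wt]

lemma sum_sq_int {φ : CSp n → ℝ} (hφ : ContDiff ℝ ∞ φ) {f : CSp n → ℂ} (hf : Tst f) :
    Integrable (fun x => ‖f x‖^2 * Real.exp (-φ x)) := by
  have := (hf.mul_right (hf.conj.1.mul (wt_sm hφ))).integrable.re
  refine this.congr ?_
  filter_upwards with x
  rw [wt_eq, ← mul_assoc, Complex.mul_conj, Complex.normSq_eq_norm_sq, ← Complex.ofReal_mul]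
  exact Complex.ofReal_re _

/-- basic a priori estimate -/
theorem be_ineq {φ : CSp n → ℝ} (hφ : ContDiff ℝ ∞ φ) {Y : Fin n → CSp n → ℂ}
    (hY : ∀ j, Tst (Y j)) :
    ∫ x, levi φ (fun j => Y j x) x * Real.exp (-φ x) ≤
      (∫ x, ‖∑ j, del φ j (Y j) x‖^2 * Real.exp (-φ x)) +
      (1/2) * ∫ x, (∑ j, ∑ k, ‖curl Y j k x‖^2) * Real.exp (-φ x) := by
  have hI1 : ∀ j k, Integrable (fun x => del φ j (Y j) x * conj (del φ k (Y k) x) * wt φ x) :=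
    fun j k => ((((hY j).del hφ j).mul_right (((hY k).del hφ k).conj.1)).mul_right (wt_sm hφ)).integrable
  have hI2 : ∀ j k, Integrable (fun x => dbar k (Y j) x * conj (dbar j (Y k) x) * wt φ x) :=
    fun j k => ((((hY j).dbar k).mul_right (((hY k).dbar j).conj.1)).mul_right (wt_sm hφ)).integrable
  have hI3 : ∀ j k, Integrable (fun x => dbar k (dd j (rc φ)) x * Y j x * conj (Y k x) * wt φ x) :=
    fun j k => ((((hY j).mul_left (dbar_sm (dd_sm (rc_sm hφ) j) k)).mul_right
      (hY k).conj.1).mul_right (wt_sm hφ)).integrable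
  have main : ∑ j, ∑ k, ∫ x, del φ j (Y j) x * conj (del φ k (Y k) x) * wt φ x =
      (∑ j, ∑ k, ∫ x, dbar k (Y j) x * conj (dbar j (Y k) x) * wt φ x) +
      ∑ j, ∑ k, ∫ x, dbar k (dd j (rc φ)) x * Y j x * conj (Y k x) * wt φ x := by
    simp_rw [be_pair hφ (hY _) (hY _), Finset.sum_add_distrib]
  have S : ∀ (F : Fin n → Fin n → CSp n → ℂ), (∀ j k, Integrable (F j k)) →
      (∑ j, ∑ k, ∫ x, F j k x).re = ∫ x, (∑ j, ∑ k, F j k x).re := by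
    intro F hF
    have : ∑ j, ∑ k, ∫ x, F j k x = ∫ x, ∑ j, ∑ k, F j k x := by
      rw [integral_finsetSum _ (fun j _ => integrable_finsetSum _ (fun k _ => hF j k))]
      apply Finset.sum_congr rfl
      intro j _
      rw [integral_finsetSum _ (fun k _ => hF j k)]
    rw [this]
    exact (integral_re (integrable_finsetSum _ (fun j _ => integrable_finsetSum _ (fun k _ => hF j k)))).symm
  have SI : ∀ (F : Fin n → Fin n → CSp n → ℂ), (∀ j k, Integrable (F j k)) →
      Integrable (fun x => (∑ j, ∑ k, F j k x).re) := fun F hF =>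
    (integrable_finsetSum _ (fun j _ => integrable_finsetSum _ (fun k _ => hF j k))).re
  have main2 := congrArg Complex.re main
  rw [Complex.add_re, S _ hI1, S _ hI2, S _ hI3] at main2
  have h1 : ∫ x, (∑ j, ∑ k, del φ j (Y j) x * conj (del φ k (Y k) x) * wt φ x).re =
      ∫ x, ‖∑ j, del φ j (Y j) x‖^2 * Real.exp (-φ x) := by
    apply integral_congr_ae
    filter_upwards with x
    have : ∑ j, ∑ k, del φ j (Y j) x * conj (del φ k (Y k) x) * wt φ x
        = ((‖∑ j, del φ j (Y j) x‖^2 * Real.exp (-φ x) : ℝ) : ℂ) := by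
      rw [Complex.ofReal_mul, Complex.sq_norm, ← Complex.mul_conj, ← wt_eq, map_sum,
        Finset.sum_mul_sum]
      simp only [Finset.sum_mul]
    rw [this, Complex.ofReal_re]
  have h3 : ∫ x, (∑ j, ∑ k, dbar k (dd j (rc φ)) x * Y j x * conj (Y k x) * wt φ x).re =
      ∫ x, levi φ (fun j => Y j x) x * Real.exp (-φ x) := by
    apply integral_congr_ae
    filter_upwards with x
    simp only [levi, ← Finset.sum_mul]
    rw [wt_eq, Complex.re_mul_ofReal]
  have h2 : - ((1/2) * ∫ x, (∑ j, ∑ k, ‖curl Y j k x‖^2) * Real.exp (-φ x)) ≤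
      ∫ x, (∑ j, ∑ k, dbar k (Y j) x * conj (dbar j (Y k) x) * wt φ x).re := by
    rw [← integral_const_mul, ← integral_neg]
    apply integral_mono
    · apply Integrable.neg
      apply Integrable.const_mul
      simp only [Finset.sum_mul]
      refine integrable_finsetSum _ (fun j _ => integrable_finsetSum _ (fun k _ => ?_))
      exact sum_sq_int hφ (((hY k).dbar j).sub ((hY j).dbar k))
    · exact SI _ hI2
    · intro x
      have := curl_alg (fun j k => dbar j (Y k) x)
      simp only [← Finset.sum_mul, curl]
      rw [wt_eq, Complex.re_mul_ofReal]
      have h5 := mul_le_mul_of_nonneg_right this (Real.exp_pos (-φ x)).le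
      linarith
  rw [h1, h3] at main2
  linarith

end PartA2
end

open Metric Set Filter Asymptotics
open scoped Manifold Topology
noncomputable section

section PartA3
open MeasureTheory
open scoped ContDiff ComplexConjugate

variable {n : ℕ}

lemma exists_cutoff {K D : Set (CSp n)} (hK : IsCompact K) (hD : IsOpen D) (hKD : K ⊆ D) :
    ∃ κ : CSp n → ℝ, ContDiff ℝ ∞ κ ∧ HasCompactSupport κ ∧ tsupport κ ⊆ D ∧
      (∀ᶠ x in 𝓝ˢ K, κ x = 1) ∧ ∀ x, κ x ∈ Icc (0:ℝ) 1 := by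
  obtain ⟨L, hL, hKL, hLD⟩ := exists_compact_between hK hD hKD
  obtain ⟨f, h1, h0, hI⟩ := exists_contMDiffMap_one_nhds_of_subset_interior (n := ⊤)
    (I := 𝓘(ℝ, CSp n)) hK.isClosed hKL
  have hs : tsupport (f : CSp n → ℝ) ⊆ L := by
    apply closure_minimal _ hL.isClosed
    intro x hx
    by_contra h
    exact hx (h0 x h)
  exact ⟨f, f.contMDiff.contDiff, hL.of_isClosed_subset (isClosed_tsupport _) hs,
    hs.trans hLD, h1, hI⟩


lemma sm_mul_local {κ h : CSp n → ℝ} {D : Set (CSp n)} (hD : IsOpen D) (hκ : ContDiff ℝ ∞ κ)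
    (hs : tsupport κ ⊆ D) (hh : ContDiffOn ℝ ∞ h D) : ContDiff ℝ ∞ (fun x => κ x * h x) := by
  rw [contDiff_iff_contDiffAt]
  intro x
  by_cases hx : x ∈ tsupport κ
  · exact hκ.contDiffAt.mul (hh.contDiffAt (hD.mem_nhds (hs hx)))
  · have h0 := notMem_tsupport_iff_eventuallyEq.1 hx
    have : (fun x => κ x * h x) =ᶠ[𝓝 x] fun _ => 0 := by
      filter_upwards [h0] with y hy
      simp [hy]
    exact contDiffAt_const.congr_of_eventuallyEq this

lemma sm_mul_localC {κ h : CSp n → ℂ} {D : Set (CSp n)} (hD : IsOpen D) (hκ : ContDiff ℝ ∞ κ)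
    (hs : tsupport κ ⊆ D) (hh : ContDiffOn ℝ ∞ h D) : ContDiff ℝ ∞ (fun x => κ x * h x) := by
  rw [contDiff_iff_contDiffAt]
  intro x
  by_cases hx : x ∈ tsupport κ
  · exact hκ.contDiffAt.mul (hh.contDiffAt (hD.mem_nhds (hs hx)))
  · have h0 := notMem_tsupport_iff_eventuallyEq.1 hx
    have : (fun x => κ x * h x) =ᶠ[𝓝 x] fun _ => 0 := by
      filter_upwards [h0] with y hy
      simp [hy]
    exact contDiffAt_const.congr_of_eventuallyEq this

lemma norm_add_sq_le2 (a b : ℂ) : ‖a + b‖^2 ≤ 2 * ‖a‖^2 + 2 * ‖b‖^2 := by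
  have h := norm_add_le a b
  have h0 := norm_nonneg (a+b)
  nlinarith [sq_nonneg (‖a‖ - ‖b‖), norm_nonneg a, norm_nonneg b]

lemma cs_sum (a b : Fin n → ℂ) : ‖∑ j, a j * b j‖^2 ≤ (∑ j, ‖a j‖^2) * ∑ j, ‖b j‖^2 := by
  have h1 : ‖∑ j, a j * b j‖ ≤ ∑ j, ‖a j‖ * ‖b j‖ := by
    refine (norm_sum_le _ _).trans (le_of_eq ?_)
    simp
  calc ‖∑ j, a j * b j‖^2 ≤ (∑ j, ‖a j‖ * ‖b j‖)^2 := by gcongr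
    _ ≤ _ := Finset.sum_mul_sq_le_sq_mul_sq _ _ _

lemma Tst.sum {ι : Type*} (s : Finset ι) {f : ι → CSp n → ℂ} (hf : ∀ j, Tst (f j)) :
    Tst (fun x => ∑ j ∈ s, f j x) := by
  classical
  induction s using Finset.induction_on with
  | empty => simp only [Finset.sum_empty]; exact ⟨contDiff_const, HasCompactSupport.zero⟩
  | insert a s ha ih =>
    simp only [Finset.sum_insert ha]
    exact ⟨(hf a).1.add ih.1, (hf a).2.add ih.2⟩

theorem hor_global {φ ψ : CSp n → ℝ} (hφ : ContDiff ℝ ∞ φ) (hψ : ContDiff ℝ ∞ ψ)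
    {Y : Fin n → CSp n → ℂ} (hY : ∀ j, Tst (Y j))
    (hL : ∀ x, (∃ j, Y j x ≠ 0) → ∀ t : Fin n → ℂ,
      2 * ((∑ j, ‖dd j (rc ψ) x‖^2) + Real.exp (ψ x)) * (∑ j, ‖t j‖^2) ≤ levi φ t x) :
    ∫ x, (∑ j, ‖Y j x‖^2) * Real.exp (-(φ x - ψ x)) ≤
      (∫ x, ‖∑ j, del (fun y => φ y - ψ y) j (Y j) x‖^2 * Real.exp (-φ x)) +
      (1/2) * ∫ x, (∑ j, ∑ k, ‖curl Y j k x‖^2) * Real.exp (-φ x) := by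
  have hφψ : ContDiff ℝ ∞ (fun y => φ y - ψ y) := hφ.sub hψ
  have h0 := be_ineq hφ hY
  have iA : Integrable (fun x => (∑ j, ‖Y j x‖^2) * Real.exp (-(φ x - ψ x))) := by
    simp only [Finset.sum_mul]
    exact integrable_finsetSum _ (fun j _ => sum_sq_int hφψ (hY j))
  have iB : Integrable (fun x => ‖∑ j, del (fun y => φ y - ψ y) j (Y j) x‖^2 * Real.exp (-φ x)) :=
    sum_sq_int hφ (Tst.sum _ (fun j => (hY j).del hφψ j))
  have iC : Integrable (fun x => (∑ j, ∑ k, ‖curl Y j k x‖^2) * Real.exp (-φ x)) := by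
    simp only [Finset.sum_mul]
    refine integrable_finsetSum _ (fun j _ => integrable_finsetSum _ (fun k _ => ?_))
    exact sum_sq_int hφ (((hY k).dbar j).sub ((hY j).dbar k))
  have iD : Integrable (fun x => ‖∑ j, del φ j (Y j) x‖^2 * Real.exp (-φ x)) :=
    sum_sq_int hφ (Tst.sum _ (fun j => (hY j).del hφ j))
  have iL : Integrable (fun x => levi φ (fun j => Y j x) x * Real.exp (-φ x)) := by
    have hI3 : ∀ j k, Integrable (fun x => dbar k (dd j (rc φ)) x * Y j x * conj (Y k x) * wt φ x) :=
      fun j k => ((((hY j).mul_left (dbar_sm (dd_sm (rc_sm hφ) j) k)).mul_right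
        (hY k).conj.1).mul_right (wt_sm hφ)).integrable
    have := (integrable_finsetSum Finset.univ (fun j _ => integrable_finsetSum Finset.univ
      (fun k _ => hI3 j k))).re
    refine this.congr ?_
    filter_upwards with x
    simp only [levi, ← Finset.sum_mul]
    rw [wt_eq]
    exact Complex.re_mul_ofReal _ _
  have pt : ∀ x, (∑ j, ‖Y j x‖^2) * Real.exp (-(φ x - ψ x)) * 2 +
      ‖∑ j, del φ j (Y j) x‖^2 * Real.exp (-φ x) ≤
      levi φ (fun j => Y j x) x * Real.exp (-φ x) +
      2 * (‖∑ j, del (fun y => φ y - ψ y) j (Y j) x‖^2 * Real.exp (-φ x)) := by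
    intro x
    have e : Real.exp (-(φ x - ψ x)) = Real.exp (ψ x) * Real.exp (-φ x) := by
      rw [← Real.exp_add]; congr 1; ring
    have hE := Real.exp_pos (-φ x)
    have d1 : ∑ j, del φ j (Y j) x = ∑ j, del (fun y => φ y - ψ y) j (Y j) x
        + (- ∑ j, dd j (rc ψ) x * Y j x) := by
      rw [← Finset.sum_neg_distrib, ← Finset.sum_add_distrib]
      apply Finset.sum_congr rfl
      intro j _
      have : dd j (rc (fun y => φ y - ψ y)) x = dd j (rc φ) x - dd j (rc ψ) x := by
        rw [← dd_sub (sm_diff (rc_sm hφ) x) (sm_diff (rc_sm hψ) x)]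
        congr 1
        ext y; simp [rc]
      simp only [del, this]
      ring
    have d2 := norm_add_sq_le2 (∑ j, del (fun y => φ y - ψ y) j (Y j) x)
      (- ∑ j, dd j (rc ψ) x * Y j x)
    rw [← d1, norm_neg] at d2
    have d3 := cs_sum (fun j => dd j (rc ψ) x) (fun j => Y j x)
    have d4 : 2 * ((∑ j, ‖dd j (rc ψ) x‖^2) + Real.exp (ψ x)) * (∑ j, ‖Y j x‖^2)
        ≤ levi φ (fun j => Y j x) x := by
      by_cases hx : ∃ j, Y j x ≠ 0
      · exact hL x hx _
      · push Not at hx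
        simp [hx, levi]
    have d5 : (∑ j, ‖Y j x‖^2) * Real.exp (ψ x) * 2 + ‖∑ j, del φ j (Y j) x‖^2 ≤
      levi φ (fun j => Y j x) x + 2 * ‖∑ j, del (fun y => φ y - ψ y) j (Y j) x‖^2 := by
      nlinarith
    have := mul_le_mul_of_nonneg_right d5 hE.le
    rw [e]
    nlinarith
  have := integral_mono ((iA.mul_const 2).add iD) (iL.add (iB.const_mul 2)) pt
  rw [integral_add' (iA.mul_const 2) iD, integral_add' iL (iB.const_mul 2), integral_mul_const,
    integral_const_mul] at this
  have hC : 0 ≤ ∫ x, (∑ j, ∑ k, ‖curl Y j k x‖^2) * Real.exp (-φ x) := by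
    apply integral_nonneg
    intro x
    positivity
  linarith

theorem hor_local {D : Set (CSp n)} (hD : IsOpen D) {φ ψ : CSp n → ℝ} (hφ : ContDiffOn ℝ ∞ φ D)
    (hψ : ContDiffOn ℝ ∞ ψ D)
    {Y : Fin n → CSp n → ℂ} (hY : ∀ j, Tst (Y j)) (hYD : ∀ j, tsupport (Y j) ⊆ D)
    (hL : ∀ x ∈ D, ∀ t : Fin n → ℂ,
      2 * ((∑ j, ‖dd j (rc ψ) x‖^2) + Real.exp (ψ x)) * (∑ j, ‖t j‖^2) ≤ levi φ t x) :
    ∫ x, (∑ j, ‖Y j x‖^2) * Real.exp (-(φ x - ψ x)) ≤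
      (∫ x, ‖∑ j, del (fun y => φ y - ψ y) j (Y j) x‖^2 * Real.exp (-φ x)) +
      (1/2) * ∫ x, (∑ j, ∑ k, ‖curl Y j k x‖^2) * Real.exp (-φ x) := by
  have hKc : IsCompact (⋃ j, tsupport (Y j)) := isCompact_iUnion (fun j => (hY j).2)
  have hKD : (⋃ j, tsupport (Y j)) ⊆ D := iUnion_subset hYD
  obtain ⟨κ, k1, k2, k3, k4, -⟩ := exists_cutoff hKc hD hKD
  have hφ' := sm_mul_local hD k1 k3 hφ
  have hψ' := sm_mul_local hD k1 k3 hψ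
  have loc : ∀ x ∈ (⋃ j, tsupport (Y j)), ∀ g : CSp n → ℝ, (fun y => κ y * g y) =ᶠ[𝓝 x] g := by
    intro x hx g
    have := (eventually_nhdsSet_iff_forall.1 k4) x hx
    filter_upwards [this] with y hy
    simp [hy]
  have rce : ∀ x ∈ (⋃ j, tsupport (Y j)), ∀ g : CSp n → ℝ,
      rc (fun y => κ y * g y) =ᶠ[𝓝 x] rc g := by
    intro x hx g
    filter_upwards [loc x hx g] with y hy
    simp only [rc]; rw [hy]
  have hout : ∀ x, x ∉ (⋃ j, tsupport (Y j)) → ∀ j, Y j =ᶠ[𝓝 x] fun _ => 0 := by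
    intro x hx j
    apply notMem_tsupport_iff_eventuallyEq.1
    intro h
    exact hx (mem_iUnion.2 ⟨j, h⟩)
  have main := hor_global hφ' hψ' hY (by
    intro x ⟨j, hj⟩ t
    have hx : x ∈ (⋃ j, tsupport (Y j)) := mem_iUnion.2 ⟨j, subset_tsupport _ hj⟩
    have := hL x (hKD hx) t
    have e1 : ∀ j, dd j (rc fun y => κ y * ψ y) x = dd j (rc ψ) x := fun j =>
      dd_congr (rce x hx ψ) j
    have e2 : κ x * ψ x = ψ x := (loc x hx ψ).eq_of_nhds
    have e3 : levi (fun x => κ x * φ x) t x = levi φ t x := by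
      unfold levi
      congr 1
      apply Finset.sum_congr rfl; intro j _
      apply Finset.sum_congr rfl; intro k _
      rw [dbar_congr (dd_eventuallyEq (rce x hx φ) j) k]
    simp_rw [e1, e2, e3]
    exact this)
  have i1 : ∀ x, (∑ j, ‖Y j x‖^2) * Real.exp (-(κ x * φ x - κ x * ψ x)) =
      (∑ j, ‖Y j x‖^2) * Real.exp (-(φ x - ψ x)) := by
    intro x
    by_cases hx : x ∈ ⋃ j, tsupport (Y j)
    · rw [(loc x hx φ).eq_of_nhds, (loc x hx ψ).eq_of_nhds]
    · have := fun j => (hout x hx j).eq_of_nhds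
      simp [this]
  have i2 : ∀ x, ‖∑ j, del (fun y => κ y * φ y - κ y * ψ y) j (Y j) x‖^2 * Real.exp (-(κ x * φ x)) =
      ‖∑ j, del (fun y => φ y - ψ y) j (Y j) x‖^2 * Real.exp (-φ x) := by
    intro x
    by_cases hx : x ∈ ⋃ j, tsupport (Y j)
    · rw [(loc x hx φ).eq_of_nhds]
      have : ∀ j, dd j (rc (fun y => κ y * φ y - κ y * ψ y)) x = dd j (rc (fun y => φ y - ψ y)) x := by
        intro j
        apply dd_congr
        filter_upwards [loc x hx φ, loc x hx ψ] with y h1 h2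
        simp only [rc]; rw [h1, h2]
      simp only [del, this]
    · have h1 := fun j => (hout x hx j).eq_of_nhds
      have h2 := fun j => (dd_congr (hout x hx j) j).trans (dd_const' j 0 x)
      simp [del, h1, h2]
  have i3 : ∀ x, (∑ j, ∑ k, ‖curl Y j k x‖^2) * Real.exp (-(κ x * φ x)) =
      (∑ j, ∑ k, ‖curl Y j k x‖^2) * Real.exp (-φ x) := by
    intro x
    by_cases hx : x ∈ ⋃ j, tsupport (Y j)
    · rw [(loc x hx φ).eq_of_nhds]
    · have h2 := fun j k => (dbar_congr (hout x hx j) k).trans (dbar_const' k 0 x)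
      simp [curl, h2]
  simp_rw [i1, i2, i3] at main
  exact main

end PartA3
end

open Metric Set Filter Asymptotics
open scoped Manifold Topology
noncomputable section

section PartA4
open MeasureTheory
open scoped ContDiff ComplexConjugate ENNReal

variable {n : ℕ}

def cv (k g : CSp n → ℂ) (x : CSp n) : ℂ := ∫ y, k (x - y) * g y

lemma cv_eq (k g : CSp n → ℂ) :
    cv k g = MeasureTheory.convolution k g (ContinuousLinearMap.mul ℝ ℂ) volume := by
  ext x
  rw [convolution_eq_swap]
  rfl

lemma cv_sm {k g : CSp n → ℂ} (hk : Tst k) (hg : LocallyIntegrable g) : ContDiff ℝ ∞ (cv k g) := by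
  rw [cv_eq]
  exact hk.2.contDiff_convolution_left _ (n := ⊤) hk.1 hg

lemma cv_int {k g : CSp n → ℂ} (hc : Continuous k) (hs : HasCompactSupport k)
    (hg : LocallyIntegrable g) (x : CSp n) : Integrable (fun y => k (x - y) * g y) := by
  have h := hs.convolutionExists_left (ContinuousLinearMap.mul ℝ ℂ) hc hg x
  have h2 := h.integrable_swap
  exact h2

lemma cv_fderiv {k g : CSp n → ℂ} (hk : Tst k) (hg : LocallyIntegrable g) (x v : CSp n) :
    fderiv ℝ (cv k g) x v = cv (fun z => fderiv ℝ k z v) g x := by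
  have h1 := (hk.2.hasFDerivAt_convolution_left (ContinuousLinearMap.mul ℝ ℂ)
    (μ := (volume : Measure (CSp n))) (hk.1.of_le (by simp)) hg x).fderiv
  rw [cv_eq, h1, convolution_eq_swap]
  have hc : Continuous (fderiv ℝ k) := (hk.1.continuous_fderiv (by simp))
  have hI := ((hk.2.fderiv (𝕜 := ℝ)).convolutionExists_left
    ((ContinuousLinearMap.mul ℝ ℂ).precompL (CSp n)) hc hg x).integrable_swap
  rw [ContinuousLinearMap.integral_apply hI]
  rfl

lemma fderiv_Tst {k : CSp n → ℂ} (hk : Tst k) (v : CSp n) : Tst (fun z => fderiv ℝ k z v) :=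
  ⟨contDiff_fderiv_apply' hk.1 v, hk.2.fderiv_apply (𝕜 := ℝ) v⟩

lemma cv_dd {k g : CSp n → ℂ} (hk : Tst k) (hg : LocallyIntegrable g) (j : Fin n) (x : CSp n) :
    dd j (cv k g) x = cv (dd j k) g x := by
  have i1 := fun v => cv_int (fderiv_Tst hk v).1.continuous (fderiv_Tst hk v).2 hg x
  rw [dd, cv_fderiv hk hg, cv_fderiv hk hg]
  simp only [cv]
  rw [← integral_const_mul, ← integral_sub (i1 _) ((i1 _).const_mul _), ← integral_const_mul]
  apply integral_congr_ae
  filter_upwards with y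
  rw [dd]
  ring

lemma cv_dbar {k g : CSp n → ℂ} (hk : Tst k) (hg : LocallyIntegrable g) (j : Fin n) (x : CSp n) :
    dbar j (cv k g) x = cv (dbar j k) g x := by
  have i1 := fun v => cv_int (fderiv_Tst hk v).1.continuous (fderiv_Tst hk v).2 hg x
  rw [dbar, cv_fderiv hk hg, cv_fderiv hk hg]
  simp only [cv]
  rw [← integral_const_mul, ← integral_add (i1 _) ((i1 _).const_mul _), ← integral_const_mul]
  apply integral_congr_ae
  filter_upwards with y
  rw [dbar]
  ring

lemma fderiv_reflect {k : CSp n → ℂ} (hk : ContDiff ℝ ∞ k) (x y v : CSp n) :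
    fderiv ℝ (fun z => k (x - z)) y v = - fderiv ℝ k (x - y) v := by
  have h := (sm_diff hk (x - y)).hasFDerivAt.comp y ((hasFDerivAt_id y).const_sub x)
  have h2 : fderiv ℝ (fun z => k (x - z)) y = _ := h.fderiv
  rw [h2]
  simp

lemma dd_reflect {k : CSp n → ℂ} (hk : ContDiff ℝ ∞ k) (j : Fin n) (x y : CSp n) :
    dd j (fun z => k (x - z)) y = - dd j k (x - y) := by
  simp only [dd, fderiv_reflect hk]; ring

lemma dbar_reflect {k : CSp n → ℂ} (hk : ContDiff ℝ ∞ k) (j : Fin n) (x y : CSp n) :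
    dbar j (fun z => k (x - z)) y = - dbar j k (x - y) := by
  simp only [dbar, fderiv_reflect hk]; ring

lemma Tst.reflect {k : CSp n → ℂ} (hk : Tst k) (x : CSp n) : Tst (fun z => k (x - z)) := by
  refine ⟨hk.1.comp (contDiff_const.sub contDiff_id), ?_⟩
  exact hk.2.comp_homeomorph (Homeomorph.subLeft x)

/-! kernel -/

def ker0 (ε : ℝ) (x : CSp n) : ℝ := Real.smoothTransition (1 - ‖x‖^2 / ε^2)

def mkr (ε : ℝ) (x : CSp n) : ℝ := ker0 ε x / ∫ y : CSp n, ker0 ε y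

lemma ker0_sm (ε : ℝ) : ContDiff ℝ ∞ (ker0 ε : CSp n → ℝ) := by
  unfold ker0
  have h : ContDiff ℝ ∞ (fun x : CSp n => ‖x‖^2) := by
    have : (fun x : CSp n => ‖x‖^2) = fun x => ∑ i, ((x i).re^2 + (x i).im^2) := by
      ext x
      rw [EuclideanSpace.norm_sq_eq]
      apply Finset.sum_congr rfl
      intro i _
      rw [Complex.sq_norm, Complex.normSq_apply]; ring
    rw [this]
    apply ContDiff.sum
    intro i _
    have hi : ContDiff ℝ ∞ (fun x : CSp n => x i) :=
      ((EuclideanSpace.proj (𝕜 := ℂ) i).restrictScalars ℝ).contDiff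
    exact ((Complex.reCLM.contDiff.comp hi).pow 2).add ((Complex.imCLM.contDiff.comp hi).pow 2)
  exact (Real.smoothTransition.contDiff (n := ⊤)).comp (contDiff_const.sub (h.div_const _))

lemma ker0_zero {ε : ℝ} (hε : 0 < ε) {x : CSp n} (hx : ε ≤ ‖x‖) : ker0 ε x = 0 := by
  apply Real.smoothTransition.zero_of_nonpos
  have : 1 ≤ ‖x‖^2 / ε^2 := by
    rw [one_le_div (by positivity)]
    gcongr
  linarith

lemma ker0_pos {ε : ℝ} (_hε : 0 < ε) : 0 < ker0 ε (0 : CSp n) := by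
  apply Real.smoothTransition.pos_of_pos
  simp

lemma ker0_nonneg (ε : ℝ) (x : CSp n) : 0 ≤ ker0 ε x := Real.smoothTransition.nonneg _

lemma tsupport_sub_ball {ε : ℝ} {F : Type*} [Zero F] {f : CSp n → F} (h : ∀ x, ε ≤ ‖x‖ → f x = 0) :
    tsupport f ⊆ closedBall 0 ε := by
  apply closure_minimal _ isClosed_closedBall
  intro x hx
  by_contra hc
  apply hx
  apply h
  simp at hc
  exact hc.le

lemma ker0_cs {ε : ℝ} (hε : 0 < ε) : HasCompactSupport (ker0 ε : CSp n → ℝ) :=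
  (isCompact_closedBall 0 ε).of_isClosed_subset (isClosed_tsupport _)
    (tsupport_sub_ball (fun _ hx => ker0_zero hε hx))

lemma ker0_int_pos {ε : ℝ} (hε : 0 < ε) : 0 < ∫ y : CSp n, ker0 ε y :=
  (ker0_sm ε).continuous.integral_pos_of_hasCompactSupport_nonneg_nonzero (ker0_cs hε)
    (ker0_nonneg ε) (ker0_pos hε).ne'

lemma mk_sm (ε : ℝ) : ContDiff ℝ ∞ (mkr ε : CSp n → ℝ) := (ker0_sm ε).div_const _

lemma mk_nonneg {ε : ℝ} (hε : 0 < ε) (x : CSp n) : 0 ≤ mkr ε x :=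
  div_nonneg (ker0_nonneg ε x) (ker0_int_pos hε).le

lemma mk_zero {ε : ℝ} (hε : 0 < ε) {x : CSp n} (hx : ε ≤ ‖x‖) : mkr ε x = 0 := by
  unfold mkr; rw [ker0_zero hε hx, zero_div]

lemma mk_integral {ε : ℝ} (hε : 0 < ε) : ∫ x : CSp n, mkr ε x = 1 := by
  unfold mkr
  rw [integral_div, div_self (ker0_int_pos hε).ne']

lemma mk_smul (ε : ℝ) {c : ℂ} (hc : ‖c‖ = 1) (x : CSp n) : mkr ε (c • x) = mkr ε x := by
  unfold mkr ker0
  rw [norm_smul, hc, one_mul]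

def mkc (ε : ℝ) : CSp n → ℂ := rc (mkr ε)

lemma mkc_zero {ε : ℝ} (hε : 0 < ε) {x : CSp n} (hx : ε ≤ ‖x‖) : mkc ε x = 0 := by
  unfold mkc rc; rw [mk_zero hε hx]; simp

lemma mkc_Tst {ε : ℝ} (hε : 0 < ε) : Tst (mkc ε : CSp n → ℂ) :=
  ⟨rc_sm (mk_sm ε), (isCompact_closedBall 0 ε).of_isClosed_subset (isClosed_tsupport _)
    (tsupport_sub_ball (fun _ hx => mkc_zero hε hx))⟩

lemma mkc_integral {ε : ℝ} (hε : 0 < ε) : ∫ x : CSp n, mkc ε x = 1 := by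
  unfold mkc rc
  rw [integral_complex_ofReal, mk_integral hε]; simp

lemma mkc_lintegral {ε : ℝ} (hε : 0 < ε) : ∫⁻ x : CSp n, ‖mkc ε x‖ₑ = 1 := by
  have h1 : ∀ x : CSp n, ‖mkc ε x‖ₑ = ENNReal.ofReal (mkr ε x) := by
    intro x
    unfold mkc rc
    rw [← ofReal_norm, Complex.norm_real, Real.norm_of_nonneg (mk_nonneg hε x)]
  simp_rw [h1]
  rw [← ofReal_integral_eq_lintegral_ofReal, mk_integral hε, ENNReal.ofReal_one]
  · have := (mkc_Tst (n := n) hε).integrable.re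
    exact this
  · exact Eventually.of_forall (mk_nonneg hε)

lemma eLpNorm_two_sq (f : CSp n → ℂ) : eLpNorm f 2 volume ^ 2 = ∫⁻ x, ‖f x‖ₑ ^ 2 := by
  have h := eLpNorm_nnreal_pow_eq_lintegral (f := f) (μ := (volume : Measure (CSp n)))
    (p := 2) (by norm_num)
  simpa using h

/-- contraction property of mollification -/
lemma moll_contr {ε : ℝ} (hε : 0 < ε) {h : CSp n → ℂ} (hh : AEStronglyMeasurable h volume) :
    eLpNorm (cv (mkc ε) h) 2 volume ≤ eLpNorm h 2 volume := by
  have hkc : Continuous (mkc ε : CSp n → ℂ) := (mkc_Tst hε).1.continuous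
  have hm : ∀ x, AEMeasurable (fun y => ‖mkc ε (x - y)‖ₑ) (volume : Measure (CSp n)) := fun x =>
    ((hkc.comp (continuous_const.sub continuous_id)).enorm).measurable.aemeasurable
  have key : ∀ x, ‖cv (mkc ε) h x‖ₑ ^ 2 ≤ ∫⁻ y, ‖mkc ε (x - y)‖ₑ * ‖h y‖ₑ ^ 2 := by
    intro x
    have h1 : ‖cv (mkc ε) h x‖ₑ ≤ ∫⁻ y, ‖mkc ε (x - y)‖ₑ * ‖h y‖ₑ := by
      refine (enorm_integral_le_lintegral_enorm _).trans (le_of_eq ?_)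
      simp
    have h2 := ENNReal.lintegral_mul_le_Lp_mul_Lq (volume : Measure (CSp n))
      (Real.HolderConjugate.two_two) (f := fun y => ‖mkc ε (x - y)‖ₑ ^ (1/2 : ℝ))
      (g := fun y => ‖mkc ε (x - y)‖ₑ ^ (1/2 : ℝ) * ‖h y‖ₑ)
      ((hm x).pow_const _) (((hm x).pow_const _).mul hh.enorm)
    have e1 : ∀ a : ℝ≥0∞, (a ^ (1/2 : ℝ)) ^ (2:ℝ) = a := by
      intro a
      rw [← ENNReal.rpow_mul]; norm_num
    have e2 : ∀ a b : ℝ≥0∞, a ^ (1/2:ℝ) * (a ^ (1/2:ℝ) * b) = a * b := by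
      intro a b
      rw [← mul_assoc, ← ENNReal.rpow_add_of_nonneg _ _ (by norm_num) (by norm_num)]
      norm_num
    simp only [Pi.mul_apply, e2, ENNReal.mul_rpow_of_nonneg _ _ (zero_le_two : (0:ℝ) ≤ 2), e1] at h2
    have e3 : ∫⁻ y, ‖mkc ε (x - y)‖ₑ = 1 := by
      rw [lintegral_sub_left_eq_self (fun y => ‖mkc ε y‖ₑ) x, mkc_lintegral hε]
    rw [e3, ENNReal.one_rpow, one_mul] at h2
    have h3 := h1.trans h2
    calc ‖cv (mkc ε) h x‖ₑ ^ 2 ≤ ((∫⁻ y, ‖mkc ε (x - y)‖ₑ * ‖h y‖ₑ ^ (2:ℝ)) ^ (1/2:ℝ)) ^ 2 := by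
          gcongr
      _ = ∫⁻ y, ‖mkc ε (x - y)‖ₑ * ‖h y‖ₑ ^ 2 := by
          rw [← ENNReal.rpow_natCast, ← ENNReal.rpow_mul]
          norm_num
  have tot : eLpNorm (cv (mkc ε) h) 2 volume ^ 2 ≤ eLpNorm h 2 volume ^ 2 := by
    rw [eLpNorm_two_sq, eLpNorm_two_sq]
    calc ∫⁻ x, ‖cv (mkc ε) h x‖ₑ ^ 2 ≤ ∫⁻ x, ∫⁻ y, ‖mkc ε (x - y)‖ₑ * ‖h y‖ₑ ^ 2 :=
          lintegral_mono key
      _ = ∫⁻ y, ∫⁻ x, ‖mkc ε (x - y)‖ₑ * ‖h y‖ₑ ^ 2 := by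
          apply lintegral_lintegral_swap
          refine AEMeasurable.mul (f := fun p : CSp n × CSp n => ‖mkc ε (p.1 - p.2)‖ₑ)
            (g := fun p : CSp n × CSp n => ‖h p.2‖ₑ ^ 2) ?_ ?_
          · have : Continuous (fun p : CSp n × CSp n => ‖mkc ε (p.1 - p.2)‖ₑ) :=
              (hkc.comp (continuous_fst.sub continuous_snd)).enorm
            exact this.measurable.aemeasurable
          · exact ((hh.enorm.pow_const 2).comp_snd)
      _ = ∫⁻ y, ‖h y‖ₑ ^ 2 := by
          apply lintegral_congr
          intro y
          rw [lintegral_mul_const', lintegral_sub_right_eq_self (fun z => ‖mkc ε z‖ₑ) y,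
            mkc_lintegral hε, one_mul]
          exact ENNReal.pow_ne_top enorm_ne_top
  exact (ENNReal.pow_le_pow_left_iff (by norm_num)).1 tot

end PartA4
end

open Metric Set Filter Asymptotics
open scoped Manifold Topology
noncomputable section

section PartA5
open MeasureTheory
open scoped ContDiff ComplexConjugate ENNReal

variable {n : ℕ}

lemma cv_sub' {k g h : CSp n → ℂ} (hk : Tst k) (hg : LocallyIntegrable g)
    (hh : LocallyIntegrable h) : cv k (g - h) = cv k g - cv k h := by
  ext x
  simp only [cv, Pi.sub_apply, mul_sub]
  exact integral_sub (cv_int hk.1.continuous hk.2 hg x) (cv_int hk.1.continuous hk.2 hh x)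

lemma moll_conv_cont {g : CSp n → ℂ} (hg : Continuous g) (hgs : HasCompactSupport g) :
    Tendsto (fun ε : ℝ => eLpNorm (cv (mkc ε) g - g) 2 volume) (𝓝[>] 0) (𝓝 0) := by
  set C := cthickening 1 (tsupport g) with hC
  have hCc : IsCompact C := hgs.isCompact.cthickening
  have hCv : volume C ≠ (⊤:ℝ≥0∞) := hCc.measure_lt_top.ne
  have huc : UniformContinuous g := hgs.uniformContinuous_of_continuous hg
  have hgl : LocallyIntegrable g := hg.locallyIntegrable
  have key : ∀ δ : ℝ, 0 < δ → ∀ᶠ ε in 𝓝[>] (0:ℝ),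
      eLpNorm (cv (mkc ε) g - g) 2 volume ≤ ENNReal.ofReal δ * volume C ^ (1/2:ℝ) := by
    intro δ hδ
    obtain ⟨r, hr, hr2⟩ := Metric.uniformContinuous_iff.1 huc δ hδ
    filter_upwards [Ioo_mem_nhdsGT (show (0:ℝ) < min r 1 by positivity)] with ε hε
    have hε0 : 0 < ε := hε.1
    have hεr : ε < r := hε.2.trans_le (min_le_left _ _)
    have hε1 : ε < 1 := hε.2.trans_le (min_le_right _ _)
    have eq : ∀ x, cv (mkc ε) g x - g x = ∫ y, mkc ε (x - y) * (g y - g x) := by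
      intro x
      simp only [mul_sub]
      rw [integral_sub (cv_int (mkc_Tst hε0).1.continuous (mkc_Tst hε0).2 hgl x)
        (((mkc_Tst hε0).reflect x).integrable.mul_const _), integral_mul_const,
        integral_sub_left_eq_self (fun y => mkc ε y) volume x, mkc_integral hε0, one_mul]
      rfl
    have b1 : ∀ x, ‖cv (mkc ε) g x - g x‖ ≤ δ := by
      intro x
      rw [eq]
      have i1 : Integrable (fun y => mkr ε (x - y) * δ) := by
        have := ((mkc_Tst hε0).reflect x).integrable.re
        exact this.mul_const δ
      calc ‖∫ y, mkc ε (x - y) * (g y - g x)‖ ≤ ∫ y, mkr ε (x - y) * δ := by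
            apply norm_integral_le_of_norm_le i1
            filter_upwards with y
            rw [norm_mul, mkc, rc, Complex.norm_real, Real.norm_of_nonneg (mk_nonneg hε0 _)]
            by_cases hy : ε ≤ ‖x - y‖
            · rw [mk_zero hε0 hy]; simp
            · apply mul_le_mul_of_nonneg_left _ (mk_nonneg hε0 _)
              have : dist y x < r := by
                rw [dist_comm, dist_eq_norm]; push Not at hy; linarith
              have := (hr2 this).le
              rwa [dist_eq_norm] at this
        _ = δ := by
            rw [integral_mul_const, integral_sub_left_eq_self (fun y => mkr ε y) volume x,
              mk_integral hε0, one_mul]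
    have b2 : ∀ x, x ∉ C → cv (mkc ε) g x - g x = 0 := by
      intro x hx
      rw [eq]
      apply integral_eq_zero_of_ae
      filter_upwards with y
      have hgx : g x = 0 := by
        by_contra h
        exact hx (self_subset_cthickening _ (subset_tsupport _ h))
      by_cases hy : ε ≤ ‖x - y‖
      · simp [mkc_zero hε0 hy]
      · have : g y = 0 := by
          by_contra h
          apply hx
          apply mem_cthickening_of_dist_le x y 1 _ (subset_tsupport _ h)
          rw [dist_eq_norm]; push Not at hy; linarith
        simp [this, hgx]
    have b3 : eLpNorm (cv (mkc ε) g - g) 2 volume ≤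
        eLpNorm (C.indicator (fun _ => (δ : ℝ))) 2 (volume : Measure (CSp n)) := by
      apply eLpNorm_mono
      intro x
      by_cases hx : x ∈ C
      · simp only [Pi.sub_apply, indicator_of_mem hx, Real.norm_of_nonneg hδ.le]
        exact b1 x
      · simp only [Pi.sub_apply, b2 x hx]; simp
    refine b3.trans ?_
    rw [eLpNorm_indicator_const hCc.measurableSet (by norm_num) (by norm_num)]
    rw [← ofReal_norm, Real.norm_of_nonneg hδ.le]
    norm_num
  rw [ENNReal.tendsto_nhds_zero]
  intro η hη
  by_cases hη2 : η = (⊤:ℝ≥0∞)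
  · simp [hη2]
  have hvf : volume C ^ (1/2:ℝ) ≠ (⊤:ℝ≥0∞) := ENNReal.rpow_ne_top_of_nonneg (by norm_num) hCv
  set M := (volume C ^ (1/2:ℝ)).toReal
  have hηp : 0 < η.toReal := ENNReal.toReal_pos hη.ne' hη2
  have hM : 0 ≤ M := ENNReal.toReal_nonneg
  filter_upwards [key (η.toReal / (M+1)) (by positivity)] with ε h
  refine h.trans ?_
  rw [← ENNReal.ofReal_toReal hvf, ← ENNReal.ofReal_mul (by positivity)]
  apply ENNReal.ofReal_le_of_le_toReal
  rw [div_mul_eq_mul_div, div_le_iff₀ (by positivity)]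
  show η.toReal * M ≤ _
  nlinarith

lemma moll_conv {h : CSp n → ℂ} (hh : MemLp h 2 volume) :
    Tendsto (fun ε : ℝ => eLpNorm (cv (mkc ε) h - h) 2 volume) (𝓝[>] 0) (𝓝 0) := by
  rw [ENNReal.tendsto_nhds_zero]
  intro η hη
  by_cases hη2 : η = (⊤:ℝ≥0∞)
  · simp [hη2]
  have h3 : η / 3 ≠ 0 := by simp [hη.ne']
  obtain ⟨g, hgs, hgh, hgc, hgm⟩ := hh.exists_hasCompactSupport_eLpNorm_sub_le (by norm_num) h3
  have h1 := ENNReal.tendsto_nhds_zero.1 (moll_conv_cont hgc hgs) (η/3) (pos_iff_ne_zero.2 h3)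
  filter_upwards [h1, self_mem_nhdsWithin] with ε he hε
  have hε0 : 0 < ε := hε
  have hl := hh.locallyIntegrable (by norm_num)
  have hgl : LocallyIntegrable g := hgc.locallyIntegrable
  have e : cv (mkc ε) h - h = (cv (mkc ε) (h - g) - (h - g)) + (cv (mkc ε) g - g) := by
    rw [cv_sub' (mkc_Tst hε0) hl hgl]; abel
  have m1 : AEStronglyMeasurable (cv (mkc ε) (h - g)) volume :=
    (cv_sm (mkc_Tst hε0) (hl.sub hgl)).continuous.aestronglyMeasurable
  have m2 : AEStronglyMeasurable (cv (mkc ε) g) volume :=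
    (cv_sm (mkc_Tst hε0) hgl).continuous.aestronglyMeasurable
  rw [e]
  calc eLpNorm ((cv (mkc ε) (h - g) - (h - g)) + (cv (mkc ε) g - g)) 2 volume
      ≤ eLpNorm (cv (mkc ε) (h - g) - (h - g)) 2 volume + eLpNorm (cv (mkc ε) g - g) 2 volume :=
        eLpNorm_add_le (m1.sub (hh.1.sub hgm.1)) (m2.sub hgm.1) (by norm_num)
    _ ≤ (eLpNorm (cv (mkc ε) (h - g)) 2 volume + eLpNorm (h - g) 2 volume) + η/3 := by
        gcongr
        exact eLpNorm_sub_le m1 (hh.1.sub hgm.1) (by norm_num)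
    _ ≤ (η/3 + η/3) + η/3 := by
        gcongr
        exact (moll_contr hε0 (hh.1.sub hgm.1)).trans hgh
    _ = η := ENNReal.add_thirds η

/-- L² convergence -/
def L2To (F : ℕ → CSp n → ℂ) (G : CSp n → ℂ) : Prop :=
  (∀ k, MemLp (F k) 2 volume) ∧ MemLp G 2 volume ∧
    Tendsto (fun k => eLpNorm (F k - G) 2 volume) atTop (𝓝 0)

lemma memLp_moll {ε : ℝ} (hε : 0 < ε) {h : CSp n → ℂ} (hh : MemLp h 2 volume) :
    MemLp (cv (mkc ε) h) 2 volume :=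
  ⟨(cv_sm (mkc_Tst hε) (hh.locallyIntegrable (by norm_num))).continuous.aestronglyMeasurable,
    (moll_contr hε hh.1).trans_lt hh.2⟩

lemma L2To.moll {h : CSp n → ℂ} (hh : MemLp h 2 volume) {ε : ℕ → ℝ} (hε : ∀ k, 0 < ε k)
    (hε2 : Tendsto ε atTop (𝓝 0)) : L2To (fun k => cv (mkc (ε k)) h) h := by
  refine ⟨fun k => memLp_moll (hε k) hh, hh, ?_⟩
  apply (moll_conv hh).comp
  rw [tendsto_nhdsWithin_iff]
  exact ⟨hε2, Eventually.of_forall hε⟩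

lemma L2To.add {F F' : ℕ → CSp n → ℂ} {G G' : CSp n → ℂ} (h : L2To F G) (h' : L2To F' G') :
    L2To (fun k x => F k x + F' k x) (fun x => G x + G' x) := by
  refine ⟨fun k => (h.1 k).add (h'.1 k), h.2.1.add h'.2.1, ?_⟩
  have := h.2.2.add h'.2.2
  rw [add_zero] at this
  refine tendsto_of_tendsto_of_tendsto_of_le_of_le tendsto_const_nhds this
    (fun _ => zero_le) (fun k => ?_)
  have e : ((fun x => F k x + F' k x) - fun x => G x + G' x) = (F k - G) + (F' k - G') := by
    ext x; simp; ring
  show eLpNorm _ 2 volume ≤ _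
  rw [e]
  exact eLpNorm_add_le ((h.1 k).sub h.2.1).1 ((h'.1 k).sub h'.2.1).1 (by norm_num)

lemma L2To.mul {F : ℕ → CSp n → ℂ} {G : CSp n → ℂ} (h : L2To F G) {b : CSp n → ℂ}
    (hb : AEStronglyMeasurable b volume) {C : ℝ} (hC : ∀ x, ‖b x‖ ≤ C) :
    L2To (fun k x => b x * F k x) (fun x => b x * G x) := by
  have hm : ∀ {f : CSp n → ℂ}, MemLp f 2 volume → MemLp (fun x => b x * f x) 2 volume := by
    intro f hf
    refine hf.of_le_mul (c := C) (hb.mul hf.1) ?_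
    filter_upwards with x
    rw [norm_mul]
    exact mul_le_mul_of_nonneg_right (hC x) (norm_nonneg _)
  refine ⟨fun k => hm (h.1 k), hm h.2.1, ?_⟩
  have := ENNReal.Tendsto.const_mul (a := ENNReal.ofReal C) h.2.2 (Or.inr ENNReal.ofReal_ne_top)
  rw [mul_zero] at this
  refine tendsto_of_tendsto_of_tendsto_of_le_of_le tendsto_const_nhds this
    (fun _ => zero_le) (fun k => ?_)
  apply eLpNorm_le_mul_eLpNorm_of_ae_le_mul
  filter_upwards with x
  have : b x * F k x - b x * G x = b x * (F k x - G x) := by ring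
  simp only [Pi.sub_apply, this, norm_mul]
  exact mul_le_mul_of_nonneg_right (hC x) (norm_nonneg _)

lemma L2To.zero : L2To (fun _ _ => 0 : ℕ → CSp n → ℂ) (fun _ => 0) := by
  refine ⟨fun _ => MemLp.zero', MemLp.zero', ?_⟩
  have : ((fun _ => 0 : CSp n → ℂ) - fun _ => 0) = 0 := by ext; simp
  simp [this]

lemma L2To.sum {ι : Type*} (s : Finset ι) {F : ι → ℕ → CSp n → ℂ} {G : ι → CSp n → ℂ}
    (h : ∀ i, L2To (F i) (G i)) : L2To (fun k x => ∑ i ∈ s, F i k x) (fun x => ∑ i ∈ s, G i x) := by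
  classical
  induction s using Finset.induction_on with
  | empty => simpa using L2To.zero
  | insert a s ha ih =>
    simp only [Finset.sum_insert ha]
    exact (h a).add ih

lemma L2To.integral_sq {F : ℕ → CSp n → ℂ} {G : CSp n → ℂ} (h : L2To F G) :
    Tendsto (fun k => ∫ x, ‖F k x‖^2) atTop (𝓝 (∫ x, ‖G x‖^2)) := by
  have h1 := (Lp.tendsto_Lp_iff_tendsto_eLpNorm'' F h.1 G h.2.1).2 h.2.2
  have h2 := (h1.norm).pow 2
  have e : ∀ {f : CSp n → ℂ} (hf : MemLp f 2 volume), ‖hf.toLp f‖^2 = ∫ x, ‖f x‖^2 := by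
    intro f hf
    rw [Lp.norm_toLp, hf.eLpNorm_eq_integral_rpow_norm (by norm_num) (by norm_num),
      ENNReal.toReal_ofReal (by positivity)]
    have h0 : 0 ≤ ∫ x, ‖f x‖^2 := integral_nonneg (fun x => by positivity)
    simp only [ENNReal.toReal_ofNat, Real.rpow_ofNat]
    rw [← Real.rpow_natCast, ← Real.rpow_mul h0]
    norm_num
  simpa only [e] using h2

end PartA5
end

open Metric Set Filter Asymptotics
open scoped Manifold Topology
noncomputable section

section PartA6
open MeasureTheory
open scoped ContDiff ComplexConjugate ENNReal

variable {n : ℕ}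

lemma L2To.integral_sum_sq {ι : Type*} (s : Finset ι) {F : ι → ℕ → CSp n → ℂ} {G : ι → CSp n → ℂ}
    (h : ∀ i, L2To (F i) (G i)) :
    Tendsto (fun k => ∫ x, ∑ i ∈ s, ‖F i k x‖^2) atTop (𝓝 (∫ x, ∑ i ∈ s, ‖G i x‖^2)) := by
  have i1 : ∀ {f : CSp n → ℂ}, MemLp f 2 volume → Integrable (fun x => ‖f x‖^2) := fun hf => by
    simpa using hf.integrable_norm_pow (by norm_num)
  rw [integral_finsetSum _ (fun i _ => i1 (h i).2.1)]
  have : ∀ k, ∫ x, ∑ i ∈ s, ‖F i k x‖^2 = ∑ i ∈ s, ∫ x, ‖F i k x‖^2 := fun k =>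
    integral_finsetSum _ (fun i _ => i1 ((h i).1 k))
  simp only [this]
  exact tendsto_finsetSum _ (fun i _ => (h i).integral_sq)

lemma cv_supp {δ ε : ℝ} (hε : 0 < ε) (hεδ : ε ≤ δ) {K : Set (CSp n)} {h : CSp n → ℂ}
    (hh : ∀ x, x ∉ K → h x = 0) (x : CSp n) (hx : x ∉ cthickening δ K) : cv (mkc ε) h x = 0 := by
  apply integral_eq_zero_of_ae
  filter_upwards with y
  by_cases hy : ε ≤ ‖x - y‖
  · simp [mkc_zero hε hy]
  · have : h y = 0 := by
      apply hh
      intro hyK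
      apply hx
      apply mem_cthickening_of_dist_le x y δ _ hyK
      rw [dist_eq_norm]; push Not at hy; linarith
    simp [this]

lemma cut_bdd {b : CSp n → ℂ} (hb : Tst b) : ∃ C, ∀ x, ‖b x‖ ≤ C :=
  hb.1.continuous.bounded_above_of_compact_support hb.2

theorem hor_L2 {D : Set (CSp n)} (hD : IsOpen D) {φ ψ : CSp n → ℝ} (hφ : ContDiff ℝ ∞ φ)
    (hψ : ContDiff ℝ ∞ ψ)
    (hL : ∀ x ∈ D, ∀ t : Fin n → ℂ,
      2 * ((∑ j, ‖dd j (rc ψ) x‖^2) + Real.exp (ψ x)) * (∑ j, ‖t j‖^2) ≤ levi φ t x)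
    {K : Set (CSp n)} (hK : IsCompact K) (hKD : K ⊆ D)
    {Z : Fin n → CSp n → ℂ} {a : CSp n → ℂ} {c : Fin n → Fin n → CSp n → ℂ}
    (hZ : ∀ j, MemLp (Z j) 2 volume) (ha : MemLp a 2 volume) (hc : ∀ j k, MemLp (c j k) 2 volume)
    (hZ0 : ∀ j x, x ∉ K → Z j x = 0) (ha0 : ∀ x, x ∉ K → a x = 0)
    (hc0 : ∀ j k x, x ∉ K → c j k x = 0)
    (hdiv : ∀ θ, Tst θ → ∫ x, ∑ j, Z j x * dd j θ x = - ∫ x, a x * θ x)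
    (hcurl : ∀ θ, Tst θ → ∀ j k, ∫ x, (Z k x * dbar j θ x - Z j x * dbar k θ x) =
      - ∫ x, c j k x * θ x) :
    ∫ x, ∑ j, ‖Z j x * Real.exp (-(φ x - ψ x) / 2)‖^2 ≤
      (∫ x, ‖(a x - ∑ j, dd j (rc (fun y => φ y - ψ y)) x * Z j x) * Real.exp (-φ x / 2)‖^2) +
      (1/2) * ∫ x, ∑ j, ∑ k, ‖c j k x * Real.exp (-φ x / 2)‖^2 := by
  obtain ⟨δ, hδ, hδD⟩ := hK.exists_cthickening_subset_open hD hKD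
  have hK1 : IsCompact (cthickening δ K) := hK.cthickening
  obtain ⟨κ, k1, k2, k3, k4, k5⟩ := exists_cutoff hK1 hD hδD
  have kone : ∀ x ∈ cthickening δ K, κ x = 1 := fun x hx => k4.self_of_nhdsSet x hx
  have hK2 : K ⊆ cthickening δ K := self_subset_cthickening K
  set ε : ℕ → ℝ := fun k => δ / (k+1) with hεd
  have hε : ∀ k, 0 < ε k := fun k => by positivity
  have hεδ : ∀ k, ε k ≤ δ := fun k => by
    rw [hεd]; apply div_le_self hδ.le; linarith [(Nat.cast_nonneg k : (0:ℝ) ≤ k)]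
  have hε0 : Tendsto ε atTop (𝓝 0) := by
    have := tendsto_one_div_add_atTop_nhds_zero_nat (𝕜 := ℝ)
    simpa [hεd, div_eq_mul_inv] using this.const_mul δ
  have hloc : ∀ {h : CSp n → ℂ}, MemLp h 2 volume → LocallyIntegrable h := fun hh =>
    hh.locallyIntegrable (by norm_num)
  set Y : ℕ → Fin n → CSp n → ℂ := fun k j => cv (mkc (ε k)) (Z j) with hYdef
  have hYsupp : ∀ k j, tsupport (Y k j) ⊆ cthickening δ K := by
    intro k j
    apply closure_minimal _ isClosed_cthickening
    intro x hx
    by_contra h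
    exact hx (cv_supp (hε k) (hεδ k) (hZ0 j) x h)
  have hYT : ∀ k j, Tst (Y k j) := fun k j =>
    ⟨cv_sm (mkc_Tst (hε k)) (hloc (hZ j)), hK1.of_isClosed_subset (isClosed_tsupport _) (hYsupp k j)⟩
  have hYdd : ∀ k x, ∑ j, dd j (Y k j) x = cv (mkc (ε k)) a x := by
    intro k x
    have hT := mkc_Tst (n := n) (hε k)
    have h1 := hdiv _ (hT.reflect x)
    simp only [dd_reflect hT.1] at h1
    simp only [hYdef, cv_dd hT (hloc (hZ _))]
    simp only [cv]
    rw [← integral_finsetSum]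
    · rw [← neg_inj]
      have : ∫ y, mkc (ε k) (x - y) * a y = ∫ y, a y * mkc (ε k) (x - y) := by simp only [mul_comm]
      rw [this, ← h1, ← integral_neg]
      congr 1; ext y
      rw [← Finset.sum_neg_distrib]
      apply Finset.sum_congr rfl; intros; ring
    · intro j _
      exact cv_int (hT.dd j).1.continuous (hT.dd j).2 (hloc (hZ j)) x
  have hYcurl : ∀ k j l x, curl (Y k) j l x = cv (mkc (ε k)) (c j l) x := by
    intro k j l x
    have hT := mkc_Tst (n := n) (hε k)
    have h1 := hcurl _ (hT.reflect x) j l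
    simp only [dbar_reflect hT.1] at h1
    simp only [curl, hYdef, cv_dbar hT (hloc (hZ _))]
    simp only [cv]
    rw [← integral_sub (cv_int (hT.dbar j).1.continuous (hT.dbar j).2 (hloc (hZ l)) x)
      (cv_int (hT.dbar l).1.continuous (hT.dbar l).2 (hloc (hZ j)) x)]
    rw [← neg_inj]
    have : ∫ y, mkc (ε k) (x - y) * c j l y = ∫ y, c j l y * mkc (ε k) (x - y) := by
      simp only [mul_comm]
    rw [this, ← h1, ← integral_neg]
    congr 1; ext y; ring
  have ineq := fun k => hor_local hD hφ.contDiffOn hψ.contDiffOn (hYT k)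
    (fun j => (hYsupp k j).trans hδD) hL
  -- multipliers
  have hκT : Tst (rc κ) := ⟨rc_sm k1, k2.comp_left (g := fun r : ℝ => (r:ℂ)) (by simp)⟩
  have hE : ∀ {f : CSp n → ℝ}, ContDiff ℝ ∞ f → ContDiff ℝ ∞ (fun x => ((Real.exp (f x) : ℝ) : ℂ)) :=
    fun hf => rc_sm hf.exp
  set b1 : CSp n → ℂ := fun x => rc κ x * ((Real.exp (-(φ x - ψ x) / 2) : ℝ) : ℂ) with hb1
  set b3 : CSp n → ℂ := fun x => rc κ x * ((Real.exp (-φ x / 2) : ℝ) : ℂ) with hb3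
  set φ2 : CSp n → ℝ := fun y => φ y - ψ y with hφ2
  set d : Fin n → CSp n → ℂ := fun j x => b3 x * (- dd j (rc φ2) x) with hd
  have hφs2 : ContDiff ℝ ∞ φ2 := hφ.sub hψ
  have T1 : Tst b1 := hκT.mul_right (hE ((hφ.sub hψ).neg.div_const 2))
  have T3 : Tst b3 := hκT.mul_right (hE (hφ.neg.div_const 2))
  have Td : ∀ j, Tst (d j) := fun j => T3.mul_right (dd_sm (rc_sm hφs2) j).neg
  obtain ⟨C1, hC1⟩ := cut_bdd T1
  obtain ⟨C3, hC3⟩ := cut_bdd T3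
  choose Cd hCd using fun j => cut_bdd (Td j)
  have lim1 := L2To.integral_sum_sq Finset.univ (fun j : Fin n =>
    (L2To.moll (hZ j) hε hε0).mul T1.1.continuous.aestronglyMeasurable hC1)
  have lim2 := (((L2To.moll ha hε hε0).mul T3.1.continuous.aestronglyMeasurable hC3).add
    (L2To.sum Finset.univ (fun j : Fin n =>
    (L2To.moll (hZ j) hε hε0).mul (Td j).1.continuous.aestronglyMeasurable (hCd j)))).integral_sq
  have lim3 := L2To.integral_sum_sq (Finset.univ : Finset (Fin n × Fin n)) (fun p =>
    (L2To.moll (hc p.1 p.2) hε hε0).mul T3.1.continuous.aestronglyMeasurable hC3)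
  have sq : ∀ r : ℝ, (Real.exp (-r/2))^2 = Real.exp (-r) := fun r => by
    rw [← Real.exp_nat_mul]; congr 1; push_cast; ring
  have nb : ∀ (z : ℂ) (r : ℝ), ‖z * ((Real.exp r : ℝ) : ℂ)‖^2 = ‖z‖^2 * (Real.exp r)^2 := by
    intro z r
    rw [norm_mul, mul_pow, Complex.norm_real, Real.norm_of_nonneg (Real.exp_pos _).le]
  have key : ∀ {h : CSp n → ℂ}, (∀ x, x ∉ cthickening δ K → h x = 0) → ∀ x, rc κ x * h x = h x := by
    intro h hh x
    by_cases hx : x ∈ cthickening δ K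
    · simp [rc, kone x hx]
    · simp [hh x hx]
  have zK : ∀ {h : CSp n → ℂ}, (∀ x, x ∉ K → h x = 0) → ∀ x, x ∉ cthickening δ K → h x = 0 :=
    fun hh x hx => hh x (fun h => hx (hK2 h))
  have e1 : ∀ k, ∫ x, ∑ j, ‖b1 x * cv (mkc (ε k)) (Z j) x‖^2 =
      ∫ x, (∑ j, ‖Y k j x‖^2) * Real.exp (-(φ x - ψ x)) := by
    intro k
    congr 1; ext x
    rw [Finset.sum_mul]
    refine Finset.sum_congr rfl (fun j _ => ?_)
    rw [← sq, ← nb]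
    have := key (fun x hx => cv_supp (hε k) (hεδ k) (hZ0 j) x hx) x
    show ‖_‖^2 = ‖cv (mkc (ε k)) (Z j) x * _‖^2
    conv_rhs => rw [← this]
    congr 2; simp only [hb1]; ring
  have e1' : ∫ x, ∑ j, ‖b1 x * Z j x‖^2 = ∫ x, ∑ j, ‖Z j x * Real.exp (-(φ x - ψ x) / 2)‖^2 := by
    congr 1; ext x
    refine Finset.sum_congr rfl (fun j _ => ?_)
    have := key (zK (hZ0 j)) x
    conv_rhs => rw [← this]
    congr 2; simp only [hb1]; ring
  have e2 : ∀ k, ∫ x, ‖b3 x * cv (mkc (ε k)) a x + ∑ j, d j x * cv (mkc (ε k)) (Z j) x‖^2 =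
      ∫ x, ‖∑ j, del (fun y => φ y - ψ y) j (Y k j) x‖^2 * Real.exp (-φ x) := by
    intro k
    congr 1; ext x
    rw [← sq, ← nb]
    simp only [del, Finset.sum_sub_distrib, hYdd]
    congr 2
    have h1 := key (fun x hx => cv_supp (hε k) (hεδ k) ha0 x hx) x
    have h2 := fun j => key (fun x hx => cv_supp (hε k) (hεδ k) (hZ0 j) x hx) x
    rw [sub_mul, sub_eq_add_neg, Finset.sum_mul, ← Finset.sum_neg_distrib]
    congr 1
    · conv_rhs => rw [← h1]
      simp only [hb3]; ring
    · refine Finset.sum_congr rfl (fun j _ => ?_)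
      show _ = -(dd j (rc φ2) x * cv (mkc (ε k)) (Z j) x * _)
      conv_rhs => rw [← h2 j]
      simp only [hd, hb3]; ring
  have e2' : ∫ x, ‖b3 x * a x + ∑ j, d j x * Z j x‖^2 =
      ∫ x, ‖(a x - ∑ j, dd j (rc φ2) x * Z j x) * Real.exp (-φ x / 2)‖^2 := by
    congr 1; ext x
    congr 2
    have h1 := key (zK ha0) x
    have h2 := fun j => key (zK (hZ0 j)) x
    rw [sub_mul, sub_eq_add_neg, Finset.sum_mul, ← Finset.sum_neg_distrib]
    congr 1
    · conv_rhs => rw [← h1]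
      simp only [hb3]; ring
    · refine Finset.sum_congr rfl (fun j _ => ?_)
      conv_rhs => rw [← h2 j]
      simp only [hd, hb3]; ring
  have e3 : ∀ k, ∫ x, ∑ p : Fin n × Fin n, ‖b3 x * cv (mkc (ε k)) (c p.1 p.2) x‖^2 =
      ∫ x, (∑ j, ∑ l, ‖curl (Y k) j l x‖^2) * Real.exp (-φ x) := by
    intro k
    congr 1; ext x
    rw [Fintype.sum_prod_type, Finset.sum_mul]
    refine Finset.sum_congr rfl (fun j _ => ?_)
    rw [Finset.sum_mul]
    refine Finset.sum_congr rfl (fun l _ => ?_)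
    rw [← sq, ← nb, hYcurl]
    have := key (fun x hx => cv_supp (hε k) (hεδ k) (hc0 j l) x hx) x
    conv_rhs => rw [← this]
    congr 2; simp only [hb3]; ring
  have e3' : ∫ x, ∑ p : Fin n × Fin n, ‖b3 x * c p.1 p.2 x‖^2 =
      ∫ x, ∑ j, ∑ k, ‖c j k x * Real.exp (-φ x / 2)‖^2 := by
    congr 1; ext x
    rw [Fintype.sum_prod_type]
    refine Finset.sum_congr rfl (fun j _ => Finset.sum_congr rfl (fun l _ => ?_))
    have := key (zK (hc0 j l)) x
    conv_rhs => rw [← this]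
    congr 2; simp only [hb3]; ring
  simp only [e1, e1'] at lim1
  simp only [e2, e2'] at lim2
  simp only [e3, e3'] at lim3
  exact le_of_tendsto_of_tendsto' lim1 (lim2.add (lim3.const_mul (1/2))) ineq

end PartA6
end

open Metric Set Filter Asymptotics
open scoped Manifold Topology
noncomputable section

section PartA7
open MeasureTheory
open scoped ContDiff ComplexConjugate ENNReal

variable {n : ℕ}

lemma Tst.memLp {f : CSp n → ℂ} (hf : Tst f) : MemLp f 2 volume :=
  hf.1.continuous.memLp_of_hasCompactSupport hf.2

lemma memLp_mul_T {F θ : CSp n → ℂ} (hF : MemLp F 2 volume) (hθ : Tst θ) :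
    MemLp (fun x => θ x * F x) 2 volume := by
  obtain ⟨C, hC⟩ := cut_bdd hθ
  refine hF.of_le_mul (c := C) (hθ.1.continuous.aestronglyMeasurable.mul hF.1) ?_
  filter_upwards with x
  rw [norm_mul]
  exact mul_le_mul_of_nonneg_right (hC x) (norm_nonneg _)

lemma int_mul_T {F θ : CSp n → ℂ} (hF : MemLp F 2 volume) (hθ : Tst θ) :
    Integrable (fun x => F x * θ x) := hF.integrable_mul hθ.memLp

/-- real exponential, complex valued -/
def ex (f : CSp n → ℝ) : CSp n → ℂ := fun x => ((Real.exp (f x) : ℝ) : ℂ)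

lemma ex_sm {f : CSp n → ℝ} (hf : ContDiff ℝ ∞ f) : ContDiff ℝ ∞ (ex f) := rc_sm hf.exp

lemma ex_congr {f g : CSp n → ℝ} {x : CSp n} (h : f x = g x) : ex f x = ex g x := by
  simp [ex, h]

lemma dd_ex {f : CSp n → ℝ} (hf : ContDiff ℝ ∞ f) (j : Fin n) (x : CSp n) :
    dd j (ex f) x = ex f x * dd j (rc f) x := by
  have e : ex f = fun y => Complex.exp (rc f y) := by ext y; simp [ex, rc]
  have := dd_comp (sm_diff (rc_sm hf) x) (Complex.hasDerivAt_exp (rc f x)) j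
  rw [e]; exact this

lemma rc_Tst {κ : CSp n → ℝ} (h1 : ContDiff ℝ ∞ κ) (h2 : HasCompactSupport κ) : Tst (rc κ) :=
  ⟨rc_sm h1, h2.comp_left (g := fun r : ℝ => (r:ℂ)) (by simp)⟩

lemma rc_tsupport (κ : CSp n → ℝ) : tsupport (rc κ) = tsupport κ := by
  unfold tsupport; congr 1; ext x; simp [rc]

structure Wts (D : Set (CSp n)) (φ ψ : CSp n → ℝ) : Prop where
  hD : IsOpen D
  hφ : ContDiffOn ℝ ∞ φ D
  hψ : ContDiffOn ℝ ∞ ψ D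
  hL : ∀ x ∈ D, ∀ t : Fin n → ℂ,
      2 * ((∑ j, ‖dd j (rc ψ) x‖^2) + Real.exp (ψ x)) * (∑ j, ‖t j‖^2) ≤ levi φ t x

/-- `F e^{φ2/2}` is weakly closed on D -/
def WClosed (D : Set (CSp n)) (φ2 : CSp n → ℝ) (F : Fin n → CSp n → ℂ) : Prop :=
  ∀ θ, Tst θ → tsupport θ ⊆ D → ∀ j k, ∫ x, (F k x * (ex (fun y => φ2 y / 2) x * dbar j θ x) -
    F j x * (ex (fun y => φ2 y / 2) x * dbar k θ x)) = 0

def WDiv (D : Set (CSp n)) (φ2 : CSp n → ℝ) (F : Fin n → CSp n → ℂ) (e : CSp n → ℂ) : Prop :=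
  ∀ θ, Tst θ → tsupport θ ⊆ D → ∫ x, ∑ j, F j x * (ex (fun y => -φ2 y / 2) x * dd j θ x) =
    - ∫ x, e x * θ x

theorem core_nu {D : Set (CSp n)} {φ ψ : CSp n → ℝ} (hW : Wts D φ ψ)
    {F : Fin n → CSp n → ℂ} (hF : ∀ j, MemLp (F j) 2 volume)
    {e : CSp n → ℂ} (he : Tst e)
    (hcl : WClosed D (fun y => φ y - ψ y) F) (hdv : WDiv D (fun y => φ y - ψ y) F e)
    {χ : CSp n → ℝ} (h1 : ContDiff ℝ ∞ χ) (h2 : HasCompactSupport χ) (h3 : tsupport χ ⊆ D) :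
    ∫ x, ∑ j, ‖rc χ x * F j x‖^2 ≤
      (∫ x, ‖rc χ x * e x * ex (fun y => (φ y - 2 * ψ y)/2) x +
        ∑ j, F j x * (dd j (rc χ) x * ex (fun y => - ψ y / 2) x)‖^2) +
      (1/2) * ∫ x, ∑ j, ∑ k, ‖(F k x * (dbar j (rc χ) x * ex (fun y => - ψ y / 2) x)
        - F j x * (dbar k (rc χ) x * ex (fun y => - ψ y / 2) x))‖^2 := by
  obtain ⟨hD, hφ, hψ, hL⟩ := hW
  obtain ⟨κ, k1, k2, k3, k4, -⟩ := exists_cutoff h2 hD h3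
  have hφ' := sm_mul_local hD k1 k3 hφ
  have hψ' := sm_mul_local hD k1 k3 hψ
  set φ' : CSp n → ℝ := fun x => κ x * φ x with hφd
  set ψ' : CSp n → ℝ := fun x => κ x * ψ x with hψd
  set D' := D ∩ interior {x | κ x = 1} with hD'
  have hD'o : IsOpen D' := hD.inter isOpen_interior
  have hKD' : tsupport χ ⊆ D' := fun x hx => ⟨h3 hx, by
    rw [mem_interior_iff_mem_nhds]
    exact (eventually_nhdsSet_iff_forall.1 k4) x hx⟩
  have loc : ∀ x ∈ D', φ' =ᶠ[𝓝 x] φ ∧ ψ' =ᶠ[𝓝 x] ψ := by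
    intro x hx
    have := mem_interior_iff_mem_nhds.1 hx.2
    constructor <;> filter_upwards [this] with y hy <;> have hy' : κ y = 1 := hy <;>
      simp [hφd, hψd, hy']
  have rcl : ∀ {f g : CSp n → ℝ} {x : CSp n}, f =ᶠ[𝓝 x] g → rc f =ᶠ[𝓝 x] rc g := by
    intro f g x h
    filter_upwards [h] with y hy
    simp [rc, hy]
  have hL' : ∀ x ∈ D', ∀ t : Fin n → ℂ,
      2 * ((∑ j, ‖dd j (rc ψ') x‖^2) + Real.exp (ψ' x)) * (∑ j, ‖t j‖^2) ≤ levi φ' t x := by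
    intro x hx t
    obtain ⟨l1, l2⟩ := loc x hx
    have := hL x hx.1 t
    unfold levi at this ⊢
    simp only [dd_congr (rcl l2), l2.self_of_nhds, dbar_congr (dd_eventuallyEq (rcl l1) _)]
    exact this
  have vv : ∀ x ∈ tsupport χ, φ' x = φ x ∧ ψ' x = ψ x := fun x hx =>
    ⟨(loc x (hKD' hx)).1.self_of_nhds, (loc x (hKD' hx)).2.self_of_nhds⟩
  set w : CSp n → ℂ := ex (fun y => (φ' y - ψ' y)/2) with hw
  have hws : ContDiff ℝ ∞ w := ex_sm ((hφ'.sub hψ').div_const 2)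
  set φ2' : CSp n → ℝ := fun y => φ' y - ψ' y with hφ2'
  have hφs2 : ContDiff ℝ ∞ φ2' := hφ'.sub hψ'
  have hχT : Tst (rc χ) := rc_Tst h1 h2
  have hχs : tsupport (rc χ) = tsupport χ := rc_tsupport χ
  have χ0 : ∀ x, x ∉ tsupport χ → rc χ x = 0 := fun x hx => by
    rw [← hχs] at hx; exact image_eq_zero_of_notMem_tsupport hx
  have dχ0 : ∀ j x, x ∉ tsupport χ → dd j (rc χ) x = 0 := fun j x hx => by
    rw [← hχs] at hx
    exact image_eq_zero_of_notMem_tsupport (fun h => hx (dd_supp j h))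
  have dbχ0 : ∀ j x, x ∉ tsupport χ → dbar j (rc χ) x = 0 := fun j x hx => by
    rw [← hχs] at hx
    exact image_eq_zero_of_notMem_tsupport (fun h => hx (dbar_supp j h))
  have hsd : ∀ j x, dd j (rc φ2') x = dd j (rc φ2') x := fun _ _ => rfl
  -- the data
  set T : Fin n → CSp n → ℂ := fun j x => (dd j (rc χ) x + rc χ x * dd j (rc φ2') x) * w x with hT
  have hTT : ∀ j, Tst (T j) := fun j => by
    have t1 := (hχT.dd j)
    have t2 := hχT.mul_right (dd_sm (rc_sm hφs2) j)
    have t3 : Tst (fun x => dd j (rc χ) x + rc χ x * dd j (rc φ2') x) := ⟨t1.1.add t2.1, t1.2.add t2.2⟩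
    exact t3.mul_right hws
  have hχw : Tst (fun x => rc χ x * w x) := hχT.mul_right hws
  have hZm : ∀ j, MemLp (fun x => rc χ x * w x * F j x) 2 volume := fun j => memLp_mul_T (hF j) hχw
  have ham : MemLp (fun x => rc χ x * w x * w x * e x + ∑ j, T j x * F j x) 2 volume := by
    refine (memLp_mul_T he.memLp (hχw.mul_right hws)).add ?_
    exact memLp_finsetSum _ (fun j _ => memLp_mul_T (hF j) (hTT j))
  have hcm : ∀ j k, MemLp (fun x => (dbar j (rc χ) x * w x) * F k x -
      (dbar k (rc χ) x * w x) * F j x) 2 volume := fun j k =>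
    (memLp_mul_T (hF k) ((hχT.dbar j).mul_right hws)).sub
      (memLp_mul_T (hF j) ((hχT.dbar k).mul_right hws))
  have wE : ∀ x ∈ tsupport χ, ex (fun y => (φ y - ψ y)/2) x = w x := fun x hx => by
    obtain ⟨v1, v2⟩ := vv x hx
    apply ex_congr; simp only [v1, v2]
  have wEi : ∀ x ∈ tsupport χ, ex (fun y => -(φ y - ψ y)/2) x * (w x * w x) = w x := fun x hx => by
    obtain ⟨v1, v2⟩ := vv x hx
    simp only [hw, ex, ← Complex.ofReal_mul, ← Real.exp_add, v1, v2]
    congr 2; ring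
  have main := hor_L2 hD'o hφ' hψ' hL' h2 hKD' hZm ham hcm
    (fun j x hx => by simp [χ0 x hx])
    (fun x hx => by simp [χ0 x hx, hT, dχ0 _ x hx])
    (fun j k x hx => by simp [dbχ0 _ x hx])
    (by
      intro θ hθ
      have tT : Tst (fun x => (rc χ x * (w x * w x)) * θ x) :=
        (hχT.mul_right (hws.mul hws)).mul_right hθ.1
      have := hdv _ tT (by
        refine (closure_minimal ?_ (isClosed_tsupport (rc χ))).trans (hχs.le.trans h3)
        intro x hx
        apply subset_tsupport
        intro h0
        simp [h0] at hx)
      have hww : ∀ j x, dd j (fun x => w x * w x) x = dd j (rc φ2') x * (w x * w x) := by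
        intro j x
        have d2 : dd j (rc fun y => (φ' y - ψ' y)/2) x = dd j (rc φ2') x / 2 := by
          have : rc (fun y => (φ' y - ψ' y)/2) = fun y => (1/2 : ℂ) * rc φ2' y := by
            ext y; simp [rc, hφ2']; ring
          rw [this, dd_mul (differentiableAt_const _) (sm_diff (rc_sm hφs2) x), dd_const']
          ring
        rw [dd_mul (sm_diff hws x) (sm_diff hws x), hw, dd_ex ((hφ'.sub hψ').div_const 2), d2]
        ring
      have pt : ∀ j x, ex (fun y => -(φ y - ψ y)/2) x *
          dd j (fun x => (rc χ x * (w x * w x)) * θ x) x =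
          T j x * θ x + rc χ x * w x * dd j θ x := by
        intro j x
        by_cases hx : x ∈ tsupport χ
        · rw [dd_mul (sm_diff (hχT.mul_right (hws.mul hws)).1 x) (sm_diff hθ.1 x),
            dd_mul (sm_diff hχT.1 x) (sm_diff (hws.mul hws) x), hww]
          simp only [hT]
          linear_combination ((dd j (rc χ) x + rc χ x * dd j (rc φ2') x) * θ x
            + rc χ x * dd j θ x) * wEi x hx
        · have : dd j (fun x => (rc χ x * (w x * w x)) * θ x) x = 0 := by
            apply image_eq_zero_of_notMem_tsupport
            intro h
            apply hx
            rw [← hχs]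
            refine closure_minimal ?_ (isClosed_tsupport (rc χ)) (dd_supp j h)
            intro y hy
            apply subset_tsupport
            intro h0
            simp [h0] at hy
          rw [this]
          simp [hT, χ0 x hx, dχ0 j x hx]
      simp only [pt] at this
      have i1 : ∀ j, Integrable (fun x => F j x * (T j x * θ x)) := fun j =>
        int_mul_T (hF j) ((hTT j).mul_right hθ.1)
      have i2 : ∀ j, Integrable (fun x => F j x * (rc χ x * w x * dd j θ x)) := fun j =>
        int_mul_T (hF j) (hχw.mul_right (hθ.dd j).1)
      have i3 : Integrable (fun x => e x * (rc χ x * (w x * w x) * θ x)) :=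
        int_mul_T he.memLp tT
      simp only [mul_add, Finset.sum_add_distrib] at this
      rw [integral_add (integrable_finsetSum _ (fun j _ => i1 j))
        (integrable_finsetSum _ (fun j _ => i2 j))] at this
      have l1 : ∫ x, ∑ j, rc χ x * w x * F j x * dd j θ x =
          ∫ x, ∑ j, F j x * (rc χ x * w x * dd j θ x) := by
        congr 1; ext x; refine Finset.sum_congr rfl (fun j _ => by ring)
      have l2 : ∫ x, (rc χ x * w x * w x * e x + ∑ j, T j x * F j x) * θ x =
          (∫ x, e x * (rc χ x * (w x * w x) * θ x)) + ∫ x, ∑ j, F j x * (T j x * θ x) := by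
        rw [← integral_add i3 (integrable_finsetSum _ (fun j _ => i1 j))]
        congr 1; ext x
        rw [add_mul, Finset.sum_mul]
        congr 1
        · ring
        · refine Finset.sum_congr rfl (fun j _ => by ring)
      rw [l1, l2]
      linear_combination this)
    (by
      intro θ hθ j k
      have tT : Tst (fun x => rc χ x * θ x) := hχT.mul_right hθ.1
      have := hcl _ tT (by
        refine (closure_minimal ?_ (isClosed_tsupport (rc χ))).trans (hχs.le.trans h3)
        intro x hx
        apply subset_tsupport
        intro h0
        simp [h0] at hx) j k
      have pt : ∀ j x, ex (fun y => (φ y - ψ y)/2) x * dbar j (fun x => rc χ x * θ x) x =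
          (dbar j (rc χ) x * w x) * θ x + rc χ x * w x * dbar j θ x := by
        intro j x
        rw [dbar_mul (sm_diff hχT.1 x) (sm_diff hθ.1 x)]
        by_cases hx : x ∈ tsupport χ
        · rw [wE x hx]; ring
        · simp [χ0 x hx, dbχ0 j x hx]
      simp only [pt] at this
      have i1 : ∀ j k, Integrable (fun x => F j x * (dbar k (rc χ) x * w x * θ x)) := fun j k =>
        int_mul_T (hF j) (((hχT.dbar k).mul_right hws).mul_right hθ.1)
      have i2 : ∀ j k, Integrable (fun x => F j x * (rc χ x * w x * dbar k θ x)) := fun j k =>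
        int_mul_T (hF j) (hχw.mul_right (hθ.dbar k).1)
      have l1 : ∫ x, (rc χ x * w x * F k x * dbar j θ x - rc χ x * w x * F j x * dbar k θ x) =
          (∫ x, F k x * (rc χ x * w x * dbar j θ x)) - ∫ x, F j x * (rc χ x * w x * dbar k θ x) := by
        rw [← integral_sub (i2 _ _) (i2 _ _)]
        congr 1; ext x; ring
      have l2 : ∫ x, ((dbar j (rc χ) x * w x) * F k x - (dbar k (rc χ) x * w x) * F j x) * θ x =
          (∫ x, F k x * (dbar j (rc χ) x * w x * θ x)) - ∫ x, F j x * (dbar k (rc χ) x * w x * θ x) := by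
        rw [← integral_sub (i1 _ _) (i1 _ _)]
        congr 1; ext x; ring
      have l3 : ∫ x, (F k x * (dbar j (rc χ) x * w x * θ x + rc χ x * w x * dbar j θ x) -
          F j x * (dbar k (rc χ) x * w x * θ x + rc χ x * w x * dbar k θ x)) =
          ((∫ x, F k x * (dbar j (rc χ) x * w x * θ x)) + (∫ x, F k x * (rc χ x * w x * dbar j θ x)))
          - ((∫ x, F j x * (dbar k (rc χ) x * w x * θ x)) +
            (∫ x, F j x * (rc χ x * w x * dbar k θ x))) := by
        rw [← integral_add (i1 _ _) (i2 _ _), ← integral_add (i1 _ _) (i2 _ _), ← integral_sub]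
        · congr 1; ext x; ring
        · exact (i1 _ _).add (i2 _ _)
        · exact (i1 _ _).add (i2 _ _)
      rw [l3] at this
      rw [l1, l2]
      linear_combination this)
  have c1 : ∀ x, w x * ((Real.exp (-(φ' x - ψ' x)/2) : ℝ) : ℂ) = 1 := by
    intro x
    simp only [hw, ex, ← Complex.ofReal_mul, ← Real.exp_add]
    rw [show (φ' x - ψ' x)/2 + -(φ' x - ψ' x)/2 = 0 by ring]; simp
  have c2 : ∀ x ∈ tsupport χ, w x * ((Real.exp (-φ' x/2) : ℝ) : ℂ) = ex (fun y => -ψ y / 2) x := by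
    intro x hx
    simp only [hw, ex, ← Complex.ofReal_mul, ← Real.exp_add, ← (vv x hx).2]
    congr 2; ring
  have c3 : ∀ x ∈ tsupport χ, w x * w x * ((Real.exp (-φ' x/2) : ℝ) : ℂ) =
      ex (fun y => (φ y - 2 * ψ y) / 2) x := by
    intro x hx
    simp only [hw, ex, ← Complex.ofReal_mul, ← Real.exp_add, ← (vv x hx).2, ← (vv x hx).1]
    congr 2; ring
  convert main using 1
  · congr 1; ext x
    refine Finset.sum_congr rfl (fun j _ => ?_)
    congr 2
    linear_combination - rc χ x * F j x * c1 x
  · congr 1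
    · congr 1; ext x
      congr 2
      by_cases hx : x ∈ tsupport χ
      · rw [← c2 x hx, ← c3 x hx]
        have : (∑ j, T j x * F j x) - ∑ j, dd j (rc φ2') x * (rc χ x * w x * F j x) =
            ∑ j, F j x * (dd j (rc χ) x * w x) := by
          rw [← Finset.sum_sub_distrib]
          refine Finset.sum_congr rfl (fun j _ => ?_)
          simp only [hT]; ring
        rw [add_sub_assoc, this, add_mul, Finset.sum_mul]
        congr 1
        · ring
        · refine Finset.sum_congr rfl (fun j _ => by ring)
      · simp [χ0 x hx, dχ0 _ x hx, hT]
    · congr 2; ext x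
      refine Finset.sum_congr rfl (fun j _ => Finset.sum_congr rfl (fun k _ => ?_))
      congr 2
      by_cases hx : x ∈ tsupport χ
      · rw [← c2 x hx]; ring
      · simp [dbχ0 _ x hx]

end PartA7
end

open Metric Set Filter Asymptotics
open scoped Manifold Topology
noncomputable section

section PartA8
open MeasureTheory
open scoped ContDiff ComplexConjugate ENNReal

variable {n : ℕ}

structure Cut (D : Set (CSp n)) (ψ : CSp n → ℝ) (χ : ℕ → CSp n → ℝ) : Prop where
  sm : ∀ ν, ContDiff ℝ ∞ (χ ν)
  cs : ∀ ν, HasCompactSupport (χ ν)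
  ts : ∀ ν, tsupport (χ ν) ⊆ D
  rng : ∀ ν x, χ ν x ∈ Icc (0:ℝ) 1
  bd : ∀ ν, ∀ x ∈ D, ∑ j, ‖dd j (rc (χ ν)) x‖^2 ≤ Real.exp (ψ x)
  lim : ∀ x ∈ D, ∀ᶠ ν in atTop, χ ν =ᶠ[𝓝 x] fun _ => 1

lemma ex_smOn {D : Set (CSp n)} {f : CSp n → ℝ} (hf : ContDiffOn ℝ ∞ f D) :
    ContDiffOn ℝ ∞ (ex f) D := by
  exact Complex.ofRealCLM.contDiff.comp_contDiffOn hf.exp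

lemma Tst.mul_loc {D : Set (CSp n)} (hD : IsOpen D) {θ g : CSp n → ℂ} (hθ : Tst θ)
    (hs : tsupport θ ⊆ D) (hg : ContDiffOn ℝ ∞ g D) : Tst (fun x => θ x * g x) :=
  ⟨sm_mul_localC hD hθ.1 hs hg, hθ.2.mul_right⟩

lemma int_sq {f : CSp n → ℂ} (hf : MemLp f 2 volume) : Integrable (fun x => ‖f x‖^2) := by
  simpa using hf.integrable_norm_pow (by norm_num)

theorem core {D : Set (CSp n)} {φ ψ : CSp n → ℝ} (hW : Wts D φ ψ) {χ : ℕ → CSp n → ℝ}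
    (hC : Cut D ψ χ)
    {F : Fin n → CSp n → ℂ} (hF : ∀ j, MemLp (F j) 2 volume)
    {e : CSp n → ℂ} (he : Tst e) (hes : tsupport e ⊆ D)
    (hcl : WClosed D (fun y => φ y - ψ y) F) (hdv : WDiv D (fun y => φ y - ψ y) F e) :
    ∫ x, ∑ j, ‖D.indicator (F j) x‖^2 ≤ ∫ x, ‖e x * ex (fun y => (φ y - 2 * ψ y)/2) x‖^2 := by
  have hD := hW.hD
  have hineq := fun ν => core_nu hW hF he hcl hdv (hC.sm ν) (hC.cs ν) (hC.ts ν)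
  have hφ1 : ContDiffOn ℝ ∞ (fun y => (φ y - 2 * ψ y)/2) D :=
    (hW.hφ.sub (contDiffOn_const.mul hW.hψ)).div_const 2
  have hψ2 : ContDiffOn ℝ ∞ (fun y => - ψ y / 2) D := hW.hψ.neg.div_const 2
  have heT : Tst (fun x => e x * ex (fun y => (φ y - 2 * ψ y)/2) x) := he.mul_loc hD hes (ex_smOn hφ1)
  have hsF : Integrable (fun x => ∑ j, ‖F j x‖^2) := integrable_finsetSum _ (fun j _ => int_sq (hF j))
  have χT : ∀ ν, Tst (rc (χ ν)) := fun ν => rc_Tst (hC.sm ν) (hC.cs ν)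
  have χs : ∀ ν, tsupport (rc (χ ν)) ⊆ D := fun ν => (rc_tsupport _).le.trans (hC.ts ν)
  have χn : ∀ ν x, ‖rc (χ ν) x‖ ≤ 1 := fun ν x => by
    rw [rc, Complex.norm_real, Real.norm_of_nonneg (hC.rng ν x).1]; exact (hC.rng ν x).2
  have dT : ∀ ν j, Tst (fun x => dd j (rc (χ ν)) x * ex (fun y => - ψ y / 2) x) := fun ν j =>
    ((χT ν).dd j).mul_loc hD ((dd_supp j).trans (χs ν)) (ex_smOn hψ2)
  have dbT : ∀ ν j, Tst (fun x => dbar j (rc (χ ν)) x * ex (fun y => - ψ y / 2) x) := fun ν j =>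
    ((χT ν).dbar j).mul_loc hD ((dbar_supp j).trans (χs ν)) (ex_smOn hψ2)
  have sq : ∀ r : ℝ, (Real.exp (-r/2))^2 = Real.exp (-r) := fun r => by
    rw [← Real.exp_nat_mul]; congr 1; push_cast; ring
  have d0 : ∀ ν j x, x ∉ D → dd j (rc (χ ν)) x = 0 := fun ν j x hx =>
    image_eq_zero_of_notMem_tsupport (fun h => hx (χs ν (dd_supp j h)))
  have dconj : ∀ ν j x, dbar j (rc (χ ν)) x = conj (dd j (rc (χ ν)) x) := fun ν j x =>
    dbar_rc ((hC.sm ν).differentiable (by simp) x) j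
  have exn : ∀ (f : CSp n → ℝ) x, ‖ex f x‖ = Real.exp (f x) := fun f x => by
    rw [ex, Complex.norm_real, Real.norm_of_nonneg (Real.exp_pos _).le]
  have bdd : ∀ ν x, ∑ j, ‖dd j (rc (χ ν)) x * ex (fun y => - ψ y / 2) x‖^2 ≤ 1 := by
    intro ν x
    by_cases hx : x ∈ D
    · simp only [norm_mul, mul_pow, exn, sq]
      rw [← Finset.sum_mul]
      calc _ ≤ Real.exp (ψ x) * Real.exp (-ψ x) :=
            mul_le_mul_of_nonneg_right (hC.bd ν x hx) (Real.exp_pos _).le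
        _ = 1 := by rw [← Real.exp_add]; simp
    · simp [d0 ν _ x hx]
  have bdd1 : ∀ ν j x, ‖dbar j (rc (χ ν)) x * ex (fun y => - ψ y / 2) x‖^2 ≤ 1 := by
    intro ν j x
    refine le_trans ?_ (bdd ν x)
    have := Finset.single_le_sum (f := fun j => ‖dd j (rc (χ ν)) x * ex (fun y => - ψ y / 2) x‖^2)
      (fun j _ => by positivity) (Finset.mem_univ j)
    refine le_trans (le_of_eq ?_) this
    simp only [norm_mul, dconj, RCLike.norm_conj]
  have ddz : ∀ x, ∀ᶠ ν in atTop, ∀ j, dd j (rc (χ ν)) x = 0 := by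
    intro x
    by_cases hx : x ∈ D
    · filter_upwards [hC.lim x hx] with ν h j
      have : rc (χ ν) =ᶠ[𝓝 x] fun _ => 1 := by
        filter_upwards [h] with y hy; simp [rc, hy]
      rw [dd_congr this, dd_const']
    · exact Eventually.of_forall (fun ν j => d0 ν j x hx)
  have lim1 : Tendsto (fun ν => ∫ x, ∑ j, ‖rc (χ ν) x * F j x‖^2) atTop
      (𝓝 (∫ x, ∑ j, ‖D.indicator (F j) x‖^2)) := by
    refine tendsto_integral_of_dominated_convergence _ (fun ν => ?_) hsF (fun ν => ?_) ?_
    · exact (integrable_finsetSum _ (fun j _ => int_sq (memLp_mul_T (hF j) (χT ν)))).1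
    · filter_upwards with x
      rw [Real.norm_of_nonneg (Finset.sum_nonneg (fun j _ => by positivity))]
      refine Finset.sum_le_sum (fun j _ => ?_)
      rw [norm_mul, mul_pow]
      have := pow_le_one₀ (norm_nonneg _) (χn ν x) (n := 2)
      nlinarith [sq_nonneg ‖F j x‖]
    · filter_upwards with x
      by_cases hx : x ∈ D
      · apply tendsto_const_nhds.congr'
        filter_upwards [hC.lim x hx] with ν h
        have := h.self_of_nhds
        simp [rc, this, hx]
      · apply tendsto_const_nhds.congr'
        filter_upwards with ν
        have : rc (χ ν) x = 0 := image_eq_zero_of_notMem_tsupport (fun h => hx (χs ν h))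
        simp [this, hx]
  have lim2 : Tendsto (fun ν => ∫ x, ‖rc (χ ν) x * e x * ex (fun y => (φ y - 2 * ψ y)/2) x +
        ∑ j, F j x * (dd j (rc (χ ν)) x * ex (fun y => - ψ y / 2) x)‖^2) atTop
      (𝓝 (∫ x, ‖e x * ex (fun y => (φ y - 2 * ψ y)/2) x‖^2)) := by
    refine tendsto_integral_of_dominated_convergence
      (fun x => 2 * ‖e x * ex (fun y => (φ y - 2 * ψ y)/2) x‖^2 + 2 * ∑ j, ‖F j x‖^2)
      (fun ν => ?_) (((int_sq heT.memLp).const_mul 2).add (hsF.const_mul 2)) (fun ν => ?_) ?_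
    · have m1 := memLp_mul_T heT.memLp (χT ν)
      have m2 := memLp_finsetSum Finset.univ (fun j _ => memLp_mul_T (hF j) (dT ν j))
      refine (int_sq (m1.add m2)).1.congr ?_
      filter_upwards with x
      simp only [Pi.add_apply, mul_assoc, mul_comm (F _ x)]
    · filter_upwards with x
      rw [Real.norm_of_nonneg (by positivity)]
      refine (norm_add_sq_le2 _ _).trans ?_
      have h1 := cs_sum (fun j => F j x) (fun j => dd j (rc (χ ν)) x * ex (fun y => - ψ y / 2) x)
      have h2 := bdd ν x
      have h3 : 0 ≤ ∑ j, ‖F j x‖^2 := Finset.sum_nonneg (fun j _ => by positivity)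
      have h4 : ‖rc (χ ν) x * e x * ex (fun y => (φ y - 2 * ψ y)/2) x‖^2 ≤
          ‖e x * ex (fun y => (φ y - 2 * ψ y)/2) x‖^2 := by
        rw [mul_assoc, norm_mul, mul_pow]
        have := pow_le_one₀ (norm_nonneg _) (χn ν x) (n := 2)
        nlinarith [sq_nonneg ‖e x * ex (fun y => (φ y - 2 * ψ y)/2) x‖]
      have h5 := mul_le_mul_of_nonneg_left h2 h3
      linarith
    · filter_upwards with x
      apply tendsto_const_nhds.congr'
      by_cases hx : x ∈ D
      · filter_upwards [hC.lim x hx, ddz x] with ν h h'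
        have := h.self_of_nhds
        simp [rc, this, h']
      · filter_upwards [ddz x] with ν h'
        have : e x = 0 := image_eq_zero_of_notMem_tsupport (fun h => hx (hes h))
        simp [h', this]
  have lim3 : Tendsto (fun ν => ∫ x, ∑ j, ∑ k,
      ‖(F k x * (dbar j (rc (χ ν)) x * ex (fun y => - ψ y / 2) x)
        - F j x * (dbar k (rc (χ ν)) x * ex (fun y => - ψ y / 2) x))‖^2) atTop
      (𝓝 (∫ _x : CSp n, (0:ℝ))) := by
    refine tendsto_integral_of_dominated_convergence
      (fun x => ∑ j, ∑ k, (2 * ‖F k x‖^2 + 2 * ‖F j x‖^2))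
      (fun ν => ?_) ?_ (fun ν => ?_) ?_
    · refine (integrable_finsetSum _ (fun j _ => integrable_finsetSum _ (fun k _ => ?_))).1
      have m := (memLp_mul_T (hF k) (dbT ν j)).sub (memLp_mul_T (hF j) (dbT ν k))
      refine (int_sq m).congr ?_
      filter_upwards with x
      simp only [Pi.sub_apply, mul_comm (F _ x)]
    · refine (integrable_finsetSum _ (fun j _ => integrable_finsetSum _ (fun k _ => ?_)))
      exact ((int_sq (hF k)).const_mul 2).add ((int_sq (hF j)).const_mul 2)
    · filter_upwards with x
      rw [Real.norm_of_nonneg (Finset.sum_nonneg (fun j _ => Finset.sum_nonneg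
        (fun k _ => by positivity)))]
      refine Finset.sum_le_sum (fun j _ => Finset.sum_le_sum (fun k _ => ?_))
      rw [sub_eq_add_neg]
      refine (norm_add_sq_le2 _ _).trans ?_
      rw [norm_neg, norm_mul, norm_mul (F j x), mul_pow, mul_pow]
      have h1 := mul_le_mul_of_nonneg_left (bdd1 ν j x) (sq_nonneg ‖F k x‖)
      have h2 := mul_le_mul_of_nonneg_left (bdd1 ν k x) (sq_nonneg ‖F j x‖)
      linarith
    · filter_upwards with x
      apply tendsto_const_nhds.congr'
      filter_upwards [ddz x] with ν h'
      simp [dconj, h']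
  have := le_of_tendsto_of_tendsto' lim1 (lim2.add (lim3.const_mul (1/2))) hineq
  simpa using this

/-! Hilbert space lemmas -/

lemma hilb_proj {H : Type*} [NormedAddCommGroup H] [InnerProductSpace ℂ H] [CompleteSpace H]
    (S : Set H) (G : H) : ∃ G' : H, (∀ s ∈ S, inner ℂ s G' = 0) ∧
      ∀ t, (∀ s ∈ S, inner ℂ s t = 0) → inner ℂ t G' = inner ℂ t G := by
  set N := (Submodule.span ℂ S)ᗮ with hN
  have mem : ∀ t, t ∈ N ↔ ∀ s ∈ S, inner ℂ s t = 0 := by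
    intro t
    rw [hN, Submodule.mem_orthogonal]
    refine ⟨fun h s hs => h s (Submodule.subset_span hs), fun h u hu => ?_⟩
    induction hu using Submodule.span_induction with
    | mem x hx => exact h x hx
    | zero => simp
    | add x y _ _ hx hy => simp [inner_add_left, hx, hy]
    | smul a x _ hx => simp [inner_smul_left, hx]
  refine ⟨N.starProjection G, (mem _).1 (N.starProjection_apply_mem G), fun t ht => ?_⟩
  have h1 := N.sub_starProjection_mem_orthogonal G
  have h2 := (Submodule.mem_orthogonal N _).1 h1 t ((mem t).2 ht)
  rw [inner_sub_right, sub_eq_zero] at h2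
  exact h2.symm

lemma hilb_riesz {H M : Type*} [NormedAddCommGroup H] [InnerProductSpace ℂ H] [CompleteSpace H]
    [AddCommGroup M] [Module ℂ M] (A : M →ₗ[ℂ] H) (B : M →ₗ[ℂ] ℂ) (C : ℝ)
    (h : ∀ m, ‖B m‖ ≤ C * ‖A m‖) : ∃ v : H, ∀ m, B m = inner ℂ v (A m) := by
  obtain ⟨g, hg⟩ := LinearMap.exists_rightInverse_of_surjective A.rangeRestrict
    (LinearMap.range_rangeRestrict A)
  have hg' : ∀ y : A.range, A (g y) = y := fun y => by
    have := LinearMap.congr_fun hg y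
    simpa using congrArg Subtype.val this
  set f : A.range →L[ℂ] ℂ := (B ∘ₗ g).mkContinuous C (fun y => by
    have := h (g y); rw [hg'] at this; exact this)
  obtain ⟨F, hF, -⟩ := exists_extension_norm_eq A.range f
  refine ⟨(InnerProductSpace.toDual ℂ H).symm F, fun m => ?_⟩
  rw [InnerProductSpace.toDual_symm_apply]
  have h1 := hF ⟨A m, LinearMap.mem_range_self A m⟩
  simp only at h1
  rw [h1]
  show B m = B (g ⟨A m, _⟩)
  have h2 := h (m - g ⟨A m, LinearMap.mem_range_self A m⟩)
  rw [map_sub, map_sub, hg'] at h2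
  simp only [sub_self, norm_zero, mul_zero] at h2
  exact sub_eq_zero.1 (norm_le_zero_iff.1 h2)

end PartA8
end

open Metric Set Filter Asymptotics
open scoped Manifold Topology
noncomputable section

section PartA9
open MeasureTheory
open scoped ContDiff ComplexConjugate ENNReal

variable {n : ℕ}

abbrev LL (n : ℕ) := Lp ℂ 2 (volume : Measure (CSp n))
abbrev HH (n : ℕ) := PiLp 2 (fun _ : Fin n => LL n)

lemma lp_norm_sq {f : CSp n → ℂ} (hf : MemLp f 2 volume) : ‖hf.toLp f‖^2 = ∫ x, ‖f x‖^2 := by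
  rw [Lp.norm_toLp, hf.eLpNorm_eq_integral_rpow_norm (by norm_num) (by norm_num),
    ENNReal.toReal_ofReal (by positivity)]
  have h0 : 0 ≤ ∫ x, ‖f x‖^2 := integral_nonneg (fun x => by positivity)
  simp only [ENNReal.toReal_ofNat, Real.rpow_ofNat]
  rw [← Real.rpow_natCast, ← Real.rpow_mul h0]
  norm_num

lemma lp_inner {f : CSp n → ℂ} (hf : MemLp f 2 volume) (g : LL n) :
    inner ℂ (hf.toLp f) g = ∫ x, conj (f x) * g x := by
  rw [L2.inner_def]
  apply integral_congr_ae
  filter_upwards [hf.coeFn_toLp] with x hx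
  rw [hx]; simp [mul_comm]

lemma lp_inner2 {f g : CSp n → ℂ} (hf : MemLp f 2 volume) (hg : MemLp g 2 volume) :
    inner ℂ (hf.toLp f) (hg.toLp g) = ∫ x, conj (f x) * g x := by
  rw [lp_inner hf]
  apply integral_congr_ae
  filter_upwards [hg.coeFn_toLp] with x hx
  rw [hx]

/-- vector for closedness condition -/
def sv {a b : CSp n → ℂ} (ha : MemLp a 2 volume) (hb : MemLp b 2 volume) (j k : Fin n) : HH n :=
  WithLp.toLp 2 (fun i => (if i = k then ha.toLp a else 0) - (if i = j then hb.toLp b else 0))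

lemma sv_inner {a b : CSp n → ℂ} (ha : MemLp a 2 volume) (hb : MemLp b 2 volume) (j k : Fin n)
    (F : HH n) : inner ℂ (sv ha hb j k) F = inner ℂ (ha.toLp a) (F k) - inner ℂ (hb.toLp b) (F j) := by
  rw [PiLp.inner_apply]
  simp only [sv, inner_sub_left, Finset.sum_sub_distrib]
  congr 1
  · rw [Finset.sum_eq_single k]
    · simp
    · intro b _ hb; simp [hb]
    · simp
  · rw [Finset.sum_eq_single j]
    · simp
    · intro b _ hb; simp [hb]
    · simp

/-- test tuples -/
def MM (D : Set (CSp n)) : Submodule ℂ (Fin n → CSp n → ℂ) where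
  carrier := {g | ∀ j, Tst (g j) ∧ tsupport (g j) ⊆ D}
  add_mem' := by
    intro a b ha hb j
    refine ⟨⟨(ha j).1.1.add (hb j).1.1, (ha j).1.2.add (hb j).1.2⟩, ?_⟩
    exact (tsupport_add (a j) (b j)).trans (union_subset (ha j).2 (hb j).2)
  zero_mem' := by
    intro j
    refine ⟨⟨contDiff_const, HasCompactSupport.zero⟩, ?_⟩
    simp [tsupport]
  smul_mem' := by
    intro c a ha j
    refine ⟨(ha j).1.mul_left contDiff_const, ?_⟩
    exact (tsupport_mul_subset_right (f := fun _ => c)).trans (ha j).2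

def toHH {F : Fin n → CSp n → ℂ} (hF : ∀ j, MemLp (F j) 2 volume) : HH n :=
  WithLp.toLp 2 (fun j => (hF j).toLp (F j))

lemma wclosed_congr {D : Set (CSp n)} {φ2 : CSp n → ℝ} {F G : Fin n → CSp n → ℂ}
    (h : ∀ j, F j =ᵐ[volume] G j) (hF : WClosed D φ2 F) : WClosed D φ2 G := by
  intro θ hθ hs j k
  rw [← hF θ hθ hs j k]
  apply integral_congr_ae
  filter_upwards [h j, h k] with x h1 h2
  rw [h1, h2]

set_option maxHeartbeats 4000000 in
theorem hor_exist {D : Set (CSp n)} {φ ψ : CSp n → ℝ} (hW : Wts D φ ψ) {χ : ℕ → CSp n → ℝ}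
    (hC : Cut D ψ χ) {w : Fin n → CSp n → ℂ} (hw : ∀ j, MemLp (w j) 2 volume)
    (hw0 : ∀ j x, x ∉ D → w j x = 0) (hcl : WClosed D (fun y => φ y - ψ y) w) :
    ∃ v : CSp n → ℂ, MemLp v 2 volume ∧ ∀ θ, Tst θ → tsupport θ ⊆ D → ∀ j,
      ∫ x, v x * (ex (fun y => (φ y - 2 * ψ y)/2) x * dbar j θ x) =
        - ∫ x, w j x * (ex (fun y => (φ y - ψ y)/2) x * θ x) := by
  have hD := hW.hD
  have hφ1 : ContDiffOn ℝ ∞ (ex (fun y => (φ y - 2 * ψ y)/2)) D :=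
    ex_smOn ((hW.hφ.sub (contDiffOn_const.mul hW.hψ)).div_const 2)
  have hφ2 : ContDiffOn ℝ ∞ (ex (fun y => (φ y - ψ y)/2)) D :=
    ex_smOn ((hW.hφ.sub hW.hψ).div_const 2)
  have hφ2' : ContDiffOn ℝ ∞ (ex (fun y => -(φ y - ψ y)/2)) D :=
    ex_smOn ((hW.hφ.sub hW.hψ).neg.div_const 2)
  have exc : ∀ (f : CSp n → ℝ) x, conj (ex f x) = ex f x := fun f x => Complex.conj_ofReal _
  have E1 : ∀ x, ex (fun y => -(φ y - ψ y)/2) x * ex (fun y => (φ y - ψ y)/2) x = 1 := by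
    intro x
    simp only [ex, ← Complex.ofReal_mul, ← Real.exp_add]
    rw [show -(φ x - ψ x)/2 + (φ x - ψ x)/2 = 0 by ring]; simp
  -- closedness vectors
  have aT : ∀ θ : CSp n → ℂ, Tst θ → tsupport θ ⊆ D → ∀ j, Tst (fun x => conj (dbar j θ x) *
      ex (fun y => (φ y - ψ y)/2) x) := fun θ hθ hs j => by
    refine (hθ.dbar j).conj.mul_loc hD ?_ hφ2
    refine (closure_minimal ?_ (isClosed_tsupport (dbar j θ))).trans ((dbar_supp j).trans hs)
    intro x hx
    apply subset_tsupport
    intro h0; apply hx; simp [h0]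
  set S : Set (HH n) := {s | ∃ θ, ∃ hθ : Tst θ, ∃ hs : tsupport θ ⊆ D, ∃ j k,
    s = sv (aT θ hθ hs j).memLp (aT θ hθ hs k).memLp j k} with hS
  have memS : ∀ F : HH n, (∀ s ∈ S, inner ℂ s F = 0) ↔
      WClosed D (fun y => φ y - ψ y) (fun j => (F j : CSp n → ℂ)) := by
    intro F
    have key : ∀ θ (hθ : Tst θ) (hs : tsupport θ ⊆ D) j k,
        inner ℂ (sv (aT θ hθ hs j).memLp (aT θ hθ hs k).memLp j k) F =
        ∫ x, (F k x * (ex (fun y => (φ y - ψ y) / 2) x * dbar j θ x) -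
          F j x * (ex (fun y => (φ y - ψ y) / 2) x * dbar k θ x)) := by
      intro θ hθ hs j k
      rw [sv_inner, lp_inner, lp_inner, ← integral_sub]
      · congr 1; ext x
        simp only [map_mul, Complex.conj_conj, exc]
        ring
      · exact (aT θ hθ hs j).conj.memLp.integrable_mul (Lp.memLp (F k))
      · exact (aT θ hθ hs k).conj.memLp.integrable_mul (Lp.memLp (F j))
    constructor
    · intro h θ hθ hs j k
      rw [← h _ ⟨θ, hθ, hs, j, k, rfl⟩, key θ hθ hs j k]
    · rintro h s ⟨θ, hθ, hs, j, k, rfl⟩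
      rw [key θ hθ hs j k]; exact h θ hθ hs j k
  set wv : HH n := toHH hw with hwv
  have hwS : ∀ s ∈ S, inner ℂ s wv = 0 :=
    (memS wv).2 (wclosed_congr (fun j => ((hw j).coeFn_toLp).symm) hcl)
  -- operators
  have hdg : ∀ g : MM D, Tst (fun x => ∑ j, dbar j (g.1 j) x) ∧
      tsupport (fun x => ∑ j, dbar j (g.1 j) x) ⊆ D := by
    intro g
    have hT := Tst.sum Finset.univ (fun j => (g.2 j).1.dbar j)
    refine ⟨hT, ?_⟩
    have : tsupport (fun x => ∑ j, dbar j (g.1 j) x) ⊆ ⋃ j, tsupport (g.1 j) := by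
      apply closure_minimal
      · intro x hx
        by_contra h
        apply hx
        apply Finset.sum_eq_zero
        intro j _
        apply image_eq_zero_of_notMem_tsupport
        intro h'
        exact h (mem_iUnion.2 ⟨j, dbar_supp j h'⟩)
      · exact isClosed_iUnion_of_finite (fun j => isClosed_tsupport _)
    exact this.trans (iUnion_subset (fun j => (g.2 j).2))
  have hAT : ∀ g : MM D, Tst (fun x => (∑ j, dbar j (g.1 j) x) *
      ex (fun y => (φ y - 2 * ψ y)/2) x) := fun g => (hdg g).1.mul_loc hD (hdg g).2 hφ1
  set A : MM D →ₗ[ℂ] LL n :=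
    { toFun := fun g => (hAT g).memLp.toLp _
      map_add' := by
        intro g h
        rw [← MemLp.toLp_add]
        congr 1
        ext x
        simp only [Pi.add_apply, ← add_mul, ← Finset.sum_add_distrib]
        congr 1
        refine Finset.sum_congr rfl (fun j _ => ?_)
        exact dbar_add (sm_diff (g.2 j).1.1 x) (sm_diff (h.2 j).1.1 x) j
      map_smul' := by
        intro c g
        simp only [RingHom.id_apply]
        rw [← MemLp.toLp_const_smul]
        congr 1
        ext x
        simp only [Pi.smul_apply, smul_eq_mul, ← mul_assoc, Finset.mul_sum]
        congr 1
        refine Finset.sum_congr rfl (fun j _ => ?_)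
        have := dbar_mul (differentiableAt_const c) (sm_diff (g.2 j).1.1 x) j
        rw [dbar_const', zero_mul, zero_add] at this
        exact this } with hA
  have iB : ∀ (g : MM D) j, Integrable (fun x => w j x * (g.1 j x * ex (fun y => (φ y - ψ y)/2) x)) :=
    fun g j => int_mul_T (hw j) ((g.2 j).1.mul_loc hD (g.2 j).2 hφ2)
  set B : MM D →ₗ[ℂ] ℂ :=
    { toFun := fun g => ∑ j, ∫ x, w j x * (g.1 j x * ex (fun y => (φ y - ψ y)/2) x)
      map_add' := by
        intro g h
        rw [← Finset.sum_add_distrib]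
        refine Finset.sum_congr rfl (fun j _ => ?_)
        rw [← integral_add (iB g j) (iB h j)]
        congr 1; ext x
        show w j x * ((g.1 j x + h.1 j x) * _) = _
        ring
      map_smul' := by
        intro c g
        simp only [RingHom.id_apply, smul_eq_mul]
        rw [Finset.mul_sum]
        refine Finset.sum_congr rfl (fun j _ => ?_)
        rw [← integral_const_mul]
        congr 1; ext x
        show w j x * ((c * g.1 j x) * _) = _
        ring } with hB
  have est : ∀ g, ‖B g‖ ≤ ‖wv‖ * ‖A g‖ := by
    intro g
    have hGT : ∀ j, Tst (fun x => conj (g.1 j x * ex (fun y => (φ y - ψ y)/2) x)) := fun j =>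
      ((g.2 j).1.mul_loc hD (g.2 j).2 hφ2).conj
    set G : HH n := toHH (fun j => (hGT j).memLp) with hG
    obtain ⟨G', hG1, hG2⟩ := hilb_proj S G
    set e : CSp n → ℂ := fun x => conj (∑ j, dbar j (g.1 j) x) with he
    have heT : Tst e := (hdg g).1.conj
    have hes : tsupport e ⊆ D := by
      refine (closure_minimal ?_ (isClosed_tsupport _)).trans (hdg g).2
      intro x hx
      apply subset_tsupport
      intro h0; apply hx
      have h0' : ∑ j, dbar j (g.1 j) x = 0 := h0
      simp only [he]; rw [h0']; simp
    have hdiv : WDiv D (fun y => φ y - ψ y) (fun j => (G' j : CSp n → ℂ)) e := by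
      intro θ hθ hs
      have tT : ∀ j, Tst (fun x => conj (dd j θ x) * ex (fun y => -(φ y - ψ y)/2) x) := fun j => by
        refine (hθ.dd j).conj.mul_loc hD ?_ hφ2'
        refine (closure_minimal ?_ (isClosed_tsupport (dd j θ))).trans ((dd_supp j).trans hs)
        intro x hx
        apply subset_tsupport
        intro h0; apply hx; simp [h0]
      set t : HH n := toHH (fun j => (tT j).memLp) with ht
      have htS : ∀ s ∈ S, inner ℂ s t = 0 := by
        refine (memS t).2 (wclosed_congr (fun j => ((tT j).memLp.coeFn_toLp).symm) ?_)
        intro η hη hηs j k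
        have e1 : ∀ j k x, conj (dd j θ x) * ex (fun y => -(φ y - ψ y)/2) x *
            (ex (fun y => (φ y - ψ y)/2) x * dbar k η x) = dbar k η x * dbar j (fun y => conj (θ y)) x := by
          intro j k x
          rw [dbar_conj (sm_diff hθ.1 x)]
          linear_combination conj (dd j θ x) * dbar k η x * E1 x
        simp only [e1]
        have hc := hθ.conj
        rw [integral_sub ((hη.dbar j).mul_right (dbar_sm hc.1 k)).integrable
          ((hη.dbar k).mul_right (dbar_sm hc.1 j)).integrable,
          ibp_dbar hη (dbar_sm hc.1 k), ibp_dbar hη (dbar_sm hc.1 j)]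
        simp only [dbar_dbar_comm hc.1 k j]
        ring
      have h1 := hG2 t htS
      have h2 : inner ℂ t G' = ∫ x, ∑ j, G' j x * (ex (fun y => -(φ y - ψ y) / 2) x * dd j θ x) := by
        rw [PiLp.inner_apply, integral_finsetSum]
        · refine Finset.sum_congr rfl (fun j _ => ?_)
          show inner ℂ ((tT j).memLp.toLp _) (G' j) = _
          rw [lp_inner]
          congr 1; ext x
          simp only [map_mul, Complex.conj_conj, exc]; ring
        · intro j _
          refine ((tT j).conj.memLp.integrable_mul (Lp.memLp (G' j))).congr ?_
          filter_upwards with x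
          simp only [Pi.mul_apply, map_mul, Complex.conj_conj, exc]; ring
      have h3 : inner ℂ t G = - ∫ x, e x * θ x := by
        rw [PiLp.inner_apply]
        have : ∀ j, inner ℂ (t j) (G j) = - ∫ x, conj (dbar j (g.1 j) x) * θ x := by
          intro j
          show inner ℂ ((tT j).memLp.toLp _) ((hGT j).memLp.toLp _) = _
          rw [lp_inner2]
          have h4 := ibp_dd hθ (g.2 j).1.conj.1 j
          simp only [dd_conj (sm_diff (g.2 j).1.1 _)] at h4
          have h5 : ∫ x, conj (dbar j (g.1 j) x) * θ x = ∫ x, θ x * conj (dbar j (g.1 j) x) := by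
            simp only [mul_comm]
          rw [h5, ← h4]
          congr 1; ext x
          simp only [map_mul, Complex.conj_conj, exc]
          linear_combination dd j θ x * conj (g.1 j x) * E1 x
        simp only [this]
        rw [Finset.sum_neg_distrib, ← integral_finsetSum]
        · congr 2; ext x; simp only [he, map_sum, Finset.sum_mul]
        · intro j _
          exact (((g.2 j).1.dbar j).conj.mul_right hθ.1).integrable
      rw [← h2, h1, h3]
    have hcore := core hW hC (fun j => Lp.memLp (G' j)) heT hes ((memS G').1 hG1) hdiv
    set P : HH n := toHH (fun j => (Lp.memLp (G' j)).indicator hD.measurableSet) with hP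
    have nP : ‖P‖^2 ≤ ‖A g‖^2 := by
      rw [PiLp.norm_sq_eq_of_L2]
      have a1 : ∀ j, ‖P j‖^2 = ∫ x, ‖D.indicator (G' j : CSp n → ℂ) x‖^2 := fun j =>
        lp_norm_sq ((Lp.memLp (G' j)).indicator hD.measurableSet)
      simp only [a1]
      rw [← integral_finsetSum]
      · refine hcore.trans (le_of_eq ?_)
        show _ = ‖(hAT g).memLp.toLp _‖^2
        rw [lp_norm_sq]
        congr 1; ext x
        simp only [he, norm_mul, RCLike.norm_conj]
      · intro j _
        exact int_sq ((Lp.memLp (G' j)).indicator hD.measurableSet)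
    have nP' : ‖P‖ ≤ ‖A g‖ := le_of_sq_le_sq nP (norm_nonneg _)
    have b1 : B g = inner ℂ G wv := by
      rw [PiLp.inner_apply]
      show (∑ j, ∫ x, w j x * (g.1 j x * ex (fun y => (φ y - ψ y)/2) x)) = _
      refine Finset.sum_congr rfl (fun j _ => ?_)
      show _ = inner ℂ ((hGT j).memLp.toLp _) ((hw j).toLp _)
      rw [lp_inner2]
      congr 1; ext x; simp only [Complex.conj_conj]; ring
    have b2 : inner ℂ G' wv = inner ℂ G wv := by
      rw [← inner_conj_symm, hG2 wv hwS, inner_conj_symm]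
    have b3 : inner ℂ wv P = inner ℂ wv G' := by
      rw [PiLp.inner_apply, PiLp.inner_apply]
      refine Finset.sum_congr rfl (fun j _ => ?_)
      show inner ℂ ((hw j).toLp _) (MemLp.toLp _ ((Lp.memLp (G' j)).indicator hD.measurableSet)) = inner ℂ ((hw j).toLp _) (G' j)
      rw [lp_inner2, lp_inner]
      congr 1; ext x
      by_cases hx : x ∈ D
      · simp [hx]
      · simp [hw0 j x hx]
    rw [b1, ← b2, ← inner_conj_symm, RCLike.norm_conj, ← b3]
    exact (norm_inner_le_norm _ _).trans (mul_le_mul_of_nonneg_left nP' (norm_nonneg _))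
  obtain ⟨v, hv⟩ := hilb_riesz A B ‖wv‖ est
  refine ⟨fun x => - conj (v x), ?_, ?_⟩
  · have := (Lp.memLp v).star
    refine this.neg.ae_eq ?_
    filter_upwards with x
    rfl
  · intro θ hθ hs j
    classical
    have hm : Pi.single j θ ∈ MM D := by
      intro i
      by_cases h : i = j
      · subst h; simp only [Pi.single_eq_same]; exact ⟨hθ, hs⟩
      · rw [Pi.single_eq_of_ne h]
        exact (MM D).zero_mem i
    have h := hv ⟨Pi.single j θ, hm⟩
    have hBv : B ⟨Pi.single j θ, hm⟩ = ∫ x, w j x * (ex (fun y => (φ y - ψ y)/2) x * θ x) := by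
      show ∑ i, ∫ x, w i x * ((Pi.single j θ : Fin n → CSp n → ℂ) i x * _) = _
      rw [Finset.sum_eq_single j]
      · congr 1; ext x; rw [Pi.single_eq_same]; ring
      · intro i _ hi
        simp [Pi.single_eq_of_ne hi]
      · simp
    have hAv : inner ℂ v (A ⟨Pi.single j θ, hm⟩) =
        ∫ x, conj (v x) * (ex (fun y => (φ y - 2 * ψ y)/2) x * dbar j θ x) := by
      show inner ℂ v (MemLp.toLp _ (hAT _).memLp) = _
      rw [← inner_conj_symm, lp_inner, ← integral_conj]
      congr 1; ext x
      rw [Finset.sum_eq_single j]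
      · simp only [map_mul, Complex.conj_conj, Pi.single_eq_same]; ring
      · intro i _ hi
        show dbar i ((Pi.single j θ : Fin n → CSp n → ℂ) i) x = 0
        rw [Pi.single_eq_of_ne hi]
        exact dbar_const' i 0 x
      · simp
    rw [hBv, hAv] at h
    rw [h, ← integral_neg]
    congr 1; ext x; ring

end PartA9
end

open Metric Set Filter Asymptotics
open scoped Manifold Topology
noncomputable section

section PartA10
open MeasureTheory
open scoped ContDiff ComplexConjugate ENNReal

variable {n : ℕ}

lemma sum_eB (x : CSp n) : x = ∑ j, x j • (eB j : CSp n) := by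
  ext i
  simp [eB, Pi.single_apply]

lemma holo_of_dbar {f : CSp n → ℂ} {x : CSp n} (hf : DifferentiableAt ℝ f x)
    (h : ∀ j, dbar j f x = 0) : DifferentiableAt ℂ f x := by
  rw [differentiableAt_iff_restrictScalars ℝ hf]
  set L := fderiv ℝ f x with hL
  have h1 : ∀ j, L (Complex.I • eB j) = Complex.I * L (eB j) := by
    intro j
    have := h j
    simp only [dbar, ← hL] at this
    have h2 : L (eB j) + Complex.I * L (Complex.I • eB j) = 0 := by
      simpa using this
    linear_combination (-Complex.I) * h2 + L (Complex.I • eB j) * Complex.I_sq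
  have h2 : ∀ (c : ℂ) j, L (c • eB j) = c * L (eB j) := by
    intro c j
    have e : c • (eB j : CSp n) = c.re • (eB j : CSp n) + c.im • (Complex.I • (eB j : CSp n)) := by
      conv_lhs => rw [← Complex.re_add_im c]
      rw [add_smul, mul_smul]
      rfl
    rw [e, map_add, map_smul, map_smul, h1]
    conv_rhs => rw [← Complex.re_add_im c]
    simp only [Complex.real_smul]; ring
  refine ⟨∑ j, (L (eB j)) • (EuclideanSpace.proj j : CSp n →L[ℂ] ℂ), ?_⟩
  ext v
  conv_rhs => rw [sum_eB v, map_sum]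
  simp only [h2]
  simp [mul_comm]

lemma dbar_holo {f : CSp n → ℂ} {x : CSp n} (hf : DifferentiableAt ℂ f x) (j : Fin n) :
    dbar j f x = 0 := by
  have h := (hf.hasFDerivAt.restrictScalars ℝ).fderiv
  simp only [dbar, h]
  simp only [ContinuousLinearMap.coe_restrictScalars', map_smul, smul_eq_mul]
  rw [← mul_assoc, Complex.I_mul_I]; ring

lemma mp_rot {c : ℂ} (hc : ‖c‖ = 1) : MeasurePreserving (fun x : CSp n => c • x) volume volume := by
  have hc0 : c ≠ 0 := by rintro rfl; simp at hc
  let A : CSp n ≃ₗᵢ[ℝ] CSp n := { (LinearEquiv.smulOfNeZero ℂ (CSp n) c hc0).restrictScalars ℝ with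
    norm_map' := fun x => by
      show ‖c • x‖ = ‖x‖
      rw [norm_smul, hc, one_mul] }
  exact A.measurePreserving

lemma int_rot {c : ℂ} (hc : ‖c‖ = 1) (F : CSp n → ℂ) : ∫ x, F (c • x) = ∫ x, F x := by
  have hc0 : c ≠ 0 := by rintro rfl; simp at hc
  exact (mp_rot hc).integral_comp (Homeomorph.smulOfNeZero c hc0).measurableEmbedding F

lemma mean_val {g : CSp n → ℂ} (hg : Continuous g) {x : CSp n} {r δ : ℝ}
    (hd : ∀ y ∈ ball x r, DifferentiableAt ℂ g y) (hδ : 0 < δ) (hδr : δ < r) :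
    cv (mkc δ) g x = g x := by
  have e0 : cv (mkc δ) g x = ∫ y, mkc δ y * g (x - y) := by
    rw [cv, ← integral_sub_left_eq_self _ volume x]
    simp
  have cm : ∀ θ : ℝ, ‖circleMap 0 1 θ‖ = 1 := by intro θ; simp
  have e1 : ∀ θ : ℝ, ∫ y, mkc δ y * g (x - circleMap 0 1 θ • y) = cv (mkc δ) g x := by
    intro θ
    rw [e0, ← int_rot (cm θ) (fun y => mkc δ y * g (x - y))]
    congr 1; ext y
    congr 1
    simp only [mkc, rc, mk_smul δ (cm θ)]
  have e2 : ∀ y : CSp n, ∫ θ in (0:ℝ)..2*Real.pi, mkc δ y * g (x - circleMap 0 1 θ • y)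
      = (2*Real.pi) * (mkc δ y * g x) := by
    intro y
    by_cases hy : δ ≤ ‖y‖
    · simp [mkc_zero hδ hy]
    push Not at hy
    have hdf : ∀ c ∈ closedBall (0:ℂ) 1, DifferentiableAt ℂ (fun c : ℂ => g (x - c • y)) c := by
      intro c hc
      have h3 : x - c • y ∈ ball x r := by
        rw [mem_ball, dist_eq_norm]
        have : ‖x - c • y - x‖ = ‖c‖ * ‖y‖ := by
          rw [← norm_smul, ← norm_neg]; congr 1; abel
        rw [this]
        have hc1 : ‖c‖ ≤ 1 := by simpa using hc
        nlinarith [norm_nonneg y]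
      have := hd _ h3
      exact this.comp c (by fun_prop)
    have h4 := circleAverage_of_differentiable_on_off_countable (s := ∅) (c := (0:ℂ)) (R := 1)
      (f := fun c : ℂ => g (x - c • y)) countable_empty
      (fun c hc => (hdf c (by simpa using hc)).continuousAt.continuousWithinAt)
      (fun c hc => hdf c (ball_subset_closedBall (by simpa using hc.1)))
    rw [Real.circleAverage] at h4
    rw [intervalIntegral.integral_const_mul]
    simp only [zero_smul, sub_zero] at h4
    rw [← h4]
    simp only [Complex.real_smul]
    have : (Real.pi : ℂ) ≠ 0 := by exact_mod_cast Real.pi_ne_zero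
    push_cast
    field_simp
  have hk := (mkc_Tst (n := n) hδ)
  have sw : ∫ y, ∫ θ in (0:ℝ)..2*Real.pi, mkc δ y * g (x - circleMap 0 1 θ • y)
      = ∫ θ in (0:ℝ)..2*Real.pi, ∫ y, mkc δ y * g (x - circleMap 0 1 θ • y) := by
    simp only [intervalIntegral.integral_of_le Real.two_pi_pos.le]
    apply integral_integral_swap (f := fun y θ => mkc δ y * g (x - circleMap 0 1 θ • y))
    have hc : Continuous (Function.uncurry
        (fun (y : CSp n) (θ : ℝ) => mkc δ y * g (x - circleMap 0 1 θ • y))) := by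
      have h5 : Continuous fun q : CSp n × ℝ => circleMap 0 1 q.2 :=
        (continuous_circleMap 0 1).comp continuous_snd
      refine (hk.1.continuous.comp continuous_fst).mul (hg.comp ?_)
      exact continuous_const.sub (h5.smul continuous_fst)
    have i1 : IntegrableOn (Function.uncurry
        (fun (y : CSp n) (θ : ℝ) => mkc δ y * g (x - circleMap 0 1 θ • y)))
        (closedBall 0 δ ×ˢ Icc 0 (2*Real.pi)) (volume.prod volume) :=
      hc.continuousOn.integrableOn_compact ((isCompact_closedBall 0 δ).prod isCompact_Icc)
    have i2 : IntegrableOn (Function.uncurry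
        (fun (y : CSp n) (θ : ℝ) => mkc δ y * g (x - circleMap 0 1 θ • y)))
        (univ ×ˢ Ioc 0 (2*Real.pi)) (volume.prod volume) := by
      refine i1.of_forall_sdiff_eq_zero (MeasurableSet.univ.prod measurableSet_Ioc) ?_
      rintro ⟨y, θ⟩ ⟨⟨-, h1⟩, h2⟩
      have : δ ≤ ‖y‖ := by
        by_contra hlt
        push Not at hlt
        exact h2 ⟨by simpa using hlt.le, Ioc_subset_Icc_self h1⟩
      simp [Function.uncurry, mkc_zero hδ this]
    rw [IntegrableOn, ← Measure.prod_restrict, Measure.restrict_univ] at i2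
    exact i2
  simp only [e1, e2] at sw
  rw [integral_const_mul, integral_mul_const, mkc_integral hδ, intervalIntegral.integral_const] at sw
  simp only [Complex.real_smul, sub_zero, one_mul] at sw
  have : (2 * Real.pi : ℂ) ≠ 0 := by
    simp [Real.pi_ne_zero]
  push_cast at sw
  exact (mul_left_cancel₀ this sw).symm

lemma L2To.integral_mul {F : ℕ → CSp n → ℂ} {G : CSp n → ℂ} (h : L2To F G) {k : CSp n → ℂ}
    (hk : MemLp k 2 volume) :
    Tendsto (fun m => ∫ x, k x * F m x) atTop (𝓝 (∫ x, k x * G x)) := by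
  have h1 := (Lp.tendsto_Lp_iff_tendsto_eLpNorm'' F h.1 G h.2.1).2 h.2.2
  have hk' : MemLp (fun x => conj (k x)) 2 volume := hk.star
  have h2 := (tendsto_const_nhds (x := hk'.toLp _)).inner (𝕜 := ℂ) h1
  simp only [lp_inner2, Complex.conj_conj] at h2
  exact h2

lemma weyl_local {h : CSp n → ℂ} (hh : MemLp h 2 volume) {x0 : CSp n} {r : ℝ} (hr : 0 < r)
    (hw : ∀ θ, Tst θ → tsupport θ ⊆ ball x0 (3*r) → ∀ j, ∫ x, h x * dbar j θ x = 0) :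
    ∃ U : CSp n → ℂ, DifferentiableOn ℂ U (ball x0 r) ∧ U =ᵐ[volume.restrict (ball x0 r)] h := by
  have hl : LocallyIntegrable h := hh.locallyIntegrable (by norm_num)
  set u : ℝ → CSp n → ℂ := fun ε => cv (mkc ε) h with hu
  have hsm : ∀ ε, 0 < ε → ContDiff ℝ ∞ (u ε) := fun ε hε => cv_sm (mkc_Tst hε) hl
  have hhol : ∀ ε, 0 < ε → ε < r → ∀ x ∈ ball x0 (2*r), DifferentiableAt ℂ (u ε) x := by
    intro ε hε hεr x hx
    refine holo_of_dbar (sm_diff (hsm ε hε) x) (fun j => ?_)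
    rw [hu]
    simp only
    rw [cv_dbar (mkc_Tst hε) hl, cv]
    have hT := (mkc_Tst (n := n) hε).reflect x
    have h1 := hw _ hT ?_ j
    · simp only [dbar_reflect (mkc_Tst hε).1] at h1
      rw [← neg_eq_zero, ← integral_neg, ← h1]
      congr 1; ext y; ring
    · have : tsupport (fun z => mkc ε (x - z)) ⊆ closedBall x ε := by
        apply closure_minimal _ isClosed_closedBall
        intro y hy
        by_contra hc
        apply hy
        apply mkc_zero hε
        rw [mem_closedBall, dist_comm, dist_eq_norm] at hc
        exact (not_le.1 hc).le
      refine this.trans ?_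
      intro y hy
      rw [mem_closedBall] at hy
      rw [mem_ball] at hx ⊢
      linarith [dist_triangle y x x0]
  have hmv : ∀ ε δ, 0 < ε → ε < r → 0 < δ → δ < r → ∀ x ∈ ball x0 r, cv (mkc δ) (u ε) x = u ε x := by
    intro ε δ hε hεr hδ hδr x hx
    refine mean_val (hsm ε hε).continuous (r := r) ?_ hδ hδr
    intro y hy
    apply hhol ε hε hεr
    rw [mem_ball] at *
    linarith [dist_triangle y x x0]
  set ε : ℕ → ℝ := fun k => r / (k + 2) with hε
  have hε0 : ∀ k, 0 < ε k := fun k => by simp only [hε]; positivity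
  have hε1 : ∀ k, ε k < r := fun k => by
    simp only [hε]
    rw [div_lt_iff₀ (by positivity)]
    have : (0:ℝ) ≤ k := Nat.cast_nonneg k
    nlinarith
  have hεl : Tendsto ε atTop (𝓝 0) := by
    apply Tendsto.const_div_atTop
    exact tendsto_atTop_add_const_right _ _ tendsto_natCast_atTop_atTop
  have hL := L2To.moll hh hε0 hεl
  have hlim : ∀ δ, 0 < δ → δ < r → ∀ x ∈ ball x0 r,
      Tendsto (fun k => u (ε k) x) atTop (𝓝 (u δ x)) := by
    intro δ hδ hδr x hx
    have h1 := hL.integral_mul ((mkc_Tst (n := n) hδ).reflect x).memLp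
    refine h1.congr (fun k => ?_)
    exact hmv (ε k) δ (hε0 k) (hε1 k) hδ hδr x hx
  have heq : ∀ k, ∀ x ∈ ball x0 r, u (ε k) x = u (ε 0) x := fun k x hx =>
    tendsto_nhds_unique (hlim _ (hε0 k) (hε1 k) x hx) (hlim _ (hε0 0) (hε1 0) x hx)
  refine ⟨u (ε 0), fun x hx => (hhol _ (hε0 0) (hε1 0) x
    (ball_subset_ball (by linarith) hx)).differentiableWithinAt, ?_⟩
  have h3 : eLpNorm (u (ε 0) - h) 2 (volume.restrict (ball x0 r)) = 0 := by
    have h4 : ∀ k, eLpNorm (u (ε 0) - h) 2 (volume.restrict (ball x0 r)) ≤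
        eLpNorm (u (ε k) - h) 2 volume := by
      intro k
      refine le_trans (le_of_eq ?_) (eLpNorm_mono_measure _
        (Measure.restrict_le_self (s := ball x0 r)))
      apply eLpNorm_congr_ae
      filter_upwards [ae_restrict_mem measurableSet_ball] with x hx
      simp [heq k x hx]
    exact le_antisymm (ge_of_tendsto' hL.2.2 h4) (by simp)
  rw [eLpNorm_eq_zero_iff (((hsm _ (hε0 0)).continuous.aestronglyMeasurable.sub hh.1).restrict)
    (by norm_num)] at h3
  filter_upwards [h3] with x hx
  simpa [sub_eq_zero] using hx

/-- Weyl lemma for the Cauchy--Riemann equations. -/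
lemma weyl {D : Set (CSp n)} (hD : IsOpen D) {u : CSp n → ℂ}
    (hu : ∀ x ∈ D, ∃ r > 0, MemLp ((closedBall x r).indicator u) 2 volume)
    (hw : ∀ θ, Tst θ → tsupport θ ⊆ D → ∀ j, ∫ x, u x * dbar j θ x = 0) :
    ∃ U : CSp n → ℂ, DifferentiableOn ℂ U D ∧ U =ᵐ[volume.restrict D] u := by
  have loc : ∀ x : CSp n, ∃ (r : ℝ) (V : CSp n → ℂ), x ∈ D → 0 < r ∧ ball x r ⊆ D ∧
      DifferentiableOn ℂ V (ball x r) ∧ V =ᵐ[volume.restrict (ball x r)] u := by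
    intro x
    by_cases hx : x ∈ D
    swap
    · exact ⟨0, 0, fun h => absurd h hx⟩
    obtain ⟨r, hr, hm⟩ := hu x hx
    obtain ⟨s, hs, hsD⟩ := Metric.isOpen_iff.1 hD x hx
    set t := min r s / 3 with ht
    have ht0 : 0 < t := by rw [ht]; have := lt_min hr hs; positivity
    have htr : 3 * t ≤ r := by rw [ht]; have := min_le_left r s; linarith
    have hts : 3 * t ≤ s := by rw [ht]; have := min_le_right r s; linarith
    obtain ⟨V, hV1, hV2⟩ := weyl_local hm (x0 := x) ht0 (by
      intro θ hθ hs' j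
      rw [← hw θ hθ (hs'.trans ((ball_subset_ball hts).trans hsD)) j]
      congr 1; ext y
      by_cases hy : y ∈ closedBall x r
      · rw [indicator_of_mem hy]
      · have : dbar j θ y = 0 := by
          apply image_eq_zero_of_notMem_tsupport
          intro h'
          exact hy (ball_subset_closedBall (ball_subset_ball htr (hs' (dbar_supp j h'))))
        simp [this])
    refine ⟨t, V, fun _ => ⟨ht0, (ball_subset_ball (by linarith)).trans hsD, hV1, hV2.trans ?_⟩⟩
    filter_upwards [ae_restrict_mem measurableSet_ball] with y hy
    rw [indicator_of_mem]
    exact ball_subset_closedBall (ball_subset_ball (by linarith) hy)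
  choose r V hV using loc
  have hg : ∀ x ∈ D, ∀ y ∈ ball x (r x), V y y = V x y := by
    intro x hx y hy
    obtain ⟨a1, a2, a3, a4⟩ := hV x hx
    have hyD := a2 hy
    obtain ⟨b1, b2, b3, b4⟩ := hV y hyD
    have hO : IsOpen (ball x (r x) ∩ ball y (r y)) := isOpen_ball.inter isOpen_ball
    have := Measure.eqOn_open_of_ae_eq (μ := volume) (f := V y) (g := V x)
      (U := ball x (r x) ∩ ball y (r y)) ?_ hO
      (b3.continuousOn.mono inter_subset_right) (a3.continuousOn.mono inter_subset_left)
    · exact this ⟨hy, mem_ball_self b1⟩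
    · have c1 := ae_restrict_of_ae_restrict_of_subset (inter_subset_left (t := ball y (r y))) a4
      have c2 := ae_restrict_of_ae_restrict_of_subset (inter_subset_right (s := ball x (r x))) b4
      exact Filter.EventuallyEq.trans c2 (Filter.EventuallyEq.symm c1)
  refine ⟨fun y => V y y, ?_, ?_⟩
  · intro x hx
    obtain ⟨a1, a2, a3, a4⟩ := hV x hx
    have h1 := a3.differentiableAt (isOpen_ball.mem_nhds (mem_ball_self a1))
    refine (h1.congr_of_eventuallyEq ?_).differentiableWithinAt
    filter_upwards [isOpen_ball.mem_nhds (mem_ball_self a1)] with y hy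
    exact hg x hx y hy
  · have : ∀ᵐ y, y ∈ D → V y y = u y := by
      rw [ae_iff]
      apply measure_null_of_locally_null
      intro x hx
      have hxD : x ∈ D := by
        by_contra h; exact hx (fun h' => absurd h' h)
      obtain ⟨a1, a2, a3, a4⟩ := hV x hxD
      refine ⟨{y | ¬ (y ∈ ball x (r x) → V x y = u y)} , ?_, ?_⟩
      · rw [mem_nhdsWithin]
        refine ⟨ball x (r x), isOpen_ball, mem_ball_self a1, ?_⟩
        rintro y ⟨h1, h2⟩ h3
        exact h2 (fun _ => (hg x hxD y h1).trans (h3 h1))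
      · rw [← ae_iff]
        exact (ae_restrict_iff' measurableSet_ball).1 a4
    exact (ae_restrict_iff' hD.measurableSet).2 this

end PartA10
end

open Metric Set Filter Asymptotics
open scoped Manifold Topology
noncomputable section

section PartA11
open MeasureTheory
open scoped ContDiff ComplexConjugate ENNReal

variable {n : ℕ}

lemma eta_exists : ∃ (η η' : ℝ → ℝ) (M : ℝ), ContDiff ℝ ∞ η ∧ (∀ s, HasDerivAt η (η' s) s) ∧
    (∀ s, s ≤ 1 → η s = 0) ∧ (∀ s, 2 ≤ s → η s = 1) ∧ (∀ s, η s ∈ Icc (0:ℝ) 1) ∧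
    ∀ s, (s * η' s)^2 ≤ M := by
  set η : ℝ → ℝ := fun s => Real.smoothTransition (s - 1) with hη
  have hs : ContDiff ℝ ∞ η := Real.smoothTransition.contDiff.comp (contDiff_id.sub contDiff_const)
  have hd : ∀ s, HasDerivAt η (deriv η s) s := fun s =>
    (hs.differentiable (by simp) s).hasDerivAt
  have h0 : ∀ s, s ≤ 1 → η s = 0 := fun s h => Real.smoothTransition.zero_of_nonpos (by linarith)
  have h1 : ∀ s, 2 ≤ s → η s = 1 := fun s h => Real.smoothTransition.one_of_one_le (by linarith)
  have hc : Continuous (deriv η) := hs.continuous_deriv (by simp)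
  obtain ⟨M, hM⟩ := (isCompact_Icc (a := (1:ℝ)) (b := 2)).exists_bound_of_continuousOn
    (f := fun s => (s * deriv η s)^2) (by fun_prop)
  refine ⟨η, deriv η, max M 0, hs, hd, h0, h1, fun s => ⟨Real.smoothTransition.nonneg _,
    Real.smoothTransition.le_one _⟩, ?_⟩
  intro s
  by_cases hs1 : s < 1
  · have : deriv η s = 0 := by
      have : η =ᶠ[𝓝 s] fun _ => 0 := by
        filter_upwards [Iio_mem_nhds hs1] with y hy using h0 y (le_of_lt hy)
      rw [this.deriv_eq]; simp
    simp [this]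
  by_cases hs2 : 2 < s
  · have : deriv η s = 0 := by
      have : η =ᶠ[𝓝 s] fun _ => 1 := by
        filter_upwards [Ioi_mem_nhds hs2] with y hy using h1 y (le_of_lt hy)
      rw [this.deriv_eq]; simp
    simp [this]
  · push Not at hs1 hs2
    exact ((le_abs_self _).trans (hM s ⟨hs1, hs2⟩)).trans (le_max_left _ _)

lemma rc_one_sub (r : CSp n → ℝ) (y : CSp n) : (1:ℂ) - rc r y = ((1 - r y : ℝ) : ℂ) := by
  simp [rc]

lemma sm_diff_r {f : CSp n → ℝ} (hf : ContDiff ℝ ∞ f) (x : CSp n) : DifferentiableAt ℝ f x :=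
  (hf.differentiable (by simp)) x

set_option maxHeartbeats 1000000 in
lemma wts_of_exh {r : CSp n → ℝ} (hr : ContDiff ℝ ∞ r) {V D : Set (CSp n)} (hV : IsOpen V)
    (hL : IsCompact {z ∈ V | r z ≤ 1}) (hD : D = {z ∈ V | r z < 1}) {ε0 : ℝ} (hε0 : 0 < ε0)
    (hlev : ∀ x ∈ D, ∀ t : Fin n → ℂ, ε0 * ∑ j, ‖t j‖^2 ≤ levi r t x) :
    ∃ (φ ψ : CSp n → ℝ) (χ : ℕ → CSp n → ℝ) (m : ℝ), Wts D φ ψ ∧ Cut D ψ χ ∧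
      ∀ x ∈ D, m ≤ φ x - ψ x := by
  obtain ⟨η, η', M, hη, hη', η0, η1, ηr, hM⟩ := eta_exists
  have hM0 : 0 ≤ M := (sq_nonneg _).trans (hM 0)
  have hDo : IsOpen D := by
    rw [hD]; exact hV.inter (isOpen_lt hr.continuous continuous_const)
  have hDV : D ⊆ V := by rw [hD]; exact fun x hx => hx.1
  have hD1 : ∀ x ∈ D, r x < 1 := by rw [hD]; exact fun x hx => hx.2
  have hDL : D ⊆ {z ∈ V | r z ≤ 1} := fun x hx => ⟨hDV hx, (hD1 x hx).le⟩
  have hcr : ContDiff ℝ ∞ (rc r) := rc_sm hr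
  obtain ⟨B0, hB0⟩ := hL.exists_bound_of_continuousOn (f := fun x => ∑ j, ‖dd j (rc r) x‖^2)
    (by
      apply Continuous.continuousOn
      exact continuous_finsetSum _ (fun j _ => ((dd_sm hcr j).continuous.norm.pow 2)))
  set B := max B0 0 with hB
  have hBn : 0 ≤ B := le_max_right _ _
  have hBb : ∀ x ∈ D, ∑ j, ‖dd j (rc r) x‖^2 ≤ B := fun x hx =>
    ((le_abs_self _).trans (hB0 x (hDL hx))).trans (le_max_left _ _)
  obtain ⟨κ, κs, κc, κt, κ1, κr⟩ := exists_cutoff hL hV (fun x hx => hx.1)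
  set C := M * B + 1 with hC
  have hC0 : 0 < C := by positivity
  set A := 2 * (4 * B + C) / ε0 with hA
  have hA0 : 0 < A := by positivity
  set φ : CSp n → ℝ := fun x => A / (1 - r x) with hφ
  set ψ : CSp n → ℝ := fun x => Real.log C - 2 * Real.log (1 - r x) with hψ
  set χ : ℕ → CSp n → ℝ := fun ν x => κ x * η ((ν + 1) * (1 - r x)) with hχ
  have expψ : ∀ x ∈ D, Real.exp (ψ x) = C / (1 - r x)^2 := by
    intro x hx
    have h1 : 0 < 1 - r x := by linarith [hD1 x hx]
    simp only [hψ]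
    rw [Real.exp_sub, Real.exp_log hC0, two_mul, Real.exp_add, Real.exp_log h1]
    ring
  have near : ∀ x ∈ D, ∀ᶠ y in 𝓝 x, y ∈ D := fun x hx => hDo.mem_nhds hx
  have ne1 : ∀ x ∈ D, (1:ℂ) - rc r x ≠ 0 := by
    intro x hx
    rw [rc_one_sub]
    have : 1 - r x ≠ 0 := by linarith [hD1 x hx]
    exact_mod_cast this
  have ddψ : ∀ x ∈ D, ∀ j, dd j (rc ψ) x = 2 / (1 - rc r x) * dd j (rc r) x := by
    intro x hx j
    have h1 : 0 < 1 - r x := by linarith [hD1 x hx]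
    have e : rc ψ =ᶠ[𝓝 x] fun y => ((Real.log C : ℝ):ℂ) - 2 * Complex.log (1 - rc r y) := by
      filter_upwards [near x hx] with y hy
      have h2 : 0 < 1 - r y := by linarith [hD1 y hy]
      rw [rc_one_sub, ← Complex.ofReal_log h2.le]
      simp [rc, hψ]
    rw [dd_congr e]
    refine dd_comp (g := fun z => ((Real.log C : ℝ):ℂ) - 2 * Complex.log (1 - z)) (sm_diff hcr x) ?_ j
    have hs : (1:ℂ) - rc r x ∈ Complex.slitPlane := by
      rw [rc_one_sub]; exact Complex.ofReal_mem_slitPlane.2 h1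
    have h3 := (((hasDerivAt_id (rc r x)).const_sub 1).clog hs).const_mul 2
    have h4 := h3.const_sub ((Real.log C : ℝ):ℂ)
    refine h4.congr_deriv ?_
    simp [neg_div]; ring
  have ddφ : ∀ x ∈ D, ∀ j, dd j (rc φ) x = A / (1 - rc r x)^2 * dd j (rc r) x := by
    intro x hx j
    have e : rc φ =ᶠ[𝓝 x] fun y => (A:ℂ) * (1 - rc r y)⁻¹ := by
      filter_upwards with y
      simp [rc, hφ, div_eq_mul_inv]
    rw [dd_congr e]
    refine dd_comp (g := fun z => (A:ℂ) * (1 - z)⁻¹) (sm_diff hcr x) ?_ j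
    have h3 := (((hasDerivAt_id (rc r x)).const_sub 1).inv (ne1 x hx)).const_mul (A:ℂ)
    refine h3.congr_deriv ?_
    simp [div_eq_mul_inv]
  have ddbφ : ∀ x ∈ D, ∀ j k, dbar k (dd j (rc φ)) x =
      A / (1 - rc r x)^2 * dbar k (dd j (rc r)) x +
      2 * A / (1 - rc r x)^3 * conj (dd k (rc r) x) * dd j (rc r) x := by
    intro x hx j k
    have e : dd j (rc φ) =ᶠ[𝓝 x] fun y => ((A:ℂ) * ((1 - rc r y)^2)⁻¹) * dd j (rc r) y := by
      filter_upwards [near x hx] with y hy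
      rw [ddφ y hy, div_eq_mul_inv]
    have hg : HasDerivAt (fun z : ℂ => (A:ℂ) * ((1 - z)^2)⁻¹) (2 * A / (1 - rc r x)^3) (rc r x) := by
      have h3 := ((((hasDerivAt_id (rc r x)).const_sub 1).pow 2).inv
        (pow_ne_zero 2 (ne1 x hx))).const_mul (A:ℂ)
      refine h3.congr_deriv ?_
      have := ne1 x hx
      simp
      field_simp
    have hc := dbar_comp (sm_diff hcr x) hg k
    have hdf : DifferentiableAt ℝ (fun y => (A:ℂ) * ((1 - rc r y)^2)⁻¹) x :=
      DifferentiableAt.comp x (g := fun z : ℂ => (A:ℂ) * ((1 - z)^2)⁻¹) (hg.differentiableAt.restrictScalars ℝ) (sm_diff hcr x)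
    rw [dbar_congr e, dbar_mul hdf (sm_diff (dd_sm hcr j) x), hc, dbar_rc (sm_diff_r hr x)]
    rw [div_eq_mul_inv]; ring
  have levφ : ∀ x ∈ D, ∀ t : Fin n → ℂ, A / (1 - r x)^2 * levi r t x ≤ levi φ t x := by
    intro x hx t
    have h1 : 0 < 1 - r x := by linarith [hD1 x hx]
    have e : ∑ j, ∑ k, dbar k (dd j (rc φ)) x * t j * conj (t k) =
        ((A / (1 - r x)^2 : ℝ) : ℂ) * ∑ j, ∑ k, dbar k (dd j (rc r)) x * t j * conj (t k) +
        ((2 * A / (1 - r x)^3 * ‖∑ j, dd j (rc r) x * t j‖^2 : ℝ) : ℂ) := by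
      have e2 : ((‖∑ j, dd j (rc r) x * t j‖^2 : ℝ) : ℂ) =
          ∑ j, ∑ k, (dd j (rc r) x * t j) * conj (dd k (rc r) x * t k) := by
        rw [← Finset.sum_mul_sum, ← map_sum, Complex.mul_conj, Complex.normSq_eq_norm_sq]
      rw [Complex.ofReal_mul, e2, Finset.mul_sum, Finset.mul_sum, ← Finset.sum_add_distrib]
      refine Finset.sum_congr rfl (fun j _ => ?_)
      rw [Finset.mul_sum, Finset.mul_sum, ← Finset.sum_add_distrib]
      refine Finset.sum_congr rfl (fun k _ => ?_)
      rw [ddbφ x hx j k, rc_one_sub]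
      push_cast
      simp only [map_mul]
      ring
    rw [levi, levi, e, Complex.add_re, Complex.re_ofReal_mul, Complex.ofReal_re]
    have : 0 ≤ 2 * A / (1 - r x)^3 * ‖∑ j, dd j (rc r) x * t j‖^2 := by positivity
    linarith
  refine ⟨φ, ψ, χ, 2 - 2 * Real.log (2 / A) - Real.log C, ⟨hDo, ?_, ?_, ?_⟩, ⟨?_, ?_, ?_, ?_, ?_, ?_⟩, ?_⟩
  · exact contDiffOn_const.div (contDiffOn_const.sub hr.contDiffOn)
      (fun x hx => by linarith [hD1 x hx])
  · exact contDiffOn_const.sub (contDiffOn_const.mul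
      ((contDiffOn_const.sub hr.contDiffOn).log (fun x hx => by linarith [hD1 x hx])))
  · intro x hx t
    have h1 : 0 < 1 - r x := by linarith [hD1 x hx]
    refine le_trans ?_ (levφ x hx t)
    have h2 := hlev x hx t
    rw [expψ x hx]
    have h3 : ∑ j, ‖dd j (rc ψ) x‖^2 = 4 / (1 - r x)^2 * ∑ j, ‖dd j (rc r) x‖^2 := by
      rw [Finset.mul_sum]
      refine Finset.sum_congr rfl (fun j _ => ?_)
      rw [ddψ x hx, rc_one_sub, norm_mul, norm_div, Complex.norm_real, Real.norm_of_nonneg h1.le]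
      rw [mul_pow, div_pow]; norm_num
    rw [h3]
    have h4 : A / (1 - r x)^2 * (ε0 * ∑ j, ‖t j‖^2) ≤ A / (1 - r x)^2 * levi r t x :=
      mul_le_mul_of_nonneg_left h2 (by positivity)
    refine le_trans ?_ h4
    have h5 : A * ε0 = 2 * (4 * B + C) := by rw [hA]; field_simp
    have h6 : 2 * (4 / (1 - r x)^2 * ∑ j, ‖dd j (rc r) x‖^2 + C / (1 - r x)^2) ≤ A * ε0 / (1 - r x)^2 := by
      rw [h5]
      have h7 := hBb x hx
      have : 4 / (1 - r x)^2 * ∑ j, ‖dd j (rc r) x‖^2 ≤ 4 / (1 - r x)^2 * B :=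
        mul_le_mul_of_nonneg_left h7 (by positivity)
      calc _ ≤ 2 * (4 / (1 - r x)^2 * B + C / (1 - r x)^2) := by linarith
        _ = _ := by ring
    have h8 : 0 ≤ ∑ j, ‖t j‖^2 := by positivity
    calc _ ≤ A * ε0 / (1 - r x)^2 * ∑ j, ‖t j‖^2 := mul_le_mul_of_nonneg_right h6 h8
      _ = _ := by ring
  · intro ν
    exact κs.mul (hη.comp (contDiff_const.mul (contDiff_const.sub hr)))
  · intro ν
    exact κc.mul_right
  · intro ν
    have h1 : tsupport (χ ν) ⊆ tsupport κ ∩ {x | 1 ≤ (ν+1) * (1 - r x)} := by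
      apply closure_minimal
      · intro x hx
        refine ⟨subset_tsupport _ (fun h => hx (by simp [hχ, h])), ?_⟩
        by_contra h
        apply hx
        have h' : ¬ (1 ≤ ((ν:ℝ)+1) * (1 - r x)) := h
        simp only [hχ]
        rw [η0 _ (not_le.1 h').le, mul_zero]
      · exact (isClosed_tsupport _).inter (isClosed_le continuous_const
          (continuous_const.mul (continuous_const.sub hr.continuous)))
    intro x hx
    obtain ⟨h2, h3⟩ := h1 hx
    rw [hD]
    refine ⟨κt h2, ?_⟩
    have h3' : 1 ≤ ((ν:ℝ)+1) * (1 - r x) := h3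
    by_contra h4
    push Not at h4
    have : (0:ℝ) ≤ ν := Nat.cast_nonneg ν
    nlinarith
  · intro ν x
    have h1 := κr x
    have h2 := ηr (((ν:ℝ)+1) * (1 - r x))
    exact ⟨mul_nonneg h1.1 h2.1, mul_le_one₀ h1.2 h2.1 h2.2⟩
  · intro ν x hx
    have h1 : 0 < 1 - r x := by linarith [hD1 x hx]
    rw [expψ x hx]
    set s : ℝ := ((ν:ℝ)+1) * (1 - r x) with hs
    have e : ∀ j, dd j (rc (χ ν)) x = ((-(ν+1) * η' s : ℝ) : ℂ) * dd j (rc r) x := by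
      intro j
      have hκx : ∀ᶠ y in 𝓝 x, κ y = 1 := (eventually_nhdsSet_iff_forall.1 κ1) x (hDL hx)
      have e1 : rc (χ ν) =ᶠ[𝓝 x] rc (fun y => η (((ν:ℝ)+1) * (1 - r y))) := by
        filter_upwards [hκx] with y hy
        simp [rc, hχ, hy]
      rw [dd_congr e1]
      have hF : HasFDerivAt (fun y => η (((ν:ℝ)+1) * (1 - r y)))
          ((-(ν+1) * η' s) • fderiv ℝ r x) x := by
        have a1 := ((sm_diff_r hr x).hasFDerivAt.const_sub 1).const_mul ((ν:ℝ)+1)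
        have a2 := (hη' s).comp_hasFDerivAt x a1
        have a3 : (-((ν:ℝ)+1) * η' s) • fderiv ℝ r x = η' s • (((ν:ℝ)+1) • -fderiv ℝ r x) := by
          module
        rw [a3]
        exact a2
      have hF2 : fderiv ℝ (rc (fun y => η (((ν:ℝ)+1) * (1 - r y)))) x =
          Complex.ofRealCLM.comp ((-(ν+1) * η' s) • fderiv ℝ r x) :=
        (Complex.ofRealCLM.hasFDerivAt.comp x hF).fderiv
      have hF3 : fderiv ℝ (rc r) x = Complex.ofRealCLM.comp (fderiv ℝ r x) :=
        (Complex.ofRealCLM.hasFDerivAt.comp x (sm_diff_r hr x).hasFDerivAt).fderiv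
      simp only [dd, hF2, hF3]
      simp
      ring
    have e2 : ∑ j, ‖dd j (rc (χ ν)) x‖^2 = (s * η' s)^2 / (1 - r x)^2 * ∑ j, ‖dd j (rc r) x‖^2 := by
      rw [Finset.mul_sum]
      refine Finset.sum_congr rfl (fun j _ => ?_)
      rw [e j, norm_mul, Complex.norm_real, mul_pow, Real.norm_eq_abs, sq_abs, hs]
      congr 1
      field_simp
    rw [e2]
    have h9 : (s * η' s)^2 / (1 - r x)^2 * ∑ j, ‖dd j (rc r) x‖^2 ≤ M / (1 - r x)^2 * B := by
      apply mul_le_mul _ (hBb x hx) (by positivity) (by positivity)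
      exact div_le_div_of_nonneg_right (hM s) (by positivity)
    refine h9.trans ?_
    rw [div_mul_eq_mul_div]
    apply div_le_div_of_nonneg_right _ (by positivity)
    rw [hC]; linarith
  · intro x hx
    have h1 : 0 < 1 - r x := by linarith [hD1 x hx]
    have hκx : ∀ᶠ y in 𝓝 x, κ y = 1 := (eventually_nhdsSet_iff_forall.1 κ1) x (hDL hx)
    have h2 : ∀ᶠ y in 𝓝 x, (1 - r x)/2 < 1 - r y := by
      have : ContinuousAt (fun y => 1 - r y) x := (continuous_const.sub hr.continuous).continuousAt
      exact this.eventually (lt_mem_nhds (by linarith))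
    obtain ⟨N, hN⟩ := exists_nat_gt (4 / (1 - r x))
    filter_upwards [eventually_ge_atTop N] with ν hν
    filter_upwards [hκx, h2] with y hy1 hy2
    simp only [hχ, hy1, one_mul]
    apply η1
    have h3 : (N:ℝ) ≤ ν := by exact_mod_cast hν
    have h4 : 4 / (1 - r x) < (ν:ℝ) + 1 := by linarith
    rw [div_lt_iff₀ h1] at h4
    have : (0:ℝ) ≤ ν := Nat.cast_nonneg ν
    nlinarith
  · intro x hx
    have h1 : 0 < 1 - r x := by linarith [hD1 x hx]
    simp only [hφ, hψ]
    have h2 : Real.log (A / (2 * (1 - r x))) ≤ A / (2 * (1 - r x)) - 1 :=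
      Real.log_le_sub_one_of_pos (by positivity)
    have h3 : Real.log (A / (2 * (1 - r x))) = - Real.log (2 / A) - Real.log (1 - r x) := by
      rw [← Real.log_inv, ← Real.log_div (by positivity) (by positivity)]
      congr 1; field_simp
    have h4 : A / (1 - r x) = 2 * (A / (2 * (1 - r x))) := by field_simp
    rw [h4]
    linarith

end PartA11
end

open Metric Set Filter Asymptotics
open scoped Manifold Topology
noncomputable section

section PartA12
open MeasureTheory
open scoped ContDiff ComplexConjugate ENNReal

variable {n : ℕ}

/-- Holomorphic functions of several variables are smooth. -/
lemma holo_sm {V : Set (CSp n)} (hV : IsOpen V) {g : CSp n → ℂ} (hg : DifferentiableOn ℂ g V) :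
    ContDiffOn ℝ ∞ g V := by
  intro x hx
  obtain ⟨s, hs, hsV⟩ := Metric.isOpen_iff.1 hV x hx
  obtain ⟨κ, κs, κc, κt, κ1, κr⟩ := exists_cutoff (isCompact_closedBall x (s/2)) hV
    ((closedBall_subset_ball (by linarith)).trans hsV)
  set G : CSp n → ℂ := fun y => (κ y : ℂ) * g y with hG
  have hGc : Continuous G := by
    rw [continuous_iff_continuousAt]
    intro y
    by_cases hy : y ∈ tsupport κ
    · exact (Complex.continuous_ofReal.comp κs.continuous).continuousAt.mul
        ((hg.differentiableAt (hV.mem_nhds (κt hy))).continuousAt)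
    · have h0 := notMem_tsupport_iff_eventuallyEq.1 hy
      have : G =ᶠ[𝓝 y] fun _ => 0 := by
        filter_upwards [h0] with z hz
        simp [hG, hz]
      exact continuousAt_const.congr this.symm
  have hGd : ∀ y ∈ closedBall x (s/2), G =ᶠ[𝓝 y] g := by
    intro y hy
    filter_upwards [(eventually_nhdsSet_iff_forall.1 κ1) y hy] with z hz
    simp [hG, hz]
  have hmv : ∀ y ∈ ball x (s/4), cv (mkc (s/8)) G y = g y := by
    intro y hy
    rw [mean_val hGc (r := s/4) _ (by linarith) (by linarith),
      (hGd y (ball_subset_closedBall (ball_subset_ball (by linarith) hy))).eq_of_nhds]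
    intro z hz
    have hz' : z ∈ closedBall x (s/2) := by
      rw [mem_ball] at hz hy
      rw [mem_closedBall]
      linarith [dist_triangle z y x]
    refine DifferentiableAt.congr_of_eventuallyEq ?_ (hGd z hz')
    exact hg.differentiableAt (hV.mem_nhds (hsV (closedBall_subset_ball (by linarith) hz')))
  have h1 : ContDiff ℝ ∞ (cv (mkc (s/8)) G) := cv_sm (mkc_Tst (by linarith)) hGc.locallyIntegrable
  refine (h1.contDiffAt.congr_of_eventuallyEq ?_).contDiffWithinAt
  filter_upwards [isOpen_ball.mem_nhds (mem_ball_self (by linarith : 0 < s/4))] with y hy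
  exact (hmv y hy).symm

lemma levi_add {f g : CSp n → ℝ} (hf : ContDiff ℝ ∞ f) (hg : ContDiff ℝ ∞ g) (t : Fin n → ℂ)
    (x : CSp n) : levi (fun y => f y + g y) t x = levi f t x + levi g t x := by
  have e : rc (fun y => f y + g y) = fun y => rc f y + rc g y := by ext y; simp [rc]
  have e1 : ∀ j, dd j (rc (fun y => f y + g y)) = fun y => dd j (rc f) y + dd j (rc g) y := by
    intro j; ext y
    rw [e, dd_add (sm_diff (rc_sm hf) y) (sm_diff (rc_sm hg) y)]
  have e2 : ∀ j k, dbar k (dd j (rc (fun y => f y + g y))) x =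
      dbar k (dd j (rc f)) x + dbar k (dd j (rc g)) x := by
    intro j k
    rw [e1, dbar_add (sm_diff (dd_sm (rc_sm hf) j) x) (sm_diff (dd_sm (rc_sm hg) j) x)]
  simp only [levi, e2, add_mul, Finset.sum_add_distrib, Complex.add_re]

lemma levi_zero (t : Fin n → ℂ) (x : CSp n) : levi (fun _ => 0) t x = 0 := by
  have e : (rc (fun _ : CSp n => (0:ℝ))) = fun _ => 0 := by ext y; simp [rc]
  have e1 : ∀ j, dd j (rc (fun _ : CSp n => (0:ℝ))) = fun _ => 0 := by
    intro j; ext y; rw [e]; exact dd_const' j 0 y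
  simp only [levi, e1, dbar_const']
  simp

lemma levi_sum {ι : Type*} (s : Finset ι) {f : ι → CSp n → ℝ} (hf : ∀ i, ContDiff ℝ ∞ (f i))
    (t : Fin n → ℂ) (x : CSp n) :
    levi (fun y => ∑ i ∈ s, f i y) t x = ∑ i ∈ s, levi (f i) t x := by
  classical
  induction s using Finset.induction_on with
  | empty => simpa using levi_zero t x
  | insert a s ha ih =>
    rw [Finset.sum_insert ha, ← ih, ← levi_add (hf a) (ContDiff.sum (fun i _ => hf i))]
    congr 1; ext y; rw [Finset.sum_insert ha]

lemma levi_sq {F : CSp n → ℂ} (hF : ContDiff ℝ ∞ F) {x : CSp n}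
    (hx : ∀ᶠ y in 𝓝 x, DifferentiableAt ℂ F y) (t : Fin n → ℂ) :
    levi (fun y => ‖F y‖^2) t x = ‖∑ j, dd j F x * t j‖^2 := by
  have hc := sm_conj hF
  have e0 : rc (fun y => ‖F y‖^2) = fun y => F y * conj (F y) := by
    ext y; simp [rc, Complex.mul_conj, Complex.normSq_eq_norm_sq]
  have e1 : ∀ j, dd j (rc (fun y => ‖F y‖^2)) =ᶠ[𝓝 x] fun y => dd j F y * conj (F y) := by
    intro j
    filter_upwards [hx] with y hy
    rw [e0, dd_mul (sm_diff hF y) (sm_diff hc y), dd_conj (sm_diff hF y), dbar_holo hy]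
    simp
  have e2 : ∀ j k, dbar k (dd j (rc (fun y => ‖F y‖^2))) x = dd j F x * conj (dd k F x) := by
    intro j k
    have h0 : dbar k (dd j F) x = 0 := by
      rw [dbar_dd_comm hF]
      have : dbar k F =ᶠ[𝓝 x] fun _ => 0 := by
        filter_upwards [hx] with y hy using dbar_holo hy k
      rw [dd_congr this]
      exact dd_const' j 0 x
    rw [dbar_congr (e1 j), dbar_mul (sm_diff (dd_sm hF j) x) (sm_diff hc x), h0,
      dbar_conj (sm_diff hF x)]
    simp
  have e3 : ((‖∑ j, dd j F x * t j‖^2 : ℝ) : ℂ) =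
      ∑ j, ∑ k, (dd j F x * t j) * conj (dd k F x * t k) := by
    rw [← Finset.sum_mul_sum, ← map_sum, Complex.mul_conj, Complex.normSq_eq_norm_sq]
  rw [levi, ← Complex.ofReal_re (‖∑ j, dd j F x * t j‖^2), e3]
  congr 1
  refine Finset.sum_congr rfl (fun j _ => Finset.sum_congr rfl (fun k _ => ?_))
  rw [e2, map_mul]; ring

lemma dd_holo {f : CSp n → ℂ} {x : CSp n} (hf : DifferentiableAt ℂ f x) (j : Fin n) :
    dd j f x = fderiv ℂ f x (eB j) := by
  have h := (hf.hasFDerivAt.restrictScalars ℝ).fderiv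
  simp only [dd, h]
  simp only [ContinuousLinearMap.coe_restrictScalars', map_smul, smul_eq_mul]
  rw [← mul_assoc, Complex.I_mul_I]; ring

lemma norm_sq_sm {F : CSp n → ℂ} (hF : ContDiff ℝ ∞ F) : ContDiff ℝ ∞ (fun y => ‖F y‖^2) :=
  hF.norm_sq ℝ

theorem stein_exh {V K : Set (CSp n)} (hV : IsSteinOpen V) (hK : IsCompact K) (hKV : K ⊆ V) :
    ∃ (D : Set (CSp n)) (φ ψ : CSp n → ℝ) (χ : ℕ → CSp n → ℝ) (m : ℝ), K ⊆ D ∧ D ⊆ V ∧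
      Wts D φ ψ ∧ Cut D ψ χ ∧ ∀ x ∈ D, m ≤ φ x - ψ x := by
  obtain ⟨hVo, hVh⟩ := hV
  have hH := hVh K hKV hK
  set H := {z ∈ V | ∀ g : CSp n → ℂ, DifferentiableOn ℂ g V →
      ‖g z‖ ≤ sSup ((fun w => ‖g w‖) '' K)} with hHdef
  have hle : ∀ g : CSp n → ℂ, DifferentiableOn ℂ g V → ∀ w ∈ K,
      ‖g w‖ ≤ sSup ((fun w => ‖g w‖) '' K) := by
    intro g hg w hw
    apply le_csSup _ (mem_image_of_mem _ hw)
    exact (hK.image_of_continuousOn (hg.continuousOn.mono hKV).norm).bddAbove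
  have hKH : K ⊆ H := fun w hw => ⟨hKV hw, fun g hg => hle g hg w hw⟩
  obtain ⟨L, hL, hHL, hLV⟩ := exists_compact_between hH hVo (fun x hx => hx.1)
  set S := L \ interior L with hS
  have hSc : IsCompact S := hL.diff isOpen_interior
  -- functions
  have hex : ∀ z ∈ S, ∃ g : CSp n → ℂ, DifferentiableOn ℂ g V ∧ 1 < ‖g z‖ ∧ ∀ w ∈ K, ‖g w‖ < 1 := by
    intro z hz
    have hzH : z ∉ H := fun h => hz.2 (hHL h)
    have : ∃ g : CSp n → ℂ, DifferentiableOn ℂ g V ∧ sSup ((fun w => ‖g w‖) '' K) < ‖g z‖ := by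
      by_contra hc
      push Not at hc
      exact hzH ⟨hLV hz.1, hc⟩
    obtain ⟨g, hg, hgz⟩ := this
    obtain ⟨c, hc1, hc2⟩ := exists_between hgz
    have hc0 : 0 < c := lt_of_le_of_lt (Real.sSup_nonneg (by rintro _ ⟨w, _, rfl⟩; exact norm_nonneg _)) hc1
    refine ⟨fun y => g y / c, by simpa only [div_eq_mul_inv] using hg.mul_const _, ?_, ?_⟩
    · rw [norm_div, Complex.norm_real, Real.norm_of_nonneg hc0.le, one_lt_div hc0]; exact hc2
    · intro w hw
      rw [norm_div, Complex.norm_real, Real.norm_of_nonneg hc0.le, div_lt_one hc0]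
      exact (hle g hg w hw).trans_lt hc1
  choose! g hg1 hg2 hg3 using hex
  obtain ⟨T, hTS, hTc⟩ := hSc.elim_nhds_subcover (fun z => {y | y ∈ V ∧ 1 < ‖g z y‖}) (by
    intro z hz
    have hzV := hLV hz.1
    have h1 := ((hg1 z hz).differentiableAt (hVo.mem_nhds hzV)).continuousAt.norm
    filter_upwards [hVo.mem_nhds hzV, h1.eventually (lt_mem_nhds (hg2 z hz))] with y hy1 hy2
    exact ⟨hy1, hy2⟩)
  -- power
  have hpow : ∃ N : ℕ, 1 ≤ N ∧ ∀ w ∈ K, ∑ z ∈ T, ‖(g z w)^N‖^2 < 1/2 := by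
    by_cases hKe : K.Nonempty
    swap
    · rw [not_nonempty_iff_eq_empty] at hKe
      exact ⟨1, le_rfl, by simp [hKe]⟩
    have hq : ∃ q : ℝ, 0 ≤ q ∧ q < 1 ∧ ∀ z ∈ T, ∀ w ∈ K, ‖g z w‖ ≤ q := by
      have : ∀ z ∈ T, ∃ q : ℝ, 0 ≤ q ∧ q < 1 ∧ ∀ w ∈ K, ‖g z w‖ ≤ q := by
        intro z hz
        obtain ⟨w0, hw0, hm⟩ := hK.exists_isMaxOn hKe
          ((hg1 z (hTS z hz)).continuousOn.mono hKV).norm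
        exact ⟨‖g z w0‖, norm_nonneg _, hg3 z (hTS z hz) w0 hw0, fun w hw => hm hw⟩
      choose! q hq0 hq1 hq2 using this
      by_cases hT : T.Nonempty
      · refine ⟨T.sup' hT q, ?_, ?_, ?_⟩
        · obtain ⟨z, hz⟩ := hT
          exact (hq0 z hz).trans (Finset.le_sup' q hz)
        · rw [Finset.sup'_lt_iff]; exact hq1
        · intro z hz w hw
          exact (hq2 z hz w hw).trans (Finset.le_sup' q hz)
      · rw [Finset.not_nonempty_iff_eq_empty] at hT
        exact ⟨0, le_rfl, one_pos, by simp [hT]⟩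
    obtain ⟨q, hq0, hq1, hq2⟩ := hq
    have hl : Tendsto (fun N : ℕ => (T.card : ℝ) * (q^2)^N) atTop (𝓝 (T.card * 0)) :=
      (tendsto_pow_atTop_nhds_zero_of_lt_one (by positivity) (by nlinarith)).const_mul _
    rw [mul_zero] at hl
    obtain ⟨N, hN1, hN2⟩ := ((eventually_ge_atTop 1).and
      (hl.eventually (gt_mem_nhds (by norm_num : (0:ℝ) < 1/2)))).exists
    refine ⟨N, hN1, fun w hw => lt_of_le_of_lt ?_ hN2⟩
    rw [← nsmul_eq_mul]
    apply Finset.sum_le_card_nsmul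
    intro z hz
    rw [norm_pow, ← pow_mul, mul_comm, pow_mul]
    exact pow_le_pow_left₀ (by positivity) (pow_le_pow_left₀ (norm_nonneg _) (hq2 z hz w hw) 2) N
  obtain ⟨N, hN1, hN⟩ := hpow
  obtain ⟨R, hR⟩ := hK.isBounded.exists_norm_le
  set ε0 : ℝ := 1 / (2 * (R^2 + 1)) with hε0
  have hεp0 : 0 < ε0 := by positivity
  obtain ⟨κ, κs, κc, κt, κ1, κr⟩ := exists_cutoff hL hVo hLV
  set F : CSp n → CSp n → ℂ := fun z y => if z ∈ T then (κ y : ℂ) * (g z y)^N else 0 with hF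
  have hFs : ∀ z, ContDiff ℝ ∞ (F z) := by
    intro z
    simp only [hF]
    by_cases hz : z ∈ T
    · simp only [hz, if_true]
      exact sm_mul_localC hVo (rc_sm κs) (by
        refine (closure_minimal ?_ (isClosed_tsupport _)).trans κt
        intro x hx; apply subset_tsupport; intro h; apply hx; simp [rc, h])
        ((holo_sm hVo (hg1 z (hTS z hz))).pow N)
    · simp only [hz, if_false]; exact contDiff_const
  have hκL : ∀ x ∈ L, ∀ᶠ y in 𝓝 x, κ y = 1 := fun x hx => (eventually_nhdsSet_iff_forall.1 κ1) x hx
  have hFh : ∀ z, ∀ x ∈ L, ∀ᶠ y in 𝓝 x, DifferentiableAt ℂ (F z) y := by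
    intro z x hx
    by_cases hz : z ∈ T
    · filter_upwards [(hκL x hx).eventually_nhds, hVo.mem_nhds (hLV hx)] with y hy hyV
      have e : F z =ᶠ[𝓝 y] fun y => (g z y)^N := by
        filter_upwards [hy] with w hw
        simp [hF, hz, hw]
      exact (((hg1 z (hTS z hz)).differentiableAt (hVo.mem_nhds hyV)).pow N).congr_of_eventuallyEq e
    · filter_upwards with y
      simp only [hF, hz, if_false]; exact differentiableAt_const _
  set r : CSp n → ℝ := fun y => (∑ j : Fin n, ‖((Real.sqrt ε0 : ℝ):ℂ) * y j‖^2) + ∑ z ∈ T, ‖F z y‖^2 with hr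
  have hcs : ∀ j : Fin n, ContDiff ℝ ∞ (fun y : CSp n => ((Real.sqrt ε0 : ℝ):ℂ) * y j) := by
    intro j
    exact contDiff_const.mul ((EuclideanSpace.proj j : CSp n →L[ℂ] ℂ).restrictScalars ℝ).contDiff
  have s1 : ContDiff ℝ ∞ (fun y : CSp n => ∑ j : Fin n, ‖((Real.sqrt ε0 : ℝ):ℂ) * y j‖^2) :=
    ContDiff.sum (fun j _ => norm_sq_sm (hcs j))
  have s2 : ContDiff ℝ ∞ (fun y : CSp n => ∑ z ∈ T, ‖F z y‖^2) :=
    ContDiff.sum (fun z _ => norm_sq_sm (hFs z))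
  have hrs : ContDiff ℝ ∞ r := s1.add s2
  have r1 : ∀ y : CSp n, ∑ j : Fin n, ‖((Real.sqrt ε0 : ℝ):ℂ) * y j‖^2 = ε0 * ‖y‖^2 := by
    intro y
    rw [EuclideanSpace.norm_sq_eq, Finset.mul_sum]
    refine Finset.sum_congr rfl (fun j _ => ?_)
    rw [norm_mul, mul_pow, Complex.norm_real, Real.norm_eq_abs, sq_abs, Real.sq_sqrt hεp0.le]
  have rS : ∀ y ∈ S, 1 < r y := by
    intro y hy
    have := hTc hy
    simp only [mem_iUnion] at this
    obtain ⟨z, hz, hyV, hy2⟩ := this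
    have hκy : κ y = 1 := (hκL y hy.1).self_of_nhds
    have h1 : 1 < ‖F z y‖^2 := by
      simp only [hF, hz, if_true, hκy]
      rw [Complex.ofReal_one, one_mul, norm_pow, ← pow_mul]
      exact one_lt_pow₀ hy2 (by omega)
    have h2 : ‖F z y‖^2 ≤ ∑ z ∈ T, ‖F z y‖^2 :=
      Finset.single_le_sum (f := fun z => ‖F z y‖^2) (fun _ _ => by positivity) hz
    have h3 : 0 ≤ ε0 * ‖y‖^2 := by positivity
    simp only [hr, r1]
    linarith
  have rK : ∀ w ∈ K, r w < 1 := by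
    intro w hw
    have hκw : κ w = 1 := (hκL w (interior_subset (hHL (hKH hw)))).self_of_nhds
    simp only [hr, r1]
    have h1 : ∑ z ∈ T, ‖F z w‖^2 < 1/2 := by
      refine lt_of_le_of_lt (le_of_eq ?_) (hN w hw)
      refine Finset.sum_congr rfl (fun z hz => ?_)
      simp [hF, hz, hκw]
    have h2 : ε0 * ‖w‖^2 ≤ 1/2 := by
      have h3 := hR w hw
      have h4 : ‖w‖^2 ≤ R^2 + 1 := by nlinarith [norm_nonneg w]
      rw [hε0]
      rw [div_mul_eq_mul_div, div_le_div_iff₀ (by positivity) (by norm_num)]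
      linarith
    linarith
  have hLr : {z ∈ interior L | r z ≤ 1} = L ∩ {z | r z ≤ 1} := by
    ext z
    constructor
    · rintro ⟨h1, h2⟩; exact ⟨interior_subset h1, h2⟩
    · rintro ⟨h1, h2⟩
      refine ⟨?_, h2⟩
      by_contra h
      exact absurd (rS z ⟨h1, h⟩) (not_lt.2 h2)
  obtain ⟨φ, ψ, χ, m, hW, hC, hm⟩ := wts_of_exh hrs (V := interior L) (D := {z ∈ interior L | r z < 1})
    isOpen_interior (by rw [hLr]; exact hL.inter_right (isClosed_le hrs.continuous continuous_const))
    rfl hεp0 (by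
      intro x hx t
      have hxL : x ∈ L := interior_subset hx.1
      rw [levi_add s1 s2, levi_sum _ (fun j => norm_sq_sm (hcs j)), levi_sum _ (fun z => norm_sq_sm (hFs z))]
      have h1 : 0 ≤ ∑ z ∈ T, levi (fun y => ‖F z y‖^2) t x := by
        apply Finset.sum_nonneg
        intro z _
        rw [levi_sq (hFs z) (hFh z x hxL)]
        positivity
      have h2 : ∀ j : Fin n, levi (fun y : CSp n => ‖((Real.sqrt ε0 : ℝ):ℂ) * y j‖^2) t x = ε0 * ‖t j‖^2 := by
        intro j
        set A : CSp n →L[ℂ] ℂ := ((Real.sqrt ε0 : ℝ):ℂ) • (EuclideanSpace.proj j : CSp n →L[ℂ] ℂ) with hA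
        have hAe : (fun y : CSp n => ((Real.sqrt ε0 : ℝ):ℂ) * y j) = A := by ext y; simp [hA]
        have hd : ∀ y, DifferentiableAt ℂ (fun y : CSp n => ((Real.sqrt ε0 : ℝ):ℂ) * y j) y := by
          rw [hAe]; exact fun y => A.differentiableAt
        rw [levi_sq (hcs j) (Eventually.of_forall hd)]
        have : ∀ i, dd i (fun y : CSp n => ((Real.sqrt ε0 : ℝ):ℂ) * y j) x * t i =
            if i = j then ((Real.sqrt ε0 : ℝ):ℂ) * t j else 0 := by
          intro i
          rw [dd_holo (hd x), hAe, A.fderiv]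
          by_cases h : i = j
          · subst h; simp [hA, eB]
          · simp [hA, eB, h, Ne.symm h]
        simp only [this]
        rw [Finset.sum_ite_eq' Finset.univ j]
        simp only [Finset.mem_univ, if_true]
        rw [norm_mul, mul_pow, Complex.norm_real, Real.norm_eq_abs, sq_abs, Real.sq_sqrt hεp0.le]
      simp only [h2]
      rw [← Finset.mul_sum]
      linarith)
  exact ⟨{z ∈ interior L | r z < 1}, φ, ψ, χ, m, fun w hw => ⟨hHL (hKH hw), rK w hw⟩, fun w hw => hLV (interior_subset hw.1), hW, hC, hm⟩

end PartA12
end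

open Metric Set Filter Asymptotics
open scoped Manifold Topology
noncomputable section
section PartA13
open MeasureTheory
open scoped ContDiff ComplexConjugate ENNReal
variable {n : ℕ}

lemma ibp_loc {D : Set (CSp n)} (hD : IsOpen D) {θ g : CSp n → ℂ} (hθ : Tst θ)
    (hs : tsupport θ ⊆ D) (hg : ContDiffOn ℝ ∞ g D) (j : Fin n) :
    ∫ x, g x * dbar j θ x = - ∫ x, dbar j g x * θ x := by
  obtain ⟨κ, k1, k2, k3, k4, -⟩ := exists_cutoff hθ.2 hD hs
  have hT : Tst (fun x => rc κ x * g x) := Tst.mul_loc hD (rc_Tst k1 k2) (by rwa [rc_tsupport]) hg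
  have loc : ∀ x ∈ tsupport θ, (fun x => rc κ x * g x) =ᶠ[𝓝 x] g := by
    intro x hx
    filter_upwards [(eventually_nhdsSet_iff_forall.1 k4) x hx] with y hy
    simp [rc, hy]
  have h := ibp_dbar hT hθ.1 j
  have e1 : ∀ x, rc κ x * g x * dbar j θ x = g x * dbar j θ x := by
    intro x
    by_cases hx : x ∈ tsupport θ
    · rw [(loc x hx).eq_of_nhds]
    · have : dbar j θ x = 0 := image_eq_zero_of_notMem_tsupport (fun h => hx (dbar_supp j h))
      simp [this]
  have e2 : ∀ x, dbar j (fun x => rc κ x * g x) x * θ x = dbar j g x * θ x := by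
    intro x
    by_cases hx : x ∈ tsupport θ
    · rw [dbar_congr (loc x hx)]
    · simp [image_eq_zero_of_notMem_tsupport hx]
  simp only [e1, e2] at h
  rw [h, neg_neg]

lemma int_loc {D : Set (CSp n)} (hD : IsOpen D) {θ g : CSp n → ℂ} (hθ : Tst θ)
    (hs : tsupport θ ⊆ D) (hg : ContDiffOn ℝ ∞ g D) : Integrable (fun x => g x * θ x) := by
  have := (Tst.mul_loc hD hθ hs hg).integrable
  simpa only [mul_comm] using this

lemma memLp_ball {O : Set (CSp n)} (hO : IsOpen O) {v E : CSp n → ℂ} (hv : MemLp v 2 volume)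
    (hE : ContinuousOn E O) {x : CSp n} (hx : x ∈ O) :
    ∃ r > 0, closedBall x r ⊆ O ∧ MemLp ((closedBall x r).indicator (fun y => v y * E y)) 2 volume := by
  obtain ⟨r, hr, hrO⟩ := nhds_basis_closedBall.mem_iff.1 (hO.mem_nhds hx)
  refine ⟨r, hr, hrO, ?_⟩
  obtain ⟨C, hC⟩ := (isCompact_closedBall x r).exists_bound_of_continuousOn (hE.mono hrO)
  refine hv.of_le_mul (c := C) ?_ ?_
  · rw [aestronglyMeasurable_indicator_iff measurableSet_closedBall]
    exact hv.1.restrict.mul ((hE.mono hrO).aestronglyMeasurable measurableSet_closedBall)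
  · filter_upwards with y
    by_cases hy : y ∈ closedBall x r
    · rw [indicator_of_mem hy, norm_mul, mul_comm]
      exact mul_le_mul_of_nonneg_right (hC y hy) (norm_nonneg _)
    · rw [indicator_of_notMem hy, norm_zero]
      exact mul_nonneg ((norm_nonneg _).trans (hC x (mem_closedBall_self hr.le))) (norm_nonneg _)

lemma memLp_bd {D : Set (CSp n)} (hD : IsOpen D) {F : CSp n → ℂ} (hF : ContinuousOn F D)
    {C R : ℝ} {p : CSp n} (hC : ∀ x ∈ D, ‖F x‖ ≤ C) (h0 : ∀ x, x ∉ closedBall p R → F x = 0) :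
    MemLp (D.indicator F) 2 volume := by
  have h1 : MemLp ((closedBall p R).indicator (fun _ => (|C| : ℝ))) 2 (volume : Measure (CSp n)) :=
    memLp_indicator_const 2 measurableSet_closedBall _ (Or.inr (measure_closedBall_lt_top.ne))
  refine h1.mono ?_ ?_
  · rw [aestronglyMeasurable_indicator_iff hD.measurableSet]
    exact hF.aestronglyMeasurable hD.measurableSet
  · filter_upwards with y
    by_cases hy : y ∈ closedBall p R
    · rw [indicator_of_mem hy]
      by_cases hyD : y ∈ D
      · rw [indicator_of_mem hyD]; simp only [Real.norm_eq_abs, abs_abs]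
        exact (hC y hyD).trans (le_abs_self _)
      · rw [indicator_of_notMem hyD]; simp
    · have : D.indicator F y = 0 := by
        by_cases hyD : y ∈ D
        · rw [indicator_of_mem hyD, h0 y hy]
        · rw [indicator_of_notMem hyD]
      rw [this]; simp

lemma dbar_comm_at {f : CSp n → ℂ} {O : Set (CSp n)} (hO : IsOpen O) (hf : ContDiffOn ℝ ∞ f O)
    {x : CSp n} (hx : x ∈ O) (j k : Fin n) : dbar k (dbar j f) x = dbar j (dbar k f) x := by
  obtain ⟨κ, k1, k2, k3, k4, -⟩ := exists_cutoff (isCompact_singleton (x := x)) hO (by simpa using hx)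
  have hT : Tst (fun x => rc κ x * f x) := Tst.mul_loc hO (rc_Tst k1 k2) (by rwa [rc_tsupport]) hf
  have loc : (fun x => rc κ x * f x) =ᶠ[𝓝 x] f := by
    filter_upwards [(eventually_nhdsSet_iff_forall.1 k4) x rfl] with y hy
    simp [rc, hy]
  rw [← dbar_congr (dbar_eventuallyEq loc j), ← dbar_congr (dbar_eventuallyEq loc k)]
  exact dbar_dbar_comm hT.1 j k x

set_option maxHeartbeats 1000000 in
theorem cousin {V K : Set (CSp n)} (hV : IsSteinOpen V) (hK : IsCompact K) (hKV : K ⊆ V)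
    {p : CSp n} {P : CSp n → ℂ} (hP : Differentiable ℂ P) {r0 c : ℝ} (hr0 : 0 < r0) (hc : 0 < c)
    (hsh : ∀ z ∈ V, r0 / 2 ≤ dist z p → dist z p ≤ r0 → c ≤ ‖P z‖) :
    ∃ D : Set (CSp n), IsOpen D ∧ K ⊆ D ∧ D ⊆ V ∧ ∃ S h : CSp n → ℂ,
      IsOpen (D ∩ {z | z ∈ closedBall p r0 → P z ≠ 0}) ∧
      DifferentiableOn ℂ S (D ∩ {z | z ∈ closedBall p r0 → P z ≠ 0}) ∧
      DifferentiableOn ℂ h (D ∩ ball p (r0/2)) ∧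
      ∀ z ∈ D ∩ ball p (r0/2), P z ≠ 0 → S z = (P z)⁻¹ + h z := by
  obtain ⟨D, φ, ψ, χ, m, hKD, hDV, hW, hC, hm⟩ := stein_exh hV hK hKV
  have hD := hW.hD
  obtain ⟨κ, k1, k2, k3, k4, k5⟩ := exists_cutoff (isCompact_closedBall p (r0/2)) isOpen_ball
    (closedBall_subset_ball (by linarith : r0/2 < r0))
  have hκT := rc_Tst k1 k2
  have hPc : Continuous P := hP.continuous
  have hPs : ContDiff ℝ ∞ P := by
    have := holo_sm isOpen_univ hP.differentiableOn
    rwa [contDiffOn_univ] at this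
  set O1 := D ∩ {z | z ∈ closedBall p r0 → P z ≠ 0} with hO1
  set O2 := D ∩ ball p (r0/2) with hO2
  have hO1o : IsOpen O1 := by
    have : O1 = D ∩ (closedBall p r0 ∩ P ⁻¹' {0})ᶜ := by
      ext z; simp [hO1]
    rw [this]
    exact hD.inter (isClosed_closedBall.inter (isClosed_singleton.preimage hPc)).isOpen_compl
  have hO2o : IsOpen O2 := hD.inter isOpen_ball
  -- trichotomy
  have near1 : ∀ x ∈ closedBall p (r0/2), rc κ =ᶠ[𝓝 x] fun _ => 1 := by
    intro x hx
    filter_upwards [(eventually_nhdsSet_iff_forall.1 k4) x hx] with y hy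
    simp [rc, hy]
  have near0 : ∀ x, x ∉ ball p r0 → rc κ =ᶠ[𝓝 x] fun _ => 0 := by
    intro x hx
    have := notMem_tsupport_iff_eventuallyEq.1 (fun h : x ∈ tsupport κ => hx (k3 h))
    filter_upwards [this] with y hy
    simp [rc, hy]
  have d1 : ∀ j, ∀ x ∈ closedBall p (r0/2), dbar j (rc κ) =ᶠ[𝓝 x] fun _ => 0 := by
    intro j x hx
    filter_upwards [dbar_eventuallyEq (near1 x hx) j] with y hy
    rw [hy, dbar_const' j]
  have d0 : ∀ j, ∀ x, x ∉ ball p r0 → dbar j (rc κ) =ᶠ[𝓝 x] fun _ => 0 := by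
    intro j x hx
    filter_upwards [dbar_eventuallyEq (near0 x hx) j] with y hy
    rw [hy, dbar_const' j]
  set om : Fin n → CSp n → ℂ := fun j x => dbar j (rc κ) x * (P x)⁻¹ with hom
  set G : CSp n → ℂ := fun x => rc κ x * (P x)⁻¹ with hG
  have hom1 : ∀ j, ∀ x ∈ closedBall p (r0/2), om j =ᶠ[𝓝 x] fun _ => 0 := by
    intro j x hx
    filter_upwards [d1 j x hx] with y hy
    simp [hom, hy]
  have hom0 : ∀ j, ∀ x, x ∉ ball p r0 → om j =ᶠ[𝓝 x] fun _ => 0 := by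
    intro j x hx
    filter_upwards [d0 j x hx] with y hy
    simp [hom, hy]
  have homs : ∀ j, ContDiffOn ℝ ∞ (om j) D := by
    intro j x hx
    apply ContDiffAt.contDiffWithinAt
    by_cases h1 : x ∈ closedBall p (r0/2)
    · exact contDiffAt_const.congr_of_eventuallyEq (hom1 j x h1)
    by_cases h0 : x ∉ ball p r0
    · exact contDiffAt_const.congr_of_eventuallyEq (hom0 j x h0)
    push Not at h0
    have hPx : P x ≠ 0 := by
      have := hsh x (hDV hx) (by simpa using (not_le.1 h1).le) (mem_ball.1 h0).le
      exact norm_pos_iff.1 (hc.trans_le this)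
    exact (hκT.dbar j).1.contDiffAt.mul (hPs.contDiffAt.inv hPx)
  have hGs : ContDiffOn ℝ ∞ G O1 := by
    intro x hx
    apply ContDiffAt.contDiffWithinAt
    by_cases h0 : x ∉ ball p r0
    · have : G =ᶠ[𝓝 x] fun _ => 0 := by
        filter_upwards [near0 x h0] with y hy
        simp [hG, hy]
      exact contDiffAt_const.congr_of_eventuallyEq this
    push Not at h0
    exact hκT.1.contDiffAt.mul (hPs.contDiffAt.inv (hx.2 (ball_subset_closedBall h0)))
  have hdG : ∀ j, ∀ x ∈ O1, dbar j G x = om j x := by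
    intro j x hx
    by_cases h0 : x ∉ ball p r0
    · have : G =ᶠ[𝓝 x] fun _ => 0 := by
        filter_upwards [near0 x h0] with y hy
        simp [hG, hy]
      rw [dbar_congr this, dbar_const' j, (hom0 j x h0).eq_of_nhds]
    push Not at h0
    have hPx := hx.2 (ball_subset_closedBall h0)
    have hi : DifferentiableAt ℂ (fun y => (P y)⁻¹) x := (hP x).inv hPx
    rw [hG, dbar_mul (sm_diff hκT.1 x) (hi.restrictScalars ℝ), dbar_holo hi]
    simp [hom]
  have homc : ∀ j k, ∀ x ∈ D, dbar j (om k) x = dbar k (om j) x := by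
    intro j k x hx
    by_cases h1 : x ∈ O1
    · have e : ∀ i, dbar i G =ᶠ[𝓝 x] om i := by
        intro i
        filter_upwards [hO1o.mem_nhds h1] with y hy using hdG i y hy
      rw [← dbar_congr (e k), ← dbar_congr (e j)]
      exact dbar_comm_at hO1o hGs h1 k j
    · have hx2 : x ∈ closedBall p (r0/2) := by
        by_contra h2
        apply h1
        refine ⟨hx, fun h3 => ?_⟩
        have := hsh x (hDV hx) (by simpa using (not_le.1 h2).le) h3
        exact norm_pos_iff.1 (hc.trans_le this)
      rw [dbar_congr (hom1 k x hx2), dbar_congr (hom1 j x hx2), dbar_const', dbar_const']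
  have homb : ∀ j, ∃ C, ∀ x ∈ D, ‖om j x‖ ≤ C := by
    intro j
    obtain ⟨C, hC⟩ := cut_bdd (hκT.dbar j)
    have hC0 : 0 ≤ C := (norm_nonneg _).trans (hC p)
    refine ⟨C * c⁻¹, fun x hx => ?_⟩
    by_cases h1 : x ∈ closedBall p (r0/2)
    · rw [(hom1 j x h1).eq_of_nhds, norm_zero]; positivity
    by_cases h0 : x ∉ ball p r0
    · rw [(hom0 j x h0).eq_of_nhds, norm_zero]; positivity
    push Not at h0
    have := hsh x (hDV hx) (by simpa using (not_le.1 h1).le) (mem_ball.1 h0).le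
    simp only [hom]
    rw [norm_mul, norm_inv]
    exact mul_le_mul (hC x) (inv_anti₀ hc this) (by positivity) hC0
  have hφs2 : ContDiffOn ℝ ∞ (fun y => φ y - ψ y) D := hW.hφ.sub hW.hψ
  have hem : ContDiffOn ℝ ∞ (ex (fun y => -(φ y - ψ y)/2)) D := ex_smOn (hφs2.neg.div_const 2)
  set w : Fin n → CSp n → ℂ := fun j => D.indicator (fun x => om j x * ex (fun y => -(φ y - ψ y)/2) x) with hw
  have hwM : ∀ j, MemLp (w j) 2 volume := by
    intro j
    obtain ⟨C, hC⟩ := homb j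
    refine memLp_bd hD ((homs j).continuousOn.mul hem.continuousOn) (C := C * Real.exp (-m/2)) (p := p) (R := r0) ?_ ?_
    · intro x hx
      rw [norm_mul]
      refine mul_le_mul (hC x hx) ?_ (norm_nonneg _) ((norm_nonneg _).trans (hC x hx))
      simp only [ex]
      rw [Complex.norm_real, Real.norm_of_nonneg (Real.exp_pos _).le]
      exact Real.exp_le_exp.2 (by linarith [hm x hx])
    · intro x hx
      rw [(hom0 j x (fun h => hx (ball_subset_closedBall h))).eq_of_nhds, zero_mul]
  have hwe : ∀ j, ∀ x ∈ D, w j x * ex (fun y => (φ y - ψ y)/2) x = om j x := by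
    intro j x hx
    simp only [hw]
    rw [indicator_of_mem hx, mul_assoc]
    have : ex (fun y => -(φ y - ψ y)/2) x * ex (fun y => (φ y - ψ y)/2) x = 1 := by
      simp only [ex]
      rw [← Complex.ofReal_mul, ← Real.exp_add]
      have : -(φ x - ψ x)/2 + (φ x - ψ x)/2 = 0 := by ring
      rw [this]; simp
    rw [this, mul_one]
  have hwθ : ∀ j θ, tsupport θ ⊆ D → ∀ x, w j x * (ex (fun y => (φ y - ψ y)/2) x * θ x) = om j x * θ x := by
    intro j θ hs x
    by_cases hx : x ∈ D
    · rw [← mul_assoc, hwe j x hx]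
    · rw [image_eq_zero_of_notMem_tsupport (fun h => hx (hs h))]; simp
  have hcl : WClosed D (fun y => φ y - ψ y) w := by
    intro θ hθ hs j k
    simp only [hwθ _ _ ((dbar_supp _).trans hs)]
    rw [integral_sub (int_loc hD (hθ.dbar j) ((dbar_supp _).trans hs) (homs k))
      (int_loc hD (hθ.dbar k) ((dbar_supp _).trans hs) (homs j)),
      ibp_loc hD hθ hs (homs k), ibp_loc hD hθ hs (homs j)]
    have : ∀ x, dbar j (om k) x * θ x = dbar k (om j) x * θ x := by
      intro x
      by_cases hx : x ∈ D
      · rw [homc j k x hx]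
      · rw [image_eq_zero_of_notMem_tsupport (fun h => hx (hs h))]; simp
    simp only [this, sub_self]
  obtain ⟨v, hv, hvw⟩ := hor_exist hW hC hwM (fun j x hx => indicator_of_notMem hx _) hcl
  set E := ex (fun y => (φ y - 2 * ψ y)/2) with hE
  have hEs : ContDiffOn ℝ ∞ E D :=
    ex_smOn ((hW.hφ.sub (contDiffOn_const.mul hW.hψ)).div_const 2)
  set u : CSp n → ℂ := fun x => v x * E x with hu
  have hui : ∀ θ, Tst θ → tsupport θ ⊆ D → Integrable (fun x => u x * θ x) := by
    intro θ hθ hs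
    have := int_mul_T hv (Tst.mul_loc hD hθ hs hEs)
    refine this.congr (Eventually.of_forall fun x => ?_)
    simp only [hu]; ring
  have huw : ∀ θ, Tst θ → tsupport θ ⊆ D → ∀ j, ∫ x, u x * dbar j θ x = - ∫ x, om j x * θ x := by
    intro θ hθ hs j
    have := hvw θ hθ hs j
    simp only [hwθ _ _ hs] at this
    rw [← this]
    simp only [hu, mul_assoc]
  obtain ⟨S, hS, hSu⟩ := weyl hO1o (u := fun x => G x - u x) (by
    intro x hx
    obtain ⟨r, hr, hrO, hM⟩ := memLp_ball hO1o hv (hEs.continuousOn.mono inter_subset_left) hx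
    refine ⟨r, hr, ?_⟩
    obtain ⟨C, hCb⟩ := (isCompact_closedBall x r).exists_bound_of_continuousOn (hGs.continuousOn.mono hrO)
    have h2 : MemLp ((closedBall x r).indicator G) 2 volume := by
      have h1 : MemLp ((closedBall x r).indicator (fun _ => (C : ℝ))) 2 (volume : Measure (CSp n)) :=
        memLp_indicator_const 2 measurableSet_closedBall _ (Or.inr (measure_closedBall_lt_top.ne))
      refine h1.mono ?_ ?_
      · rw [aestronglyMeasurable_indicator_iff measurableSet_closedBall]
        exact (hGs.continuousOn.mono hrO).aestronglyMeasurable measurableSet_closedBall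
      · filter_upwards with y
        by_cases hy : y ∈ closedBall x r
        · rw [indicator_of_mem hy, indicator_of_mem hy]
          exact (hCb y hy).trans (le_abs_self _)
        · rw [indicator_of_notMem hy]; simp
    have := h2.sub hM
    rw [← Set.indicator_sub'] at this
    exact this) (by
    intro θ hθ hs j
    have hsD : tsupport θ ⊆ D := hs.trans inter_subset_left
    simp only [sub_mul]
    rw [integral_sub (int_loc hO1o (hθ.dbar j) ((dbar_supp _).trans hs) hGs)
      (hui _ (hθ.dbar j) ((dbar_supp _).trans hsD)), ibp_loc hO1o hθ hs hGs, huw θ hθ hsD j]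
    have : ∀ x, dbar j G x * θ x = om j x * θ x := by
      intro x
      by_cases hx : x ∈ O1
      · rw [hdG j x hx]
      · rw [image_eq_zero_of_notMem_tsupport (fun h => hx (hs h))]; simp
    simp only [this, sub_self])
  obtain ⟨h, hh, hhu⟩ := weyl hO2o (u := fun x => - u x) (by
    intro x hx
    obtain ⟨r, hr, hrO, hM⟩ := memLp_ball hO2o hv (hEs.continuousOn.mono inter_subset_left) hx
    refine ⟨r, hr, ?_⟩
    have := hM.neg
    rw [← Set.indicator_neg'] at this
    exact this) (by
    intro θ hθ hs j
    have hsD : tsupport θ ⊆ D := hs.trans inter_subset_left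
    simp only [neg_mul]
    rw [integral_neg, huw θ hθ hsD j, neg_neg]
    have : ∀ x, om j x * θ x = 0 := by
      intro x
      by_cases hx : x ∈ O2
      · rw [(hom1 j x (ball_subset_closedBall hx.2)).eq_of_nhds, zero_mul]
      · rw [image_eq_zero_of_notMem_tsupport (fun h => hx (hs h))]; simp
    simp only [this, integral_zero])
  refine ⟨D, hD, hKD, hDV, S, h, hO1o, hS, hh, ?_⟩
  have hPi : ContinuousOn (fun z => (P z)⁻¹) (O1 ∩ O2) := by
    intro z hz
    exact (hPc.continuousAt.inv₀ (hz.1.2 (closedBall_subset_closedBall (by linarith)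
      (ball_subset_closedBall hz.2.2)))).continuousWithinAt
  have key : EqOn S (fun z => (P z)⁻¹ + h z) (O1 ∩ O2) := by
    apply Measure.eqOn_open_of_ae_eq (μ := volume) _ (hO1o.inter hO2o)
      (hS.continuousOn.mono inter_subset_left) (hPi.add (hh.continuousOn.mono inter_subset_right))
    have a1 := ae_restrict_of_ae_restrict_of_subset (inter_subset_left (s := O1) (t := O2)) hSu
    have a2 := ae_restrict_of_ae_restrict_of_subset (inter_subset_right (s := O1) (t := O2)) hhu
    filter_upwards [a1, a2, ae_restrict_mem (hO1o.inter hO2o).measurableSet] with z z1 z2 z3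
    show S z = (P z)⁻¹ + h z
    rw [z1, z2]
    have := (near1 z (ball_subset_closedBall z3.2.2)).eq_of_nhds
    simp only [hG, this]
    ring
  intro z hz hPz
  exact key ⟨⟨hz.1, fun _ => hPz⟩, hz⟩

end PartA13
end

open Metric Set Filter Asymptotics
open scoped Manifold Topology
noncomputable section
section PartB1
variable {n : ℕ}

lemma finrank_CSp : Module.finrank ℝ (CSp n) = 2 * n := by
  have := Module.finrank_mul_finrank ℝ ℂ (CSp n)
  rw [Complex.finrank_real_complex] at this
  simpa using this.symm

lemma compl_ball_conn (hn : 2 ≤ n) {R : ℝ} (hR : 0 < R) : IsPreconnected (closedBall (0 : CSp n) R)ᶜ := by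
  have hr : 1 < Module.rank ℝ (CSp n) := by
    have := Module.lt_rank_of_lt_finrank (R := ℝ) (M := CSp n) (n := 1) (by rw [finrank_CSp]; omega)
    simpa using this
  have h0 := (isConnected_compl_singleton_of_one_lt_rank hr (0 : CSp n)).isPreconnected
  have himg : (fun x : CSp n => (1 + R / ‖x‖) • x) '' {0}ᶜ = (closedBall (0 : CSp n) R)ᶜ := by
    ext y
    simp only [mem_image, mem_compl_iff, mem_singleton_iff, mem_closedBall, dist_zero_right, not_le]
    constructor
    · rintro ⟨x, hx, rfl⟩
      have hx' := norm_pos_iff.2 hx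
      rw [norm_smul, Real.norm_of_nonneg (by positivity), add_mul, div_mul_cancel₀ _ hx'.ne']
      linarith
    · intro hy
      have hy0 : 0 < ‖y‖ := hR.trans hy
      have hpos : 0 < 1 - R/‖y‖ := by rw [sub_pos, div_lt_one hy0]; exact hy
      refine ⟨(1 - R/‖y‖) • y, ?_, ?_⟩
      · rw [smul_eq_zero, not_or]; exact ⟨hpos.ne', norm_pos_iff.1 hy0⟩
      · rw [norm_smul, Real.norm_of_nonneg hpos.le, smul_smul]
        have : (1 + R / ((1 - R / ‖y‖) * ‖y‖)) * (1 - R / ‖y‖) = 1 := by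
          have h1 : (1 - R / ‖y‖) * ‖y‖ = ‖y‖ - R := by field_simp
          have h2 : ‖y‖ - R ≠ 0 := by linarith
          rw [h1]; field_simp; ring
        rw [this, one_smul]
  rw [← himg]
  apply h0.image
  intro x hx
  have : ‖x‖ ≠ 0 := norm_ne_zero_iff.2 hx
  apply ContinuousAt.continuousWithinAt
  exact ((continuousAt_const.add (continuousAt_const.div continuous_norm.continuousAt this)).smul continuousAt_id)

lemma no_bdd_comp (hn : 2 ≤ n) {K : Set (CSp n)} (hK : IsCompact K) (hs : HasSteinNbhdBasis K)
    {a : CSp n} (ha : a ∈ Kᶜ) : ¬ Bornology.IsBounded (connectedComponentIn Kᶜ a) := by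
  intro hb
  set B := connectedComponentIn Kᶜ a with hB
  have hBo : IsOpen B := hK.isClosed.isOpen_compl.connectedComponentIn
  have haB : a ∈ B := mem_connectedComponentIn ha
  have hfr : ∀ x ∈ closure B, x ∉ B → x ∈ K := by
    intro x hx hxB
    by_contra hxK
    have hC : IsOpen (connectedComponentIn Kᶜ x) := hK.isClosed.isOpen_compl.connectedComponentIn
    have hxC : x ∈ connectedComponentIn Kᶜ x := mem_connectedComponentIn hxK
    obtain ⟨y, hy1, hy2⟩ := mem_closure_iff.1 hx _ hC hxC
    have e1 := connectedComponentIn_eq hy1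
    have e2 := connectedComponentIn_eq hy2
    apply hxB
    rw [hB, e2, ← e1]; exact hxC
  obtain ⟨V, hV, hKV, hVa⟩ := hs {a}ᶜ isOpen_compl_singleton (fun x hx h => ha (h ▸ hx))
  have hVo := hV.1
  have hCc : IsCompact (closure B \ V) := hb.isCompact_closure.diff hVo
  have hcont : Continuous (fun z : CSp n => (z ⟨0, by omega⟩).re) := by fun_prop
  obtain ⟨b, hbC, hbmax⟩ := hCc.exists_isMaxOn ⟨a, subset_closure haB, fun h => hVa h rfl⟩ hcont.continuousOn
  have hbB : b ∈ B := by
    by_contra h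
    exact hbC.2 (hKV (hfr b hbC.1 h))
  set H := {z ∈ V | ∀ g : CSp n → ℂ, DifferentiableOn ℂ g V →
      ‖g z‖ ≤ sSup ((fun w => ‖g w‖) '' K)} with hH
  have hHc : IsCompact H := hV.2 K hKV hK
  set i0 : Fin n := ⟨0, by omega⟩
  set i1 : Fin n := ⟨1, by omega⟩
  have hi : i0 ≠ i1 := by simp [i0, i1]
  have key : ∀ t : ℝ, 0 < t → b + (t:ℂ) • eB i0 ∈ B → b + (t:ℂ) • eB i0 ∈ H := by
    intro t ht hbt
    set L : ℂ → CSp n := fun ζ => b + (t:ℂ) • eB i0 + ζ • eB i1 with hL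
    have hLd : Differentiable ℂ L := by
      apply Differentiable.const_add
      exact differentiable_id.smul_const _
    have hLV : ∀ ζ, L ζ ∈ closure B → L ζ ∈ V := by
      intro ζ hζ
      by_contra h
      have h1 : ((L ζ) i0).re ≤ (b i0).re := hbmax ⟨hζ, h⟩
      simp [hL, eB, hi, hi.symm] at h1
      linarith
    have hcl : ∀ ζ ∈ closure (L ⁻¹' B), L ζ ∈ closure B := fun ζ hζ =>
      (closure_minimal (s := L ⁻¹' B) (t := L ⁻¹' (closure B)) (fun y hy => subset_closure hy)
        (isClosed_closure.preimage hLd.continuous)) hζ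
    refine ⟨by simpa [hL] using hLV 0 (by simpa [hL] using subset_closure hbt), fun g hg => ?_⟩
    have hd : DiffContOnCl ℂ (fun ζ => g (L ζ)) (L ⁻¹' B) := by
      apply DifferentiableOn.diffContOnCl
      intro ζ hζ
      exact ((hg.differentiableAt (hVo.mem_nhds (hLV ζ (hcl ζ hζ)))).comp ζ (hLd ζ)).differentiableWithinAt
    have hbd : Bornology.IsBounded (L ⁻¹' B) := by
      obtain ⟨R, hR⟩ := hb.subset_closedBall 0
      refine (isBounded_iff_forall_norm_le).2 ⟨R + ‖b i1‖, fun ζ hζ => ?_⟩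
      have h1 := hR hζ
      rw [mem_closedBall_zero_iff] at h1
      have h2 := (EuclideanSpace.norm_eq (L ζ) ▸ PiLp.norm_apply_le (L ζ) i1 : ‖L ζ i1‖ ≤ _)
      have h3 : L ζ i1 = b i1 + ζ := by simp [hL, eB, hi, hi.symm]
      have h4 : ‖L ζ i1‖ ≤ R := (PiLp.norm_apply_le (L ζ) i1).trans h1
      rw [h3] at h4
      calc ‖ζ‖ = ‖(b i1 + ζ) - b i1‖ := by congr 1; ring
        _ ≤ _ := (norm_sub_le _ _).trans (by linarith)
    have := Complex.norm_le_of_forall_mem_frontier_norm_le hbd hd (C := sSup ((fun w => ‖g w‖) '' K)) (by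
      intro ζ hζ
      apply le_csSup (hK.image_of_continuousOn (hg.continuousOn.mono hKV).norm).bddAbove
      refine ⟨L ζ, hfr _ (hcl ζ hζ.1) ?_, rfl⟩
      intro h
      rw [(hBo.preimage hLd.continuous).frontier_eq] at hζ
      exact hζ.2 h) (z := 0) (subset_closure (by simpa [hL] using hbt))
    simpa [hL] using this
  have hlim : Tendsto (fun t : ℝ => b + (t:ℂ) • eB i0) (𝓝[>] 0) (𝓝 b) := by
    have : Continuous (fun t : ℝ => b + (t:ℂ) • eB i0) := by fun_prop
    have h2 := this.tendsto 0
    simp at h2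
    exact h2.mono_left nhdsWithin_le_nhds
  have hbH : b ∈ H := by
    apply hHc.isClosed.mem_of_tendsto hlim
    filter_upwards [hlim.eventually (hBo.mem_nhds hbB), self_mem_nhdsWithin] with t h1 h2
    exact key t h2 h1
  exact hbC.2 hbH.1

theorem compl_conn (hn : 2 ≤ n) {K : Set (CSp n)} (hK : IsCompact K) (hs : HasSteinNbhdBasis K) :
    IsPathConnected Kᶜ := by
  obtain ⟨R, hR0, hR⟩ := hK.isBounded.subset_closedBall_lt 0 0
  have hsub : (closedBall (0 : CSp n) R)ᶜ ⊆ Kᶜ := compl_subset_compl.2 hR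
  have hconn := compl_ball_conn hn hR0
  have hex : ∀ a ∈ Kᶜ, ∃ y ∈ connectedComponentIn Kᶜ a, y ∈ (closedBall (0 : CSp n) R)ᶜ := by
    intro a ha
    by_contra h
    push Not at h
    have h2 : connectedComponentIn Kᶜ a ⊆ closedBall (0 : CSp n) R := fun y hy => not_not.1 (h y hy)
    exact no_bdd_comp hn hK hs ha (isBounded_closedBall.subset h2)
  have hne : ∃ x0, x0 ∈ (closedBall (0 : CSp n) R)ᶜ := by
    refine ⟨EuclideanSpace.single ⟨0, by omega⟩ ((R+1 : ℝ):ℂ), ?_⟩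
    simp only [mem_compl_iff, mem_closedBall, dist_zero_right, EuclideanSpace.norm_single, Complex.norm_real]
    rw [Real.norm_of_nonneg (by linarith)]; linarith
  obtain ⟨x0, hx0⟩ := hne
  rw [← hK.isClosed.isOpen_compl.isConnected_iff_isPathConnected]
  refine ⟨⟨x0, hsub hx0⟩, isPreconnected_of_forall x0 fun y hy => ?_⟩
  obtain ⟨z, hz1, hz2⟩ := hex y hy
  refine ⟨connectedComponentIn Kᶜ y, connectedComponentIn_subset _ _, ?_, mem_connectedComponentIn hy,
    isPreconnected_connectedComponentIn⟩
  rw [connectedComponentIn_eq hz1]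
  exact hconn.subset_connectedComponentIn hz2 hsub hx0

end PartB1
end

open Metric Set Filter Asymptotics
open scoped Manifold Topology
noncomputable section
section PartC1
variable {n : ℕ}

lemma taylor2 {ρ : CSp n → ℝ} {p : CSp n} (h : ContDiffAt ℝ 2 ρ p) {ε : ℝ} (hε : 0 < ε) :
    ∀ᶠ v in 𝓝 (0 : CSp n), |ρ (p + v) - ρ p - fderiv ℝ ρ p v -
      (1/2) * fderiv ℝ (fderiv ℝ ρ) p v v| ≤ ε * ‖v‖^2 := by
  set H := fderiv ℝ (fderiv ℝ ρ) p with hH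
  set L := fderiv ℝ ρ p with hL
  have hsym : ∀ v w, H v w = H w v := fun v w => (h.isSymmSndFDerivAt (by simp)) v w
  have hD : HasFDerivAt (fderiv ℝ ρ) H p :=
    ((h.fderiv_right (m := 1) (by norm_num)).differentiableAt (by norm_num)).hasFDerivAt
  have h1 := hD.isLittleO.bound hε
  have h2 : ∀ᶠ y in 𝓝 p, DifferentiableAt ℝ ρ y :=
    (h.eventually (by simp)).mono fun y hy => hy.differentiableAt (by norm_num)
  obtain ⟨δ, hδ, hb⟩ := Metric.eventually_nhds_iff_ball.1 (h1.and h2)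
  filter_upwards [ball_mem_nhds (0 : CSp n) hδ] with v hv
  rw [mem_ball_zero_iff] at hv
  have hder : ∀ w ∈ closedBall (0 : CSp n) ‖v‖, HasFDerivWithinAt
      (fun w => ρ (p + w) - L w - (1/2) * H w w) (fderiv ℝ ρ (p + w) - L - H w) (closedBall 0 ‖v‖) w := by
    intro w hw
    rw [mem_closedBall_zero_iff] at hw
    apply HasFDerivAt.hasFDerivWithinAt
    have hd := (hb (p + w) (by rw [mem_ball, dist_eq_norm]; simpa using hw.trans_lt hv)).2.hasFDerivAt
    have e1 : HasFDerivAt (fun w => ρ (p + w)) (fderiv ℝ ρ (p + w)) w := by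
      exact (hd.comp w ((hasFDerivAt_id w).const_add p)).congr_fderiv (by ext; simp)
    have e2 : HasFDerivAt (fun w => H w w) ((2:ℝ) • H w) w := by
      have := H.hasFDerivAt (x := w) |>.clm_apply (hasFDerivAt_id w)
      refine this.congr_fderiv ?_
      ext u
      simp [hsym u w, two_mul]
    refine ((e1.sub L.hasFDerivAt).sub (e2.const_mul (1/2 : ℝ))).congr_fderiv ?_
    ext u; simp
  have hbd : ∀ w ∈ closedBall (0 : CSp n) ‖v‖, ‖fderiv ℝ ρ (p + w) - L - H w‖ ≤ ε * ‖v‖ := by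
    intro w hw
    rw [mem_closedBall_zero_iff] at hw
    have := (hb (p + w) (by rw [mem_ball, dist_eq_norm]; simpa using hw.trans_lt hv)).1
    simp only [add_sub_cancel_left] at this
    exact this.trans (by gcongr)
  have := (convex_closedBall (0 : CSp n) ‖v‖).norm_image_sub_le_of_norm_hasFDerivWithin_le hder hbd
    (mem_closedBall_self (norm_nonneg _)) (mem_closedBall_zero_iff.2 le_rfl)
  simp only [add_zero, map_zero, sub_zero, mul_zero, Real.norm_eq_abs] at this
  rw [pow_two, ← mul_assoc]
  refine le_trans (le_of_eq ?_) this
  congr 1; ring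

/-- complex linear form with given real part -/
lemma levi_poly (L : CSp n →L[ℝ] ℝ) (H : CSp n →L[ℝ] CSp n →L[ℝ] ℝ) (hs : ∀ v w, H v w = H w v)
    (hL : L ≠ 0) (p : CSp n) :
    ∃ P : CSp n → ℂ, Differentiable ℂ P ∧ P p = 0 ∧ fderiv ℂ P p ≠ 0 ∧
      ∀ z, (P z).re = L (z - p) + (1/4) * (H (z-p) (z-p) - H (Complex.I • (z-p)) (Complex.I • (z-p))) := by
  set J : CSp n →L[ℝ] CSp n := (Complex.I • ContinuousLinearMap.id ℂ (CSp n)).restrictScalars ℝ with hJ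
  have hJa : ∀ v, J v = Complex.I • v := fun v => by simp [hJ]
  have hJJ : ∀ v, J (J v) = -v := fun v => by simp [hJa, smul_smul]
  set a : CSp n → ℝ := fun z => L (z - p) + (1/4) * (H (z-p) (z-p) - H (J (z-p)) (J (z-p))) with ha
  set b : CSp n → ℝ := fun z => -L (J (z-p)) - (1/2) * H (z-p) (J (z-p)) with hb
  have hid : ∀ z, HasFDerivAt (fun z : CSp n => z - p) (ContinuousLinearMap.id ℝ (CSp n)) z :=
    fun z => (hasFDerivAt_id z).sub_const p
  have hJd : ∀ z, HasFDerivAt (fun z : CSp n => J (z - p)) J z := fun z => by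
    exact (J.hasFDerivAt.comp z (hid z)).congr_fderiv (by ext; simp)
  have ea : ∀ z, HasFDerivAt a (L + (1/2:ℝ) • (H (z-p) - (H (J (z-p))).comp J)) z := by
    intro z
    have h1 := L.hasFDerivAt.comp z (hid z)
    have h2 := (H.hasFDerivAt.comp z (hid z)).clm_apply (hid z)
    have h3 := (H.hasFDerivAt.comp z (hJd z)).clm_apply (hJd z)
    refine (h1.add ((h2.sub h3).const_mul (1/4))).congr_fderiv ?_
    ext u
    simp [hs u z, hs u p, hs (J u) (J z), hs (J u) (J p)]
    ring
  have eb : ∀ z, HasFDerivAt b (-(L.comp J) - (1/2:ℝ) • ((H (z-p)).comp J + H (J (z-p)))) z := by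
    intro z
    have h1 := L.hasFDerivAt.comp z (hJd z)
    have h2 := (H.hasFDerivAt.comp z (hid z)).clm_apply (hJd z)
    refine (h1.neg.sub (h2.const_mul (1/2))).congr_fderiv ?_
    ext u
    simp [hs u (J z), hs u (J p)]
  set P : CSp n → ℂ := fun z => (a z : ℂ) + (b z : ℂ) * Complex.I with hP
  have eP : ∀ z, HasFDerivAt P (Complex.ofRealCLM.comp (L + (1/2:ℝ) • (H (z-p) - (H (J (z-p))).comp J)) +
      Complex.I • (Complex.ofRealCLM.comp (-(L.comp J) - (1/2:ℝ) • ((H (z-p)).comp J + H (J (z-p)))))) z := by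
    intro z
    have h1 := Complex.ofRealCLM.hasFDerivAt.comp z (ea z)
    have h2 := (Complex.ofRealCLM.hasFDerivAt.comp z (eb z)).mul_const Complex.I
    exact h1.add h2
  have hPd : Differentiable ℂ P := by
    intro z
    apply holo_of_dbar (eP z).differentiableAt
    intro j
    rw [dbar, (eP z).fderiv, ← hJa]
    simp [hJJ]
    linear_combination ((L (eB j) : ℂ) + (1/2) * (H z (eB j) - H p (eB j) - H (J z) (J (eB j)) + H (J p) (J (eB j)))) * Complex.I_sq
  refine ⟨P, hPd, by simp [hP, ha, hb], ?_, ?_⟩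
  · intro h0
    apply hL
    have h1 : HasFDerivAt P ((fderiv ℂ P p).restrictScalars ℝ) p := (hPd p).hasFDerivAt.restrictScalars ℝ
    have h2 := h1.unique (eP p)
    rw [h0] at h2
    ext u
    have h3 := congrArg (fun F : CSp n →L[ℝ] ℂ => (F u).re) h2
    simp at h3
    simpa using h3.symm
  · intro z
    simp [hP, ha, hJa]

theorem local_peak {Ω U : Set (CSp n)} {p : CSp n} {ρ : CSp n → ℝ} (hΩ : IsOpen Ω)
    (hp : p ∈ frontier Ω) (hU : IsOpen U) (hpU : p ∈ U) (hρ : ContDiffOn ℝ 2 ρ U)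
    (hd : fderiv ℝ ρ p ≠ 0) (hdef : Ω ∩ U = {z ∈ U | ρ z < 0}) (hlevi : LeviPosDef ρ p) :
    ∃ P : CSp n → ℂ, Differentiable ℂ P ∧ P p = 0 ∧ fderiv ℂ P p ≠ 0 ∧
      ∃ c > 0, ∃ r > 0, ∀ z ∈ closure Ω, dist z p ≤ r → (P z).re ≤ -c * (dist z p)^2 := by
  have hCp : ContDiffAt ℝ 2 ρ p := hρ.contDiffAt (hU.mem_nhds hpU)
  have hle : ∀ z ∈ closure Ω, z ∈ U → ρ z ≤ 0 := by
    intro z hz hzU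
    by_contra hpos
    push Not at hpos
    have hc : ContinuousAt ρ z := (hρ.continuousOn.continuousAt (hU.mem_nhds hzU))
    have h1 := (hc.eventually (lt_mem_nhds hpos)).and (hU.mem_nhds hzU)
    obtain ⟨y, ⟨hy1, hy2⟩, hy3⟩ := mem_closure_iff_nhds.1 hz _ h1
    have : y ∈ {z ∈ U | ρ z < 0} := hdef ▸ ⟨hy3, hy2⟩
    exact lt_asymm hy1 this.2
  have hp0 : ρ p = 0 := by
    apply le_antisymm (hle p hp.1 hpU)
    by_contra h
    push Not at h
    have : p ∈ Ω ∩ U := hdef ▸ ⟨hpU, h⟩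
    rw [hΩ.frontier_eq] at hp
    exact hp.2 this.1
  set H := fderiv ℝ (fderiv ℝ ρ) p with hH
  have hsym : ∀ v w, H v w = H w v := fun v w => (hCp.isSymmSndFDerivAt (by simp)) v w
  obtain ⟨P, hP1, hP2, hP3, hP4⟩ := levi_poly _ H hsym hd p
  refine ⟨P, hP1, hP2, hP3, ?_⟩
  -- positivity
  have hlev : ∀ t : CSp n, t ≠ 0 → 0 < H t t + H (Complex.I • t) (Complex.I • t) := by
    intro t ht
    have := hlevi t ht
    rw [iteratedFDeriv_two_apply, iteratedFDeriv_two_apply] at this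
    simpa using this
  have hcoer : ∃ c > 0, ∀ t : CSp n, 8 * c * ‖t‖^2 ≤ H t t + H (Complex.I • t) (Complex.I • t) := by
    have hcont : Continuous (fun t : CSp n => H t t + H (Complex.I • t) (Complex.I • t)) := by fun_prop
    by_cases hne : (sphere (0 : CSp n) 1).Nonempty
    · obtain ⟨t0, ht0, hmin⟩ := (isCompact_sphere (0 : CSp n) 1).exists_isMinOn hne hcont.continuousOn
      have ht0' : t0 ≠ 0 := by rintro rfl; simp at ht0
      refine ⟨_, div_pos (hlev t0 ht0') (by norm_num : (0:ℝ) < 8), fun t => ?_⟩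
      by_cases ht : t = 0
      · simp [ht]
      have hn := norm_pos_iff.2 ht
      have h1 := hmin (a := (‖t‖⁻¹ : ℝ) • t) (by simp [norm_smul, hn.ne'])
      simp only [mem_setOf_eq, smul_comm Complex.I, map_smul, ContinuousLinearMap.smul_apply, smul_eq_mul] at h1
      have h2 : H t t + H (Complex.I • t) (Complex.I • t) = ‖t‖^2 * (‖t‖⁻¹ * (‖t‖⁻¹ * H t t) + ‖t‖⁻¹ * (‖t‖⁻¹ * H (Complex.I • t) (Complex.I • t))) := by
        field_simp
      rw [h2]
      have := mul_le_mul_of_nonneg_left h1 (sq_nonneg ‖t‖)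
      linarith
    · refine ⟨1, one_pos, fun t => ?_⟩
      have : t = 0 := by
        by_contra ht
        exact hne ⟨(‖t‖⁻¹ : ℝ) • t, by simp [norm_smul, (norm_pos_iff.2 ht).ne']⟩
      simp [this]
  obtain ⟨c, hc, hcb⟩ := hcoer
  have ht := taylor2 hCp hc
  have hU' : ∀ᶠ v in 𝓝 (0 : CSp n), p + v ∈ U := by
    have : Continuous (fun v : CSp n => p + v) := by fun_prop
    exact this.continuousAt.eventually (hU.mem_nhds (by simpa using hpU))
  obtain ⟨δ, hδ, hb⟩ := Metric.nhds_basis_closedBall.mem_iff.1 (ht.and hU')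
  refine ⟨c, hc, δ, hδ, fun z hz hzd => ?_⟩
  obtain ⟨h1, h2⟩ := hb (a := z - p) (by simpa [dist_eq_norm] using hzd)
  rw [add_sub_cancel] at h1 h2
  have h3 := hle z hz h2
  have h4 := hcb (z - p)
  have h5 := (abs_le.1 h1).1
  rw [hP4, dist_eq_norm]
  rw [hp0] at h5
  linarith

end PartC1
end

open Metric Set Filter Asymptotics
open scoped Manifold Topology
noncomputable section
section PartC2
variable {n : ℕ}

lemma re_inv_lt {w : ℂ} (h : w.re < 0) : (w⁻¹).re < 0 := by
  rw [Complex.inv_re]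
  apply div_neg_of_neg_of_pos h
  rw [Complex.normSq_pos]; rintro rfl; simp at h

set_option maxHeartbeats 1000000 in
theorem peak {K : Set (CSp n)} {p : CSp n} (hK : IsCompact K) (hs : HasSteinNbhdBasis K) (hpK : p ∈ K)
    {P : CSp n → ℂ} (hP : Differentiable ℂ P) (hp0 : P p = 0) {c r : ℝ} (hc : 0 < c) (hr : 0 < r)
    (hPr : ∀ z ∈ K, dist z p ≤ r → (P z).re ≤ -c * (dist z p)^2) :
    ∃ W : Set (CSp n), IsOpen W ∧ K ⊆ W ∧ ∃ Φ : CSp n → ℂ, DifferentiableOn ℂ Φ W ∧ Φ p = 0 ∧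
      fderiv ℂ Φ p = fderiv ℂ P p ∧ ∃ c' > 0, ∀ z ∈ K, (Φ z).re ≤ -c' * (dist z p)^2 := by
  have hPc := hP.continuous
  set c0 := c * r^2/8 with hc0
  have hc0p : 0 < c0 := by positivity
  have hcl : IsClosed {z : CSp n | r/2 ≤ dist z p ∧ dist z p ≤ r ∧ ‖P z‖ ≤ c0} := by
    apply IsClosed.inter
    · exact isClosed_le continuous_const (continuous_id.dist continuous_const)
    · exact (isClosed_le (continuous_id.dist continuous_const) continuous_const).inter (isClosed_le hPc.norm continuous_const)
  obtain ⟨V, hV, hKV, hVU⟩ := hs _ hcl.isOpen_compl (by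
    rintro z hz ⟨h1, h2, h3⟩
    have h4 := hPr z hz h2
    have h5 : |(P z).re| ≤ ‖P z‖ := Complex.abs_re_le_norm _
    have h6 := (abs_le.1 h5).1
    have h7 : (r/2)^2 ≤ (dist z p)^2 := by gcongr
    have : c * (r/2)^2 ≤ c * (dist z p)^2 := by gcongr
    have : c0 < c * (r/2)^2 := by rw [hc0]; nlinarith [sq_nonneg r, mul_pos hc (pow_pos hr 2)]
    linarith)
  obtain ⟨D, hD, hKD, hDV, S, h, hO1, hS, hh, hSh⟩ := cousin hV hK hKV hP hr hc0p (p := p) (by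
    intro z hz h1 h2
    by_contra h3
    push Not at h3
    exact hVU hz ⟨h1, h2, h3.le⟩)
  set O1 := D ∩ {z | z ∈ closedBall p r → P z ≠ 0} with hO1d
  set O2 := D ∩ ball p (r/2) with hO2d
  have hO2 : IsOpen O2 := hD.inter isOpen_ball
  have hpO2 : p ∈ O2 := ⟨hKD hpK, mem_ball_self (by linarith)⟩
  have hKneg : ∀ z ∈ K, z ≠ p → dist z p ≤ r → (P z).re < 0 := by
    intro z hz hzp hzr
    have h1 := hPr z hz hzr
    have h2 := dist_pos.2 hzp
    have : 0 < c * (dist z p)^2 := by positivity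
    linarith
  have hKO1 : ∀ z ∈ K, z ≠ p → z ∈ O1 := by
    intro z hz hzp
    refine ⟨hKD hz, fun hzr h0 => ?_⟩
    have := hKneg z hz hzp hzr
    rw [h0] at this; simp at this
  -- bound for h near p
  have hhc : ContinuousAt h p := (hh.continuousOn.continuousAt (hO2.mem_nhds hpO2))
  obtain ⟨M1, hM1⟩ : ∃ M1, ∀ᶠ z in 𝓝 p, ‖h z‖ ≤ M1 :=
    ⟨‖h p‖ + 1, (hhc.norm.eventually (gt_mem_nhds (by linarith : ‖h p‖ < ‖h p‖ + 1))).mono fun z hz => le_of_lt hz⟩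
  obtain ⟨δ, hδ, hδb⟩ := Metric.eventually_nhds_iff_ball.1 (hM1.and (hO2.mem_nhds hpO2))
  have hKδ : IsCompact (K \ ball p δ) := hK.diff isOpen_ball
  have hKδne : ∀ z ∈ K \ ball p δ, z ≠ p := fun z hz h => hz.2 (h ▸ mem_ball_self hδ)
  obtain ⟨M2, hM2⟩ := hKδ.exists_bound_of_continuousOn (f := S)
    (hS.continuousOn.mono fun z hz => hKO1 z hz.1 (hKδne z hz))
  set C0 : ℝ := |M1| + |M2| + 1 with hC0
  have hSneg : ∀ z ∈ K, z ≠ p → (S z - C0).re < 0 := by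
    intro z hz hzp
    rw [Complex.sub_re, Complex.ofReal_re]
    by_cases hzd : z ∈ ball p δ
    · obtain ⟨h1, h2⟩ := hδb z hzd
      have h3 : z ∈ closedBall p r := by
        have := h2.2; rw [mem_ball] at this; rw [mem_closedBall]; linarith
      have h4 := hKneg z hz hzp h3
      have hne : P z ≠ 0 := by rintro h0; rw [h0] at h4; simp at h4
      rw [hSh z h2 hne, Complex.add_re]
      have h5 := re_inv_lt h4
      have h6 := (Complex.re_le_norm (h z)).trans h1
      have := le_abs_self M1; have := abs_nonneg M2
      linarith
    · have h1 := (Complex.re_le_norm (S z)).trans (hM2 z ⟨hz, hzd⟩)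
      have := le_abs_self M2; have := abs_nonneg M1
      linarith
  classical
  set Φ : CSp n → ℂ := fun z => if z ∈ closedBall p r ∧ P z = 0 then 0 else (S z - C0)⁻¹ with hΦ
  set N : CSp n → ℂ := fun z => 1 + P z * (h z - C0) with hN
  have hΦ1 : ∀ z ∈ O1, Φ z = (S z - C0)⁻¹ := by
    intro z hz
    simp only [hΦ]
    rw [if_neg]
    rintro ⟨h1, h2⟩
    exact hz.2 h1 h2
  have hΦ2 : ∀ z ∈ O2, Φ z = P z * (N z)⁻¹ := by
    intro z hz
    have hzr : z ∈ closedBall p r := by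
        have := hz.2; rw [mem_ball] at this; rw [mem_closedBall]; linarith
    by_cases h0 : P z = 0
    · simp [hΦ, h0, mem_closedBall.1 hzr]
    · rw [hΦ1 z ⟨hz.1, fun _ => h0⟩, hSh z hz h0]
      have : (P z)⁻¹ + h z - C0 = (P z)⁻¹ * N z := by
        simp only [hN]; field_simp; ring
      rw [this, mul_inv, inv_inv]
  have hNd : DifferentiableOn ℂ N O2 :=
    (differentiableOn_const _).add (hP.differentiableOn.mul (hh.sub (differentiableOn_const _)))
  have hNp : N p = 1 := by simp [hN, hp0]
  set W1 := O1 ∩ {z | S z - C0 ≠ 0} with hW1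
  set W2 := O2 ∩ {z | N z ≠ 0} with hW2
  have hW1o : IsOpen W1 :=
    (hS.continuousOn.sub continuousOn_const).isOpen_inter_preimage hO1 isOpen_compl_singleton
  have hW2o : IsOpen W2 := hNd.continuousOn.isOpen_inter_preimage hO2 isOpen_compl_singleton
  have hpW2 : p ∈ W2 := ⟨hpO2, by show N p ≠ 0; rw [hNp]; exact one_ne_zero⟩
  have hinv2 : DifferentiableAt ℂ (fun z => P z * (N z)⁻¹) p :=
    (hP p).mul ((hNd.differentiableAt (hO2.mem_nhds hpO2)).inv hpW2.2)
  have hev : Φ =ᶠ[𝓝 p] (fun z => P z * (N z)⁻¹) := by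
    filter_upwards [hO2.mem_nhds hpO2] with z hz using hΦ2 z hz
  refine ⟨W1 ∪ W2, hW1o.union hW2o, ?_, Φ, ?_, ?_, ?_, ?_⟩
  · intro z hz
    by_cases hzp : z = p
    · right; rw [hzp]; exact hpW2
    · left; exact ⟨hKO1 z hz hzp, fun h0 => by have := hSneg z hz hzp; rw [h0] at this; simp at this⟩
  · rintro z (hz | hz)
    · have : DifferentiableAt ℂ (fun z => (S z - C0)⁻¹) z :=
        (((hS.differentiableAt (hO1.mem_nhds hz.1)).sub_const _).inv hz.2)
      refine (this.congr_of_eventuallyEq ?_).differentiableWithinAt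
      filter_upwards [hO1.mem_nhds hz.1] with y hy using hΦ1 y hy
    · have : DifferentiableAt ℂ (fun z => P z * (N z)⁻¹) z :=
        (hP z).mul ((hNd.differentiableAt (hO2.mem_nhds hz.1)).inv hz.2)
      refine (this.congr_of_eventuallyEq ?_).differentiableWithinAt
      filter_upwards [hO2.mem_nhds hz.1] with y hy using hΦ2 y hy
  · rw [hΦ2 p hpO2, hp0, zero_mul]
  · rw [hev.fderiv_eq, fderiv_fun_mul (hP p) ((hNd.differentiableAt (hO2.mem_nhds hpO2)).fun_inv hpW2.2), hp0, hNp]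
    simp
    ext u; simp
  · -- quadratic bound
    have hNc : ContinuousAt N p := hNd.continuousOn.continuousAt (hO2.mem_nhds hpO2)
    have hN2 : ∀ᶠ z in 𝓝 p, ‖N z‖ < 2 := hNc.norm.eventually (gt_mem_nhds (by show ‖N p‖ < 2; rw [hNp]; norm_num))
    obtain ⟨δ', hδ', hδb'⟩ := Metric.eventually_nhds_iff_ball.1 (hN2.and (ball_mem_nhds p hδ))
    have hnear : ∀ z ∈ K, z ∈ ball p δ' → (Φ z).re ≤ -(c/4) * (dist z p)^2 := by
      intro z hz hzd
      by_cases hzp : z = p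
      · rw [hzp, hΦ2 p hpO2, hp0]; simp
      obtain ⟨h1, h2⟩ := hδb' z hzd
      obtain ⟨h3, h4⟩ := hδb z h2
      have hzr : z ∈ closedBall p r := by
        have := h4.2; rw [mem_ball] at this; rw [mem_closedBall]; linarith
      have hneg := hKneg z hz hzp hzr
      have hPz := hPr z hz hzr
      have hP0 : P z ≠ 0 := by rintro h0; rw [h0] at hneg; simp at hneg
      have hS0 := hSneg z hz hzp
      have hSne : S z - C0 ≠ 0 := fun h0 => by rw [h0] at hS0; simp at hS0
      have hfac : S z - C0 = (P z)⁻¹ * N z := by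
        rw [hSh z h4 hP0]; simp only [hN]; field_simp; ring
      have hN0 : N z ≠ 0 := by rintro h0; rw [h0, mul_zero] at hfac; exact hSne hfac
      rw [hΦ1 z (hKO1 z hz hzp), Complex.inv_re]
      have hre : (S z - C0).re ≤ (P z).re / Complex.normSq (P z) := by
        rw [hSh z h4 hP0, Complex.sub_re, Complex.add_re, Complex.inv_re, Complex.ofReal_re]
        have h6 := (Complex.re_le_norm (h z)).trans h3
        have := le_abs_self M1; have := abs_nonneg M2
        linarith
      have hns : Complex.normSq (S z - C0) = (Complex.normSq (P z))⁻¹ * Complex.normSq (N z) := by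
        rw [hfac, map_mul, map_inv₀]
      have hnP : 0 < Complex.normSq (P z) := Complex.normSq_pos.2 hP0
      have hnN : 0 < Complex.normSq (N z) := Complex.normSq_pos.2 hN0
      have hnN4 : Complex.normSq (N z) ≤ 4 := by
        rw [Complex.normSq_eq_norm_sq]; nlinarith [norm_nonneg (N z)]
      calc (S z - C0).re / Complex.normSq (S z - C0) ≤ ((P z).re / Complex.normSq (P z)) / Complex.normSq (S z - C0) := by
            gcongr; exact Complex.normSq_nonneg _
        _ = (P z).re / Complex.normSq (N z) := by rw [hns]; field_simp
        _ ≤ (P z).re / 4 := by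
            rw [div_le_div_iff₀ hnN (by norm_num)]
            nlinarith
        _ ≤ _ := by linarith
    have hKc : IsCompact (K \ ball p δ') := hK.diff isOpen_ball
    have hKne : ∀ z ∈ K \ ball p δ', z ≠ p := fun z hz h => hz.2 (h ▸ mem_ball_self hδ')
    by_cases hne : (K \ ball p δ').Nonempty
    · have hcont : ContinuousOn (fun z => (Φ z).re) (K \ ball p δ') := by
        refine Complex.continuous_re.comp_continuousOn ?_
        have : ContinuousOn (fun z => (S z - C0)⁻¹) (K \ ball p δ') := by
          apply ((hS.continuousOn.mono fun z hz => hKO1 z hz.1 (hKne z hz)).sub continuousOn_const).inv₀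
          intro z hz h0
          replace h0 : S z - C0 = 0 := h0
          have := hSneg z hz.1 (hKne z hz); rw [h0] at this; simp at this
        exact this.congr fun z hz => hΦ1 z (hKO1 z hz.1 (hKne z hz))
      obtain ⟨z0, hz0, hmax⟩ := hKc.exists_isMaxOn hne hcont
      obtain ⟨R, hR⟩ := hK.isBounded.subset_closedBall p
      have hm0 : (Φ z0).re < 0 := by
        rw [hΦ1 z0 (hKO1 z0 hz0.1 (hKne z0 hz0))]
        exact re_inv_lt (hSneg z0 hz0.1 (hKne z0 hz0))
      have hR0 : 0 < R := (dist_pos.2 (hKne z0 hz0)).trans_le (hR hz0.1)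
      refine ⟨min (c/4) (-(Φ z0).re / R^2), lt_min (by positivity) (div_pos (by linarith) (by positivity)), fun z hz => ?_⟩
      by_cases hzd : z ∈ ball p δ'
      · refine (hnear z hz hzd).trans ?_
        have := min_le_left (c/4) (-(Φ z0).re / R^2)
        nlinarith [sq_nonneg (dist z p)]
      · have h1 : (Φ z).re ≤ (Φ z0).re := hmax ⟨hz, hzd⟩
        have h2 := min_le_right (c/4) (-(Φ z0).re / R^2)
        have h3 : dist z p ≤ R := hR hz
        have h4 : (dist z p)^2 ≤ R^2 := by gcongr
        have h5 : -(Φ z0).re / R^2 * (dist z p)^2 ≤ -(Φ z0).re := by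
          rw [div_mul_eq_mul_div, div_le_iff₀ (by positivity)]
          exact mul_le_mul_of_nonneg_left h4 (by linarith)
        nlinarith [sq_nonneg (dist z p)]
    · refine ⟨c/4, by positivity, fun z hz => hnear z hz ?_⟩
      by_contra h
      exact hne ⟨z, hz, h⟩

end PartC2
end

open Metric Set Filter Asymptotics
open scoped Manifold Topology
noncomputable section
section PartD1
variable {n : ℕ}

lemma norm_eB (i : Fin n) : ‖eB i‖ = 1 := by simp [eB]

lemma norm_smul_eB (i : Fin n) {t : ℝ} (ht : 0 ≤ t) : ‖t • eB i‖ = t := by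
  rw [norm_smul, norm_eB, mul_one, Real.norm_of_nonneg ht]

lemma re_smul_eB (i : Fin n) (t : ℝ) : ((t • eB i) i).re = t := by simp [eB]

/-- base curve -/
theorem base_curve {K : Set (CSp n)} (hK : IsCompact K)
    (hconn : IsPathConnected Kᶜ) (i : Fin n) {r1 C1 : ℝ} (hr1 : 0 < r1) (hC1 : 0 < C1)
    (hcone : ∀ z ∈ K, ‖z‖ ≤ r1 → (z i).re ≤ C1 * ‖z‖^2) :
    ∃ s0 T0 T : ℝ, 0 < s0 ∧ s0 < T0 ∧ T0 + 1 < T ∧ K ⊆ ball 0 T ∧ ∃ g : ℝ → CSp n,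
      Continuous g ∧ (∀ s ≤ s0, g s = 0) ∧ (∀ s, T0 ≤ s → g s = 0) ∧
      (∀ s, 0 < s → s ≤ T → s • eB i + (s * (T - s)^2) • g s ∉ K) ∧
      (∀ s, 0 ≤ s → s ≤ T0 → ‖s • eB i + (s * (T - s)^2) • g s‖ ≤ T - 1) := by
  set s0 := min r1 (C1⁻¹/2) with hs0
  have hs0p : 0 < s0 := lt_min hr1 (by positivity)
  have hsK : ∀ s, 0 < s → s ≤ s0 → s • eB i ∉ K := by
    intro s h1 h2 h3
    have h4 := hcone _ h3 (by rw [norm_smul_eB i h1.le]; exact h2.trans (min_le_left _ _))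
    rw [re_smul_eB, norm_smul_eB i h1.le] at h4
    have h5 : s ≤ C1⁻¹/2 := h2.trans (min_le_right _ _)
    have h6 : C1 * s ≤ 1/2 := by
      calc C1 * s ≤ C1 * (C1⁻¹/2) := by gcongr
        _ = 1/2 := by field_simp
    nlinarith
  obtain ⟨R, hR0, hR⟩ := hK.isBounded.subset_ball_lt 0 0
  set T0 := s0 + R with hT0
  have hTK : ∀ s, T0 ≤ s → s • eB i ∉ K := by
    intro s h1 h2
    have := hR h2
    rw [mem_ball_zero_iff, norm_smul_eB i (by linarith)] at this
    linarith
  obtain ⟨γp, hγp⟩ := hconn.joinedIn _ (hsK s0 hs0p le_rfl) _ (hTK T0 le_rfl)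
  set d := T0 - s0 with hd
  have hdp : 0 < d := by linarith
  set γ : ℝ → CSp n := fun s => γp.extend ((s - s0)/d) + (s - max s0 (min s T0)) • eB i with hγ
  have hγc : Continuous γ := by
    have : Continuous (fun s : ℝ => γp.extend ((s - s0)/d)) := γp.continuous_extend.comp (by fun_prop)
    exact this.add (by fun_prop)
  have hγ1 : ∀ s, s ≤ s0 → γ s = s • eB i := by
    intro s hs
    simp only [hγ]
    rw [γp.extend_of_le_zero (div_nonpos_of_nonpos_of_nonneg (by linarith) hdp.le),
      max_eq_left ((min_le_left _ _).trans hs), ← add_smul]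
    congr 1; ring
  have hγ2 : ∀ s, T0 ≤ s → γ s = s • eB i := by
    intro s hs
    simp only [hγ]
    rw [γp.extend_of_one_le (by rw [le_div_iff₀ hdp]; linarith), min_eq_right hs, max_eq_right (by linarith),
      ← add_smul]
    congr 1; ring
  have hγ3 : ∀ s, s0 ≤ s → s ≤ T0 → γ s ∉ K := by
    intro s h1 h2
    simp only [hγ]
    rw [min_eq_left h2, max_eq_right h1, sub_self, zero_smul, add_zero]
    have hm : (s - s0)/d ∈ Icc (0:ℝ) 1 := ⟨div_nonneg (by linarith) hdp.le, by rw [div_le_one hdp]; linarith⟩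
    rw [γp.extend_apply hm]
    exact hγp _
  obtain ⟨R', hR'⟩ := (isCompact_Icc (a := (0:ℝ)) (b := T0)).exists_bound_of_continuousOn hγc.continuousOn
  have hR'0 : 0 ≤ R' := (norm_nonneg _).trans (hR' 0 ⟨le_rfl, by linarith⟩)
  set T := R' + T0 + R + 2 with hT
  set g : ℝ → CSp n := fun s => (s * (T - s)^2)⁻¹ • (γ s - s • eB i) with hg
  have hg1 : ∀ s ≤ s0, g s = 0 := fun s hs => by simp [hg, hγ1 s hs]
  have hg2 : ∀ s, T0 ≤ s → g s = 0 := fun s hs => by simp [hg, hγ2 s hs]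
  have hgγ : ∀ s, s • eB i + (s * (T - s)^2) • g s = γ s := by
    intro s
    by_cases h1 : s ≤ s0
    · rw [hg1 s h1, hγ1 s h1]; simp
    by_cases h2 : T0 ≤ s
    · rw [hg2 s h2, hγ2 s h2]; simp
    push Not at h1 h2
    have : s * (T - s)^2 ≠ 0 := by
      apply mul_ne_zero (by linarith)
      apply pow_ne_zero; linarith
    simp only [hg]
    rw [smul_smul, mul_inv_cancel₀ this, one_smul]; abel
  refine ⟨s0, T0, T, hs0p, by linarith, by linarith, hR.trans (ball_subset_ball (by linarith)), g, ?_, hg1, hg2, ?_, ?_⟩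
  · rw [continuous_iff_continuousAt]
    intro s
    by_cases h1 : s < s0
    · have : g =ᶠ[𝓝 s] fun _ => 0 := by
        filter_upwards [gt_mem_nhds h1] with y hy using hg1 y (le_of_lt hy)
      exact continuousAt_const.congr this.symm
    by_cases h2 : T0 < s
    · have : g =ᶠ[𝓝 s] fun _ => 0 := by
        filter_upwards [lt_mem_nhds h2] with y hy using hg2 y (le_of_lt hy)
      exact continuousAt_const.congr this.symm
    push Not at h1 h2
    have : s * (T - s)^2 ≠ 0 := by
      apply mul_ne_zero (by linarith)
      apply pow_ne_zero; linarith
    have hc : ContinuousAt (fun s : ℝ => s * (T - s)^2) s := by fun_prop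
    exact (hc.inv₀ this).smul (hγc.sub (by fun_prop)).continuousAt
  · intro s h1 h2
    rw [hgγ]
    by_cases h3 : s ≤ s0
    · rw [hγ1 s h3]; exact hsK s h1 h3
    by_cases h4 : T0 ≤ s
    · rw [hγ2 s h4]; exact hTK s h4
    push Not at h3 h4
    exact hγ3 s h3.le h4.le
  · intro s h1 h2
    rw [hgγ]
    exact (hR' s ⟨h1, h2⟩).trans (by linarith)

theorem robust_curve {K : Set (CSp n)} (hK : IsCompact K)
    (hconn : IsPathConnected Kᶜ) (i : Fin n) {r1 C1 : ℝ} (hr1 : 0 < r1) (hC1 : 0 < C1)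
    (hcone : ∀ z ∈ K, ‖z‖ ≤ r1 → (z i).re ≤ C1 * ‖z‖^2) :
    ∃ T : ℝ, 0 < T ∧ K ⊆ ball 0 T ∧ ∃ g : ℝ → CSp n, Continuous g ∧ ∃ ε > 0,
      ∀ h : ℝ → CSp n, (∀ s, 0 ≤ s → s ≤ T → ‖h s - g s‖ ≤ ε) →
      (∀ s, 0 < s → s ≤ T → s • eB i + (s * (T - s)^2) • h s ∉ K) ∧
      (∀ s, 0 ≤ s → s < T → ‖s • eB i + (s * (T - s)^2) • h s‖ < T) ∧
      0 < 1 + T^2 * ((h 0) i).re := by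
  obtain ⟨s0, T0, T, hs0, hsT, hTT, hKT, g, hg, hg1, hg2, hgK, hgB⟩ := base_curve hK hconn i hr1 hC1 hcone
  have hT : 0 < T := by linarith
  set s2 := min s0 (min (r1 / 2) (C1⁻¹ / 9)) with hs2
  have hs2p : 0 < s2 := lt_min hs0 (lt_min (by positivity) (by positivity))
  -- distance
  have hγc : Continuous (fun s : ℝ => s • eB i + (s * (T - s)^2) • g s) := by fun_prop
  obtain ⟨d, hd, hdK⟩ : ∃ d > 0, ∀ s, s2 ≤ s → s ≤ T → ∀ z ∈ K, d ≤ dist (s • eB i + (s * (T - s)^2) • g s) z := by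
    have hdis : Disjoint ((fun s : ℝ => s • eB i + (s * (T - s)^2) • g s) '' Icc s2 T) K := by
      rw [Set.disjoint_left]
      rintro _ ⟨s, hs, rfl⟩
      exact hgK s (hs2p.trans_le hs.1) hs.2
    obtain ⟨d, hd, hb⟩ := hdis.exists_thickenings (isCompact_Icc.image hγc) hK.isClosed
    refine ⟨d, hd, fun s h1 h2 z hz => ?_⟩
    by_contra h
    push Not at h
    exact Set.disjoint_left.1 hb
      (mem_thickening_iff.2 ⟨_, ⟨s, ⟨h1, h2⟩, rfl⟩, by rw [dist_comm]; exact h⟩)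
      (self_subset_thickening hd _ hz)
  set A := T^3 + T^2 + 1 with hA
  have hAp : 0 < A := by positivity
  set ε := min (1/2) (d/2) / A with hε
  have hεp : 0 < ε := div_pos (lt_min (by norm_num) (by linarith)) hAp
  have hεA : ε * A = min (1/2) (d/2) := by rw [hε, div_mul_cancel₀ _ hAp.ne']
  have e1 : ε * T^3 + ε * T^2 + ε ≤ 1/2 := by
    have : ε * A ≤ 1/2 := hεA ▸ min_le_left _ _
    rw [hA] at this; linarith
  have e2 : ε * T^3 + ε * T^2 + ε ≤ d/2 := by
    have : ε * A ≤ d/2 := hεA ▸ min_le_right _ _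
    rw [hA] at this; linarith
  have p3 : 0 < ε * T^3 := by positivity
  have p2 : 0 < ε * T^2 := by positivity
  refine ⟨T, hT, hKT, g, hg, ε, hεp, fun h hh => ?_⟩
  have hdiff : ∀ s, 0 ≤ s → s ≤ T → ‖(s • eB i + (s * (T - s)^2) • h s) - (s • eB i + (s * (T - s)^2) • g s)‖
      ≤ s * (T - s)^2 * ε := by
    intro s h1 h2
    rw [add_sub_add_left_eq_sub, ← smul_sub, norm_smul, Real.norm_of_nonneg (by positivity)]
    gcongr
    exact hh s h1 h2
  have hb3 : ∀ s, 0 ≤ s → s ≤ T → s * (T - s)^2 * ε ≤ ε * T^3 := by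
    intro s h1 h2
    have : s * (T - s)^2 ≤ T * T^2 := by gcongr; linarith
    nlinarith
  have hb2 : ∀ s, 0 ≤ s → s ≤ T → s * (T - s)^2 * ε ≤ s * (ε * T^2) := by
    intro s h1 h2
    have : (T - s)^2 ≤ T^2 := by gcongr; linarith
    have : s * (T-s)^2 ≤ s * T^2 := by gcongr
    nlinarith
  refine ⟨?_, ?_, ?_⟩
  · intro s h1 h2 hK'
    by_cases h3 : s2 ≤ s
    · have h4 := hdK s h3 h2 _ hK'
      rw [dist_comm, dist_eq_norm] at h4
      have := hdiff s h1.le h2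
      have := hb3 s h1.le h2
      linarith
    · push Not at h3
      have hs0' : s ≤ s0 := h3.le.trans (min_le_left _ _)
      have h5 := hdiff s h1.le h2
      rw [hg1 s hs0', smul_zero, add_zero] at h5
      have h6 := hb2 s h1.le h2
      set z := s • eB i + (s * (T - s)^2) • h s with hz
      have h7 : ‖z - s • eB i‖ ≤ s / 2 := by nlinarith
      have h8 : ‖z‖ ≤ 3/2 * s := by
        calc ‖z‖ = ‖(z - s • eB i) + s • eB i‖ := by congr 1; abel
          _ ≤ _ := (norm_add_le _ _).trans (by rw [norm_smul_eB i h1.le]; linarith)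
      have h9 : s/2 ≤ (z i).re := by
        have h10 : |((z - s • eB i) i).re| ≤ s/2 :=
          (Complex.abs_re_le_norm _).trans ((PiLp.norm_apply_le _ i).trans h7)
        have h11 : ((z - s • eB i) i).re = (z i).re - s := by
          rw [PiLp.sub_apply, Complex.sub_re, re_smul_eB]
        rw [h11] at h10
        linarith [(abs_le.1 h10).1]
      have hr : s ≤ r1/2 := h3.le.trans ((min_le_right _ _).trans (min_le_left _ _))
      have hCs : s ≤ C1⁻¹/9 := h3.le.trans ((min_le_right _ _).trans (min_le_right _ _))
      have h12 := hcone z hK' (by linarith)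
      have h13 : ‖z‖^2 ≤ (3/2*s)^2 := by gcongr
      have h14 : C1 * s ≤ 1/9 := by
        calc C1 * s ≤ C1 * (C1⁻¹/9) := by gcongr
          _ = 1/9 := by field_simp
      have h15 : C1 * ‖z‖^2 ≤ C1 * (3/2*s)^2 := by gcongr
      nlinarith
  · intro s h1 h2
    have h3 := hdiff s h1 h2.le
    have h4 := norm_le_norm_add_norm_sub' (s • eB i + (s * (T - s)^2) • h s) (s • eB i + (s * (T - s)^2) • g s)
    by_cases h5 : s ≤ T0
    · have := hgB s h1 h5
      have := hb3 s h1 h2.le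
      linarith
    · push Not at h5
      have h6 : ‖s • eB i + (s * (T - s)^2) • g s‖ = s := by
        rw [hg2 s h5.le, smul_zero, add_zero, norm_smul_eB i h1]
      have h7 : s * (T - s)^2 * ε < T - s := by
        have h8 : 0 < T - s := by linarith
        have h9 : s * (T - s) * ε < 1 := by
          have : s * (T - s) ≤ T * T := by gcongr; linarith
          nlinarith
        nlinarith
      linarith
  · have h1 := hh 0 le_rfl hT.le
    rw [hg1 0 hs0.le, sub_zero] at h1
    have h2 : |((h 0) i).re| ≤ ε := (Complex.abs_re_le_norm _).trans ((PiLp.norm_apply_le _ i).trans h1)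
    have h3 := (abs_le.1 h2).1
    have : T^2 * (-ε) ≤ T^2 * ((h 0) i).re := by gcongr
    linarith

end PartD1
end

open Metric Set Filter Asymptotics
open scoped Manifold Topology
noncomputable section
section PartD2
variable {n : ℕ}

theorem weier_vec {g : ℝ → CSp n} (hg : Continuous g) (T : ℝ) {ε : ℝ} (hε : 0 < ε) :
    ∃ k : ℂ → CSp n, Differentiable ℂ k ∧ ∀ t : ℝ, 0 ≤ t → t ≤ T → ‖k (t:ℂ) - g t‖ ≤ ε := by
  have hgc : ∀ j, Continuous (fun t => g t j) := fun j => by fun_prop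
  set δ := ε / (2 * (n + 1)) with hδ
  have hδp : 0 < δ := by positivity
  have h1 : ∀ j : Fin n, ∃ p : Polynomial ℝ, ∀ x ∈ Icc 0 T, |p.eval x - (g x j).re| < δ := fun j =>
    exists_polynomial_near_of_continuousOn 0 T (fun t => (g t j).re)
      (Complex.continuous_re.comp (hgc j)).continuousOn δ hδp
  have h2 : ∀ j : Fin n, ∃ p : Polynomial ℝ, ∀ x ∈ Icc 0 T, |p.eval x - (g x j).im| < δ := fun j =>
    exists_polynomial_near_of_continuousOn 0 T (fun t => (g t j).im)
      (Complex.continuous_im.comp (hgc j)).continuousOn δ hδp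
  choose p hp using h1
  choose r hr using h2
  let c : Fin n → ℂ → ℂ := fun j s => ((p j).map (algebraMap ℝ ℂ)).eval s +
    Complex.I * ((r j).map (algebraMap ℝ ℂ)).eval s
  have hc : ∀ j, Differentiable ℂ (c j) := fun j =>
    (Polynomial.differentiable _).add ((differentiable_const _).mul (Polynomial.differentiable _))
  refine ⟨fun s => ∑ j, c j s • eB j, ?_, fun t h0 hT => ?_⟩
  · exact Differentiable.fun_sum fun j _ => (hc j).smul_const _
  · have hdec : g t = ∑ j, (g t j) • (eB j : CSp n) := by
      ext l
      simp [eB, Pi.single_apply]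
    have hev : ∀ (P : Polynomial ℝ), (P.map (algebraMap ℝ ℂ)).eval (t:ℂ) = ((P.eval t : ℝ) : ℂ) := by
      intro P
      have := Polynomial.eval_map_algebraMap P (t:ℂ)
      rw [this]
      exact Polynomial.aeval_ofReal P t
    have hcj : ∀ j, ‖c j t - g t j‖ ≤ 2 * δ := by
      intro j
      have e : c j t - g t j = (((p j).eval t - (g t j).re : ℝ) : ℂ) +
          Complex.I * (((r j).eval t - (g t j).im : ℝ) : ℂ) := by
        simp only [c, hev]
        apply Complex.ext <;> simp
      rw [e]
      refine (norm_add_le _ _).trans ?_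
      rw [norm_mul, Complex.norm_I, one_mul, Complex.norm_real, Complex.norm_real, Real.norm_eq_abs,
        Real.norm_eq_abs]
      linarith [hp j t ⟨h0, hT⟩, hr j t ⟨h0, hT⟩]
    rw [hdec, ← Finset.sum_sub_distrib]
    refine (norm_sum_le _ _).trans ?_
    have : ∀ j ∈ (Finset.univ : Finset (Fin n)), ‖c j t • (eB j : CSp n) - g t j • eB j‖ ≤ 2 * δ := by
      intro j _
      rw [← sub_smul, norm_smul, norm_eB, mul_one]; exact hcj j
    refine (Finset.sum_le_sum this).trans ?_
    rw [Finset.sum_const, Finset.card_univ, Fintype.card_fin, nsmul_eq_mul, hδ]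
    have : (n:ℝ) * (2 * (ε / (2 * (n+1)))) = ε * (n / (n+1)) := by field_simp
    rw [this]
    have h3 : (n:ℝ) / (n+1) ≤ 1 := by rw [div_le_one (by positivity)]; linarith
    nlinarith

theorem avoid_dense {X E : Type*} [NormedAddCommGroup X] [NormedSpace ℝ X] [FiniteDimensional ℝ X]
    [NormedAddCommGroup E] [NormedSpace ℝ E] [FiniteDimensional ℝ E]
    {s : Set X} (hs : IsOpen s) {F : X → E} (hF : ContDiffOn ℝ 1 F s)
    (h : Module.finrank ℝ X < Module.finrank ℝ E) : Dense (F '' s)ᶜ := by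
  apply dense_compl_of_dimH_lt_finrank
  have h1 : dimH (F '' s) ≤ dimH s := by
    apply dimH_image_le_of_locally_lipschitzOn
    intro x hx
    obtain ⟨C, t, ht, hl⟩ := (hF.contDiffAt (hs.mem_nhds hx)).exists_lipschitzOnWith
    exact ⟨C, t, mem_nhdsWithin_of_mem_nhds ht, hl⟩
  have h2 : dimH s ≤ Module.finrank ℝ X := by
    refine (dimH_mono (subset_univ s)).trans ?_
    rw [Real.dimH_univ_eq_finrank]
  exact (h1.trans h2).trans_lt (by exact_mod_cast h)

end PartD2
end

open Metric Set Filter Asymptotics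
open scoped Manifold Topology
noncomputable section
section PartD3
variable {n : ℕ}

def mS (T : ℝ) (s : ℂ) : ℂ := s * ((T:ℂ) - s)^2 * (1 + Complex.I * s)
def mS' (T : ℝ) (s : ℂ) : ℂ :=
  ((T:ℂ) - s) * (((T:ℂ) - 3 * s) * (1 + Complex.I * s) + Complex.I * s * ((T:ℂ) - s))

theorem mS_hasDeriv (T : ℝ) (s : ℂ) : HasDerivAt (mS T) (mS' T s) s := by
  have h1 : HasDerivAt (fun s : ℂ => s) 1 s := hasDerivAt_id s
  have h2 : HasDerivAt (fun s : ℂ => (T:ℂ) - s) (-1) s := by simpa using h1.const_sub (T:ℂ)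
  have h3 : HasDerivAt (fun s : ℂ => 1 + Complex.I * s) (Complex.I) s := by
    simpa using (h1.const_mul Complex.I).const_add 1
  have := (h1.mul (h2.pow 2)).mul h3
  refine this.congr_deriv ?_
  simp only [mS', Pi.mul_apply, Pi.pow_apply]
  push_cast
  ring

theorem mS'_diff (T : ℝ) : Differentiable ℂ (mS' T) := by unfold mS'; fun_prop

theorem mS_eq {T : ℝ} {s t : ℝ} (h : mS T s = mS T t) : s = t ∨ (s * (T - s)^2 = 0 ∧ t * (T - t)^2 = 0) := by
  have e : ∀ s : ℝ, mS T s = ((s * (T - s)^2 : ℝ) : ℂ) + Complex.I * ((s * (s * (T - s)^2) : ℝ) : ℂ) := by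
    intro s; simp only [mS]; push_cast; ring
  rw [e, e] at h
  have h1 := congrArg Complex.re h
  have h2 := congrArg Complex.im h
  simp only [Complex.add_re, Complex.ofReal_re, Complex.mul_re, Complex.I_re, Complex.I_im,
    Complex.ofReal_im, Complex.add_im, Complex.mul_im] at h1 h2
  set A := s * (T - s)^2
  set B := t * (T - t)^2
  have hAB : A = B := by linarith
  rw [← hAB] at h2 ⊢
  by_cases hA : A = 0
  · right; exact ⟨hA, hA⟩
  · left; exact mul_right_cancel₀ hA (by linarith)

theorem mS'_ne {T s : ℝ} (h0 : 0 ≤ s) (hT : s < T) : mS' T s ≠ 0 := by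
  intro h
  unfold mS' at h
  have h1 : (T:ℂ) - s ≠ 0 := by
    rw [← Complex.ofReal_sub]; exact Complex.ofReal_ne_zero.2 (by linarith)
  have h2 := (mul_eq_zero.1 h).resolve_left h1
  have e : ((T:ℂ) - 3 * s) * (1 + Complex.I * s) + Complex.I * s * ((T:ℂ) - s)
    = ((T - 3 * s : ℝ) : ℂ) + Complex.I * (((T - 3*s) * s + s * (T - s) : ℝ) : ℂ) := by push_cast; ring
  rw [e] at h2
  have h3 := congrArg Complex.re h2
  have h4 := congrArg Complex.im h2
  simp only [Complex.add_re, Complex.ofReal_re, Complex.mul_re, Complex.I_re, Complex.I_im,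
    Complex.ofReal_im, Complex.add_im, Complex.mul_im, Complex.zero_re, Complex.zero_im] at h3 h4
  have h5 : T = 3 * s := by linarith
  subst h5
  nlinarith

theorem diff_contDiff_real {E : Type*} [NormedAddCommGroup E] [NormedSpace ℂ E] [CompleteSpace E]
    {Q : ℂ → E} (hQ : Differentiable ℂ Q) : ContDiff ℝ 1 (fun t : ℝ => Q t) :=
  ((hQ.contDiff (n := 1)).restrict_scalars ℝ).comp Complex.ofRealCLM.contDiff

theorem generic_curve (hn : 2 ≤ n) {T : ℝ} (hT : 0 < T) (i : Fin n) {Q : ℂ → CSp n}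
    (hQ : Differentiable ℂ Q) (h0T : Q 0 ≠ Q T) (hdT : (deriv Q T) i ≠ 0) {η : ℝ} (hη : 0 < η) :
    ∃ a : CSp n, ‖a‖ ≤ η ∧
      (∀ t : ℝ, 0 ≤ t → t ≤ T → (deriv Q t) i + mS' T t * a i ≠ 0) ∧
      InjOn (fun t : ℝ => Q t + mS T t • a) (Icc 0 T) := by
  have hdQ : Differentiable ℂ (fun s => (deriv Q s) i) := by
    have : Differentiable ℂ (deriv Q) := fun z =>
      ((hQ.differentiableOn (s := univ)).deriv isOpen_univ).differentiableAt univ_mem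
    exact (EuclideanSpace.proj (𝕜 := ℂ) i).differentiable.comp this
  have hm : Differentiable ℂ (mS T) := fun s => (mS_hasDeriv T s).differentiableAt
  have hmT : mS' T T = 0 := by simp [mS']
  -- step 1
  obtain ⟨α, hα, hα1⟩ : ∃ α : ℂ, ‖α‖ < η / 2 ∧ ∀ t : ℝ, 0 ≤ t → t ≤ T →
      (deriv Q t) i + mS' T t * α ≠ 0 := by
    have ho : IsOpen {t : ℝ | mS' T t ≠ 0} :=
      isOpen_ne_fun ((mS'_diff T).continuous.comp Complex.continuous_ofReal) continuous_const
    have hd := avoid_dense (E := ℂ) ho (F := fun t : ℝ => - (deriv Q t) i / mS' T t)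
      (by
        simp only [div_eq_mul_inv]
        refine ContDiffOn.mul (diff_contDiff_real hdQ).neg.contDiffOn
          (ContDiffOn.inv (diff_contDiff_real (mS'_diff T)).contDiffOn ?_)
        intro x hx; exact hx)
      (by rw [Complex.finrank_real_complex]; simp)
    obtain ⟨α, hα, hb⟩ := hd.exists_mem_open isOpen_ball ⟨0, mem_ball_self (x := (0:ℂ)) (half_pos hη)⟩
    refine ⟨α, by simpa using hb, fun t h0 h1 he => ?_⟩
    rcases h1.lt_or_eq with h | rfl
    · refine hα ⟨t, mS'_ne h0 h, ?_⟩
      have := mS'_ne h0 h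
      show - (deriv Q t) i / mS' T t = α
      field_simp
      linear_combination -he
    · rw [hmT] at he; simp at he; exact hdT he
  -- lower bound
  obtain ⟨c, hc, hcb⟩ : ∃ c > 0, ∀ t : ℝ, 0 ≤ t → t ≤ T → c ≤ ‖(deriv Q t) i + mS' T t * α‖ := by
    have hcont : Continuous (fun t : ℝ => ‖(deriv Q t) i + mS' T t * α‖) := by
      have h1 := hdQ.continuous.comp Complex.continuous_ofReal
      have h2 := (mS'_diff T).continuous.comp Complex.continuous_ofReal
      exact (h1.add (h2.mul continuous_const)).norm
    obtain ⟨t0, ht0, hmin⟩ := (isCompact_Icc (a := (0:ℝ)) (b := T)).exists_isMinOn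
      ⟨0, le_refl _, hT.le⟩ hcont.continuousOn
    exact ⟨_, norm_pos_iff.2 (hα1 t0 ht0.1 ht0.2), fun t h1 h2 => hmin ⟨h1, h2⟩⟩
  obtain ⟨C, hC⟩ : ∃ C, ∀ t : ℝ, 0 ≤ t → t ≤ T → ‖mS' T t‖ ≤ C := by
    have hcont : Continuous (fun t : ℝ => mS' T t) :=
      (mS'_diff T).continuous.comp Complex.continuous_ofReal
    obtain ⟨C, hC⟩ := (isCompact_Icc (a := (0:ℝ)) (b := T)).exists_bound_of_continuousOn hcont.continuousOn
    exact ⟨C, fun t h1 h2 => hC t ⟨h1, h2⟩⟩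
  have hC0 : 0 ≤ C := (norm_nonneg _).trans (hC 0 le_rfl hT.le)
  -- step 2
  set Q1 : ℂ → CSp n := fun s => Q s + mS T s • (α • eB i) with hQ1
  have hQ1d : Differentiable ℂ Q1 := hQ.add (hm.smul_const _)
  have hQ1c := diff_contDiff_real hQ1d
  have hmc := diff_contDiff_real hm
  have ho : IsOpen {x : ℝ × ℝ | mS T x.1 - mS T x.2 ≠ 0} :=
    isOpen_ne_fun ((hmc.continuous.comp continuous_fst).sub (hmc.continuous.comp continuous_snd))
      continuous_const
  have hd := avoid_dense (E := CSp n) ho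
    (F := fun x : ℝ × ℝ => (mS T x.1 - mS T x.2)⁻¹ • (Q1 x.2 - Q1 x.1))
    (by
      refine ContDiffOn.smul (ContDiffOn.inv ?_ fun x hx => hx) ?_
      · exact ((hmc.comp contDiff_fst).sub (hmc.comp contDiff_snd)).contDiffOn
      · exact ((hQ1c.comp contDiff_snd).sub (hQ1c.comp contDiff_fst)).contDiffOn)
    (by rw [finrank_CSp]; simp; omega)
  set η2 := min (η/2) (c / (2 * (C + 1))) with hη2
  have hηp2 : 0 < η2 := lt_min (half_pos hη) (by positivity)
  obtain ⟨a2, ha2, hb⟩ := hd.exists_mem_open isOpen_ball ⟨0, mem_ball_self (x := (0:CSp n)) hηp2⟩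
  have hb' : ‖a2‖ < η2 := by simpa using hb
  refine ⟨α • eB i + a2, ?_, ?_, ?_⟩
  · refine (norm_add_le _ _).trans ?_
    rw [norm_smul, norm_eB, mul_one]
    linarith [hη2.le.trans (min_le_left _ _)]
  · intro t h0 h1 he
    have e : (α • eB i + a2 : CSp n) i = α + a2 i := by simp [eB]
    rw [e, mul_add, ← add_assoc] at he
    have h2 := hcb t h0 h1
    rw [eq_neg_of_add_eq_zero_left he, norm_neg, norm_mul] at h2
    have h3 : ‖a2 i‖ ≤ ‖a2‖ := PiLp.norm_apply_le a2 i
    have h4 : ‖a2 i‖ ≤ c / (2 * (C+1)) := h3.trans (hb'.le.trans (min_le_right _ _))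
    have h5 : ‖mS' T t‖ * ‖a2 i‖ ≤ C * (c / (2 * (C+1))) :=
      mul_le_mul (hC t h0 h1) h4 (norm_nonneg _) hC0
    have h6 : C * (c / (2 * (C+1))) ≤ c / 2 := by
      rw [← mul_div_assoc, div_le_div_iff₀ (by positivity) (by norm_num)]
      nlinarith
    linarith
  · intro t ht t' ht' he
    have he' : Q1 t + mS T t • a2 = Q1 t' + mS T t' • a2 := by
      have he2 : Q t + mS T t • (α • eB i + a2) = Q t' + mS T t' • (α • eB i + a2) := he
      simp only [hQ1]
      rw [add_assoc, add_assoc, ← smul_add, ← smul_add]; exact he2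
    by_cases hmm : mS T t - mS T t' = 0
    · rcases mS_eq (sub_eq_zero.1 hmm) with h | ⟨h1, h2⟩
      · exact h
      · have hz : ∀ s : ℝ, s * (T - s)^2 = 0 → s = 0 ∨ s = T := by
          intro s hs
          rcases mul_eq_zero.1 hs with h | h
          · exact Or.inl h
          · right; have := pow_eq_zero_iff (two_ne_zero) |>.1 h; linarith
        have he3 : Q t = Q t' := by
          have hm0 : mS T t = mS T t' := sub_eq_zero.1 hmm
          have he2 : Q t + mS T t • (α • eB i + a2) = Q t' + mS T t' • (α • eB i + a2) := he
          rw [hm0] at he2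
          exact add_right_cancel he2
        rcases hz t h1 with rfl | rfl <;> rcases hz t' h2 with rfl | h3
        · rfl
        · subst h3; simp at he3; exact absurd he3 (by simpa using h0T)
        · simp at he3; exact absurd he3.symm (by simpa using h0T)
        · exact h3.symm
    · exfalso
      refine ha2 ⟨(t, t'), hmm, ?_⟩
      show (mS T t - mS T t')⁻¹ • (Q1 t' - Q1 t) = a2
      rw [inv_smul_eq_iff₀ hmm, sub_smul]
      rw [sub_eq_sub_iff_add_eq_add, ← he', add_comm]

end PartD3
end

open Metric Set Filter Asymptotics
open scoped Manifold Topology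
noncomputable section
section PartD4
variable {n : ℕ}

theorem curve_exists (hn : 2 ≤ n) {K : Set (CSp n)} (hK : IsCompact K) (hconn : IsPathConnected Kᶜ)
    (i : Fin n) {r1 C1 : ℝ} (hr1 : 0 < r1) (hC1 : 0 < C1)
    (hcone : ∀ z ∈ K, ‖z‖ ≤ r1 → (z i).re ≤ C1 * ‖z‖^2) :
    ∃ T : ℝ, 0 < T ∧ K ⊆ ball 0 T ∧ ∃ q : ℂ → CSp n, Differentiable ℂ q ∧
      q 0 = 0 ∧ q T = (T:ℂ) • eB i ∧ deriv q T = eB i ∧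
      InjOn (fun t : ℝ => q t) (Icc 0 T) ∧
      (∀ t : ℝ, 0 ≤ t → t ≤ T → (deriv q t) i ≠ 0) ∧ 0 < ((deriv q 0) i).re ∧
      (∀ t : ℝ, 0 < t → t ≤ T → q t ∉ K) ∧
      (∀ t : ℝ, 0 ≤ t → t < T → ‖q t‖ < T) := by
  obtain ⟨T, hT, hKT, g, hg, ε, hε, hrob⟩ := robust_curve hK hconn i hr1 hC1 hcone
  obtain ⟨k, hk, hkg⟩ := weier_vec hg T (half_pos hε)
  set Q : ℂ → CSp n := fun s => s • eB i + (s * ((T:ℂ) - s)^2) • k s with hQ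
  have hQd : ∀ s, HasDerivAt Q (eB i + (((s * ((T:ℂ) - s)^2)) • deriv k s +
      (((T:ℂ) - s) * ((T:ℂ) - 3 * s)) • k s)) s := by
    intro s
    have h1 : HasDerivAt (fun s : ℂ => s) 1 s := hasDerivAt_id s
    have h2 : HasDerivAt (fun s : ℂ => (T:ℂ) - s) (-1) s := by simpa using h1.const_sub (T:ℂ)
    have h3 := h1.mul (h2.pow 2)
    have h4 : HasDerivAt (fun s : ℂ => s • (eB i : CSp n)) ((1:ℂ) • eB i) s := h1.smul_const _
    have h5 := h4.add (h3.smul (hk s).hasDerivAt)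
    refine h5.congr_deriv ?_
    simp only [one_smul, Pi.mul_apply, Pi.pow_apply]
    congr 2
    congr 1
    push_cast
    ring
  have hQdiff : Differentiable ℂ Q := fun s => (hQd s).differentiableAt
  have hQ0 : Q 0 = 0 := by simp [hQ]
  have hQT : Q T = (T:ℂ) • eB i := by simp [hQ]
  have hQ'T : deriv Q T = eB i := by rw [(hQd T).deriv]; simp
  have hTC : (T:ℂ) ≠ 0 := Complex.ofReal_ne_zero.2 hT.ne'
  have heB : (eB i : CSp n) ≠ 0 := by
    intro h; have := norm_eB (n := n) i; rw [h] at this; simp at this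
  obtain ⟨a, ha, ha1, ha2⟩ := generic_curve hn hT i hQdiff
    (by rw [hQ0, hQT]; exact (smul_ne_zero hTC heB).symm)
    (by rw [hQ'T]; simp [eB]) (η := ε / (2 * (1 + T))) (by positivity)
  have hqd : ∀ s, HasDerivAt (fun s => Q s + mS T s • a) (deriv Q s + mS' T s • a) s := fun s =>
    (hQdiff s).hasDerivAt.add ((mS_hasDeriv T s).smul_const a)
  set h : ℝ → CSp n := fun s => k s + (1 + Complex.I * s) • a with hh
  have hq : ∀ s : ℝ, Q s + mS T s • a = s • eB i + (s * (T - s)^2) • h s := by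
    intro s
    simp only [hQ, hh, mS, ← Complex.coe_smul (E := CSp n)]
    push_cast
    module
  obtain ⟨hr1, hr2, hr3⟩ := hrob h (by
    intro s h0 hsT
    have e : h s - g s = (k s - g s) + (1 + Complex.I * s) • a := by simp only [hh]; abel
    rw [e]
    refine (norm_add_le _ _).trans ?_
    rw [norm_smul]
    have h1 : ‖1 + Complex.I * (s:ℂ)‖ ≤ 1 + T := by
      refine (norm_add_le _ _).trans ?_
      rw [norm_mul, Complex.norm_I, Complex.norm_real, Real.norm_eq_abs, abs_of_nonneg h0, norm_one]
      linarith
    have h2 : ‖1 + Complex.I * (s:ℂ)‖ * ‖a‖ ≤ (1 + T) * (ε / (2 * (1 + T))) :=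
      mul_le_mul h1 ha (norm_nonneg _) (by linarith)
    have h3 : (1 + T) * (ε / (2 * (1 + T))) = ε / 2 := by field_simp
    linarith [hkg s h0 hsT])
  have hmT : mS T T = 0 := by simp [mS]
  have hm'T : mS' T T = 0 := by simp [mS']
  have hm0 : mS T 0 = 0 := by simp [mS]
  refine ⟨T, hT, hKT, fun s => Q s + mS T s • a, fun s => (hqd s).differentiableAt, ?_, ?_, ?_, ha2,
    ?_, ?_, ?_, ?_⟩
  · simp [hQ0, hm0]
  · simp [hQT, hmT]
  · rw [(hqd T).deriv, hQ'T, hm'T]; simp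
  · intro t h0 h1
    rw [(hqd t).deriv]
    simpa using ha1 t h0 h1
  · rw [(hqd 0).deriv, (hQd 0).deriv]
    have e : mS' T 0 = ((T^2:ℝ):ℂ) := by simp [mS']; ring
    have e2 : ((T:ℂ) - 0) * ((T:ℂ) - 3 * 0) = ((T^2:ℝ):ℂ) := by push_cast; ring
    rw [e, e2]
    have e3 : (eB i + (((0:ℂ) * ((T:ℂ) - 0)^2) • deriv k 0 + ((T^2:ℝ):ℂ) • k 0) + ((T^2:ℝ):ℂ) • a : CSp n)
        = eB i + ((T^2:ℝ):ℂ) • h 0 := by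
      simp only [hh]; simp; abel
    rw [e3]
    have e4 : ((eB i + ((T^2:ℝ):ℂ) • h 0 : CSp n) i) = 1 + ((T^2:ℝ):ℂ) * (h 0 i) := by simp [eB]
    rw [e4, Complex.add_re, Complex.re_ofReal_mul]
    simpa using hr3
  · intro t h0 h1
    show Q t + mS T t • a ∉ K
    rw [hq]; exact hr1 t h0 h1
  · intro t h0 h1
    show ‖Q t + mS T t • a‖ < T
    rw [hq]; exact hr2 t h0 h1

end PartD4
end

open Metric Set Filter Asymptotics
open scoped Manifold Topology
noncomputable section
section PartE1
variable {n : ℕ}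

def rectS (T ρ : ℝ) : Set ℂ := {s | (-ρ ≤ s.re ∧ s.re ≤ T + ρ) ∧ |s.im| ≤ ρ}

theorem rectS_eq (T ρ : ℝ) : rectS T ρ = Complex.re ⁻¹' (Icc (-ρ) (T + ρ)) ∩ Complex.im ⁻¹' (Icc (-ρ) ρ) := by
  ext s; simp [rectS, abs_le]

theorem rectS_convex (T ρ : ℝ) : Convex ℝ (rectS T ρ) := by
  rw [rectS_eq]
  exact ((convex_Icc _ _).linear_preimage Complex.reLm).inter
    ((convex_Icc _ _).linear_preimage Complex.imLm)

theorem rectS_compact (T ρ : ℝ) : IsCompact (rectS T ρ) := by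
  rw [rectS_eq]
  refine Metric.isCompact_of_isClosed_isBounded
    ((isClosed_Icc.preimage Complex.continuous_re).inter (isClosed_Icc.preimage Complex.continuous_im)) ?_
  refine (isBounded_iff_forall_norm_le).2 ⟨(|T| + |ρ|) + |ρ|, ?_⟩
  rintro s ⟨⟨h1, h2⟩, h3, h4⟩
  refine (Complex.norm_le_abs_re_add_abs_im s).trans (add_le_add (abs_le.2 ⟨?_, ?_⟩) (abs_le.2 ⟨?_, ?_⟩))
  · have := le_abs_self ρ; have := abs_nonneg T; linarith
  · have := le_abs_self ρ; have := le_abs_self T; linarith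
  · have := le_abs_self ρ; linarith
  · have := le_abs_self ρ; linarith

theorem rectS_mono {T ρ ρ' : ℝ} (h : ρ ≤ ρ') : rectS T ρ ⊆ rectS T ρ' := by
  rintro s ⟨⟨h1, h2⟩, h3⟩
  exact ⟨⟨by linarith, by linarith⟩, by linarith⟩

theorem rectS_near {T ρ : ℝ} (hT : 0 < T) {s : ℂ} (hs : s ∈ rectS T ρ) :
    ∃ t : ℝ, 0 ≤ t ∧ t ≤ T ∧ ‖s - t‖ ≤ 2 * ρ ∧ (0 ≤ s.re → t ≤ s.re) := by
  obtain ⟨⟨h1, h2⟩, h3⟩ := hs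
  refine ⟨max 0 (min s.re T), le_max_left _ _, max_le hT.le (min_le_right _ _), ?_,
    fun h => max_le h (min_le_left _ _)⟩
  refine (Complex.norm_le_abs_re_add_abs_im _).trans ?_
  simp only [Complex.sub_re, Complex.ofReal_re, Complex.sub_im, Complex.ofReal_im, sub_zero]
  have : |s.re - max 0 (min s.re T)| ≤ ρ := by
    rcases le_total s.re T with h | h
    · rw [min_eq_left h]
      rcases le_total 0 s.re with h' | h'
      · rw [max_eq_right h', sub_self, abs_zero]; exact (abs_nonneg _).trans h3
      · rw [max_eq_left h', abs_le]; constructor <;> linarith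
    · rw [min_eq_right h, max_eq_right hT.le, abs_le]; constructor <;> linarith
  linarith

variable {q : ℂ → CSp n} {T : ℝ}

theorem qE_lip (hq : Differentiable ℂ q) (T : ℝ) :
    ∃ M > 0, ∀ s ∈ rectS T 1, ∀ s' ∈ rectS T 1, ‖q s - q s'‖ ≤ M * ‖s - s'‖ := by
  have hc : Continuous (deriv q) := (hq.contDiff (n := 1)).continuous_deriv le_rfl
  obtain ⟨C, hC⟩ := (rectS_compact T 1).exists_bound_of_continuousOn hc.continuousOn
  refine ⟨max C 1, by positivity, fun s hs s' hs' => ?_⟩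
  exact (rectS_convex T 1).norm_image_sub_le_of_norm_deriv_le (fun x _ => hq x)
    (fun x hx => (hC x hx).trans (le_max_left _ _)) hs' hs

theorem qE_inj (hT : 0 < T) (hq : Differentiable ℂ q) (hinj : InjOn (fun t : ℝ => q t) (Icc 0 T)) {κ : ℝ}
    (hκ : 0 < κ) : ∃ ρ > 0, ∀ s ∈ rectS T ρ, ∀ s' ∈ rectS T ρ, ‖q s - q s'‖ ≤ ρ → ‖s - s'‖ < κ := by
  obtain ⟨M, hM, hMl⟩ := qE_lip hq T
  have hqc : Continuous (fun t : ℝ => q t) := hq.continuous.comp Complex.continuous_ofReal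
  obtain ⟨m, hm, hml⟩ : ∃ m > 0, ∀ t ∈ Icc 0 T, ∀ t' ∈ Icc 0 T, κ/2 ≤ |t - t'| → m ≤ ‖q t - q t'‖ := by
    have hcp : IsCompact ((Icc 0 T ×ˢ Icc 0 T) ∩ {x : ℝ × ℝ | κ/2 ≤ |x.1 - x.2|}) :=
      (isCompact_Icc.prod isCompact_Icc).inter_right
        (isClosed_le continuous_const (continuous_fst.sub continuous_snd).abs)
    have hcont : Continuous (fun x : ℝ × ℝ => ‖q x.1 - q x.2‖) :=
      ((hqc.comp continuous_fst).sub (hqc.comp continuous_snd)).norm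
    rcases Set.eq_empty_or_nonempty ((Icc 0 T ×ˢ Icc 0 T) ∩ {x : ℝ × ℝ | κ/2 ≤ |x.1 - x.2|}) with he | hne
    · refine ⟨1, one_pos, fun t ht t' ht' h => ?_⟩
      have : (t, t') ∈ ((Icc 0 T ×ˢ Icc 0 T) ∩ {x : ℝ × ℝ | κ/2 ≤ |x.1 - x.2|}) := ⟨⟨ht, ht'⟩, h⟩
      rw [he] at this; exact this.elim
    · obtain ⟨x, ⟨hx1, hx2⟩, hmin⟩ := hcp.exists_isMinOn hne hcont.continuousOn
      refine ⟨‖q x.1 - q x.2‖, ?_, fun t ht t' ht' h => isMinOn_iff.1 hmin (t, t') ⟨⟨ht, ht'⟩, h⟩⟩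
      rw [gt_iff_lt, norm_pos_iff]
      intro h
      have := hinj hx1.1 hx1.2 (sub_eq_zero.1 h)
      have hx2' : κ/2 ≤ |x.1 - x.2| := hx2
      rw [this, sub_self, abs_zero] at hx2'
      linarith
  set ρ := min 1 (min (κ / 8) (m / (2 * (1 + 4 * M)))) with hρ
  have hρp : 0 < ρ := lt_min one_pos (lt_min (by positivity) (by positivity))
  have r1 : ρ ≤ 1 := min_le_left _ _
  have r2 : ρ ≤ κ / 8 := (min_le_right _ _).trans (min_le_left _ _)
  have r3 : ρ * (1 + 4 * M) ≤ m / 2 := by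
    have h : ρ ≤ m / (2 * (1 + 4 * M)) := (min_le_right _ _).trans (min_le_right _ _)
    rw [le_div_iff₀ (by positivity)] at h; linarith
  refine ⟨ρ, hρp, fun s hs s' hs' h => ?_⟩
  by_contra hcon
  push Not at hcon
  obtain ⟨t, t0, t1, ht, -⟩ := rectS_near hT hs
  obtain ⟨t', t0', t1', ht', -⟩ := rectS_near hT hs'
  have hR : ∀ t : ℝ, 0 ≤ t → t ≤ T → (t:ℂ) ∈ rectS T 1 := fun t h0 h1 => by
    refine ⟨⟨?_, ?_⟩, ?_⟩ <;> simp <;> linarith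
  have h1 := hMl s (rectS_mono r1 hs) t (hR t t0 t1)
  have h2 := hMl s' (rectS_mono r1 hs') t' (hR t' t0' t1')
  have h3 : κ/2 ≤ |t - t'| := by
    have e : s - s' = (s - t) + ((t - t' : ℝ) : ℂ) - (s' - t') := by push_cast; ring
    have : ‖s - s'‖ ≤ 2 * ρ + |t - t'| + 2 * ρ := by
      rw [e]
      refine (norm_sub_le _ _).trans (add_le_add ((norm_add_le _ _).trans (add_le_add ht ?_)) ht')
      rw [Complex.norm_real, Real.norm_eq_abs]
    linarith
  have h4 := hml t ⟨t0, t1⟩ t' ⟨t0', t1'⟩ h3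
  have h5 : ‖q t - q t'‖ ≤ M * (2 * ρ) + ρ + M * (2 * ρ) := by
    have e : q t - q t' = -(q s - q t) + (q s - q s') + (q s' - q t') := by abel
    rw [e]
    refine (norm_add_le _ _).trans (add_le_add ((norm_add_le _ _).trans (add_le_add ?_ h)) ?_)
    · rw [norm_neg]; exact h1.trans (mul_le_mul_of_nonneg_left ht hM.le)
    · exact h2.trans (mul_le_mul_of_nonneg_left ht' hM.le)
  nlinarith

theorem rectS_open (hT : 0 < T) {O : Set ℂ} (hO : IsOpen O) (h : ∀ t : ℝ, 0 ≤ t → t ≤ T → (t:ℂ) ∈ O) :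
    ∃ ρ > 0, rectS T ρ ⊆ O := by
  have hc : IsCompact (Complex.ofReal '' Icc 0 T) := isCompact_Icc.image Complex.continuous_ofReal
  obtain ⟨d, hd, hdO⟩ := hc.exists_cthickening_subset_open hO (by rintro _ ⟨t, ht, rfl⟩; exact h t ht.1 ht.2)
  refine ⟨d / 2, half_pos hd, fun s hs => hdO ?_⟩
  obtain ⟨t, h0, h1, h2, -⟩ := rectS_near hT hs
  refine mem_cthickening_of_dist_le s t d _ ⟨t, ⟨h0, h1⟩, rfl⟩ ?_
  rw [dist_eq_norm]; linarith

theorem qE_deriv (hT : 0 < T) (i : Fin n) (hq : Differentiable ℂ q)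
    (hd : ∀ t : ℝ, 0 ≤ t → t ≤ T → (deriv q t) i ≠ 0) (hd0 : 0 < ((deriv q 0) i).re) :
    ∃ m > 0, ∃ ρ > 0, (∀ s ∈ rectS T ρ, m ≤ ‖(deriv q s) i‖) ∧
      (∀ s ∈ rectS T ρ, s.re ≤ ρ → m ≤ ((deriv q s) i).re) ∧
      (∀ s ∈ rectS T ρ, ∀ s' ∈ rectS T ρ, ‖s - s'‖ ≤ ρ → ‖(deriv q s) i - (deriv q s') i‖ ≤ m / 4) := by
  have hc0 : Continuous (deriv q) := (hq.contDiff (n := 1)).continuous_deriv le_rfl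
  have hc : Continuous (fun s => (deriv q s) i) := by fun_prop
  obtain ⟨m1, hm1, hml⟩ : ∃ c > 0, ∀ t : ℝ, 0 ≤ t → t ≤ T → c ≤ ‖(deriv q t) i‖ := by
    obtain ⟨t0, ht0, hmin⟩ := (isCompact_Icc (a := (0:ℝ)) (b := T)).exists_isMinOn
      ⟨0, le_refl _, hT.le⟩ (hc.comp Complex.continuous_ofReal).norm.continuousOn
    exact ⟨_, norm_pos_iff.2 (hd t0 ht0.1 ht0.2), fun t h1 h2 => hmin ⟨h1, h2⟩⟩
  set m := min (m1/2) (((deriv q 0) i).re / 2) with hm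
  have hmp : 0 < m := lt_min (by linarith) (by linarith)
  have a1 : m ≤ m1/2 := min_le_left _ _
  have a2 : m ≤ ((deriv q 0) i).re / 2 := min_le_right _ _
  obtain ⟨ρ1, hρ1, hr1⟩ := rectS_open hT (O := {s | m < ‖(deriv q s) i‖}) (isOpen_lt continuous_const hc.norm)
    (fun t h0 h1 => by have := hml t h0 h1; show m < _; linarith)
  have ho : IsOpen {s | m < ((deriv q s) i).re} := isOpen_lt continuous_const (Complex.continuous_re.comp hc)
  obtain ⟨ρ2, hρ2, hr2⟩ := Metric.isOpen_iff.1 ho 0 (by show m < _; linarith)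
  have huc := (rectS_compact T 1).uniformContinuousOn_of_continuous hc.continuousOn
  obtain ⟨ρ3, hρ3, hr3⟩ := Metric.uniformContinuousOn_iff_le.1 huc (m/4) (by linarith)
  set ρ := min (min ρ1 (ρ2 / 3)) (min ρ3 1) with hρ
  have b1 : ρ ≤ ρ1 := (min_le_left _ _).trans (min_le_left _ _)
  have b2 : ρ ≤ ρ2/3 := (min_le_left _ _).trans (min_le_right _ _)
  have b3 : ρ ≤ ρ3 := (min_le_right _ _).trans (min_le_left _ _)
  have b4 : ρ ≤ 1 := (min_le_right _ _).trans (min_le_right _ _)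
  have hρp : 0 < ρ := lt_min (lt_min hρ1 (by linarith)) (lt_min hρ3 one_pos)
  refine ⟨m, hmp, ρ, hρp, fun s hs => ?_, fun s hs hsr => ?_, fun s hs s' hs' h => ?_⟩
  · exact le_of_lt (hr1 (rectS_mono b1 hs))
  · refine le_of_lt (hr2 ?_)
    rw [mem_ball_zero_iff]
    have h1 : |s.re| ≤ ρ := abs_le.2 ⟨hs.1.1, hsr⟩
    have h2 := hs.2
    have := Complex.norm_le_abs_re_add_abs_im s
    linarith
  · have := hr3 s (rectS_mono b4 hs) s' (rectS_mono b4 hs') (by rw [dist_eq_norm]; linarith)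
    rwa [dist_eq_norm] at this

theorem qE_ball (hT : 0 < T) (hq : Differentiable ℂ q) (hb : ∀ t : ℝ, 0 ≤ t → t < T → ‖q t‖ < T) {τ : ℝ}
    (hτ : 0 < τ) (hτT : τ < T) : ∃ gap > 0, ∃ ρ > 0, ∀ s ∈ rectS T ρ, s.re ≤ T - τ → ‖q s‖ ≤ T - gap := by
  have hT' : 0 < T - τ := by linarith
  obtain ⟨g, hg, hgl⟩ : ∃ g : ℝ, 0 < g ∧ ∀ t : ℝ, 0 ≤ t → t ≤ T - τ → ‖q t‖ ≤ T - g := by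
    obtain ⟨t0, ht0, hmin⟩ := (isCompact_Icc (a := (0:ℝ)) (b := T - τ)).exists_isMaxOn
      ⟨0, le_refl _, hT'.le⟩ (hq.continuous.comp Complex.continuous_ofReal).norm.continuousOn
    refine ⟨T - ‖q t0‖, by linarith [hb t0 ht0.1 (by linarith [ht0.2])], fun t h1 h2 => ?_⟩
    have h3 : ‖q t‖ ≤ ‖q t0‖ := hmin ⟨h1, h2⟩
    linarith
  obtain ⟨ρ, hρ, hr⟩ := rectS_open hT' (O := {s | ‖q s‖ < T - g/2}) (isOpen_lt hq.continuous.norm continuous_const)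
    (fun t h0 h1 => by have := hgl t h0 h1; show ‖q t‖ < T - g/2; linarith)
  refine ⟨g/2, half_pos hg, ρ, hρ, fun s hs h => le_of_lt (hr ?_)⟩
  exact ⟨⟨hs.1.1, by linarith⟩, hs.2⟩

theorem qE_dist (hT : 0 < T) (hq : Differentiable ℂ q) {K : Set (CSp n)} (hK : IsCompact K) (h0 : q 0 = 0)
    (hqK : ∀ t : ℝ, 0 < t → t ≤ T → q t ∉ K) {r : ℝ} (hr : 0 < r) :
    ∃ d > 0, ∃ ρ > 0, ∀ s ∈ rectS T ρ, ∀ z ∈ K, r ≤ ‖z‖ → d ≤ ‖q s - z‖ := by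
  have hqc : Continuous (fun t : ℝ => q t) := hq.continuous.comp Complex.continuous_ofReal
  have hcl : IsClosed (K ∩ {z | r ≤ ‖z‖}) := hK.isClosed.inter (isClosed_le continuous_const continuous_norm)
  have hdis : Disjoint ((fun t : ℝ => q t) '' Icc 0 T) (K ∩ {z | r ≤ ‖z‖}) := by
    rw [Set.disjoint_left]
    rintro _ ⟨t, ht, rfl⟩ ⟨h1, h2⟩
    rcases ht.1.eq_or_lt with h | h
    · have h2' : r ≤ ‖q t‖ := h2
      rw [← h] at h2'
      simp [h0] at h2'
      linarith
    · exact hqK t h ht.2 h1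
  obtain ⟨d, hd, hb⟩ := hdis.exists_thickenings (isCompact_Icc.image hqc) hcl
  obtain ⟨ρ, hρ, hro⟩ := rectS_open hT (O := q ⁻¹' (thickening d ((fun t : ℝ => q t) '' Icc 0 T)))
    (isOpen_thickening.preimage hq.continuous)
    (fun t h0 h1 => self_subset_thickening hd _ ⟨t, ⟨h0, h1⟩, rfl⟩)
  refine ⟨d, hd, ρ, hρ, fun s hs z hz hzr => ?_⟩
  by_contra h
  push Not at h
  exact Set.disjoint_left.1 hb (hro hs)
    (mem_thickening_iff.2 ⟨z, ⟨hz, hzr⟩, by rw [dist_eq_norm]; exact h⟩)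

end PartE1
end

open Metric Set Filter Asymptotics
open scoped Manifold Topology
noncomputable section
section PartE2
variable {n : ℕ}

theorem quad_rem {𝕜 E F : Type*} [RCLike 𝕜] [NormedAddCommGroup E] [NormedSpace 𝕜 E] [NormedSpace ℝ E] [NormedAddCommGroup F] [NormedSpace 𝕜 F]
    {f : E → F} {x : E} (h : ContDiffAt 𝕜 2 f x) :
    ∃ C > 0, ∃ r > 0, ∀ v, ‖v‖ ≤ r → ‖f (x + v) - f x - fderiv 𝕜 f x v‖ ≤ C * ‖v‖^2 := by
  have hD : DifferentiableAt 𝕜 (fderiv 𝕜 f) x :=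
    ((h.fderiv_right (m := 1) (by norm_num)).differentiableAt (by norm_num))
  obtain ⟨C, hC, hb⟩ := hD.hasFDerivAt.isBigO_sub.exists_pos
  have hdf : ∀ᶠ y in 𝓝 x, DifferentiableAt 𝕜 f y :=
    (h.eventually (by simp)).mono fun y hy => hy.differentiableAt (by norm_num)
  obtain ⟨r, hr, hrb⟩ := Metric.nhds_basis_closedBall.mem_iff.1 (hb.bound.and hdf)
  refine ⟨C, hC, r, hr, fun v hv => ?_⟩
  have hcv : Convex ℝ (closedBall x ‖v‖) := convex_closedBall _ _
  have := hcv.norm_image_sub_le_of_norm_hasFDerivWithin_le' (𝕜 := 𝕜) (f := f) (f' := fderiv 𝕜 f)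
    (φ := fderiv 𝕜 f x) (C := C * ‖v‖) (x := x) (y := x + v) ?_ ?_ (by simp) (by simp)
  · simpa [pow_two, mul_assoc] using this
  · intro y hy
    exact (hrb (closedBall_subset_closedBall hv hy)).2.hasFDerivAt.hasFDerivWithinAt
  · intro y hy
    have h1 := (hrb (closedBall_subset_closedBall hv hy)).1
    refine h1.trans (mul_le_mul_of_nonneg_left ?_ hC.le)
    rw [← dist_eq_norm]; exact hy

/-- lower bound from real part of derivative -/
theorem re_deriv_lower {G G' : ℂ → ℂ} {S : Set ℂ} (hS : Convex ℝ S) {m : ℝ}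
    (hG : ∀ s ∈ S, HasDerivAt G (G' s) s) (hm : ∀ s ∈ S, m ≤ (G' s).re) {s t : ℂ} (hs : s ∈ S) (ht : t ∈ S) :
    m * ‖s - t‖ ≤ ‖G s - G t‖ := by
  by_cases hst : s = t
  · simp [hst]
  set d := s - t with hd
  have hd0 : 0 < ‖d‖ := norm_pos_iff.2 (sub_ne_zero.2 hst)
  let φ : ℝ → ℝ := fun x => (starRingEnd ℂ d * G (t + x * d)).re
  have hmem : ∀ x : ℝ, 0 ≤ x → x ≤ 1 → t + x * d ∈ S := fun x h0 h1 => by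
    have := hS ht hs (a := 1 - x) (b := x) (by linarith) h0 (by ring)
    convert this using 1
    simp only [Complex.real_smul, hd]; push_cast; ring
  have hφ : ∀ x : ℝ, 0 ≤ x → x ≤ 1 → HasDerivAt φ ((starRingEnd ℂ d * (G' (t + x * d) * d)).re) x := by
    intro x h0 h1
    have h2 : HasDerivAt (fun x : ℂ => t + x * d) d (x:ℂ) := by
      simpa using ((hasDerivAt_id (x:ℂ)).mul_const d).const_add t
    have h3 : HasDerivAt (fun x : ℂ => starRingEnd ℂ d * G (t + x * d)) (starRingEnd ℂ d * (G' (t + x * d) * d)) (x:ℂ) :=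
      ((hG _ (hmem x h0 h1)).comp (x:ℂ) h2).const_mul _
    exact h3.real_of_complex
  have hval : ∀ w : ℂ, (starRingEnd ℂ d * (w * d)).re = ‖d‖^2 * w.re := by
    intro w
    have : starRingEnd ℂ d * (w * d) = ((‖d‖^2 : ℝ) : ℂ) * w := by
      have h := Complex.conj_mul' d
      push_cast
      linear_combination w * h
    rw [this, Complex.re_ofReal_mul]
  have h1 : m * ‖d‖^2 ≤ φ 1 - φ 0 := by
    obtain ⟨x, hx, he⟩ := exists_deriv_eq_slope φ zero_lt_one
      (fun x hx => (hφ x hx.1 hx.2).continuousAt.continuousWithinAt)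
      (fun x hx => (hφ x hx.1.le hx.2.le).differentiableAt.differentiableWithinAt)
    rw [(hφ x hx.1.le hx.2.le).deriv, hval] at he
    have := hm _ (hmem x hx.1.le hx.2.le)
    have e : φ 1 - φ 0 = ‖d‖^2 * (G' (t + x * d)).re := by rw [he]; simp
    rw [e]
    nlinarith [sq_nonneg ‖d‖]
  have h2 : φ 1 - φ 0 ≤ ‖d‖ * ‖G s - G t‖ := by
    have e : φ 1 - φ 0 = (starRingEnd ℂ d * (G s - G t)).re := by
      simp only [φ]
      rw [← Complex.sub_re, ← mul_sub]
      simp [hd]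
    rw [e]
    refine (Complex.re_le_norm _).trans ?_
    rw [norm_mul, RCLike.norm_conj]
  have h3 : ‖d‖ * (m * ‖d‖) ≤ ‖d‖ * ‖G s - G t‖ := by nlinarith
  exact le_of_mul_le_mul_left h3 hd0

theorem near_deriv_lower {G G' : ℂ → ℂ} {S : Set ℂ} (hS : Convex ℝ S) {m : ℝ} {a : ℂ} (ha : 2 * m ≤ ‖a‖)
    (hG : ∀ s ∈ S, HasDerivAt G (G' s) s) (hm : ∀ s ∈ S, ‖G' s - a‖ ≤ m) {s t : ℂ} (hs : s ∈ S) (ht : t ∈ S) :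
    m * ‖s - t‖ ≤ ‖G s - G t‖ := by
  have h := hS.norm_image_sub_le_of_norm_hasDerivWithin_le (f := fun w => G w - a * w) (f' := fun w => G' w - a)
    (C := m) (fun x hx => by
      have h1 : HasDerivAt (fun w : ℂ => a * w) a x := by simpa using (hasDerivAt_id x).const_mul a
      exact ((hG x hx).sub h1).hasDerivWithinAt) hm ht hs
  have e : a * (s - t) = (G s - G t) - ((G s - a * s) - (G t - a * t)) := by ring
  have h2 : ‖a‖ * ‖s - t‖ ≤ ‖G s - G t‖ + m * ‖s - t‖ := by
    rw [← norm_mul, e]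
    exact (norm_sub_le _ _).trans (add_le_add le_rfl h)
  nlinarith [norm_nonneg (s - t)]

end PartE2
end

open Metric Set Filter Asymptotics
open scoped Manifold Topology
noncomputable section
section PartE3
variable {n : ℕ}

def uF (T ε : ℝ) (Φ : CSp n → ℂ) (z : CSp n) : ℂ := ((Real.exp (-T/ε) : ℝ) : ℂ) - Φ z
def sF (T ε : ℝ) (Φ : CSp n → ℂ) (z : CSp n) : ℂ := -(ε:ℂ) * Complex.log (uF T ε Φ z)

variable {T ε : ℝ} {Φ : CSp n → ℂ} {z z' : CSp n}

theorem sF_re : (sF T ε Φ z).re = -ε * Real.log ‖uF T ε Φ z‖ := by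
  rw [sF, ← Complex.ofReal_neg, Complex.re_ofReal_mul, Complex.log_re]

theorem sF_im : (sF T ε Φ z).im = -ε * Complex.arg (uF T ε Φ z) := by
  rw [sF, ← Complex.ofReal_neg, Complex.im_ofReal_mul, Complex.log_im]

theorem sF_exp (hε : 0 < ε) (h : uF T ε Φ z ≠ 0) : Complex.exp (-(sF T ε Φ z) / ε) = uF T ε Φ z := by
  have : -(sF T ε Φ z) / ε = Complex.log (uF T ε Φ z) := by
    have : (ε:ℂ) ≠ 0 := Complex.ofReal_ne_zero.2 hε.ne'
    rw [sF]; field_simp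
  rw [this, Complex.exp_log h]

theorem sF_im_le (hε : 0 < ε) (h : 0 < (uF T ε Φ z).re) : |(sF T ε Φ z).im| ≤ ε * (Real.pi / 2) := by
  rw [sF_im, abs_mul, abs_neg, abs_of_pos hε]
  exact mul_le_mul_of_nonneg_left (Complex.abs_arg_le_pi_div_two_iff.2 h.le) hε.le

theorem uF_re {c : ℝ} (h : (Φ z).re ≤ -c * ‖z‖^2) : Real.exp (-T/ε) + c * ‖z‖^2 ≤ (uF T ε Φ z).re := by
  rw [uF, Complex.sub_re, Complex.ofReal_re]; linarith

theorem sF_re_le (hε : 0 < ε) (h : Real.exp (-T/ε) ≤ (uF T ε Φ z).re) : (sF T ε Φ z).re ≤ T := by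
  rw [sF_re]
  have h1 : Real.log (Real.exp (-T/ε)) ≤ Real.log ‖uF T ε Φ z‖ :=
    Real.log_le_log (Real.exp_pos _) (h.trans (Complex.re_le_norm _))
  rw [Real.log_exp] at h1
  have h2 := mul_le_mul_of_nonneg_left h1 hε.le
  have e : ε * (-T/ε) = -T := by field_simp
  rw [e] at h2; linarith

theorem sF_zero (hε : 0 < ε) (h : Φ z = 0) : sF T ε Φ z = T := by
  rw [sF, uF, h, sub_zero, ← Complex.ofReal_log (Real.exp_pos _).le, Real.log_exp]
  push_cast
  have : (ε:ℂ) ≠ 0 := Complex.ofReal_ne_zero.2 hε.ne'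
  field_simp

theorem uF_norm_le (hT : 0 < T) (hε : 0 < ε) {M : ℝ} (h : ‖Φ z‖ ≤ M) : ‖uF T ε Φ z‖ ≤ 1 + M := by
  rw [uF]
  refine (norm_sub_le _ _).trans (add_le_add ?_ h)
  rw [Complex.norm_real, Real.norm_eq_abs, abs_of_pos (Real.exp_pos _)]
  exact Real.exp_le_one_iff.2 (div_nonpos_of_nonpos_of_nonneg (by linarith) hε.le)

theorem sF_re_ge (hT : 0 < T) (hε : 0 < ε) {M : ℝ} (h : ‖Φ z‖ ≤ M) (hu : 0 < (uF T ε Φ z).re) :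
    -(ε * Real.log (1 + M)) ≤ (sF T ε Φ z).re := by
  rw [sF_re]
  have h1 : Real.log ‖uF T ε Φ z‖ ≤ Real.log (1 + M) :=
    Real.log_le_log (hu.trans_le (Complex.re_le_norm _)) (uF_norm_le hT hε h)
  nlinarith

theorem sF_norm_le (hT : 0 < T) (hε : 0 < ε) {M a : ℝ} (h : ‖Φ z‖ ≤ M) (ha : 0 < a) (hu : a ≤ (uF T ε Φ z).re) :
    ‖sF T ε Φ z‖ ≤ ε * (|Real.log a| + |Real.log (1 + M)| + Real.pi / 2) := by
  have hu0 : 0 < (uF T ε Φ z).re := ha.trans_le hu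
  refine (Complex.norm_le_abs_re_add_abs_im _).trans ?_
  have h1 := sF_im_le hε hu0
  have h2 : |(sF T ε Φ z).re| ≤ ε * (|Real.log a| + |Real.log (1 + M)|) := by
    rw [sF_re, abs_mul, abs_neg, abs_of_pos hε]
    refine mul_le_mul_of_nonneg_left (abs_le.2 ⟨?_, ?_⟩) hε.le
    · have h1 : Real.log a ≤ Real.log ‖uF T ε Φ z‖ := Real.log_le_log ha (hu.trans (Complex.re_le_norm _))
      have := neg_abs_le (Real.log a); have := abs_nonneg (Real.log (1+M)); linarith
    · have h1 : Real.log ‖uF T ε Φ z‖ ≤ Real.log (1 + M) :=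
        Real.log_le_log (hu0.trans_le (Complex.re_le_norm _)) (uF_norm_le hT hε h)
      have := le_abs_self (Real.log (1+M)); have := abs_nonneg (Real.log a); linarith
  linarith

theorem sF_lip (hε : 0 < ε) {a : ℝ} (ha : 0 < a) (hu : a ≤ (uF T ε Φ z).re) (hu' : a ≤ (uF T ε Φ z').re) :
    ‖sF T ε Φ z - sF T ε Φ z'‖ ≤ ε * (a⁻¹ * ‖Φ z - Φ z'‖) := by
  have hS : Convex ℝ {w : ℂ | a ≤ w.re} := convex_halfSpace_re_ge a
  have h := hS.norm_image_sub_le_of_norm_hasDerivWithin_le (f := Complex.log) (f' := fun w => w⁻¹)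
    (C := a⁻¹) (fun w hw => (Complex.hasDerivAt_log (Or.inl (ha.trans_le hw))).hasDerivWithinAt)
    (fun w hw => by
      rw [norm_inv]
      exact inv_anti₀ ha (le_trans hw (Complex.re_le_norm w))) hu' hu
  have e : uF T ε Φ z - uF T ε Φ z' = -(Φ z - Φ z') := by simp only [uF]; ring
  rw [e, norm_neg] at h
  rw [sF, sF, ← mul_sub, norm_mul, norm_neg, Complex.norm_real, Real.norm_eq_abs, abs_of_pos hε]
  exact mul_le_mul_of_nonneg_left h hε.le

theorem ev_small (C : ℝ) {ρ : ℝ} (hρ : 0 < ρ) : ∀ᶠ ε : ℝ in 𝓝[>] 0, ε * C < ρ := by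
  have h : Tendsto (fun ε : ℝ => ε * C) (𝓝[>] 0) (𝓝 0) := by
    have : Tendsto (fun ε : ℝ => ε * C) (𝓝 0) (𝓝 (0 * C)) := (continuous_id.mul continuous_const).tendsto 0
    rw [zero_mul] at this
    exact this.mono_left nhdsWithin_le_nhds
  exact h.eventually (gt_mem_nhds hρ)

theorem ev_pos : ∀ᶠ ε : ℝ in 𝓝[>] 0, 0 < ε := eventually_mem_nhdsWithin

variable {K : Set (CSp n)} {c M : ℝ}

theorem ev_rect (hT : 0 < T) (hM : ∀ z ∈ K, ‖Φ z‖ ≤ M) (hc : 0 ≤ c) (hΦ : ∀ z ∈ K, (Φ z).re ≤ -c * ‖z‖^2)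
    {ρ : ℝ} (hρ : 0 < ρ) : ∀ᶠ ε : ℝ in 𝓝[>] 0, ∀ z ∈ K,
      -ρ < (sF T ε Φ z).re ∧ (sF T ε Φ z).re ≤ T ∧ |(sF T ε Φ z).im| ≤ ρ := by
  filter_upwards [ev_pos, ev_small (Real.log (1 + M)) hρ, ev_small (Real.pi/2) hρ] with ε h0 h1 h2 z hz
  have hu := uF_re (T := T) (ε := ε) (hΦ z hz)
  have hcz : 0 ≤ c * ‖z‖^2 := by positivity
  have he := Real.exp_pos (-T/ε)
  have hu0 : 0 < (uF T ε Φ z).re := by linarith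
  exact ⟨by linarith [sF_re_ge hT h0 (hM z hz) hu0], sF_re_le h0 (by linarith), (sF_im_le h0 hu0).trans h2.le⟩

theorem ev_away (hT : 0 < T) (hM : ∀ z ∈ K, ‖Φ z‖ ≤ M) (hc : 0 < c) (hΦ : ∀ z ∈ K, (Φ z).re ≤ -c * ‖z‖^2)
    {ρ r : ℝ} (hρ : 0 < ρ) (hr : 0 < r) : ∀ᶠ ε : ℝ in 𝓝[>] 0, ∀ z ∈ K, r ≤ ‖z‖ → ‖sF T ε Φ z‖ ≤ ρ := by
  filter_upwards [ev_pos, ev_small (|Real.log (c * r^2)| + |Real.log (1 + M)| + Real.pi / 2) hρ] with ε h0 h1 z hz hzr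
  have hu := uF_re (T := T) (ε := ε) (hΦ z hz)
  have he := Real.exp_pos (-T/ε)
  have h2 : c * r^2 ≤ c * ‖z‖^2 := by gcongr
  exact (sF_norm_le hT h0 (hM z hz) (by positivity) (by linarith)).trans h1.le

def AS (T ε : ℝ) (Φ : CSp n → ℂ) (W : Set (CSp n)) (ρ : ℝ) : Set (CSp n) :=
  {z ∈ W | 0 < (uF T ε Φ z).re ∧ -ρ < (sF T ε Φ z).re ∧ (sF T ε Φ z).re < T + ρ}

variable {W : Set (CSp n)} {ρ : ℝ}

theorem sF_diff (hΦ : DifferentiableOn ℂ Φ W) : DifferentiableOn ℂ (sF T ε Φ) (W ∩ {z | 0 < (uF T ε Φ z).re}) := by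
  intro z hz
  have h1 : DifferentiableWithinAt ℂ (uF T ε Φ) (W ∩ {z | 0 < (uF T ε Φ z).re}) z :=
    ((hΦ z hz.1).mono inter_subset_left).const_sub _
  exact (h1.clog (Or.inl hz.2)).const_mul _

theorem AS_open (hW : IsOpen W) (hΦ : DifferentiableOn ℂ Φ W) : IsOpen (AS T ε Φ W ρ) := by
  have hu : ContinuousOn (uF T ε Φ) W := continuousOn_const.sub hΦ.continuousOn
  have ho : IsOpen (W ∩ {z | 0 < (uF T ε Φ z).re}) :=
    (Complex.continuous_re.comp_continuousOn hu).isOpen_inter_preimage hW isOpen_Ioi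
  have hs := (Complex.continuous_re.comp_continuousOn (sF_diff (T := T) (ε := ε) hΦ).continuousOn).isOpen_inter_preimage ho
    (isOpen_Ioo (a := -ρ) (b := T + ρ))
  convert hs using 1
  ext z
  simp only [AS, mem_inter_iff, mem_preimage, mem_Ioo, Function.comp_apply]
  constructor
  · rintro ⟨h1, h2, h3, h4⟩; exact ⟨⟨h1, h2⟩, h3, h4⟩
  · rintro ⟨⟨h1, h2⟩, h3, h4⟩; exact ⟨h1, h2, h3, h4⟩

theorem AS_rect (hε : 0 < ε) (h : ε * (Real.pi/2) ≤ ρ) (hz : z ∈ AS T ε Φ W ρ) : sF T ε Φ z ∈ rectS T ρ := by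
  obtain ⟨-, h2, h3, h4⟩ := hz
  exact ⟨⟨h3.le, h4.le⟩, (sF_im_le hε h2).trans h⟩

end PartE3
end

open Metric Set Filter Asymptotics
open scoped Manifold Topology
noncomputable section
section PartE4
variable {n : ℕ} {T : ℝ} {Φ : CSp n → ℂ} {q : ℂ → CSp n}

theorem ev_exp {a m : ℝ} (ha : 0 < a) (hm : 0 < m) :
    ∀ᶠ ε : ℝ in 𝓝[>] 0, ε⁻¹ * Real.exp (-(a/ε)) ≤ m := by
  filter_upwards [ev_pos, ev_small (2 / a^2) hm] with ε h0 h1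
  have hx : 0 < a / ε := by positivity
  have h2 := Real.quadratic_le_exp_of_nonneg hx.le
  have h3 : (a/ε)^2/2 ≤ Real.exp (a/ε) := by nlinarith
  rw [Real.exp_neg]
  have h4 : (Real.exp (a/ε))⁻¹ ≤ ((a/ε)^2/2)⁻¹ := inv_anti₀ (by positivity) h3
  have h5 : ε⁻¹ * ((a/ε)^2/2)⁻¹ = ε * (2 / a^2) := by field_simp
  calc ε⁻¹ * (Real.exp (a/ε))⁻¹ ≤ ε⁻¹ * ((a/ε)^2/2)⁻¹ := by gcongr
    _ = _ := h5
    _ ≤ m := h1.le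

set_option maxHeartbeats 1000000 in
theorem inj_near (hT : 0 < T) (i : Fin n) (hq : Differentiable ℂ q)
    (hinj : InjOn (fun t : ℝ => q t) (Icc 0 T))
    (hd : ∀ t : ℝ, 0 ≤ t → t ≤ T → (deriv q t) i ≠ 0) (hd0 : 0 < ((deriv q 0) i).re)
    (hΦ : ∀ κ > 0, ∃ r > 0, ∀ z z' : CSp n, ‖z‖ < r → ‖z'‖ < r →
      ‖Φ z - Φ z' - (z i - z' i)‖ ≤ κ * ‖z - z'‖) (W : Set (CSp n)) :
    ∃ r > 0, ∃ ρ > 0, ∀ᶠ ε : ℝ in 𝓝[>] 0, ∀ z ∈ AS T ε Φ W ρ, ∀ z' ∈ AS T ε Φ W ρ,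
      ‖z‖ < r → ‖z'‖ < r → z + q (sF T ε Φ z) = z' + q (sF T ε Φ z') → z = z' := by
  obtain ⟨M, hM, hMl⟩ := qE_lip hq T
  obtain ⟨m, hm, ρ1, hρ1, hm1, hm2, hm3⟩ := qE_deriv hT i hq hd hd0
  obtain ⟨ρ2, hρ2, hρi⟩ := qE_inj hT hq hinj (half_pos hρ1)
  obtain ⟨r0, hr0, hr0l⟩ := hΦ (m / (4 * M)) (by positivity)
  set ρ := min 1 (min ρ1 ρ2) with hρ
  have hρp : 0 < ρ := lt_min one_pos (lt_min hρ1 hρ2)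
  have b1 : ρ ≤ 1 := min_le_left _ _
  have b2 : ρ ≤ ρ1 := (min_le_right _ _).trans (min_le_left _ _)
  have b3 : ρ ≤ ρ2 := (min_le_right _ _).trans (min_le_right _ _)
  refine ⟨min r0 (ρ2/2), lt_min hr0 (half_pos hρ2), ρ, hρp, ?_⟩
  filter_upwards [ev_pos, ev_small (Real.pi/2) hρp, ev_exp (half_pos hρ1) (m := m/4) (by linarith)]
    with ε h0 h1 h2 z hz z' hz' hzr hzr' he
  have hεC : (ε:ℂ) ≠ 0 := Complex.ofReal_ne_zero.2 h0.ne'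
  have hsR := AS_rect h0 h1.le hz
  have hsR' := AS_rect h0 h1.le hz'
  have hsi := sF_im_le h0 hz.2.1
  have hsi' := sF_im_le h0 hz'.2.1
  have hse := sF_exp h0 (z := z) (T := T) (Φ := Φ) (fun h => by have := hz.2.1; rw [h] at this; simp at this)
  have hse' := sF_exp h0 (z := z') (T := T) (Φ := Φ) (fun h => by have := hz'.2.1; rw [h] at this; simp at this)
  have hue : uF T ε Φ z' - uF T ε Φ z = Φ z - Φ z' := by simp only [uF]; ring
  set s := sF T ε Φ z
  set s' := sF T ε Φ z'
  have hzz : z - z' = -(q s - q s') := by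
    have : z - z' = (z + q s) - (z' + q s') - (q s - q s') := by abel
    rw [this, he]; simp
  have hnorm : ‖z - z'‖ = ‖q s - q s'‖ := by rw [hzz, norm_neg]
  have hq1 : ‖q s - q s'‖ ≤ ρ2 := by
    rw [← hnorm]
    refine (norm_sub_le _ _).trans ?_
    have := min_le_right r0 (ρ2/2)
    linarith
  have hclose := hρi s (rectS_mono b3 hsR) s' (rectS_mono b3 hsR') hq1
  set G : ℂ → ℂ := fun w => (q w) i - Complex.exp (-w/ε) with hG
  set G' : ℂ → ℂ := fun w => (deriv q w) i + ε⁻¹ * Complex.exp (-w/ε) with hG'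
  have hGd : ∀ w, HasDerivAt G (G' w) w := by
    intro w
    have e1 : HasDerivAt (fun w => (q w) i) ((deriv q w) i) w :=
      (EuclideanSpace.proj (𝕜 := ℂ) i).hasFDerivAt.comp_hasDerivAt w (hq w).hasDerivAt
    have e2 : HasDerivAt (fun w : ℂ => -w/ε) (-1/ε) w := ((hasDerivAt_id w).neg).div_const _
    refine (e1.sub e2.cexp).congr_deriv ?_
    simp only [hG']
    push_cast
    ring
  have hGs : G s - G s' = Φ z - Φ z' - (z i - z' i) := by
    have e1 : z i - z' i = -(q s i - q s' i) := by
      have := congrArg (fun v : CSp n => v i) hzz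
      simpa using this
    rw [e1, ← hue, ← hse, ← hse']
    simp only [hG]; ring
  have hup : ‖G s - G s'‖ ≤ m / 4 * ‖s - s'‖ := by
    rw [hGs]
    refine (hr0l z z' (hzr.trans_le (min_le_left _ _)) (hzr'.trans_le (min_le_left _ _))).trans ?_
    rw [hnorm]
    have := hMl s (rectS_mono b1 hsR) s' (rectS_mono b1 hsR')
    calc m / (4*M) * ‖q s - q s'‖ ≤ m / (4 * M) * (M * ‖s - s'‖) := by gcongr
      _ = m/4 * ‖s - s'‖ := by field_simp
  have hlow : m / 2 * ‖s - s'‖ ≤ ‖G s - G s'‖ := by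
    by_cases hcase : s.re ≤ ρ1 ∧ s'.re ≤ ρ1
    · have hcv : Convex ℝ (rectS T ρ ∩ (Complex.re ⁻¹' (Iic ρ1) ∩ Complex.im ⁻¹' (Icc (-(ε * (Real.pi/2))) (ε * (Real.pi/2))))) :=
        (rectS_convex T ρ).inter (((convex_Iic _).linear_preimage Complex.reLm).inter
          ((convex_Icc _ _).linear_preimage Complex.imLm))
      have := re_deriv_lower hcv (m := m) (fun w _ => hGd w) (fun w hw => ?_) (s := s) (t := s')
        ⟨hsR, hcase.1, abs_le.1 hsi⟩ ⟨hsR', hcase.2, abs_le.1 hsi'⟩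
      · have h5 : m/2 * ‖s - s'‖ ≤ m * ‖s - s'‖ := by gcongr; linarith
        exact h5.trans this
      · obtain ⟨hw1, hw2, hw3⟩ := hw
        have h6 := hm2 w (rectS_mono b2 hw1) hw2
        have h7 : 0 ≤ ((ε⁻¹:ℂ) * Complex.exp (-w/ε)).re := by
          rw [← Complex.ofReal_inv, Complex.re_ofReal_mul, Complex.exp_re]
          refine mul_nonneg (by positivity) (mul_nonneg (Real.exp_pos _).le ?_)
          rw [Complex.div_ofReal_im, Complex.neg_im]
          obtain ⟨h8, h9⟩ := hw3
          apply Real.cos_nonneg_of_neg_pi_div_two_le_of_le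
          · rw [le_div_iff₀ h0]; linarith
          · rw [div_le_iff₀ h0]; linarith
        simp only [hG', Complex.add_re]
        push_cast at *
        linarith
    · have hre : ρ1/2 ≤ s.re ∧ ρ1/2 ≤ s'.re := by
        have h5 := (Complex.abs_re_le_norm (s - s')).trans hclose.le
        rw [Complex.sub_re, abs_le] at h5
        by_cases h6 : s.re ≤ ρ1
        · have h7 : ρ1 < s'.re := not_le.1 fun h => hcase ⟨h6, h⟩
          constructor <;> linarith [h5.1, h5.2]
        · push Not at h6
          constructor <;> linarith [h5.1, h5.2]
      have hcv : Convex ℝ (rectS T ρ ∩ (Complex.re ⁻¹' (Ici (ρ1/2)) ∩ closedBall s' ρ1)) :=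
        (rectS_convex T ρ).inter (((convex_Ici _).linear_preimage Complex.reLm).inter (convex_closedBall _ _))
      refine near_deriv_lower hcv (m := m/2) (a := (deriv q s') i) ?_ (fun w _ => hGd w) (fun w hw => ?_)
        ⟨hsR, hre.1, ?_⟩ ⟨hsR', hre.2, mem_closedBall_self hρ1.le⟩
      · have := hm1 s' (rectS_mono b2 hsR'); linarith
      · obtain ⟨hw1, hw2, hw3⟩ := hw
        rw [mem_closedBall, dist_eq_norm] at hw3
        have h5 := hm3 w (rectS_mono b2 hw1) s' (rectS_mono b2 hsR') hw3
        have h6 : ‖(ε⁻¹:ℂ) * Complex.exp (-w/ε)‖ ≤ m/4 := by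
          refine le_trans ?_ h2
          rw [norm_mul, norm_inv, Complex.norm_real, Real.norm_eq_abs, abs_of_pos h0, Complex.norm_exp,
            Complex.div_ofReal_re, Complex.neg_re]
          have hw2' : ρ1/2 ≤ w.re := hw2
          have : -w.re/ε ≤ -(ρ1/2/ε) := by rw [← neg_div]; gcongr
          gcongr
        have e : G' w - (deriv q s') i = ((deriv q w) i - (deriv q s') i) + (ε⁻¹:ℂ) * Complex.exp (-w/ε) := by
          simp only [hG']; push_cast; ring
        rw [e]
        refine (norm_add_le _ _).trans ?_
        linarith
      · rw [mem_closedBall, dist_eq_norm]; linarith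
  have hfin : ‖s - s'‖ = 0 := by
    have := norm_nonneg (s - s')
    nlinarith
  have hss : s = s' := sub_eq_zero.1 (norm_eq_zero.1 hfin)
  rw [hss, sub_self, neg_zero] at hzz
  exact sub_eq_zero.1 hzz

end PartE4
end

open Metric Set Filter Asymptotics
open scoped Manifold Topology
noncomputable section
section PartE5
variable {n : ℕ} {T : ℝ} {Φ : CSp n → ℂ} {q : ℂ → CSp n}

theorem tip_im {ε : ℝ} {z : CSp n} (hε : 0 < ε) (h : Real.exp (-T/ε) ≤ (uF T ε Φ z).re) :
    ((sF T ε Φ z).im)^2 ≤ 8 * ε * (T - (sF T ε Φ z).re) := by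
  rw [sF_im, sF_re]
  set u := uF T ε Φ z
  set x := Complex.arg u
  have hδ := Real.exp_pos (-T/ε)
  have hu : 0 < u.re := by linarith
  have hu0 : u ≠ 0 := fun h => by rw [h] at hu; simp at hu
  have hx : |x| ≤ Real.pi/2 := Complex.abs_arg_le_pi_div_two_iff.2 hu.le
  have hpi := Real.pi_lt_d2
  have hx2 : x^2 ≤ 3 := by
    have h1 : |x| ≤ 1.6 := by linarith
    have h2 : |x|^2 ≤ 1.6^2 := by gcongr
    rw [sq_abs] at h2; norm_num at h2; linarith
  have hcos : Real.cos x ≤ 1 / Real.sqrt (x^2+1) := by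
    rw [abs_le] at hx
    exact Real.cos_le_one_div_sqrt_sq_add_one (by linarith [Real.pi_pos, hx.1]) (by linarith [Real.pi_pos, hx.2])
  have hsq : 0 < Real.sqrt (x^2+1) := Real.sqrt_pos.2 (by positivity)
  have hn : 0 < ‖u‖ := norm_pos_iff.2 hu0
  have h1 : Real.exp (-T/ε) * Real.sqrt (x^2+1) ≤ ‖u‖ := by
    have h2 : u.re = ‖u‖ * Real.cos x := by
      rw [Complex.cos_arg hu0]; field_simp
    have h3 : ‖u‖ * Real.cos x ≤ ‖u‖ * (1 / Real.sqrt (x^2+1)) := by gcongr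
    rw [← le_div_iff₀ hsq]
    calc _ ≤ u.re := h
      _ ≤ ‖u‖ * (1 / Real.sqrt (x^2+1)) := by rw [h2]; exact h3
      _ = _ := by ring
  have h2 : -T/ε + 1/2 * Real.log (x^2+1) ≤ Real.log ‖u‖ := by
    have := Real.log_le_log (by positivity) h1
    rw [Real.log_mul hδ.ne' hsq.ne', Real.log_exp, Real.log_sqrt (by positivity)] at this
    linarith
  have h3 : x^2/4 ≤ Real.log (x^2+1) := by
    have := Real.one_sub_inv_le_log_of_pos (x := x^2+1) (by positivity)
    refine le_trans ?_ this
    have e : 1 - (x^2+1)⁻¹ = x^2/(x^2+1) := by field_simp; ring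
    rw [e]
    gcongr
    linarith
  have h4 : x^2 / 8 ≤ Real.log ‖u‖ + T/ε := by
    have : -T/ε = -(T/ε) := neg_div _ _
    linarith
  have h5 := mul_le_mul_of_nonneg_left h4 hε.le
  have e : ε * (Real.log ‖u‖ + T/ε) = T - -ε * Real.log ‖u‖ := by field_simp; ring
  rw [e] at h5
  nlinarith

theorem tip_re {ε c : ℝ} {z : CSp n} (hε : 0 < ε) (hc : 0 < c)
    (h : Real.exp (-T/ε) + c * ‖z‖^2 ≤ (uF T ε Φ z).re) {r : ℝ} (hr : 0 < r) (hz : ‖z‖ ≤ r) :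
    ‖z‖^2 / r^2 * (ε * Real.log (c * r^2) + T) ≤ T - (sF T ε Φ z).re := by
  rw [sF_re]
  set u := uF T ε Φ z
  set δ := Real.exp (-T/ε) with hδe
  have hδ : 0 < δ := Real.exp_pos _
  set lam := ‖z‖^2/r^2 with hlam
  have hl0 : 0 ≤ lam := by positivity
  have hl1 : lam ≤ 1 := by rw [hlam, div_le_one (by positivity)]; gcongr
  set X := c * r^2/δ with hX
  have hX0 : 0 < X := by positivity
  have h1 : δ * (1 + lam * X) ≤ ‖u‖ := by
    have e : δ * (1 + lam * X) = δ + c * ‖z‖^2 := by rw [hlam, hX]; field_simp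
    rw [e]; exact h.trans (Complex.re_le_norm u)
  have h2 : (1 + X)^lam ≤ 1 + lam * X :=
    rpow_one_add_le_one_add_mul_self (by linarith) hl0 hl1
  have h3 : lam * Real.log (1 + X) ≤ Real.log (1 + lam * X) := by
    rw [← Real.log_rpow (by linarith)]
    exact Real.log_le_log (by positivity) h2
  have h4 : Real.log X ≤ Real.log (1 + X) := Real.log_le_log hX0 (by linarith)
  have h5 : Real.log X = Real.log (c * r^2) + T/ε := by
    rw [hX, Real.log_div (by positivity) hδ.ne', hδe, Real.log_exp]; ring
  have h6 : -T/ε + Real.log (1 + lam * X) ≤ Real.log ‖u‖ := by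
    have := Real.log_le_log (by positivity) h1
    rwa [Real.log_mul hδ.ne' (by positivity), hδe, Real.log_exp] at this
  have h7 : lam * (Real.log (c * r^2) + T/ε) ≤ Real.log ‖u‖ + T/ε := by
    have h8 : lam * Real.log X ≤ lam * Real.log (1+X) := by gcongr
    rw [h5] at h8
    have : -T/ε = -(T/ε) := neg_div _ _
    linarith
  have h9 := mul_le_mul_of_nonneg_left h7 hε.le
  have e1 : ε * (lam * (Real.log (c * r^2) + T/ε)) = lam * (ε * Real.log (c * r^2) + T) := by field_simp
  have e2 : ε * (Real.log ‖u‖ + T/ε) = T - -ε * Real.log ‖u‖ := by field_simp; ring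
  rw [e1, e2] at h9
  exact h9

theorem norm_tip_sq (i : Fin n) (T : ℝ) (v : CSp n) :
    ‖(T:ℂ) • eB i + v‖^2 = T^2 + 2 * T * (v i).re + ‖v‖^2 := by
  rw [@norm_add_sq ℂ]
  rw [norm_smul, norm_eB, mul_one, Complex.norm_real, Real.norm_eq_abs, sq_abs, inner_smul_left]
  have : inner ℂ (eB i : CSp n) v = v i := by
    rw [eB, EuclideanSpace.inner_single_left]; simp
  rw [this]
  simp
  ring

set_option maxHeartbeats 1000000 in
theorem ball_tip (hT : 0 < T) (i : Fin n) (hq : Differentiable ℂ q) (hqT : q T = (T:ℂ) • eB i)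
    (hq'T : deriv q T = eB i) {K : Set (CSp n)} {c : ℝ} (hc : 0 < c) (hΦ : ∀ z ∈ K, (Φ z).re ≤ -c * ‖z‖^2)
    {r1 C1 : ℝ} (hr1 : 0 < r1) (hC1 : 0 < C1) (hcone : ∀ z ∈ K, ‖z‖ ≤ r1 → (z i).re ≤ C1 * ‖z‖^2) :
    ∃ τ > 0, τ < T ∧ ∃ r > 0, ∀ᶠ ε : ℝ in 𝓝[>] 0, ∀ z ∈ K, z ≠ 0 → ‖z‖ ≤ r →
      T - τ ≤ (sF T ε Φ z).re → ‖z + q (sF T ε Φ z)‖ < T := by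
  obtain ⟨Cq, hC, rq, hrq, hrem⟩ := quad_rem (𝕜 := ℂ) (f := q) (x := (T:ℂ)) (hq.contDiff.contDiffAt)
  set C3 := 2 * T * Cq + 3 + 3 * Cq^2 with hC3
  have hC3p : 0 < C3 := by positivity
  set C4 := 2 * T * C1 + 3 with hC4
  have hC4p : 0 < C4 := by positivity
  set τ := min (min (rq/2) (1/2)) (min (T/2) (T/(2*C3))) with hτ
  have hτp : 0 < τ := lt_min (lt_min (by positivity) (by norm_num)) (lt_min (by positivity) (by positivity))
  have t1 : τ ≤ rq/2 := (min_le_left _ _).trans (min_le_left _ _)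
  have t2 : τ ≤ 1/2 := (min_le_left _ _).trans (min_le_right _ _)
  have t3 : τ ≤ T/2 := (min_le_right _ _).trans (min_le_left _ _)
  have t4 : C3 * τ ≤ T/2 := by
    have : τ ≤ T/(2*C3) := (min_le_right _ _).trans (min_le_right _ _)
    rw [le_div_iff₀ (by positivity)] at this; linarith
  set r := min r1 (T / (2 * (C4 + 1))) with hr
  have hrp : 0 < r := lt_min hr1 (by positivity)
  have r2 : r * (2 * (C4+1)) ≤ T := by
    have : r ≤ T / (2 * (C4 + 1)) := min_le_right _ _
    rwa [le_div_iff₀ (by positivity)] at this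
  have r3 : 2 * C4 * r^2 < T^2 := by
    have h1 : (r * (2 * (C4+1)))^2 ≤ T^2 := by gcongr
    have h2 : 2 * C4 * r^2 < (r * (2 * (C4+1)))^2 := by
      have : 0 < r^2 := by positivity
      nlinarith [mul_pos this hC4p, mul_pos (mul_pos this hC4p) hC4p]
    linarith
  refine ⟨τ, hτp, by linarith, r, hrp, ?_⟩
  filter_upwards [ev_pos, ev_small 2 (ρ := min (rq/2) (1/2)) (lt_min (by positivity) (by norm_num)),
    ev_small (8 * C3) (ρ := T/2) (by positivity), ev_small (-Real.log (c * r^2)) (ρ := T/2) (by positivity)]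
    with ε h0 h1 h2 h3 z hz hz0 hzr hs
  have hu := uF_re (T := T) (ε := ε) (hΦ z hz)
  have hcz : 0 ≤ c * ‖z‖^2 := by positivity
  have hδ := Real.exp_pos (-T/ε)
  have f1 := tip_im (T := T) (Φ := Φ) (z := z) h0 (by linarith)
  have f2 := tip_re h0 hc hu hrp hzr
  have f3 := sF_im_le (T := T) (Φ := Φ) (z := z) h0 (by linarith)
  have f4 := sF_re_le (T := T) (Φ := Φ) (z := z) h0 (by linarith)
  set s := sF T ε Φ z
  set y := T - s.re with hy
  have hzp : 0 < ‖z‖^2 := by have := norm_pos_iff.2 hz0; positivity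
  set θ := s - T with hθ
  have hθs : (T:ℂ) + θ = s := by rw [hθ]; ring
  have hθre : θ.re = -y := by simp [hθ, hy]
  have hθim : θ.im = s.im := by simp [hθ]
  have hy0 : 0 ≤ y := by linarith
  have hyτ : y ≤ τ := by linarith
  have hθn : ‖θ‖^2 ≤ (τ + 8 * ε) * y := by
    rw [Complex.sq_norm, Complex.normSq_apply, hθre, hθim]
    have := mul_le_mul_of_nonneg_right hyτ hy0
    linarith
  have hpi := Real.pi_lt_d2
  have hθ1 : ‖θ‖ ≤ τ + ε * 2 := by
    refine (Complex.norm_le_abs_re_add_abs_im _).trans ?_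
    rw [hθre, hθim, abs_neg, abs_of_nonneg hy0]
    have : ε * (Real.pi/2) ≤ ε * 2 := by gcongr; linarith
    linarith
  have hm1 := min_le_left (rq/2) (1/2 : ℝ)
  have hm2 := min_le_right (rq/2) (1/2 : ℝ)
  have hR := hrem θ (by linarith)
  rw [hθs] at hR
  have hfd : fderiv ℂ q (T:ℂ) θ = θ • eB i := by
    rw [(hq (T:ℂ)).hasDerivAt.hasFDerivAt.fderiv, hq'T]; simp
  rw [hfd, hqT] at hR
  set R := q s - (T:ℂ) • eB i - θ • eB i with hRd
  have hqs : z + q s = (T:ℂ) • eB i + (z + θ • eB i + R) := by rw [hRd]; abel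
  have hθle1 : ‖θ‖ ≤ 1 := by linarith
  have hvi : ((z + θ • eB i + R : CSp n) i).re ≤ C1 * ‖z‖^2 - y + Cq * ‖θ‖^2 := by
    have e : (z + θ • eB i + R : CSp n) i = z i + θ + R i := by simp [eB]
    rw [e, Complex.add_re, Complex.add_re, hθre]
    have h5 := hcone z hz (hzr.trans (min_le_left _ _))
    have h6 : (R i).re ≤ Cq * ‖θ‖^2 := (Complex.re_le_norm _).trans ((PiLp.norm_apply_le R i).trans hR)
    linarith
  have hvn : ‖z + θ • eB i + R‖^2 ≤ 3 * ‖z‖^2 + (3 + 3 * Cq^2) * ‖θ‖^2 := by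
    have h5 : ‖z + θ • eB i + R‖ ≤ ‖z‖ + ‖θ‖ + Cq * ‖θ‖ := by
      refine (norm_add_le _ _).trans (add_le_add ((norm_add_le _ _).trans (add_le_add le_rfl ?_)) ?_)
      · rw [norm_smul, norm_eB, mul_one]
      · refine hR.trans (mul_le_mul_of_nonneg_left ?_ hC.le)
        rw [pow_two]; exact mul_le_of_le_one_left (norm_nonneg θ) hθle1
    have h6 : ‖z + θ • eB i + R‖^2 ≤ (‖z‖ + ‖θ‖ + Cq * ‖θ‖)^2 := by gcongr
    linarith [sq_nonneg (‖z‖ - ‖θ‖), sq_nonneg (‖z‖ - Cq * ‖θ‖), sq_nonneg (‖θ‖ - Cq * ‖θ‖)]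
  have hmain : ‖z + q s‖^2 < T^2 := by
    rw [hqs, norm_tip_sq]
    have g1 : C3 * ‖θ‖^2 ≤ T * y := by
      have : C3 * ‖θ‖^2 ≤ C3 * ((τ + 8 * ε) * y) := by gcongr
      have g : C3 * (τ + 8 * ε) ≤ T := by linarith
      have g' := mul_le_mul_of_nonneg_right g hy0
      linarith
    have g2 : C4 * ‖z‖^2 < T * y := by
      have g3 : ‖z‖^2/r^2 * (T/2) ≤ y := by
        refine le_trans ?_ f2
        gcongr
        linarith
      have g4 : C4 * ‖z‖^2 < T * (‖z‖^2/r^2 * (T/2)) := by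
        have e : T * (‖z‖^2/r^2 * (T/2)) = ‖z‖^2 * (T^2 / (2 * r^2)) := by field_simp
        rw [e, mul_comm C4]
        refine mul_lt_mul_of_pos_left ?_ hzp
        rw [lt_div_iff₀ (by positivity)]
        linarith
      have : T * (‖z‖^2/r^2 * (T/2)) ≤ T * y := by gcongr
      linarith
    have g5 : 2 * T * ((z + θ • eB i + R : CSp n) i).re ≤ 2 * T * (C1 * ‖z‖^2 - y + Cq * ‖θ‖^2) := by
      gcongr
    rw [hC3] at g1
    rw [hC4] at g2
    linarith
  exact lt_of_pow_lt_pow_left₀ 2 hT.le hmain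

end PartE5
end

open Metric Set Filter Asymptotics
open scoped Manifold Topology
noncomputable section
section PartE6
variable {n : ℕ} {T : ℝ} {Φ : CSp n → ℂ} {q : ℂ → CSp n} {W K : Set (CSp n)}

theorem phi_real_deriv (hW : IsOpen W) (h0 : (0:CSp n) ∈ W) (hΦ : DifferentiableOn ℂ Φ W) (i : Fin n)
    (hd : ∀ w, fderiv ℂ Φ 0 w = w i) : ∀ w, fderiv ℝ Φ 0 w = w i := by
  intro w
  have h1 : HasFDerivAt Φ (fderiv ℂ Φ 0) 0 := (hΦ.differentiableAt (hW.mem_nhds h0)).hasFDerivAt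
  rw [(h1.restrictScalars ℝ).fderiv]
  exact hd w

theorem phi_strict (hW : IsOpen W) (h0 : (0:CSp n) ∈ W) (hΦ : DifferentiableOn ℂ Φ W) (i : Fin n)
    (hd : ∀ w, fderiv ℂ Φ 0 w = w i) :
    ∀ κ > 0, ∃ r > 0, ∀ z z' : CSp n, ‖z‖ < r → ‖z'‖ < r →
      ‖Φ z - Φ z' - (z i - z' i)‖ ≤ κ * ‖z - z'‖ := by
  intro κ hκ
  have hs : HasStrictFDerivAt Φ (fderiv ℝ Φ 0) 0 :=
    ((holo_sm hW hΦ).contDiffAt (hW.mem_nhds h0)).hasStrictFDerivAt (by simp)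
  have h1 := hs.isLittleO.bound hκ
  rw [nhds_prod_eq] at h1
  obtain ⟨r, hr, hb⟩ := (Metric.nhds_basis_ball.prod_self.eventually_iff).1 h1
  refine ⟨r, hr, fun z z' hz hz' => ?_⟩
  have := hb (x := (z, z')) ⟨by simpa using hz, by simpa using hz'⟩
  simp only [phi_real_deriv hW h0 hΦ i hd] at this
  simpa using this

theorem phi_cone (hW : IsOpen W) (h0 : (0:CSp n) ∈ W) (hΦ : DifferentiableOn ℂ Φ W) (i : Fin n) (hΦ0 : Φ 0 = 0)
    (hd : ∀ w, fderiv ℂ Φ 0 w = w i) {c : ℝ} (hc : 0 < c) (hre : ∀ z ∈ K, (Φ z).re ≤ -c * ‖z‖^2) :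
    ∃ r1 > 0, ∃ C1 > 0, ∀ z ∈ K, ‖z‖ ≤ r1 → (z i).re ≤ C1 * ‖z‖^2 := by
  obtain ⟨C, hC, r, hr, h⟩ := quad_rem (𝕜 := ℝ)
    (((holo_sm hW hΦ).contDiffAt (hW.mem_nhds h0)).of_le (m := 2) (WithTop.coe_le_coe.2 (le_top : (2:ℕ∞) ≤ ⊤)))
  refine ⟨r, hr, C, hC, fun z hz hzr => ?_⟩
  have h1 := h z hzr
  rw [zero_add, hΦ0, sub_zero, phi_real_deriv hW h0 hΦ i hd] at h1
  have h2 := (abs_le.1 ((Complex.abs_re_le_norm _).trans h1)).1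
  rw [Complex.sub_re] at h2
  have h3 := hre z hz
  have : 0 ≤ c * ‖z‖^2 := by positivity
  linarith

theorem phi_lip (hW : IsOpen W) (hΦ : DifferentiableOn ℂ Φ W) {K1 : Set (CSp n)} (hK1 : IsCompact K1) (h : K1 ⊆ W) :
    ∃ L > 0, ∀ z ∈ K1, ∀ z' ∈ K1, ‖Φ z - Φ z'‖ ≤ L * ‖z - z'‖ := by
  have hl : LocallyLipschitzOn K1 Φ := by
    intro x hx
    have hc : ContDiffAt ℝ 1 Φ x :=
      ((holo_sm hW hΦ).contDiffAt (hW.mem_nhds (h hx))).of_le (by exact_mod_cast le_top)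
    obtain ⟨C, t, ht, hl⟩ := hc.exists_lipschitzOnWith
    exact ⟨C, t, mem_nhdsWithin_of_mem_nhds ht, hl⟩
  obtain ⟨L, hL⟩ := hl.exists_lipschitzOnWith_of_compact hK1
  refine ⟨L + 1, by positivity, fun z hz z' hz' => ?_⟩
  have := hL.dist_le_mul z hz z' hz'
  rw [dist_eq_norm, dist_eq_norm] at this
  nlinarith [norm_nonneg (z - z')]

theorem ball_all (hT : 0 < T) (i : Fin n) (hq : Differentiable ℂ q) (hq0 : q 0 = 0) (hqT : q T = (T:ℂ) • eB i)
    (hq'T : deriv q T = eB i) (hqb : ∀ t : ℝ, 0 ≤ t → t < T → ‖q t‖ < T)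
    (hK : IsCompact K) (hKT : K ⊆ ball 0 T) {M : ℝ} (hM : ∀ z ∈ K, ‖Φ z‖ ≤ M)
    {c : ℝ} (hc : 0 < c) (hΦ : ∀ z ∈ K, (Φ z).re ≤ -c * ‖z‖^2)
    {r1 C1 : ℝ} (hr1 : 0 < r1) (hC1 : 0 < C1) (hcone : ∀ z ∈ K, ‖z‖ ≤ r1 → (z i).re ≤ C1 * ‖z‖^2) :
    ∀ᶠ ε : ℝ in 𝓝[>] 0, ∀ z ∈ K, z ≠ 0 → ‖z + q (sF T ε Φ z)‖ < T := by
  obtain ⟨τ, hτ, hτT, r, hr, htip⟩ := ball_tip hT i hq hqT hq'T hc hΦ hr1 hC1 hcone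
  obtain ⟨gap, hgap, ρ, hρ, hg⟩ := qE_ball hT hq hqb hτ hτT
  obtain ⟨M', hM', hMl⟩ := qE_lip hq T
  set r2 := min r (gap/2) with hr2
  have hr2p : 0 < r2 := lt_min hr (half_pos hgap)
  obtain ⟨T1, hT1, hKT1⟩ : ∃ T1 < T, ∀ z ∈ K, ‖z‖ ≤ T1 := by
    rcases K.eq_empty_or_nonempty with rfl | hne
    · exact ⟨0, hT, by simp⟩
    · obtain ⟨z0, hz0, hmax⟩ := hK.exists_isMaxOn hne continuous_norm.continuousOn
      exact ⟨‖z0‖, by simpa using hKT hz0, fun z hz => hmax hz⟩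
  set η := min 1 ((T - T1) / (2 * M')) with hη
  have hηp : 0 < η := lt_min one_pos (div_pos (by linarith) (by positivity))
  have hη1 : η ≤ 1 := min_le_left _ _
  have hη2 : M' * η ≤ (T - T1)/2 := by
    have : η ≤ (T - T1) / (2 * M') := min_le_right _ _
    rw [le_div_iff₀ (by positivity)] at this; linarith
  filter_upwards [htip, ev_rect hT hM hc.le hΦ hρ, ev_away hT hM hc hΦ hηp hr2p] with ε h1 h2 h3 z hz hz0
  by_cases hzr : r2 ≤ ‖z‖
  · have h4 := h3 z hz hzr
    set s := sF T ε Φ z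
    have hs1 : s ∈ rectS T 1 := by
      have a1 := (Complex.abs_re_le_norm s).trans (h4.trans hη1)
      have a2 := (Complex.abs_im_le_norm s).trans (h4.trans hη1)
      rw [abs_le] at a1
      exact ⟨⟨a1.1, by linarith [a1.2]⟩, a2⟩
    have h01 : (0:ℂ) ∈ rectS T 1 := by
      refine ⟨⟨?_, ?_⟩, ?_⟩ <;> simp
      linarith
    have h5 := hMl s hs1 0 h01
    rw [hq0, sub_zero, sub_zero] at h5
    have h6 : M' * ‖s‖ ≤ M' * η := by gcongr
    have := norm_add_le z (q s)
    have := hKT1 z hz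
    linarith
  · push Not at hzr
    have hz1 : ‖z‖ ≤ r := hzr.le.trans (min_le_left _ _)
    have hz2 : ‖z‖ < gap/2 := hzr.trans_le (min_le_right _ _)
    by_cases hs : T - τ ≤ (sF T ε Φ z).re
    · exact h1 z hz hz0 hz1 hs
    · push Not at hs
      obtain ⟨b1, b2, b3⟩ := h2 z hz
      have h5 := hg _ ⟨⟨b1.le, by linarith⟩, b3⟩ hs.le
      have := norm_add_le z (q (sF T ε Φ z))
      linarith

theorem inj_away (hq : Differentiable ℂ q) {K1 : Set (CSp n)} {L : ℝ} (hL0 : 0 < L)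
    (hL : ∀ z ∈ K1, ∀ z' ∈ K1, ‖Φ z - Φ z'‖ ≤ L * ‖z - z'‖) {a : ℝ} (ha : 0 < a) (W : Set (CSp n)) :
    ∀ᶠ ε : ℝ in 𝓝[>] 0, ∀ ρ ≤ 1, ∀ z ∈ AS T ε Φ W ρ, ∀ z' ∈ AS T ε Φ W ρ, z ∈ K1 → z' ∈ K1 →
      a ≤ (-Φ z).re → a ≤ (-Φ z').re →
      z + q (sF T ε Φ z) = z' + q (sF T ε Φ z') → z = z' := by
  obtain ⟨M, hM, hMl⟩ := qE_lip hq T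
  filter_upwards [ev_pos, ev_small (Real.pi/2) one_pos, ev_small (M * (a⁻¹ * L)) one_pos] with ε h0 h1 h2 ρ hρ z hz z' hz' hK hK' hza hza' he
  have hmem : ∀ z ∈ AS T ε Φ W ρ, sF T ε Φ z ∈ rectS T 1 := fun z hz =>
    ⟨⟨by linarith [hz.2.2.1], by linarith [hz.2.2.2]⟩, (sF_im_le h0 hz.2.1).trans h1.le⟩
  have hu : ∀ z, a ≤ (-Φ z).re → a ≤ (uF T ε Φ z).re := fun z h => by
    rw [uF, Complex.sub_re, Complex.ofReal_re]
    rw [Complex.neg_re] at h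
    have := Real.exp_pos (-T/ε)
    linarith
  have h3 := sF_lip h0 ha (hu z hza) (hu z' hza')
  have h4 := hMl _ (hmem z hz) _ (hmem z' hz')
  have h5 := hL z hK z' hK'
  have hnorm : ‖z - z'‖ = ‖q (sF T ε Φ z) - q (sF T ε Φ z')‖ := by
    have : z - z' = (z + q (sF T ε Φ z)) - (z' + q (sF T ε Φ z')) - (q (sF T ε Φ z) - q (sF T ε Φ z')) := by abel
    rw [this, he, sub_self, zero_sub, norm_neg]
  by_contra hne
  have hp : 0 < ‖z - z'‖ := norm_pos_iff.2 (sub_ne_zero.2 hne)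
  have h6 : ‖z - z'‖ ≤ M * (ε * (a⁻¹ * (L * ‖z - z'‖))) := by
    calc ‖z - z'‖ ≤ _ := hnorm.le.trans h4
      _ ≤ M * (ε * (a⁻¹ * ‖Φ z - Φ z'‖)) := by gcongr
      _ ≤ _ := by gcongr
  have h7 : M * (ε * (a⁻¹ * (L * ‖z - z'‖))) = (ε * (M * (a⁻¹ * L))) * ‖z - z'‖ := by ring
  rw [h7] at h6
  nlinarith

end PartE6
end

open Metric Set Filter Asymptotics
open scoped Manifold Topology
noncomputable section
section PartE7
variable {n : ℕ}

theorem AS_mono {T ε : ℝ} {Φ : CSp n → ℂ} {W : Set (CSp n)} {ρ ρ' : ℝ} (h : ρ ≤ ρ') :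
    AS T ε Φ W ρ ⊆ AS T ε Φ W ρ' := by
  rintro z ⟨h1, h2, h3, h4⟩
  exact ⟨h1, h2, by linarith, by linarith⟩

set_option maxHeartbeats 1000000 in
theorem partE (hn : 2 ≤ n) {K W : Set (CSp n)} {Φ : CSp n → ℂ} (hK : IsCompact K) (hconn : IsPathConnected Kᶜ)
    (hW : IsOpen W) (hKW : K ⊆ W) (hΦ : DifferentiableOn ℂ Φ W) (h0K : (0:CSp n) ∈ K) (hΦ0 : Φ 0 = 0) (i : Fin n)
    (hd : ∀ w, fderiv ℂ Φ 0 w = w i) {c : ℝ} (hc : 0 < c) (hre : ∀ z ∈ K, (Φ z).re ≤ -c * ‖z‖^2) :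
    ∃ W' : Set (CSp n), IsOpen W' ∧ K ⊆ W' ∧ ∃ F : CSp n → CSp n, DifferentiableOn ℂ F W' ∧ InjOn F W' ∧
      F 0 = eB i ∧ ∀ z ∈ K, z ≠ 0 → ‖F z‖ < 1 := by
  obtain ⟨r1, hr1, C1, hC1, hcone⟩ := phi_cone hW (hKW h0K) hΦ i hΦ0 hd hc hre
  obtain ⟨T, hT, hKT, q, hq, hq0, hqT, hq'T, hinj, hdq, hdq0, hqK, hqb⟩ :=
    curve_exists hn hK hconn i hr1 hC1 hcone
  obtain ⟨K1, hK1, hKK1, hK1W⟩ := exists_compact_between hK hW hKW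
  obtain ⟨L, hL, hlip⟩ := phi_lip hW hΦ hK1 hK1W
  have hW1 : IsOpen (interior K1) := isOpen_interior
  have hΦ1 : DifferentiableOn ℂ Φ (interior K1) := hΦ.mono (interior_subset.trans hK1W)
  obtain ⟨M, hM⟩ := hK.exists_bound_of_continuousOn (hΦ.continuousOn.mono hKW)
  obtain ⟨r, hr, ρ, hρ, hnear⟩ := inj_near hT i hq hinj hdq hdq0
    (phi_strict hW (hKW h0K) hΦ i hd) (interior K1)
  obtain ⟨d, hd0, ρd, hρd, hdist⟩ := qE_dist hT hq hK hq0 hqK hr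
  obtain ⟨M', hM', hql⟩ := qE_lip hq T
  obtain ⟨r', hr'0, hr'r, hr'd⟩ : ∃ r' : ℝ, 0 < r' ∧ r' < r ∧ r' ≤ d/4 :=
    ⟨min (r/2) (d/4), by positivity, (min_le_left _ _).trans_lt (by linarith), min_le_right _ _⟩
  obtain ⟨η, hη0, hη1, hηd⟩ : ∃ η : ℝ, 0 < η ∧ η ≤ 1 ∧ M' * η ≤ d/4 := by
    refine ⟨min 1 (d/(4*M')), by positivity, min_le_left _ _, ?_⟩
    have := mul_le_mul_of_nonneg_left (min_le_right 1 (d/(4*M'))) hM'.le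
    refine this.trans (le_of_eq ?_)
    field_simp
  obtain ⟨ρ', hρ'0, hρ'1, hρ'ρ⟩ : ∃ ρ' : ℝ, 0 < ρ' ∧ ρ' ≤ 1 ∧ ρ' ≤ ρ :=
    ⟨min 1 ρ, by positivity, min_le_left _ _, min_le_right _ _⟩
  have ha : 0 < c * r'^2/2 := by positivity
  have hρ2 : 0 < min ρ' ρd := by positivity
  obtain ⟨ε, hε, hN, hA, hB, hR, hS⟩ := (ev_pos.and (hnear.and ((inj_away (T := T) hq hL hlip ha (interior K1)).and
    ((ball_all hT i hq hq0 hqT hq'T hqb hK hKT hM hc hre hr1 hC1 hcone).and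
    ((ev_rect hT hM hc.le hre hρ2).and (ev_away hT hM hc hre hη0 hr)))))).exists
  have hKA : K ⊆ AS T ε Φ (interior K1) ρ' := by
    intro z hz
    obtain ⟨h1, h2, h3⟩ := hR z hz
    refine ⟨hKK1 hz, ?_, ?_, by linarith⟩
    · have h4 := uF_re (T := T) (ε := ε) (hre z hz)
      have h5 : 0 ≤ c * ‖z‖^2 := by positivity
      have h6 := Real.exp_pos (-T/ε)
      linarith
    · have := min_le_left ρ' ρd
      linarith
  have hKr : ∀ z ∈ K, sF T ε Φ z ∈ rectS T ρd := by
    intro z hz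
    obtain ⟨h1, h2, h3⟩ := hR z hz
    have := min_le_right ρ' ρd
    exact ⟨⟨by linarith, by linarith⟩, by linarith⟩
  have hAo : IsOpen (AS T ε Φ (interior K1) ρ') := AS_open hW1 hΦ1
  set f : CSp n → CSp n := fun z => z + q (sF T ε Φ z) with hf
  have hfd : DifferentiableOn ℂ f (AS T ε Φ (interior K1) ρ') := by
    have h1 : DifferentiableOn ℂ (sF T ε Φ) (AS T ε Φ (interior K1) ρ') :=
      (sF_diff (T := T) (ε := ε) hΦ1).mono (fun z hz => ⟨hz.1, hz.2.1⟩)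
    exact differentiableOn_id.add (hq.comp_differentiableOn h1)
  have hbig : ∀ z ∈ K, r' ≤ ‖z‖ → c * r'^2/2 < (-Φ z).re := by
    intro z hz h
    have h1 := hre z hz
    have h2 : c * r'^2 ≤ c * ‖z‖^2 := by gcongr
    have h3 : (-Φ z).re = -(Φ z).re := rfl
    rw [h3]
    linarith
  have hmix : ∀ z ∈ K, ∀ z' ∈ K, ‖z‖ < r' → r ≤ ‖z'‖ → f z ≠ f z' := by
    intro z hz z' hz' h1 h2 he
    have h3 := hdist _ (hKr z hz) z' hz' h2
    have h4 : q (sF T ε Φ z) - z' = q (sF T ε Φ z') - z := by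
      have : z + q (sF T ε Φ z) = z' + q (sF T ε Φ z') := he
      rw [sub_eq_sub_iff_add_eq_add, add_comm, this, add_comm]
    rw [h4] at h3
    have h5 := hS z' hz' h2
    have h6 : sF T ε Φ z' ∈ rectS T 1 := by
      have h7 := (abs_le.1 ((Complex.abs_re_le_norm (sF T ε Φ z')).trans h5))
      have h8 := (Complex.abs_im_le_norm (sF T ε Φ z')).trans h5
      exact ⟨⟨by linarith [h7.1], by linarith [h7.2]⟩, by linarith⟩
    have h9 : (0:ℂ) ∈ rectS T 1 := by
      refine ⟨⟨?_, ?_⟩, ?_⟩ <;> simp <;> linarith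
    have h10 := hql _ h6 _ h9
    rw [hq0, sub_zero, sub_zero] at h10
    have h11 := mul_le_mul_of_nonneg_left h5 hM'.le
    have h12 := norm_sub_le (q (sF T ε Φ z')) z
    linarith
  have hNN : ∀ z ∈ AS T ε Φ (interior K1) ρ', ∀ z' ∈ AS T ε Φ (interior K1) ρ', ‖z‖ < r → ‖z'‖ < r →
      f z = f z' → z = z' := fun z hz z' hz' h1 h2 h =>
    hN z (AS_mono hρ'ρ hz) z' (AS_mono hρ'ρ hz') h1 h2 h
  have hAA : ∀ z ∈ AS T ε Φ (interior K1) ρ', ∀ z' ∈ AS T ε Φ (interior K1) ρ', c * r'^2/2 < (-Φ z).re →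
      c * r'^2/2 < (-Φ z').re → f z = f z' → z = z' := fun z hz z' hz' h1 h2 h =>
    hA ρ' hρ'1 z hz z' hz' (interior_subset hz.1) (interior_subset hz'.1) h1.le h2.le h
  have hinjK : InjOn f K := by
    intro z hz z' hz' he
    rcases lt_or_ge ‖z‖ r' with h1 | h1
    · rcases lt_or_ge ‖z'‖ r with h2 | h2
      · exact hNN z (hKA hz) z' (hKA hz') (h1.trans hr'r) h2 he
      · exact absurd he (hmix z hz z' hz' h1 h2)
    · rcases lt_or_ge ‖z'‖ r' with h2 | h2
      · rcases lt_or_ge ‖z‖ r with h3 | h3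
        · exact hNN z (hKA hz) z' (hKA hz') h3 (h2.trans hr'r) he
        · exact absurd he.symm (hmix z' hz' z hz h2 h3)
      · exact hAA z (hKA hz) z' (hKA hz') (hbig z hz h1) (hbig z' hz' h2) he
  have hloc : ∀ x ∈ K, ∃ u ∈ 𝓝 x, InjOn f u := by
    intro x hx
    rcases lt_or_ge ‖x‖ r with h1 | h1
    · refine ⟨AS T ε Φ (interior K1) ρ' ∩ ball 0 r, (hAo.inter isOpen_ball).mem_nhds ⟨hKA hx, by simpa using h1⟩, ?_⟩
      intro z hz z' hz' he
      exact hNN z hz.1 z' hz'.1 (by simpa using hz.2) (by simpa using hz'.2) he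
    · have hco : ContinuousOn (fun z => (-Φ z).re) (AS T ε Φ (interior K1) ρ') :=
        Complex.continuous_re.comp_continuousOn (hΦ1.continuousOn.mono (fun z hz => hz.1)).neg
      have ho := hco.isOpen_inter_preimage hAo (isOpen_Ioi (a := c * r'^2/2))
      refine ⟨_, ho.mem_nhds ⟨hKA hx, hbig x hx (hr'r.le.trans h1)⟩, ?_⟩
      intro z hz z' hz' he
      exact hAA z hz.1 z' hz'.1 hz.2 hz'.2 he
  obtain ⟨t, ht, hti⟩ := hinjK.exists_mem_nhdsSet hK
    (fun x hx => (hfd.differentiableAt (hAo.mem_nhds (hKA hx))).continuousAt) hloc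
  obtain ⟨V, hV, hKV, hVt⟩ := mem_nhdsSet_iff_exists.1 ht
  have hTc : (T:ℂ) ≠ 0 := by exact_mod_cast hT.ne'
  refine ⟨V ∩ AS T ε Φ (interior K1) ρ', hV.inter hAo, subset_inter hKV hKA,
    fun z => (T:ℂ)⁻¹ • f z, (hfd.mono inter_subset_right).const_smul ((T:ℂ)⁻¹), ?_, ?_, ?_⟩
  · intro z hz z' hz' he
    exact hti (hVt hz.1) (hVt hz'.1) (smul_right_injective _ (inv_ne_zero hTc) he)
  · simp only [hf]
    rw [sF_zero hε hΦ0, hqT, zero_add, smul_smul, inv_mul_cancel₀ hTc, one_smul]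
  · intro z hz hz0
    have h1 := hB z hz hz0
    have h2 : ‖(T:ℂ)⁻¹ • f z‖ = T⁻¹ * ‖f z‖ := by
      rw [norm_smul, norm_inv, Complex.norm_real, Real.norm_of_nonneg hT.le]
    rw [h2, inv_mul_lt_iff₀ hT, mul_one]
    exact h1

end PartE7
end

open Metric Set Filter Asymptotics
open scoped Manifold Topology
noncomputable section
section PartF1
variable {n : ℕ}

theorem exists_coord (A : CSp n →L[ℂ] ℂ) (hA : A ≠ 0) (i : Fin n) :
    ∃ B : CSp n ≃L[ℂ] CSp n, ∀ z, A z = (B z) i := by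
  set a := (InnerProductSpace.toDual ℂ (CSp n)).symm A with ha
  have ha0 : a ≠ 0 := by
    rw [ha]; simpa using hA
  have he0 : eB i ≠ (0 : CSp n) := by
    intro h
    have := norm_eB (n := n) i
    rw [h] at this; simp at this
  obtain ⟨S, hS⟩ := SeparatingDual.exists_continuousLinearEquiv_apply_eq (R := ℂ) he0 ha0
  have h1 : ∀ x, ContinuousLinearMap.adjoint (S.symm : CSp n →L[ℂ] CSp n)
      (ContinuousLinearMap.adjoint (S : CSp n →L[ℂ] CSp n) x) = x := by
    intro x
    refine ext_inner_left ℂ fun y => ?_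
    rw [ContinuousLinearMap.adjoint_inner_right, ContinuousLinearMap.adjoint_inner_right]; simp
  have h2 : ∀ x, ContinuousLinearMap.adjoint (S : CSp n →L[ℂ] CSp n)
      (ContinuousLinearMap.adjoint (S.symm : CSp n →L[ℂ] CSp n) x) = x := by
    intro x
    refine ext_inner_left ℂ fun y => ?_
    rw [ContinuousLinearMap.adjoint_inner_right, ContinuousLinearMap.adjoint_inner_right]; simp
  refine ⟨ContinuousLinearEquiv.equivOfInverse _ _ h1 h2, fun z => ?_⟩
  have h3 : A z = inner ℂ a z := (InnerProductSpace.toDual_symm_apply).symm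
  rw [h3, ← hS]
  have h4 : inner ℂ (eB i) (ContinuousLinearMap.adjoint (S : CSp n →L[ℂ] CSp n) z) = inner ℂ (S (eB i)) z :=
    ContinuousLinearMap.adjoint_inner_right _ _ _
  rw [← h4, eB, EuclideanSpace.inner_single_left]
  simp

set_option maxHeartbeats 1000000 in
theorem main_aux (hn : 2 ≤ n) (Ω : Set (CSp n)) (p : CSp n)
    (hΩ : IsBoundedDomain Ω) (hp : p ∈ frontier Ω)
    (hspc : ∃ U : Set (CSp n), IsOpen U ∧ p ∈ U ∧ ∃ ρ : CSp n → ℝ,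
      ContDiffOn ℝ 2 ρ U ∧ (∀ w ∈ U, fderiv ℝ ρ w ≠ 0) ∧
      Ω ∩ U = {z ∈ U | ρ z < 0} ∧
      ∀ w ∈ U, LeviPosDef ρ w)
    (hstein : HasSteinNbhdBasis (closure Ω)) (i : Fin n) :
    ∃ (W : Set (CSp n)) (f : CSp n → CSp n),
      IsOpen W ∧ closure Ω ⊆ W ∧
      DifferentiableOn ℂ f W ∧ Set.InjOn f W ∧ f p = eB i ∧ ∀ z ∈ closure Ω, z ≠ p → ‖f z‖ < 1 := by
  obtain ⟨U, hU, hpU, ρ, hρ, hdρ, hdef, hlevi⟩ := hspc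
  have hK : IsCompact (closure Ω) := hΩ.2.2.isCompact_closure
  have hpK : p ∈ closure Ω := hp.1
  obtain ⟨P, hP, hP0, hdP, c, hc, r, hr, hPr⟩ := local_peak hΩ.1 hp hU hpU hρ (hdρ p hpU) hdef (hlevi p hpU)
  obtain ⟨W, hW, hKW, Φ, hΦ, hΦ0, hdΦ, c', hc', hre⟩ := peak hK hstein hpK hP hP0 hc hr hPr
  have hconn := compl_conn hn hK hstein
  obtain ⟨B, hB⟩ := exists_coord (fderiv ℂ Φ p) (by rw [hdΦ]; exact hdP) i
  set K := closure Ω with hKdef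
  let h : CSp n ≃ₜ CSp n := (Homeomorph.subRight p).trans B.toHomeomorph
  have hh : ∀ z, h z = B (z - p) := fun z => rfl
  let g : CSp n → CSp n := fun w => B.symm w + p
  have hgh : ∀ z, g (h z) = z := fun z => by simp [g, hh]
  have hhg : ∀ z, h (g z) = z := fun z => by simp [g, hh]
  have hgd : Differentiable ℂ g := B.symm.differentiable.add_const p
  have hhd : Differentiable ℂ h := by
    show Differentiable ℂ (fun z => B (z - p))
    exact B.differentiable.comp (differentiable_id.sub_const p)
  have hg0 : g 0 = p := by simp [g]
  have hhp : h p = 0 := by simp [hh]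
  have hconn' : IsPathConnected (h '' K)ᶜ := by
    rw [← Homeomorph.image_compl]
    exact hconn.image h.continuous
  have hd' : ∀ w, fderiv ℂ (Φ ∘ g) 0 w = w i := by
    intro w
    have h1 : HasFDerivAt Φ (fderiv ℂ Φ p) (g 0) := by
      rw [hg0]; exact (hΦ.differentiableAt (hW.mem_nhds (hKW hpK))).hasFDerivAt
    have h2 : HasFDerivAt g (B.symm : CSp n →L[ℂ] CSp n) 0 := (B.symm.hasFDerivAt).add_const p
    rw [(h1.comp 0 h2).fderiv]
    show fderiv ℂ Φ p (B.symm w) = w i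
    rw [hB]; simp
  obtain ⟨b, hb, hbB⟩ : ∃ b > 0, ∀ z, ‖B z‖ ≤ b * ‖z‖ := by
    refine ⟨‖(B : CSp n →L[ℂ] CSp n)‖ + 1, by positivity, fun z => ?_⟩
    refine ((B : CSp n →L[ℂ] CSp n).le_opNorm z).trans ?_
    gcongr
    linarith
  obtain ⟨W', hW', hKW', F, hF, hFi, hF0, hF1⟩ := partE hn (K := h '' K) (W := g ⁻¹' W) (Φ := Φ ∘ g)
    (hK.image h.continuous) hconn' (hW.preimage hgd.continuous)
    (by rintro _ ⟨z, hz, rfl⟩; rw [mem_preimage, hgh]; exact hKW hz)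
    (hΦ.comp hgd.differentiableOn (fun z hz => hz)) ⟨p, hpK, hhp⟩ (by simp [hg0, hΦ0]) i hd'
    (c := c' / b^2) (by positivity) (by
      rintro _ ⟨z, hz, rfl⟩
      rw [Function.comp_apply, hgh]
      refine (hre z hz).trans ?_
      have h1 : ‖h z‖^2 ≤ (b * dist z p)^2 := by
        rw [hh, dist_eq_norm]; gcongr; exact hbB _
      have h2 : c' / b^2 * ‖h z‖^2 ≤ c' / b^2 * (b * dist z p)^2 := by gcongr
      have h3 : c' / b^2 * (b * dist z p)^2 = c' * dist z p ^ 2 := by field_simp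
      linarith)
  refine ⟨h ⁻¹' W', F ∘ h, hW'.preimage h.continuous, fun z hz => hKW' ⟨z, hz, rfl⟩,
    hF.comp hhd.differentiableOn (fun z hz => hz), ?_, by simp [hhp, hF0], ?_⟩
  · intro z hz z' hz' he
    exact h.injective (hFi hz hz' he)
  · intro z hz hzp
    exact hF1 _ ⟨z, hz, rfl⟩ (fun h0 => hzp (h.injective (h0.trans hhp.symm)))

end PartF1

theorem exposing_point_strongly_pseudoconvex
    (n : ℕ) (hn : 2 ≤ n) (Ω : Set (CSp n)) (p : CSp n)
    (hΩ : IsBoundedDomain Ω) (hp : p ∈ frontier Ω)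
    (hspc : ∃ U : Set (CSp n), IsOpen U ∧ p ∈ U ∧ ∃ ρ : CSp n → ℝ,
      ContDiffOn ℝ 2 ρ U ∧ (∀ w ∈ U, fderiv ℝ ρ w ≠ 0) ∧
      Ω ∩ U = {z ∈ U | ρ z < 0} ∧
      ∀ w ∈ U, LeviPosDef ρ w)
    (hstein : HasSteinNbhdBasis (closure Ω)) :
    ∃ (W : Set (CSp n)) (f : CSp n → CSp n),
      IsOpen W ∧ closure Ω ⊆ W ∧
      DifferentiableOn ℂ f W ∧ Set.InjOn f W ∧
      f '' closure Ω ⊆ Metric.closedBall (0 : CSp n) 1 ∧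
      f p = eLast n (by omega) ∧
      {z ∈ closure Ω | ‖f z‖ = 1} = {p} := by
  obtain ⟨W, f, hW, hKW, hf, hfi, hfp, hf1⟩ := main_aux hn Ω p hΩ hp hspc hstein (lastI n (by omega))
  have hp1 : ‖f p‖ = 1 := by rw [hfp]; exact norm_eB _
  refine ⟨W, f, hW, hKW, hf, hfi, ?_, hfp, ?_⟩
  · rintro _ ⟨z, hz, rfl⟩
    rw [mem_closedBall_zero_iff]
    by_cases h : z = p
    · rw [h, hp1]
    · exact (hf1 z hz h).le
  · ext z
    simp only [mem_setOf_eq, mem_singleton_iff]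
    constructor
    · rintro ⟨hz, h1⟩
      by_contra h
      exact (hf1 z hz h).ne h1
    · rintro rfl
      exact ⟨hp.1, hp1⟩

end
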